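/- Every smooth quartic surface X ⊂ ℙ³ defined over an algebraically closed field K of characteristic 2 contains at most 68 lines, i.e., the set of lines lying on X has at most 68 elements. (This is the special case of the paper's main Theorem 1.1 for smooth quartics, which are in particular K3 quartic surfaces.) -/

import Mathlib

open MvPolynomial

namespace QuarticLines
variable {K : Type*} [Field K]

/-- The quartic form in four variables with prescribed coefficients. -/
def quartic {K : Type*} [CommRing K] (c : ℕ → ℕ → ℕ → K) (x y z w : K) : K :=
  c 0 0 0 * w ^ 4 + c 0 0 1 * z * w ^ 3 + c 0 0 2 * z ^ 2 * w ^ 2 + c 0 0 3 * z ^ 3 * w +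
    c 0 0 4 * z ^ 4 + c 0 1 0 * y * w ^ 3 + c 0 1 1 * y * z * w ^ 2 + c 0 1 2 * y * z ^ 2 * w +
    c 0 1 3 * y * z ^ 3 + c 0 2 0 * y ^ 2 * w ^ 2 + c 0 2 1 * y ^ 2 * z * w +
    c 0 2 2 * y ^ 2 * z ^ 2 + c 0 3 0 * y ^ 3 * w + c 0 3 1 * y ^ 3 * z + c 0 4 0 * y ^ 4 +
    c 1 0 0 * x * w ^ 3 + c 1 0 1 * x * z * w ^ 2 + c 1 0 2 * x * z ^ 2 * w +
    c 1 0 3 * x * z ^ 3 + c 1 1 0 * x * y * w ^ 2 + c 1 1 1 * x * y * z * w +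
    c 1 1 2 * x * y * z ^ 2 + c 1 2 0 * x * y ^ 2 * w + c 1 2 1 * x * y ^ 2 * z +
    c 1 3 0 * x * y ^ 3 + c 2 0 0 * x ^ 2 * w ^ 2 + c 2 0 1 * x ^ 2 * z * w +
    c 2 0 2 * x ^ 2 * z ^ 2 + c 2 1 0 * x ^ 2 * y * w + c 2 1 1 * x ^ 2 * y * z +
    c 2 2 0 * x ^ 2 * y ^ 2 + c 3 0 0 * x ^ 3 * w + c 3 0 1 * x ^ 3 * z + c 3 1 0 * x ^ 3 * y +
    c 4 0 0 * x ^ 4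

/-- The partial derivative, in characteristic two, of `quartic c` in the variable `x`. -/
def quarticX (c : ℕ → ℕ → ℕ → K) (x y z w : K) : K :=
  c 1 0 0 * w ^ 3 + c 1 0 1 * z * w ^ 2 + c 1 0 2 * z ^ 2 * w + c 1 0 3 * z ^ 3 +
    c 1 1 0 * y * w ^ 2 + c 1 1 1 * y * z * w + c 1 1 2 * y * z ^ 2 + c 1 2 0 * y ^ 2 * w +
    c 1 2 1 * y ^ 2 * z + c 1 3 0 * y ^ 3 + c 3 0 0 * x ^ 2 * w + c 3 0 1 * x ^ 2 * z +
    c 3 1 0 * x ^ 2 * y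

/-- The partial derivative, in characteristic two, of `quartic c` in the variable `y`. -/
def quarticY (c : ℕ → ℕ → ℕ → K) (x y z w : K) : K :=
  c 0 1 0 * w ^ 3 + c 0 1 1 * z * w ^ 2 + c 0 1 2 * z ^ 2 * w + c 0 1 3 * z ^ 3 +
    c 0 3 0 * y ^ 2 * w + c 0 3 1 * y ^ 2 * z + c 1 1 0 * x * w ^ 2 + c 1 1 1 * x * z * w +
    c 1 1 2 * x * z ^ 2 + c 1 3 0 * x * y ^ 2 + c 2 1 0 * x ^ 2 * w + c 2 1 1 * x ^ 2 * z +
    c 3 1 0 * x ^ 3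

/-- The partial derivative, in characteristic two, of `quartic c` in the variable `z`. -/
def quarticZ (c : ℕ → ℕ → ℕ → K) (x y z w : K) : K :=
  c 0 0 1 * w ^ 3 + c 0 0 3 * z ^ 2 * w + c 0 1 1 * y * w ^ 2 + c 0 1 3 * y * z ^ 2 +
    c 0 2 1 * y ^ 2 * w + c 0 3 1 * y ^ 3 + c 1 0 1 * x * w ^ 2 + c 1 0 3 * x * z ^ 2 +
    c 1 1 1 * x * y * w + c 1 2 1 * x * y ^ 2 + c 2 0 1 * x ^ 2 * w + c 2 1 1 * x ^ 2 * y +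
    c 3 0 1 * x ^ 3

/-- The partial derivative, in characteristic two, of `quartic c` in the variable `w`. -/
def quarticW (c : ℕ → ℕ → ℕ → K) (x y z w : K) : K :=
  c 0 0 1 * z * w ^ 2 + c 0 0 3 * z ^ 3 + c 0 1 0 * y * w ^ 2 + c 0 1 2 * y * z ^ 2 +
    c 0 2 1 * y ^ 2 * z + c 0 3 0 * y ^ 3 + c 1 0 0 * x * w ^ 2 + c 1 0 2 * x * z ^ 2 +
    c 1 1 1 * x * y * z + c 1 2 0 * x * y ^ 2 + c 2 0 1 * x ^ 2 * z + c 2 1 0 * x ^ 2 * y +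
    c 3 0 0 * x ^ 3

/-- The quartic form with prescribed coefficients, as a polynomial. -/
noncomputable def quarticPoly (c : ℕ → ℕ → ℕ → K) : MvPolynomial (Fin 4) K :=
  C (c 0 0 0) * X 3 ^ 4 + C (c 0 0 1) * X 2 * X 3 ^ 3 + C (c 0 0 2) * X 2 ^ 2 * X 3 ^ 2 +
    C (c 0 0 3) * X 2 ^ 3 * X 3 + C (c 0 0 4) * X 2 ^ 4 + C (c 0 1 0) * X 1 * X 3 ^ 3 +
    C (c 0 1 1) * X 1 * X 2 * X 3 ^ 2 + C (c 0 1 2) * X 1 * X 2 ^ 2 * X 3 +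
    C (c 0 1 3) * X 1 * X 2 ^ 3 + C (c 0 2 0) * X 1 ^ 2 * X 3 ^ 2 +
    C (c 0 2 1) * X 1 ^ 2 * X 2 * X 3 + C (c 0 2 2) * X 1 ^ 2 * X 2 ^ 2 +
    C (c 0 3 0) * X 1 ^ 3 * X 3 + C (c 0 3 1) * X 1 ^ 3 * X 2 + C (c 0 4 0) * X 1 ^ 4 +
    C (c 1 0 0) * X 0 * X 3 ^ 3 + C (c 1 0 1) * X 0 * X 2 * X 3 ^ 2 +
    C (c 1 0 2) * X 0 * X 2 ^ 2 * X 3 + C (c 1 0 3) * X 0 * X 2 ^ 3 +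
    C (c 1 1 0) * X 0 * X 1 * X 3 ^ 2 + C (c 1 1 1) * X 0 * X 1 * X 2 * X 3 +
    C (c 1 1 2) * X 0 * X 1 * X 2 ^ 2 + C (c 1 2 0) * X 0 * X 1 ^ 2 * X 3 +
    C (c 1 2 1) * X 0 * X 1 ^ 2 * X 2 + C (c 1 3 0) * X 0 * X 1 ^ 3 +
    C (c 2 0 0) * X 0 ^ 2 * X 3 ^ 2 + C (c 2 0 1) * X 0 ^ 2 * X 2 * X 3 +
    C (c 2 0 2) * X 0 ^ 2 * X 2 ^ 2 + C (c 2 1 0) * X 0 ^ 2 * X 1 * X 3 +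
    C (c 2 1 1) * X 0 ^ 2 * X 1 * X 2 + C (c 2 2 0) * X 0 ^ 2 * X 1 ^ 2 +
    C (c 3 0 0) * X 0 ^ 3 * X 3 + C (c 3 0 1) * X 0 ^ 3 * X 2 + C (c 3 1 0) * X 0 ^ 3 * X 1 +
    C (c 4 0 0) * X 0 ^ 4

theorem eval_quarticPoly (c : ℕ → ℕ → ℕ → K) (v : Fin 4 → K) :
    eval v (quarticPoly c) = quartic c (v 0) (v 1) (v 2) (v 3) := by
  simp [quarticPoly, quartic]

section CharTwo
variable [CharP K 2]

theorem eval_pderiv_quarticPoly (c : ℕ → ℕ → ℕ → K) (v : Fin 4 → K) :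
    eval v (pderiv 0 (quarticPoly c)) = quarticX c (v 0) (v 1) (v 2) (v 3) ∧
    eval v (pderiv 1 (quarticPoly c)) = quarticY c (v 0) (v 1) (v 2) (v 3) ∧
    eval v (pderiv 2 (quarticPoly c)) = quarticZ c (v 0) (v 1) (v 2) (v 3) ∧
    eval v (pderiv 3 (quarticPoly c)) = quarticW c (v 0) (v 1) (v 2) (v 3) := by
  have h2 : (2 : K) = 0 := CharTwo.two_eq_zero
  have h3 : (3 : K) = 1 := by linear_combination h2
  have h4 : (4 : K) = 0 := by linear_combination 2 * h2
  refine ⟨?_, ?_, ?_, ?_⟩ <;>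
  · simp [quarticPoly, pderiv_X, h2, h3, h4, quarticX, quarticY, quarticZ, quarticW]
    try ring

end CharTwo

/-- A quartic form `quartic c` without singular points. -/
def SmoothCoeffs (c : ℕ → ℕ → ℕ → K) : Prop :=
  ∀ x y z w, quartic c x y z w = 0 → quarticX c x y z w = 0 → quarticY c x y z w = 0 →
    quarticZ c x y z w = 0 → quarticW c x y z w = 0 → x = 0 ∧ y = 0 ∧ z = 0 ∧ w = 0

/-- A homogeneous polynomial of degree four defining a smooth surface in `ℙ³`. -/
structure IsSmoothQuartic (F : MvPolynomial (Fin 4) K) : Prop where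
  hom : F.IsHomogeneous 4
  smooth : ∀ v : Fin 4 → K, v ≠ 0 → eval v F = 0 → ∃ i : Fin 4, eval v (pderiv i F) ≠ 0

theorem exists_eq_quarticPoly {G : MvPolynomial (Fin 4) K} (hG : G.IsHomogeneous 4) :
    ∃ c, G = quarticPoly c := by
  let e : (Fin 4 → ℕ) → (Fin 4 →₀ ℕ) := Finsupp.equivFunOnFinite.symm
  have he : Function.Injective e := Finsupp.equivFunOnFinite.symm.injective
  obtain ⟨d, hd⟩ : ∃ d : (Fin 4 → ℕ) → K, G = ∑ t ∈ Finset.Nat.antidiagonalTuple 4 4,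
      C (d t) * X 0 ^ t 0 * X 1 ^ t 1 * X 2 ^ t 2 * X 3 ^ t 3 := by
    refine ⟨fun t => coeff (e t) G, ?_⟩
    have h1 : ∀ t : Fin 4 → ℕ, C (coeff (e t) G) * X 0 ^ t 0 * X 1 ^ t 1 * X 2 ^ t 2 * X 3 ^ t 3
        = monomial (e t) (coeff (e t) G) := by
      intro t
      rw [monomial_eq, Finsupp.prod_fintype _ _ (by simp)]
      simp [Fin.prod_univ_four, e, mul_assoc]
    simp_rw [h1]
    conv_lhs => rw [← support_sum_monomial_coeff G]
    rw [← Finset.sum_image (s := Finset.Nat.antidiagonalTuple 4 4) (g := e)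
      (f := fun m => monomial m (coeff m G)) (by intro a _ b _ h; exact he h)]
    refine Finset.sum_subset ?_ ?_
    · intro m hm
      rw [mem_support_iff] at hm
      have := hG hm
      refine Finset.mem_image.2 ⟨m, ?_, by simp [e]⟩
      rw [Finset.Nat.mem_antidiagonalTuple]
      rw [Finsupp.weight_apply, Finsupp.sum_fintype _ _ (by simp)] at this
      simpa using this
    · intro m _ hm
      simp [notMem_support_iff.1 hm]
  obtain ⟨c, hc⟩ : ∃ c : ℕ → ℕ → ℕ → K, ∀ i j k, c i j k = d ![i, j, k, 4 - i - j - k] :=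
    ⟨_, fun _ _ _ => rfl⟩
  refine ⟨c, ?_⟩
  rw [hd]
  have h4 : Finset.Nat.antidiagonalTuple 4 4 =
    ((Finset.range 5 ×ˢ Finset.range 5 ×ˢ Finset.range 5).filter
      (fun p => p.1 + p.2.1 + p.2.2 ≤ 4)).image
      (fun p => ![p.1, p.2.1, p.2.2, 4 - p.1 - p.2.1 - p.2.2]) := by decide +kernel
  rw [h4, Finset.sum_image, Finset.sum_filter, Finset.sum_product]
  · simp only [← hc]
    simp [Finset.sum_product, Finset.sum_range_succ, quarticPoly]
    ring
  · rintro ⟨a, b, c⟩ _ ⟨a', b', c'⟩ _ h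
    have h0 := congrFun h 0
    have h1 := congrFun h 1
    have h2 := congrFun h 2
    simp at h0 h1 h2
    simp [h0, h1, h2]

theorem pderiv_bind₁_linear {ι : Type*} [Fintype ι] [DecidableEq ι] (b : ι → ι → K)
    (F : MvPolynomial ι K) (i : ι) :
    pderiv i (bind₁ (fun j => ∑ i, C (b i j) * X i) F) =
      ∑ j, C (b i j) * bind₁ (fun j => ∑ i, C (b i j) * X i) (pderiv j F) := by
  induction F using MvPolynomial.induction_on with
  | C a => simp [algebraMap_eq]
  | add p q hp hq => simp [hp, hq, mul_add, Finset.sum_add_distrib]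
  | mul_X p k hp =>
    simp only [map_mul, bind₁_X_right, Derivation.leibniz, hp, smul_eq_mul, map_add, mul_add,
      Finset.sum_add_distrib, map_sum, pderiv_X, pderiv_C]
    congr 1
    · have : ∀ j, C (b i j) * (bind₁ (fun j => ∑ i, C (b i j) * X i) p *
          bind₁ (fun j => ∑ i, C (b i j) * X i) ((Pi.single j 1 : ι → MvPolynomial ι K) k)) =
          if j = k then C (b i k) * bind₁ (fun j => ∑ i, C (b i j) * X i) p else
            (0 : MvPolynomial ι K) := by
        intro j
        split_ifs with h
        · subst h; simp
        · simp [Pi.single_eq_of_ne (Ne.symm h)]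
      rw [Finset.sum_congr rfl fun j _ => this j]
      simp [Pi.single_apply, mul_comm]
    · rw [Finset.mul_sum]
      exact Finset.sum_congr rfl fun j _ => by ring

namespace IsSmoothQuartic
variable {F : MvPolynomial (Fin 4) K}

theorem exists_coeffs [CharP K 2] (hF : IsSmoothQuartic F) (b : Module.Basis (Fin 4) K (Fin 4 → K)) :
    ∃ c, SmoothCoeffs c ∧ ∀ x y z w,
      eval (x • b 0 + y • b 1 + z • b 2 + w • b 3) F = quartic c x y z w := by
  set φ : Fin 4 → MvPolynomial (Fin 4) K := fun j => ∑ i, C (b i j) * X i with hφ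
  have hG : (bind₁ φ F).IsHomogeneous (1 * 4) := by
    refine hF.hom.aeval φ fun j => ?_
    refine IsHomogeneous.sum _ _ _ fun i _ => ?_
    simpa using (isHomogeneous_C _ (b i j)).mul (isHomogeneous_X K i)
  obtain ⟨c, hc⟩ := exists_eq_quarticPoly (by simpa using hG)
  have hev : ∀ (G : MvPolynomial (Fin 4) K) (v : Fin 4 → K),
      eval v (bind₁ φ G) = eval (∑ i, v i • b i) G := by
    intro G v
    have : ∀ j, eval v (φ j) = (∑ i, v i • b i) j := by
      intro j; simp [hφ, mul_comm]
    rw [← funext this]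
    induction G using MvPolynomial.induction_on with
    | C a => simp
    | add p q hp hq => simp [hp, hq]
    | mul_X p k hp => simp [hp]
  refine ⟨c, ?_, fun x y z w => ?_⟩
  · intro x y z w h0 h1 h2 h3 h4
    have hp := eval_pderiv_quarticPoly c ![x, y, z, w]
    have h0' := eval_quarticPoly c ![x, y, z, w]
    simp only [← hc, Matrix.cons_val] at hp h0'
    rw [h1, h2, h3, h4] at hp
    rw [h0, hev] at h0'
    have hd : ∀ i, eval ![x, y, z, w] (pderiv i (bind₁ φ F)) = 0 := by
      intro i; fin_cases i
      exacts [hp.1, hp.2.1, hp.2.2.1, hp.2.2.2]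
    set p := ∑ i, ![x, y, z, w] i • b i with hp'
    have hlin : Fintype.linearCombination K (fun j => eval p (pderiv j F)) = 0 := by
      refine b.ext fun i => ?_
      have := hd i
      rw [hφ, pderiv_bind₁_linear, ← hφ, map_sum] at this
      simpa [Fintype.linearCombination_apply, hev] using this
    have hpz : p = 0 := by
      by_contra hne
      obtain ⟨j, hj⟩ := hF.smooth p hne h0'
      refine hj ?_
      have := LinearMap.congr_fun hlin (Pi.single j 1)
      simpa using this
    have := Fintype.linearIndependent_iff.1 b.linearIndependent _ hpz
    exact ⟨this 0, this 1, this 2, this 3⟩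
  · have := hev F ![x, y, z, w]
    rw [hc, eval_quarticPoly] at this
    simpa [Fin.sum_univ_four] using this.symm

end IsSmoothQuartic

/-- A derivation at a point is determined by its values on the variables. -/
theorem derivation_at_point {K σ : Type*} [Field K] [Fintype σ] (t : σ → K)
    (δ : MvPolynomial σ K →ₗ[K] K)
    (hC : ∀ a, δ (C a) = 0)
    (hδ : ∀ P Q, δ (P * Q) = eval t P * δ Q + eval t Q * δ P) (P : MvPolynomial σ K) :
    δ P = ∑ i, δ (X i) * eval t (pderiv i P) := by
  classical
  induction P using MvPolynomial.induction_on with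
  | C a => simp [hC]
  | add p q hp hq => simp [hp, hq, mul_add, Finset.sum_add_distrib]
  | mul_X p k hp =>
    simp only [hδ, hp, Derivation.leibniz, smul_eq_mul, map_add, map_mul, eval_X, mul_add,
      Finset.sum_add_distrib, pderiv_X, Finset.mul_sum]
    congr 1
    · rw [Finset.sum_eq_single k]
      · simp [mul_comm]
      · intro i _ hi
        simp [Pi.single_eq_of_ne (Ne.symm hi)]
      · simp
    · exact Finset.sum_congr rfl fun j _ => by ring

/-- An affine algebraic set all of whose Zariski tangent spaces vanish is finite. -/
theorem finite_zeros_of_tangent_eq_zero {K σ : Type*} [Field K] [IsAlgClosed K] [Fintype σ]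
    (S : Set (MvPolynomial σ K))
    (hS : ∀ t : σ → K, (∀ P ∈ S, eval t P = 0) → ∀ τ : σ → K,
      (∀ P ∈ S, ∑ i, τ i * eval t (pderiv i P) = 0) → τ = 0) :
    {t : σ → K | ∀ P ∈ S, eval t P = 0}.Finite := by
  classical
  let J : Ideal (MvPolynomial σ K) := Ideal.span S
  let A := MvPolynomial σ K ⧸ J
  have hunr : Algebra.FormallyUnramified K A := by
    refine ⟨?_⟩
    by_contra hns
    rw [not_subsingleton_iff_nontrivial] at hns
    obtain ⟨N, hN⟩ := IsCoatomic.exists_coatom (α := Submodule A Ω[A⁄K])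
    have : IsSimpleModule A (Ω[A⁄K] ⧸ N) := isSimpleModule_iff_isCoatom.2 hN
    obtain ⟨m, hm, ⟨e⟩⟩ := isSimpleModule_iff_quot_maximal.1 this
    let : Field (A ⧸ m) := Ideal.Quotient.field m
    have : Module.Finite K (A ⧸ m) := finite_of_finite_type_of_isJacobsonRing K (A ⧸ m)
    have hbij : Function.Bijective (algebraMap K (A ⧸ m)) :=
      IsAlgClosed.algebraMap_bijective_of_isIntegral
    let ε : (A ⧸ m) ≃ₐ[K] K := (AlgEquiv.ofBijective (Algebra.ofId K (A ⧸ m)) hbij).symm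
    let χ : MvPolynomial σ K →ₐ[K] K :=
      (ε.toAlgHom.comp (Ideal.Quotient.mkₐ K m)).comp (Ideal.Quotient.mkₐ K J)
    let t : σ → K := fun i => χ (X i)
    have hχ : ∀ P, χ P = eval t P := by
      intro P
      have : χ = aeval t := by ext i; simp [t]
      rw [this]; rfl
    let D : A → A ⧸ m := fun a => e (N.mkQ (KaehlerDifferential.D K A a))
    have hDadd : ∀ a b, D (a + b) = D a + D b := by intro a b; simp [D]
    have hDsmul : ∀ (r : K) a, D (r • a) = r • D a := by
      intro r a
      simp only [D, Derivation.map_smul]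
      rw [← algebraMap_smul A r, map_smul, map_smul, algebraMap_smul]
    have hDmul : ∀ a b, D (a * b) = Ideal.Quotient.mk m a * D b + Ideal.Quotient.mk m b * D a := by
      intro a b
      simp only [D, Derivation.leibniz, map_add, map_smul]
      rfl
    let δ : MvPolynomial σ K →ₗ[K] K :=
      { toFun := fun P => ε (D (Ideal.Quotient.mk J P))
        map_add' := by intro P Q; simp [hDadd]
        map_smul' := by
          intro r P
          have : Ideal.Quotient.mk J (r • P) = r • Ideal.Quotient.mk J P := rfl
          simp [this, hDsmul] }
    have hδ : ∀ P Q, δ (P * Q) = eval t P * δ Q + eval t Q * δ P := by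
      intro P Q
      simp only [← hχ]
      simp only [δ, LinearMap.coe_mk, AddHom.coe_mk, map_mul, hDmul, map_add]
      rfl
    have hC : ∀ a, δ (C a) = 0 := by
      intro a
      have h1 : δ (1 * 1) = _ := hδ 1 1
      have h1' : δ 1 = 0 := by simpa using h1
      have : (C a : MvPolynomial σ K) = a • 1 := by simp [smul_eq_C_mul]
      rw [this, map_smul, h1', smul_zero]
    have hmem : ∀ P ∈ S, (Ideal.Quotient.mk J P) = 0 := fun P hP =>
      Ideal.Quotient.eq_zero_iff_mem.2 (Ideal.subset_span hP)
    have hτ := hS t (fun P hP => by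
        rw [← hχ]
        have : χ P = ε (Ideal.Quotient.mk m (Ideal.Quotient.mk J P)) := rfl
        rw [this, hmem P hP]; simp) (fun i => δ (X i)) (fun P hP => by
        rw [← derivation_at_point t δ hC hδ]
        have : δ P = ε (D (Ideal.Quotient.mk J P)) := rfl
        rw [this, hmem P hP]
        simp [D])
    have hδ0 : ∀ P, δ P = 0 := by
      intro P
      rw [derivation_at_point t δ hC hδ]
      exact Finset.sum_eq_zero fun i _ => by simp [congrFun hτ i]
    have hD0 : ∀ a, D a = 0 := by
      intro a
      obtain ⟨P, rfl⟩ := Ideal.Quotient.mk_surjective a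
      exact ε.injective ((hδ0 P).trans (map_zero ε).symm)
    apply hN.1
    rw [eq_top_iff, ← KaehlerDifferential.span_range_derivation, Submodule.span_le]
    rintro _ ⟨a, rfl⟩
    have := hD0 a
    simp only [D, EmbeddingLike.map_eq_zero_iff] at this
    simpa using this
  have : Algebra.EssFiniteType K A := inferInstance
  have : Module.Finite K A := Algebra.FormallyUnramified.finite_of_free K A
  have : Finite (A →ₐ[K] K) := inferInstance
  let Φ : {t : σ → K | ∀ P ∈ S, eval t P = 0} → (A →ₐ[K] K) := fun t =>
    Ideal.Quotient.liftₐ J (aeval t.1) (by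
      intro a ha
      have : J ≤ RingHom.ker (aeval t.1 : MvPolynomial σ K →ₐ[K] K) := by
        rw [Ideal.span_le]
        intro P hP
        exact t.2 P hP
      exact this ha)
  have hΦ : Function.Injective Φ := by
    intro s t h
    ext i
    have := AlgHom.congr_fun h (Ideal.Quotient.mk J (X i))
    have hX : ∀ u, Φ u (Ideal.Quotient.mk J (X i)) = u.1 i := fun u => by
      change aeval u.1 (X i : MvPolynomial σ K) = _
      simp
    rwa [hX, hX] at this
  exact Finite.of_injective Φ hΦ

section Basics
variable {K : Type*} [Field K]

theorem taylor_line {σ : Type*} [Fintype σ] (P : MvPolynomial σ K) (v d : σ → K) :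
    ∃ r : Polynomial K, ∀ X : K, eval (v + X • d) P =
      eval v P + X * ∑ i, d i * eval v (pderiv i P) + X ^ 2 * r.eval X := by
  classical
  induction P using MvPolynomial.induction_on with
  | C a => exact ⟨0, fun X => by simp⟩
  | add p q hp hq =>
    obtain ⟨r, hr⟩ := hp
    obtain ⟨s, hs⟩ := hq
    refine ⟨r + s, fun X => ?_⟩
    simp only [map_add, hr, hs, Polynomial.eval_add, mul_add, Finset.sum_add_distrib]
    ring
  | mul_X p k hp =>
    obtain ⟨r, hr⟩ := hp
    refine ⟨r * Polynomial.C (v k) + Polynomial.C (d k * ∑ i, d i * eval v (pderiv i p)) +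
      Polynomial.X * Polynomial.C (d k) * r, fun X => ?_⟩
    have h1 : ∑ i, d i * eval v (pderiv i (p * MvPolynomial.X k)) =
        d k * eval v p + v k * ∑ i, d i * eval v (pderiv i p) := by
      simp only [Derivation.leibniz, smul_eq_mul, map_add, map_mul, eval_X, mul_add,
        Finset.sum_add_distrib, pderiv_X, Finset.mul_sum]
      congr 1
      · rw [Finset.sum_eq_single k]
        · simp
        · intro i _ hi
          simp [Pi.single_eq_of_ne (Ne.symm hi)]
        · simp
      · exact Finset.sum_congr rfl fun j _ => by ring
    rw [h1]
    simp only [map_mul, hr, eval_X, Pi.add_apply, Pi.smul_apply, smul_eq_mul, Polynomial.eval_add,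
      Polynomial.eval_mul, Polynomial.eval_C, Polynomial.eval_X]
    ring

theorem linear_coeff_unique [Infinite K] {a b a' b' : K} {r r' : Polynomial K}
    (h : ∀ X : K, a + X * b + X ^ 2 * r.eval X = a' + X * b' + X ^ 2 * r'.eval X) : b = b' := by
  have key : (Polynomial.C a + Polynomial.X * Polynomial.C b + Polynomial.X ^ 2 * r) =
      (Polynomial.C a' + Polynomial.X * Polynomial.C b' + Polynomial.X ^ 2 * r') :=
    Polynomial.funext fun X => by
      simp only [Polynomial.eval_add, Polynomial.eval_mul, Polynomial.eval_C, Polynomial.eval_X,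
        Polynomial.eval_pow, h X]
  have := congrArg (Polynomial.coeff · 1) key
  simpa [Polynomial.coeff_X_pow_mul', Polynomial.coeff_X_mul, Polynomial.coeff_C] using this

theorem coeffs_eq_zero_of_forall [Infinite K] {a0 a1 a2 a3 a4 : K}
    (h : ∀ z : K, a0 + a1 * z + a2 * z ^ 2 + a3 * z ^ 3 + a4 * z ^ 4 = 0) :
    a0 = 0 ∧ a1 = 0 ∧ a2 = 0 ∧ a3 = 0 ∧ a4 = 0 := by
  have key : Polynomial.C a0 + Polynomial.C a1 * Polynomial.X + Polynomial.C a2 * Polynomial.X ^ 2 +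
      Polynomial.C a3 * Polynomial.X ^ 3 + Polynomial.C a4 * Polynomial.X ^ 4 = 0 :=
    Polynomial.funext fun z => by simpa using h z
  have hk := fun n => congrArg (Polynomial.coeff · n) key
  refine ⟨by simpa [Polynomial.coeff_X, Polynomial.coeff_C] using hk 0,
    by simpa [Polynomial.coeff_X, Polynomial.coeff_C] using hk 1,
    by simpa [Polynomial.coeff_X, Polynomial.coeff_C] using hk 2,
    by simpa [Polynomial.coeff_X, Polynomial.coeff_C] using hk 3,
    by simpa [Polynomial.coeff_X, Polynomial.coeff_C] using hk 4⟩

/-- The binary cubic form with prescribed coefficients. -/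
def cubic (a : ℕ → K) (z w : K) : K := a 3 * z ^ 3 + a 2 * z ^ 2 * w + a 1 * z * w ^ 2 + a 0 * w ^ 3

/-- The dehomogenization of a binary cubic form. -/
noncomputable def cubicPoly (a : ℕ → K) : Polynomial K :=
  .C (a 3) * .X ^ 3 + .C (a 2) * .X ^ 2 + .C (a 1) * .X + .C (a 0)

theorem eval_cubicPoly (a : ℕ → K) (s : K) : (cubicPoly a).eval s = cubic a s 1 := by
  simp [cubicPoly, cubic]

theorem coeff_cubicPoly (a : ℕ → K) : (cubicPoly a).coeff 0 = a 0 ∧ (cubicPoly a).coeff 1 = a 1 ∧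
    (cubicPoly a).coeff 2 = a 2 ∧ (cubicPoly a).coeff 3 = a 3 := by
  refine ⟨?_, ?_, ?_, ?_⟩ <;> simp [cubicPoly, Polynomial.coeff_X, Polynomial.coeff_C]

/-- Two binary cubic forms without common zeros. -/
def CoprimeCubics (a b : ℕ → K) : Prop :=
  ∀ z w, cubic a z w = 0 → cubic b z w = 0 → z = 0 ∧ w = 0

theorem CoprimeCubics.isCoprime [IsAlgClosed K] {a b : ℕ → K} (h : CoprimeCubics a b) :
    IsCoprime (cubicPoly a) (cubicPoly b) := by
  rw [Polynomial.isCoprime_iff_aeval_ne_zero_of_isAlgClosed K K]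
  intro s
  by_contra! hs
  simp only [Polynomial.coe_aeval_eq_eval, eval_cubicPoly] at hs
  exact one_ne_zero (h s 1 hs.1 hs.2).2

theorem CoprimeCubics.lead {a b : ℕ → K} (h : CoprimeCubics a b) (ha : a 3 = 0) : b 3 ≠ 0 := by
  intro hb
  exact one_ne_zero (h 1 0 (by simp [cubic, ha]) (by simp [cubic, hb])).1

/-- Binary cubics without common zeros admit no linear syzygies. -/
theorem CoprimeCubics.no_linear_syzygy [IsAlgClosed K] {a b : ℕ → K} (h : CoprimeCubics a b)
    {t0 t1 t2 t3 : K}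
    (hz : ∀ z w, (t0 * z + t2 * w) * cubic a z w + (t1 * z + t3 * w) * cubic b z w = 0) :
    t0 = 0 ∧ t1 = 0 ∧ t2 = 0 ∧ t3 = 0 := by
  have key : (Polynomial.C t0 * Polynomial.X + Polynomial.C t2) * cubicPoly a +
      (Polynomial.C t1 * Polynomial.X + Polynomial.C t3) * cubicPoly b = 0 :=
    Polynomial.funext fun z => by simpa [eval_cubicPoly] using hz z 1
  have hab := h.isCoprime
  obtain ⟨m, hm⟩ : cubicPoly a ∣ (Polynomial.C t1 * Polynomial.X + Polynomial.C t3) := by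
    refine hab.dvd_of_dvd_mul_right ⟨-(Polynomial.C t0 * Polynomial.X + Polynomial.C t2), ?_⟩
    linear_combination key
  have hlin : ∀ p q : K, (Polynomial.C p * Polynomial.X + Polynomial.C q).natDegree ≤ 1 := by
    intro p q; compute_degree
  have hlin0 : ∀ p q : K, Polynomial.C p * Polynomial.X + Polynomial.C q = 0 → p = 0 ∧ q = 0 := by
    intro p q hpq
    exact ⟨by simpa [Polynomial.coeff_C] using congrArg (Polynomial.coeff · 1) hpq,
      by simpa using congrArg (Polynomial.coeff · 0) hpq⟩
  have hcub : ∀ e : ℕ → K, (cubicPoly e).natDegree ≤ 1 → e 3 = 0 := by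
    intro e he
    rw [← (coeff_cubicPoly e).2.2.2]
    exact Polynomial.coeff_eq_zero_of_natDegree_lt (by omega)
  by_cases ha0 : cubicPoly a = 0
  · rw [ha0, isCoprime_zero_left] at hab
    have hb := hcub b (by rw [Polynomial.natDegree_eq_zero_of_isUnit hab]; omega)
    have ha := hcub a (by rw [ha0]; simp)
    exact absurd hb (h.lead ha)
  have h2 : Polynomial.C t0 * Polynomial.X + Polynomial.C t2 = -(cubicPoly b * m) := by
    apply mul_right_cancel₀ ha0
    rw [hm] at key
    linear_combination key
  by_cases hm0 : m = 0
  · rw [hm0, mul_zero] at hm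
    rw [hm0, mul_zero, neg_zero] at h2
    obtain ⟨h1, h3⟩ := hlin0 _ _ hm
    obtain ⟨h0, h2⟩ := hlin0 _ _ h2
    exact ⟨h0, h1, h2, h3⟩
  · have ha : a 3 = 0 := by
      refine hcub a ?_
      have := hlin t1 t3
      rw [hm, Polynomial.natDegree_mul ha0 hm0] at this
      omega
    have hb : b 3 = 0 := by
      refine hcub b ?_
      have := hlin t0 t2
      rw [h2, Polynomial.natDegree_neg] at this
      by_cases hb0 : cubicPoly b = 0
      · simp [hb0]
      · rw [Polynomial.natDegree_mul hb0 hm0] at this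
        omega
    exact absurd hb (h.lead ha)

end Basics

section Geometry
variable {K : Type*} [Field K]

/-- The vector with coordinates `x, y, z, w` with respect to `b`. -/
noncomputable def pt (b : Module.Basis (Fin 4) K (Fin 4 → K)) (x y z w : K) : Fin 4 → K :=
  x • b 0 + y • b 1 + z • b 2 + w • b 3

theorem pt_eq_zero {b : Module.Basis (Fin 4) K (Fin 4 → K)} {x y z w : K} :
    pt b x y z w = 0 ↔ x = 0 ∧ y = 0 ∧ z = 0 ∧ w = 0 := by
  constructor
  · intro h
    have := Fintype.linearIndependent_iff.1 b.linearIndependent ![x, y, z, w]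
      (by simpa [pt, Fin.sum_univ_four] using h)
    exact ⟨this 0, this 1, this 2, this 3⟩
  · rintro ⟨rfl, rfl, rfl, rfl⟩
    simp [pt]

theorem pt_inj {b : Module.Basis (Fin 4) K (Fin 4 → K)} {x y z w x' y' z' w' : K}
    (h : pt b x y z w = pt b x' y' z' w') : x = x' ∧ y = y' ∧ z = z' ∧ w = w' := by
  have : pt b (x - x') (y - y') (z - z') (w - w') = 0 := by
    rw [← sub_eq_zero.2 h]
    simp only [pt]
    module
  simpa [sub_eq_zero] using pt_eq_zero.1 this

theorem exists_eq_pt (b : Module.Basis (Fin 4) K (Fin 4 → K)) (v : Fin 4 → K) :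
    ∃ x y z w, v = pt b x y z w :=
  ⟨b.repr v 0, b.repr v 1, b.repr v 2, b.repr v 3, by
    conv_lhs => rw [← b.sum_repr v]
    rw [Fin.sum_univ_four, pt]⟩

/-- Four independent vectors form a basis. -/
theorem exists_basis (u : Fin 4 → Fin 4 → K) (hu : ∀ x y z w : K,
    x • u 0 + y • u 1 + z • u 2 + w • u 3 = 0 → x = 0 ∧ y = 0 ∧ z = 0 ∧ w = 0) :
    ∃ b : Module.Basis (Fin 4) K (Fin 4 → K), ∀ i, b i = u i := by
  have hli : LinearIndependent K u := by
    rw [Fintype.linearIndependent_iff]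
    intro g hg
    obtain ⟨h0, h1, h2, h3⟩ := hu (g 0) (g 1) (g 2) (g 3) (by simpa [Fin.sum_univ_four] using hg)
    intro i; fin_cases i
    exacts [h0, h1, h2, h3]
  exact ⟨basisOfLinearIndependentOfCardEqFinrank hli (by simp), fun i => by simp⟩

/-- The form `F` has the coefficients `c` with respect to the basis `b`, and is smooth. -/
def Coords (F : MvPolynomial (Fin 4) K) (b : Module.Basis (Fin 4) K (Fin 4 → K))
    (c : ℕ → ℕ → ℕ → K) : Prop :=
  SmoothCoeffs c ∧ ∀ x y z w, eval (pt b x y z w) F = quartic c x y z w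

/-- The lines on the surface `F = 0`. -/
def lines (F : MvPolynomial (Fin 4) K) : Set (Submodule K (Fin 4 → K)) :=
  {W | Module.finrank K W = 2 ∧ ∀ v ∈ W, eval v F = 0}

/-- The lines on the surface `F = 0` meeting `W` and different from `W`. -/
def nbrs (F : MvPolynomial (Fin 4) K) (W : Submodule K (Fin 4 → K)) :
    Set (Submodule K (Fin 4 → K)) :=
  {W' | W' ∈ lines F ∧ W' ≠ W ∧ ∃ v ∈ W', v ∈ W ∧ v ≠ 0}

/-- The line `x = y = 0` lies on the quartic. -/
def VanishesOnLine (c : ℕ → ℕ → ℕ → K) : Prop := ∀ k ≤ 4, c 0 0 k = 0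

theorem VanishesOnLine.coprime {c : ℕ → ℕ → ℕ → K} (h : VanishesOnLine c) (hc : SmoothCoeffs c) :
    CoprimeCubics (c 1 0) (c 0 1) := by
  intro z w h1 h2
  have := fun k hk => h k hk
  have e0 := h 0 (by norm_num)
  have e1 := h 1 (by norm_num)
  have e2 := h 2 (by norm_num)
  have e3 := h 3 (by norm_num)
  have e4 := h 4 (by norm_num)
  refine (hc 0 0 z w ?_ ?_ ?_ ?_ ?_).2.2
  · simp [quartic, e0, e1, e2, e3, e4]
  · simp only [cubic] at h1
    simp only [quarticX]
    linear_combination h1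
  · simp only [cubic] at h2
    simp only [quarticY]
    linear_combination h2
  · simp [quarticZ, e1, e3]
  · simp [quarticW, e1, e3]

theorem vanishesOnLine_of_forall [Infinite K] {c : ℕ → ℕ → ℕ → K}
    (h : ∀ z, quartic c 0 0 z 1 = 0) : VanishesOnLine c := by
  obtain ⟨h0, h1, h2, h3, h4⟩ := coeffs_eq_zero_of_forall (a0 := c 0 0 0) (a1 := c 0 0 1)
    (a2 := c 0 0 2) (a3 := c 0 0 3) (a4 := c 0 0 4) fun z => by
      have := h z
      simp only [quartic] at this
      linear_combination this
  intro k hk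
  interval_cases k <;> assumption

theorem span_pair_eq {W : Submodule K (Fin 4 → K)} (hW : Module.finrank K W = 2)
    {u v : Fin 4 → K} (hu : u ∈ W) (hv : v ∈ W) (h : ∀ z w : K, z • u + w • v = 0 → z = 0 ∧ w = 0) :
    Submodule.span K {u, v} = W := by
  have hli : LinearIndependent K ![u, v] := LinearIndependent.pair_iff.2 h
  refine Submodule.eq_of_le_of_finrank_eq ?_ ?_
  · rw [Submodule.span_le]
    rintro x (rfl | rfl) <;> assumption
  · rw [hW]
    have := finrank_span_eq_card hli
    rwa [Matrix.range_cons_cons_empty, Fintype.card_fin] at this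

theorem finrank_span_pair {u v : Fin 4 → K} (h : ∀ z w : K, z • u + w • v = 0 → z = 0 ∧ w = 0) :
    Module.finrank K (Submodule.span K {u, v}) = 2 := by
  have hli : LinearIndependent K ![u, v] := LinearIndependent.pair_iff.2 h
  have := finrank_span_eq_card hli
  rwa [Matrix.range_cons_cons_empty, Fintype.card_fin] at this

theorem exists_pair {W : Submodule K (Fin 4 → K)} (hW : Module.finrank K W = 2) :
    ∃ u ∈ W, ∃ v ∈ W, ∀ z w : K, z • u + w • v = 0 → z = 0 ∧ w = 0 := by
  let b := Module.finBasisOfFinrankEq K W hW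
  refine ⟨b 0, (b 0).2, b 1, (b 1).2, fun z w h => ?_⟩
  have := Fintype.linearIndependent_iff.1 b.linearIndependent ![z, w]
    (by rw [Fin.sum_univ_two]; exact Subtype.ext (by simpa using h))
  exact ⟨this 0, this 1⟩

variable {F : MvPolynomial (Fin 4) K}

theorem IsSmoothQuartic.coords [CharP K 2] (hF : IsSmoothQuartic F)
    (b : Module.Basis (Fin 4) K (Fin 4 → K)) : ∃ c, Coords F b c :=
  hF.exists_coeffs b

theorem Coords.vanishesOnLine [Infinite K] {b : Module.Basis (Fin 4) K (Fin 4 → K)}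
    {c : ℕ → ℕ → ℕ → K} (h : Coords F b c) {W : Submodule K (Fin 4 → K)} (hW : W ∈ lines F)
    (h2 : b 2 ∈ W) (h3 : b 3 ∈ W) : VanishesOnLine c :=
  vanishesOnLine_of_forall fun z => by
    rw [← h.2]
    refine hW.2 _ ?_
    simpa [pt] using W.add_mem (W.smul_mem z h2) h3

theorem eval_bind₁_eq {σ τ : Type*} (φ : σ → MvPolynomial τ K) (t : τ → K) (G : MvPolynomial σ K) :
    eval t (bind₁ φ G) = eval (fun i => eval t (φ i)) G := by
  induction G using MvPolynomial.induction_on with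
  | C a => simp
  | add p q hp hq => simp only [map_add, hp, hq]
  | mul_X p k hp => simp only [map_mul, hp, bind₁_X_right, eval_X]

theorem finite_chart [IsAlgClosed K] [CharP K 2] (hF : IsSmoothQuartic F)
    (b : Module.Basis (Fin 4) K (Fin 4 → K)) :
    {t : Fin 4 → K | ∀ z w : K, eval (z • (b 2 + t 0 • b 0 + t 1 • b 1) +
      w • (b 3 + t 2 • b 0 + t 3 • b 1)) F = 0}.Finite := by
  have : Infinite K := IsAlgClosed.instInfinite
  let P : K → K → MvPolynomial (Fin 4) K := fun z w =>
    bind₁ (fun i => C (z * b 2 i + w * b 3 i) + C (z * b 0 i) * X 0 + C (z * b 1 i) * X 1 +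
      C (w * b 0 i) * X 2 + C (w * b 1 i) * X 3) F
  have hP : ∀ z w t, eval t (P z w) = eval (z • (b 2 + t 0 • b 0 + t 1 • b 1) +
      w • (b 3 + t 2 • b 0 + t 3 • b 1)) F := by
    intro z w t
    simp only [P, eval_bind₁_eq]
    refine congrArg (fun v => eval v F) (funext fun i => ?_)
    simp
    ring
  let S : Set (MvPolynomial (Fin 4) K) := {Q | ∃ z w, Q = P z w}
  have key := finite_zeros_of_tangent_eq_zero S (by
    intro t ht τ hτ
    obtain ⟨b', hb'⟩ := exists_basis ![b 0, b 1, b 2 + t 0 • b 0 + t 1 • b 1,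
        b 3 + t 2 • b 0 + t 3 • b 1] (by
      intro x y z w h
      have : pt b (x + z * t 0 + w * t 2) (y + z * t 1 + w * t 3) z w = 0 := by
        rw [← h]; simp [pt]; module
      obtain ⟨h0, h1, rfl, rfl⟩ := pt_eq_zero.1 this
      simpa using And.intro h0 h1)
    obtain ⟨c, hc⟩ := hF.coords b'
    have hpt : ∀ x y z w, pt b' x y z w = x • b 0 + y • b 1 +
        z • (b 2 + t 0 • b 0 + t 1 • b 1) + w • (b 3 + t 2 • b 0 + t 3 • b 1) := by
      intro x y z w
      simp [pt, hb']
    have hv : VanishesOnLine c := by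
      refine vanishesOnLine_of_forall fun z => ?_
      rw [← hc.2, hpt]
      have := ht _ ⟨z, 1, rfl⟩
      rw [hP] at this
      simpa using this
    have hsyz := (hv.coprime hc.1).no_linear_syzygy (t0 := τ 0) (t1 := τ 1) (t2 := τ 2)
      (t3 := τ 3) (by
      intro z w
      obtain ⟨r, hr⟩ := taylor_line (P z w) t τ
      obtain ⟨r', hr'⟩ := taylor_line (quarticPoly c) ![0, 0, z, w]
        ![τ 0 * z + τ 2 * w, τ 1 * z + τ 3 * w, 0, 0]
      have h1 := linear_coeff_unique (r := r) (r' := r') fun X => by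
        rw [← hr, ← hr', hP, eval_quarticPoly, ← hc.2, hpt]
        refine congrArg (fun v => eval v F) ?_
        simp
        module
      rw [hτ _ ⟨z, w, rfl⟩] at h1
      obtain ⟨d0, d1, -, -⟩ := eval_pderiv_quarticPoly c ![0, 0, z, w]
      simp [Fin.sum_univ_four, d0, d1, quarticX, quarticY] at h1
      simp only [cubic]
      linear_combination -h1)
    obtain ⟨h0, h1, h2, h3⟩ := hsyz
    ext i; fin_cases i
    exacts [h0, h1, h2, h3])
  refine key.subset fun t ht => ?_
  rintro Q ⟨z, w, rfl⟩
  rw [hP]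
  exact ht z w

theorem finite_lines [IsAlgClosed K] [CharP K 2] (hF : IsSmoothQuartic F) : (lines F).Finite := by
  let B : Equiv.Perm (Fin 4) → Module.Basis (Fin 4) K (Fin 4 → K) := fun σ =>
    (Pi.basisFun K (Fin 4)).reindex σ.symm
  have hB : ∀ σ i, B σ i = Pi.single (σ i) 1 := fun σ i => by simp [B]
  have hfin : (⋃ σ, (fun t : Fin 4 → K => Submodule.span K {B σ 2 + t 0 • B σ 0 + t 1 • B σ 1,
      B σ 3 + t 2 • B σ 0 + t 3 • B σ 1}) '' {t : Fin 4 → K | ∀ z w : K,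
      eval (z • (B σ 2 + t 0 • B σ 0 + t 1 • B σ 1) +
      w • (B σ 3 + t 2 • B σ 0 + t 3 • B σ 1)) F = 0}).Finite :=
    Set.finite_iUnion fun σ => (finite_chart hF (B σ)).image _
  refine hfin.subset fun W hW => ?_
  obtain ⟨u, hu, v, hv, huv⟩ := exists_pair hW.1
  obtain ⟨i, hi⟩ : ∃ i, u i ≠ 0 := by
    by_contra! h
    have : u = 0 := funext h
    simpa using huv 1 0 (by simp [this])
  obtain ⟨j, hj⟩ : ∃ j, (v - (v i / u i) • u) j ≠ 0 := by
    by_contra! h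
    have : v - (v i / u i) • u = 0 := funext h
    simpa using huv (-(v i / u i)) 1 (by rw [← this]; module)
  have hij : i ≠ j := by
    rintro rfl
    simp [hi] at hj
  set v' := v - (v i / u i) • u with hv'
  have hv'i : v' i = 0 := by simp [hv', hi]
  have hv'W : v' ∈ W := W.sub_mem hv (W.smul_mem _ hu)
  set p := (u i)⁻¹ • (u - (u j / v' j) • v') with hp
  set r := (v' j)⁻¹ • v' with hr
  have hpW : p ∈ W := W.smul_mem _ (W.sub_mem hu (W.smul_mem _ hv'W))
  have hrW : r ∈ W := W.smul_mem _ hv'W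
  have hpi : p i = 1 := by simp [hp, hv'i, hi]
  have hpj : p j = 0 := by simp [hp, hj]
  have hri : r i = 0 := by simp [hr, hv'i]
  have hrj : r j = 1 := by simp [hr, hj]
  obtain ⟨σ, h2, h3⟩ : ∃ σ : Equiv.Perm (Fin 4), σ 2 = i ∧ σ 3 = j := by
    revert hij; clear * -; revert i j; decide
  have hexp : ∀ f : Fin 4 → K, f = f (σ 0) • B σ 0 + f (σ 1) • B σ 1 + f i • B σ 2 +
      f j • B σ 3 := by
    intro f
    conv_lhs => rw [← (B σ).sum_repr f]
    simp [Fin.sum_univ_four, B, h2, h3]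
  refine Set.mem_iUnion.2 ⟨σ, ![p (σ 0), p (σ 1), r (σ 0), r (σ 1)], ?_, ?_⟩
  · have e1 : B σ 2 + p (σ 0) • B σ 0 + p (σ 1) • B σ 1 = p := by
      conv_rhs => rw [hexp p, hpi, hpj]
      module
    have e2 : B σ 3 + r (σ 0) • B σ 0 + r (σ 1) • B σ 1 = r := by
      conv_rhs => rw [hexp r, hri, hrj]
      module
    intro z w
    simp only [Matrix.cons_val, e1, e2]
    exact hW.2 _ (W.add_mem (W.smul_mem _ hpW) (W.smul_mem _ hrW))
  · have e1 : B σ 2 + p (σ 0) • B σ 0 + p (σ 1) • B σ 1 = p := by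
      conv_rhs => rw [hexp p, hpi, hpj]
      module
    have e2 : B σ 3 + r (σ 0) • B σ 0 + r (σ 1) • B σ 1 = r := by
      conv_rhs => rw [hexp r, hri, hrj]
      module
    simp only [Matrix.cons_val, e1, e2]
    refine span_pair_eq hW.1 hpW hrW fun z w h => ?_
    exact ⟨by simpa [hpi, hri] using congrFun h i, by simpa [hpj, hrj] using congrFun h j⟩

end Geometry

section Neighbours
variable {K : Type*} [Field K]

/-- The equation of the tangent plane along `x = y = 0` is `A x + B y = 0`. -/
noncomputable def pA (c : ℕ → ℕ → ℕ → K) : Polynomial K := cubicPoly (c 1 0)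
noncomputable def pB (c : ℕ → ℕ → ℕ → K) : Polynomial K := cubicPoly (c 0 1)

/-- The part of degree two in `x, y`, evaluated along the tangent plane. -/
noncomputable def pQ (c : ℕ → ℕ → ℕ → K) (k : ℕ) : Polynomial K :=
  .C (c 2 0 k) * pB c ^ 2 + .C (c 1 1 k) * pA c * pB c + .C (c 0 2 k) * pA c ^ 2

/-- The part of degree three in `x, y`, evaluated along the tangent plane. -/
noncomputable def pL (c : ℕ → ℕ → ℕ → K) (k : ℕ) : Polynomial K :=
  .C (c 3 0 k) * pB c ^ 3 + .C (c 2 1 k) * pA c * pB c ^ 2 + .C (c 1 2 k) * pA c ^ 2 * pB c +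
    .C (c 0 3 k) * pA c ^ 3

/-- The part of degree four in `x, y`, evaluated along the tangent plane. -/
noncomputable def pK (c : ℕ → ℕ → ℕ → K) : Polynomial K :=
  .C (c 4 0 0) * pB c ^ 4 + .C (c 3 1 0) * pA c * pB c ^ 3 + .C (c 2 2 0) * pA c ^ 2 * pB c ^ 2 +
    .C (c 1 3 0) * pA c ^ 3 * pB c + .C (c 0 4 0) * pA c ^ 4

/-- The minors of the coefficient matrix of the two cubics. -/
def mn (c : ℕ → ℕ → ℕ → K) (i j : ℕ) : K := c 1 0 i * c 0 1 j + c 1 0 j * c 0 1 i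

noncomputable def pW (c : ℕ → ℕ → ℕ → K) : Polynomial K :=
  .C (mn c 2 3) * .X ^ 4 + .C (mn c 0 3 + mn c 1 2) * .X ^ 2 + .C (mn c 0 1)

noncomputable def pA₂ (c : ℕ → ℕ → ℕ → K) : Polynomial K :=
  .C (mn c 1 3) * .X ^ 2 + .C (mn c 0 3 + mn c 1 2) * .X + .C (mn c 0 2)

noncomputable def pA₃ (c : ℕ → ℕ → ℕ → K) : Polynomial K :=
  .C (mn c 2 3) * .X ^ 2 + .C (mn c 1 3) * .X + .C (mn c 0 3)

noncomputable def pq (c : ℕ → ℕ → ℕ → K) : Polynomial K :=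
  pQ c 2 * .X ^ 2 + pQ c 1 * .X + pQ c 0

noncomputable def pl (c : ℕ → ℕ → ℕ → K) : Polynomial K := pL c 1 * .X + pL c 0

/-- The three equations for the tangent line with parameters `s, μ` to lie on the surface. -/
def IsLineAt (c : ℕ → ℕ → ℕ → K) (s μ : K) : Prop :=
  (pW c).eval s * μ + (pq c).eval s = 0 ∧
  (pA₂ c).eval s * μ ^ 2 + (pQ c 1).eval s * μ + (pl c).eval s = 0 ∧
  (pA₃ c).eval s * μ ^ 3 + (pQ c 2).eval s * μ ^ 2 + (pL c 1).eval s * μ + (pK c).eval s = 0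

theorem polar_expansion [CharP K 2] (c : ℕ → ℕ → ℕ → K) (s t : K) :
    (pB c).eval s * cubic (c 1 0) (s + t) 1 + (pA c).eval s * cubic (c 0 1) (s + t) 1 =
      t * (pW c).eval s + t ^ 2 * (pA₂ c).eval s + t ^ 3 * (pA₃ c).eval s := by
  simp only [pA, pB, eval_cubicPoly, cubic, pW, pA₂, pA₃, mn, Polynomial.eval_add,
    Polynomial.eval_mul, Polynomial.eval_C, Polynomial.eval_X, Polynomial.eval_pow]
  grind

theorem tangent_expansion [CharP K 2] {c : ℕ → ℕ → ℕ → K} (hc : VanishesOnLine c) (s μ X : K) :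
    quartic c (X * (pB c).eval s) (X * (pA c).eval s) (s + X * μ) 1 =
      X ^ 2 * ((pW c).eval s * μ + (pq c).eval s) +
      X ^ 3 * ((pA₂ c).eval s * μ ^ 2 + (pQ c 1).eval s * μ + (pl c).eval s) +
      X ^ 4 * ((pA₃ c).eval s * μ ^ 3 + (pQ c 2).eval s * μ ^ 2 + (pL c 1).eval s * μ +
        (pK c).eval s) := by
  have h := polar_expansion c s (X * μ)
  have e0 := hc 0 (by norm_num)
  have e1 := hc 1 (by norm_num)
  have e2 := hc 2 (by norm_num)
  have e3 := hc 3 (by norm_num)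
  have e4 := hc 4 (by norm_num)
  simp only [quartic, e0, e1, e2, e3, e4, pq, pl, pQ, pL, pK, Polynomial.eval_add,
    Polynomial.eval_mul, Polynomial.eval_C, Polynomial.eval_X, Polynomial.eval_pow, cubic] at h ⊢
  have h2 : (2 : K) = 0 := CharTwo.two_eq_zero
  generalize (pA c).eval s = α at *
  generalize (pB c).eval s = β at *
  linear_combination X * h + X ^ 3 * s * μ * (c 2 0 2 * β ^ 2 + c 1 1 2 * α * β + c 0 2 2 * α ^ 2) * h2

theorem isLineAt_iff [CharP K 2] [Infinite K] {c : ℕ → ℕ → ℕ → K} (hc : VanishesOnLine c)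
    (s μ : K) : IsLineAt c s μ ↔
      ∀ X, quartic c (X * (pB c).eval s) (X * (pA c).eval s) (s + X * μ) 1 = 0 := by
  constructor
  · rintro ⟨h1, h2, h3⟩ X
    rw [tangent_expansion hc, h1, h2, h3]
    ring
  · intro h
    have := coeffs_eq_zero_of_forall (K := K) (a0 := 0) (a1 := 0)
      (a2 := (pW c).eval s * μ + (pq c).eval s)
      (a3 := (pA₂ c).eval s * μ ^ 2 + (pQ c 1).eval s * μ + (pl c).eval s)
      (a4 := (pA₃ c).eval s * μ ^ 3 + (pQ c 2).eval s * μ ^ 2 + (pL c 1).eval s * μ +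
        (pK c).eval s) fun X => by
      have := h X
      rw [tangent_expansion hc] at this
      linear_combination this
    exact this.2.2

theorem eval_smul_of_isHomogeneous {F : MvPolynomial (Fin 4) K} (hF : F.IsHomogeneous 4) (m : K)
    (v : Fin 4 → K) : eval (m • v) F = m ^ 4 * eval v F := by
  obtain ⟨c, rfl⟩ := exists_eq_quarticPoly hF
  simp only [eval_quarticPoly, quartic, Pi.smul_apply, smul_eq_mul]
  ring

/-- A form vanishing on an affine line vanishes on the projective line. -/
theorem eval_eq_zero_of_affine [Infinite K] {F : MvPolynomial (Fin 4) K} (hF : F.IsHomogeneous 4)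
    {p q : Fin 4 → K} (h : ∀ X : K, eval (p + X • q) F = 0) (m n : K) :
    eval (m • p + n • q) F = 0 := by
  have key : ∀ m : K, m ≠ 0 → eval (n • q + m • p) F = 0 := by
    intro m hm
    have : n • q + m • p = m • (p + (n / m) • q) := by
      rw [smul_add, smul_smul, mul_div_cancel₀ _ hm, add_comm]
    rw [this, eval_smul_of_isHomogeneous hF, h, mul_zero]
  obtain ⟨r, hr⟩ := taylor_line F (n • q) p
  have hz : Polynomial.X * (Polynomial.C (eval (n • q) F) + Polynomial.X *
      Polynomial.C (∑ i, p i * eval (n • q) (pderiv i F)) + Polynomial.X ^ 2 * r) = 0 :=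
    Polynomial.funext fun m => by
      by_cases hm : m = 0
      · simp [hm]
      · have := key m hm
        rw [hr] at this
        simp only [Polynomial.eval_add, Polynomial.eval_mul, Polynomial.eval_C, Polynomial.eval_X,
          Polynomial.eval_pow, this, mul_zero, Polynomial.eval_zero]
  have h0 := congrArg (Polynomial.eval m) ((mul_eq_zero.1 hz).resolve_left Polynomial.X_ne_zero)
  rw [add_comm (m • p), hr]
  simpa only [Polynomial.eval_add, Polynomial.eval_mul, Polynomial.eval_C, Polynomial.eval_X,
          Polynomial.eval_pow, Polynomial.eval_zero] using h0

variable {F : MvPolynomial (Fin 4) K} {b : Module.Basis (Fin 4) K (Fin 4 → K)}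
  {c : ℕ → ℕ → ℕ → K} {W : Submodule K (Fin 4 → K)}

/-- The line through the point `s` of `x = y = 0` in the tangent plane with direction `μ`. -/
noncomputable def lineAt (b : Module.Basis (Fin 4) K (Fin 4 → K)) (c : ℕ → ℕ → ℕ → K)
    (s μ : K) : Submodule K (Fin 4 → K) :=
  Submodule.span K {pt b 0 0 s 1, pt b ((pB c).eval s) ((pA c).eval s) μ 0}

theorem pA_pB_ne_zero (hc : SmoothCoeffs c) (hv : VanishesOnLine c) (s : K) :
    (pA c).eval s ≠ 0 ∨ (pB c).eval s ≠ 0 := by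
  by_contra! h
  rw [pA, pB, eval_cubicPoly, eval_cubicPoly] at h
  exact one_ne_zero (hv.coprime hc s 1 h.1 h.2).2

theorem lineAt_pair (hc : SmoothCoeffs c) (hv : VanishesOnLine c) (s μ z w : K)
    (h : z • pt b 0 0 s 1 + w • pt b ((pB c).eval s) ((pA c).eval s) μ 0 = 0) : z = 0 ∧ w = 0 := by
  have : pt b (w * (pB c).eval s) (w * (pA c).eval s) (z * s + w * μ) z = 0 := by
    rw [← h]; simp only [pt]; module
  obtain ⟨h1, h2, h3, h4⟩ := pt_eq_zero.1 this
  refine ⟨h4, ?_⟩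
  rcases pA_pB_ne_zero hc hv s with h' | h'
  · exact (mul_eq_zero.1 h2).resolve_right h'
  · exact (mul_eq_zero.1 h1).resolve_right h'

theorem mem_lineAt {s μ : K} {v : Fin 4 → K} : v ∈ lineAt b c s μ ↔
    ∃ m n : K, pt b (n * (pB c).eval s) (n * (pA c).eval s) (m * s + n * μ) m = v := by
  rw [lineAt, Submodule.mem_span_pair]
  refine exists_congr fun m => exists_congr fun n => ?_
  have : m • pt b 0 0 s 1 + n • pt b ((pB c).eval s) ((pA c).eval s) μ 0 =
      pt b (n * (pB c).eval s) (n * (pA c).eval s) (m * s + n * μ) m := by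
    simp only [pt]; module
  rw [this]

theorem lineAt_injective (hc : SmoothCoeffs c) (hv : VanishesOnLine c) :
    Function.Injective fun p : K × K => lineAt b c p.1 p.2 := by
  rintro ⟨s, μ⟩ ⟨s', μ'⟩ h
  simp only at h
  have h1 : pt b 0 0 s 1 ∈ lineAt b c s μ := mem_lineAt.2 ⟨1, 0, by simp⟩
  have h2 : pt b ((pB c).eval s) ((pA c).eval s) μ 0 ∈ lineAt b c s μ :=
    mem_lineAt.2 ⟨0, 1, by simp⟩
  rw [h, mem_lineAt] at h1 h2
  obtain ⟨m, n, h1⟩ := h1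
  obtain ⟨m', n', h2⟩ := h2
  obtain ⟨e1, e2, e3, rfl⟩ := pt_inj h1
  have hn : n = 0 := by
    rcases pA_pB_ne_zero hc hv s' with h' | h'
    · exact (mul_eq_zero.1 e2).resolve_right h'
    · exact (mul_eq_zero.1 e1).resolve_right h'
  have hs : s' = s := by simpa [hn] using e3
  subst hs
  obtain ⟨f1, f2, f3, rfl⟩ := pt_inj h2
  have hn' : n' = 1 := by
    rcases pA_pB_ne_zero hc hv s' with h' | h'
    · exact mul_right_cancel₀ h' (by rw [f2, one_mul])
    · exact mul_right_cancel₀ h' (by rw [f1, one_mul])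
  simp only [Prod.mk.injEq, true_and]
  simpa [hn'] using f3.symm

theorem lineAt_mem_lines [CharP K 2] [Infinite K] (hF : F.IsHomogeneous 4) (hb : Coords F b c)
    (hv : VanishesOnLine c) {s μ : K} (h : IsLineAt c s μ) : lineAt b c s μ ∈ lines F := by
  refine ⟨finrank_span_pair (lineAt_pair hb.1 hv s μ), fun v hmem => ?_⟩
  obtain ⟨m, n, rfl⟩ := Submodule.mem_span_pair.1 hmem
  refine eval_eq_zero_of_affine hF (fun X => ?_) m n
  refine Eq.trans ?_ ((isLineAt_iff hv s μ).1 h X)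
  rw [← hb.2]
  refine congrArg (fun v => eval v F) ?_
  simp only [pt]
  module

theorem exists_lineAt [CharP K 2] [Infinite K] (hb : Coords F b c) (hv : VanishesOnLine c)
    {W' : Submodule K (Fin 4 → K)} (hW : W' ∈ nbrs F (Submodule.span K {b 2, b 3}))
    (h2 : b 2 ∉ W') : ∃ s μ, IsLineAt c s μ ∧ lineAt b c s μ = W' := by
  obtain ⟨hl, hne, v, hvW, hvl, hv0⟩ := hW
  obtain ⟨z, w, rfl⟩ := Submodule.mem_span_pair.1 hvl
  have hw : w ≠ 0 := by
    rintro rfl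
    have hz : z ≠ 0 := by rintro rfl; simp at hv0
    refine h2 ?_
    have := W'.smul_mem z⁻¹ hvW
    simpa [smul_smul, hz] using this
  set s := z / w with hs
  have hp : pt b 0 0 s 1 ∈ W' := by
    have := W'.smul_mem w⁻¹ hvW
    have e : pt b 0 0 s 1 = w⁻¹ • (z • b 2 + w • b 3) := by
      simp only [pt, smul_add, smul_smul, inv_mul_cancel₀ hw, hs, div_eq_inv_mul]
      module
    rwa [e]
  obtain ⟨x, y, μ, hxy, hq⟩ : ∃ x y μ, (x ≠ 0 ∨ y ≠ 0) ∧ pt b x y μ 0 ∈ W' := by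
    by_contra! hcon
    have hsub : ∀ v ∈ W', v ∈ Submodule.span K {b 2, b 3} := by
      intro v hvm
      obtain ⟨x, y, z', w', rfl⟩ := exists_eq_pt b v
      have h0 : pt b x y (z' - w' * s) 0 ∈ W' := by
        have := W'.sub_mem hvm (W'.smul_mem w' hp)
        convert this using 1
        simp only [pt]
        module
      have hx : x = 0 := by by_contra hx; exact hcon _ _ _ (Or.inl hx) h0
      have hy : y = 0 := by by_contra hy; exact hcon _ _ _ (Or.inr hy) h0
      subst hx hy
      exact Submodule.mem_span_pair.2 ⟨z', w', by simp [pt]⟩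
    refine hne (Submodule.eq_of_le_of_finrank_eq hsub ?_)
    rw [hl.1, finrank_span_pair]
    intro z w h
    exact (pt_eq_zero.1 (show pt b 0 0 z w = 0 by simpa [pt] using h)).2.2
  have hF0 : ∀ X, quartic c (X * x) (X * y) (s + X * μ) 1 = 0 := by
    intro X
    rw [← hb.2]
    refine hl.2 _ ?_
    convert W'.add_mem hp (W'.smul_mem X hq) using 1
    simp only [pt]
    module
  have hlin : x * (pA c).eval s + y * (pB c).eval s = 0 := by
    obtain ⟨r, hr⟩ := taylor_line (quarticPoly c) ![0, 0, s, 1] ![x, y, μ, 0]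
    have hz := linear_coeff_unique (a := 0) (b := 0) (r := 0) (r' := r) fun X => by
      rw [← hr, eval_quarticPoly]
      have := hF0 X
      simp
      exact this.symm
    obtain ⟨d0, d1, d2, d3⟩ := eval_pderiv_quarticPoly c ![0, 0, s, 1]
    have e1 := hv 1 (by norm_num)
    have e3 := hv 3 (by norm_num)
    simp [Fin.sum_univ_four, d0, d1, d2, quarticX, quarticY, quarticZ, e1, e3] at hz
    simp only [pA, pB, eval_cubicPoly, cubic]
    linear_combination -hz
  obtain ⟨t, ht, rfl, rfl⟩ : ∃ t, t ≠ 0 ∧ x = t * (pB c).eval s ∧ y = t * (pA c).eval s := by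
    have h2 : (2 : K) = 0 := CharTwo.two_eq_zero
    rcases pA_pB_ne_zero hb.1 hv s with h' | h'
    · refine ⟨y / (pA c).eval s, ?_, ?_, by field_simp⟩
      · intro h0
        have hy : y = 0 := by simpa [h'] using h0
        subst hy
        have hx : x = 0 := by simpa [h'] using hlin
        simp [hx] at hxy
      · field_simp
        linear_combination hlin - y * (pB c).eval s * h2
    · refine ⟨x / (pB c).eval s, ?_, by field_simp, ?_⟩
      · intro h0
        have hy : x = 0 := by simpa [h'] using h0
        subst hy
        have hx : y = 0 := by simpa [h'] using hlin
        simp [hx] at hxy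
      · field_simp
        linear_combination hlin - x * (pA c).eval s * h2
  refine ⟨s, t⁻¹ * μ, ?_, ?_⟩
  · rw [isLineAt_iff hv]
    intro X
    have := hF0 (t⁻¹ * X)
    convert this using 2 <;> field_simp
  · refine span_pair_eq hl.1 hp ?_ (lineAt_pair hb.1 hv _ _)
    convert W'.smul_mem t⁻¹ hq using 1
    simp only [pt, smul_add, smul_smul, inv_mul_cancel_left₀ ht, mul_zero]

/-- Only finitely many points of a line lie on other lines. -/
theorem finite_bad_points (hfin : (lines F).Finite)
    (b : Module.Basis (Fin 4) K (Fin 4 → K)) :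
    {κ : K | ∃ W ∈ lines F, W ≠ Submodule.span K {b 2, b 3} ∧ b 2 + κ • b 3 ∈ W}.Finite := by
  have : {κ : K | ∃ W ∈ lines F, W ≠ Submodule.span K {b 2, b 3} ∧ b 2 + κ • b 3 ∈ W} =
      ⋃ W ∈ lines F, {κ : K | W ≠ Submodule.span K {b 2, b 3} ∧ b 2 + κ • b 3 ∈ W} := by
    ext x
    simp only [Set.mem_ofPred_eq, Set.mem_iUnion, exists_prop]
  rw [this]
  refine hfin.biUnion fun W hW => Set.Subsingleton.finite ?_
  rintro κ ⟨hne, h1⟩ κ' ⟨-, h2⟩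
  by_contra hκ
  refine hne (span_pair_eq hW.1 ?_ ?_ ?_).symm
  · have h3 : b 3 = (κ - κ')⁻¹ • ((b 2 + κ • b 3) - (b 2 + κ' • b 3)) := by
      have : (b 2 + κ • b 3) - (b 2 + κ' • b 3) = (κ - κ') • b 3 := by module
      rw [this, smul_smul, inv_mul_cancel₀ (sub_ne_zero.2 hκ), one_smul]
    have h3' : b 3 ∈ W := h3 ▸ W.smul_mem _ (W.sub_mem h1 h2)
    have : b 2 = (b 2 + κ • b 3) - κ • b 3 := by module
    rw [this]
    exact W.sub_mem h1 (W.smul_mem _ h3')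
  · have h3 : b 3 = (κ - κ')⁻¹ • ((b 2 + κ • b 3) - (b 2 + κ' • b 3)) := by
      have : (b 2 + κ • b 3) - (b 2 + κ' • b 3) = (κ - κ') • b 3 := by module
      rw [this, smul_smul, inv_mul_cancel₀ (sub_ne_zero.2 hκ), one_smul]
    exact h3 ▸ W.smul_mem _ (W.sub_mem h1 h2)
  · intro z w h
    exact (pt_eq_zero.1 (show pt b 0 0 z w = 0 by simpa [pt] using h)).2.2

end Neighbours

section Counting
variable {K : Type*} [Field K]

theorem sum_rootMultiplicity_le (S : Finset K) (R : Polynomial K) :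
    ∑ s ∈ S, R.rootMultiplicity s ≤ R.natDegree := by
  classical
  simp only [← Polynomial.count_roots]
  calc ∑ s ∈ S, R.roots.count s ≤ ∑ s ∈ S ∪ R.roots.toFinset, R.roots.count s :=
        Finset.sum_le_sum_of_subset Finset.subset_union_left
    _ = R.roots.card := Multiset.sum_count_eq_card (by simp +contextual)
    _ ≤ R.natDegree := R.card_roots'

/-- Bounding a set of pairs fibrewise by the multiplicities of the roots of a polynomial. -/
theorem ncard_le_natDegree_add (T : Set (K × K)) (hT : T.Finite) (R : Polynomial K) (E : Finset K)
    (h : ∀ (s : K) (S : Finset K), (∀ μ ∈ S, (s, μ) ∈ T) → S.Nonempty →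
      (S.card ≤ R.rootMultiplicity s ∨ (s ∈ E ∧ S.card ≤ R.rootMultiplicity s + 1))) :
    T.ncard ≤ R.natDegree + E.card := by
  classical
  rw [Set.ncard_eq_toFinset_card T hT]
  set t := hT.toFinset
  have h1 : t.card = ∑ s ∈ t.image Prod.fst, (t.filter fun p => p.1 = s).card :=
    Finset.card_eq_sum_card_image _ _
  rw [h1]
  have h2 : ∀ s ∈ t.image Prod.fst, (t.filter fun p => p.1 = s).card ≤
      R.rootMultiplicity s + if s ∈ E then 1 else 0 := by
    intro s hs
    have hcard : (t.filter fun p => p.1 = s).card = ((t.filter fun p => p.1 = s).image Prod.snd).card := by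
      refine (Finset.card_image_of_injOn ?_).symm
      rintro ⟨a, b⟩ ha ⟨a', b'⟩ hb hab
      simp at ha hb hab
      simp [ha.2, hb.2, hab]
    rw [hcard]
    rcases h s ((t.filter fun p => p.1 = s).image Prod.snd) (by
        intro μ hμ
        simp only [Finset.mem_image, Finset.mem_filter] at hμ
        obtain ⟨⟨a, b⟩, ⟨hp, rfl⟩, rfl⟩ := hμ
        simpa [t] using hp) (by
        obtain ⟨p, hp, rfl⟩ := Finset.mem_image.1 hs
        exact ⟨p.2, Finset.mem_image.2 ⟨p, by simp [hp], rfl⟩⟩) with h' | ⟨hE, h'⟩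
    · omega
    · simpa [hE] using h'
  refine (Finset.sum_le_sum h2).trans ?_
  rw [Finset.sum_add_distrib]
  refine add_le_add (sum_rootMultiplicity_le _ _) ?_
  rw [← Finset.sum_filter, Finset.sum_const, smul_eq_mul, mul_one]
  exact Finset.card_le_card fun s hs => (Finset.mem_filter.1 hs).2

theorem card_le_one_of_linear {S : Finset K} {a b : K} (ha : a ≠ 0)
    (h : ∀ μ ∈ S, a * μ + b = 0) : S.card ≤ 1 :=
  Finset.card_le_one.2 fun x hx y hy => mul_left_cancel₀ ha (by linear_combination h x hx - h y hy)

theorem card_le_three_of_cubic {S : Finset K} {a b c d : K}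
    (hne : a ≠ 0 ∨ b ≠ 0 ∨ c ≠ 0 ∨ d ≠ 0)
    (h : ∀ μ ∈ S, a * μ ^ 3 + b * μ ^ 2 + c * μ + d = 0) : S.card ≤ 3 := by
  classical
  set P : Polynomial K := .C a * .X ^ 3 + .C b * .X ^ 2 + .C c * .X + .C d with hP
  have hP0 : P ≠ 0 := by
    intro h0
    have hk := fun n => congrArg (Polynomial.coeff · n) h0
    have h0 := hk 0
    have h1 := hk 1
    have h2 := hk 2
    have h3 := hk 3
    simp [hP, Polynomial.coeff_X, Polynomial.coeff_C] at h0 h1 h2 h3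
    simp [h0, h1, h2, h3] at hne
  have : S ⊆ P.roots.toFinset := by
    intro μ hμ
    simp only [Multiset.mem_toFinset, Polynomial.mem_roots hP0, Polynomial.IsRoot.def]
    simpa [hP] using h μ hμ
  calc S.card ≤ P.roots.toFinset.card := Finset.card_le_card this
    _ ≤ P.roots.card := Multiset.toFinset_card_le _
    _ ≤ P.natDegree := P.card_roots'
    _ ≤ 3 := by rw [hP]; compute_degree

theorem card_le_two_of_quadratic {S : Finset K} {a b c : K}
    (ha : a ≠ 0) (h : ∀ μ ∈ S, a * μ ^ 2 + b * μ + c = 0) : S.card ≤ 2 := by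
  classical
  by_contra! hS
  obtain ⟨x, hx, y, hy, z, hz, hxy, hxz, hyz⟩ := Finset.two_lt_card.1 hS
  have e1 : a * (x + y) + b = 0 := by
    apply mul_left_cancel₀ (sub_ne_zero.2 hxy)
    linear_combination h x hx - h y hy
  have e2 : a * (x + z) + b = 0 := by
    apply mul_left_cancel₀ (sub_ne_zero.2 hxz)
    linear_combination h x hx - h z hz
  exact hyz (mul_left_cancel₀ ha (by linear_combination e1 - e2))

theorem le_rootMultiplicity_of_dvd {R : Polynomial K} (hR : R ≠ 0) {s : K} {n : ℕ}
    (h : (Polynomial.X - Polynomial.C s) ^ n ∣ R) : n ≤ R.rootMultiplicity s :=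
  (Polynomial.le_rootMultiplicity_iff hR).2 h

end Counting

section Generic
variable {K : Type*} [Field K] {c : ℕ → ℕ → ℕ → K}

theorem natDegree_cubicPoly (a : ℕ → K) : (cubicPoly a).natDegree ≤ 3 := by
  rw [cubicPoly]; compute_degree

theorem natDegree_pA : (pA c).natDegree ≤ 3 := natDegree_cubicPoly _
theorem natDegree_pB : (pB c).natDegree ≤ 3 := natDegree_cubicPoly _

theorem natDegree_pQ (k : ℕ) : (pQ c k).natDegree ≤ 6 := by
  have := natDegree_pA (c := c)
  have := natDegree_pB (c := c)
  rw [pQ]; compute_degree <;> omega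

theorem natDegree_pL (k : ℕ) : (pL c k).natDegree ≤ 9 := by
  have := natDegree_pA (c := c)
  have := natDegree_pB (c := c)
  rw [pL]; compute_degree <;> omega

theorem natDegree_pK : (pK c).natDegree ≤ 12 := by
  have := natDegree_pA (c := c)
  have := natDegree_pB (c := c)
  rw [pK]; compute_degree <;> omega

theorem natDegree_pW : (pW c).natDegree ≤ 4 := by rw [pW]; compute_degree
theorem natDegree_pA₂ : (pA₂ c).natDegree ≤ 2 := by rw [pA₂]; compute_degree
theorem natDegree_pA₃ : (pA₃ c).natDegree ≤ 2 := by rw [pA₃]; compute_degree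

theorem natDegree_pq : (pq c).natDegree ≤ 8 := by
  have h0 := natDegree_pQ (c := c) 0
  have h1 := natDegree_pQ (c := c) 1
  have h2 := natDegree_pQ (c := c) 2
  rw [pq]; compute_degree <;> omega

theorem natDegree_pl : (pl c).natDegree ≤ 10 := by
  have := natDegree_pL (c := c) 0
  have := natDegree_pL (c := c) 1
  rw [pl]; compute_degree <;> omega

/-- The eliminant of the first two line equations. -/
noncomputable def pI (c : ℕ → ℕ → ℕ → K) : Polynomial K :=
  pW c ^ 2 * pl c + pW c * pq c * pQ c 1 + pq c ^ 2 * pA₂ c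

theorem natDegree_pI : (pI c).natDegree ≤ 18 := by
  have := natDegree_pW (c := c)
  have := natDegree_pl (c := c)
  have := natDegree_pq (c := c)
  have := natDegree_pQ (c := c) 1
  have := natDegree_pA₂ (c := c)
  rw [pI]; compute_degree <;> omega

theorem CoprimeCubics.not_all_zero [IsAlgClosed K] {a b : ℕ → K} (h : CoprimeCubics a b)
    {α β : K} (hα : α ≠ 0 ∨ β ≠ 0) (hz : ∀ z w, α * cubic a z w + β * cubic b z w = 0) : False := by
  have key : ∀ {a b : ℕ → K}, CoprimeCubics a b → ∀ {α β : K}, β ≠ 0 →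
      (∀ z w, α * cubic a z w + β * cubic b z w = 0) → False := by
    intro a b h α β hβ hz
    have hb : ∀ z w, cubic a z w = 0 → cubic b z w = 0 := by
      intro z w h0
      have := hz z w
      rw [h0, mul_zero, zero_add] at this
      exact (mul_eq_zero.1 this).resolve_left hβ
    by_cases ha : a 3 = 0
    · have h0 : cubic a 1 0 = 0 := by simp [cubic, ha]
      exact one_ne_zero (h 1 0 h0 (hb _ _ h0)).1
    · obtain ⟨s, hs⟩ := IsAlgClosed.exists_root (cubicPoly a) (by
        intro hd
        have := Polynomial.natDegree_eq_zero_iff_degree_le_zero.2 hd.le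
        have h3 := (coeff_cubicPoly a).2.2.2
        rw [Polynomial.coeff_eq_zero_of_natDegree_lt (by omega)] at h3
        exact ha h3.symm)
      rw [Polynomial.IsRoot.def, eval_cubicPoly] at hs
      exact one_ne_zero (h s 1 hs (hb _ _ hs)).2
  rcases hα with hα | hβ
  · refine key (a := b) (b := a) (fun z w h1 h2 => h z w h2 h1) hα (α := β) fun z w => ?_
    rw [add_comm]
    exact hz z w
  · exact key h hβ hz

theorem cubic_hom_of_affine [Infinite K] {a b : ℕ → K} {α β γ s : K}
    (h : ∀ t, α * cubic a (s + t) 1 + β * cubic b (s + t) 1 = γ * t ^ 3) (z w : K) :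
    α * cubic a z w + β * cubic b z w = γ * (z - s * w) ^ 3 := by
  have h' : ∀ t, α * cubic a t 1 + β * cubic b t 1 = γ * (t - s) ^ 3 := by
    intro t
    have := h (t - s)
    simpa using this
  obtain ⟨h0, h1, h2, h3, -⟩ := coeffs_eq_zero_of_forall (a0 := α * a 0 + β * b 0 + γ * s ^ 3)
    (a1 := α * a 1 + β * b 1 - 3 * γ * s ^ 2) (a2 := α * a 2 + β * b 2 + 3 * γ * s)
    (a3 := α * a 3 + β * b 3 - γ) (a4 := 0) fun t => by
      have := h' t
      simp only [cubic] at this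
      linear_combination this
  simp only [cubic]
  linear_combination w ^ 3 * h0 + z * w ^ 2 * h1 + z ^ 2 * w * h2 + z ^ 3 * h3

section CharTwo
variable [CharP K 2]

theorem polar_of_triple [Infinite K] {s : K} (hW : (pW c).eval s = 0)
    (hA : (pA₂ c).eval s = 0) (z w : K) :
    (pB c).eval s * cubic (c 1 0) z w + (pA c).eval s * cubic (c 0 1) z w =
      (pA₃ c).eval s * (z - s * w) ^ 3 := by
  refine cubic_hom_of_affine (fun t => ?_) z w
  rw [polar_expansion, hW, hA]
  ring

theorem pA₃_ne_zero [IsAlgClosed K] (hc : SmoothCoeffs c) (hv : VanishesOnLine c) {s : K}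
    (hW : (pW c).eval s = 0) (hA : (pA₂ c).eval s = 0) : (pA₃ c).eval s ≠ 0 := by
  have : Infinite K := IsAlgClosed.instInfinite
  intro h3
  refine (hv.coprime hc).not_all_zero (pA_pB_ne_zero hc hv s).symm fun z w => ?_
  rw [polar_of_triple hW hA, h3, zero_mul]

theorem lead_eq_zero_of_dvd_derivative {a : ℕ → K}
    (h : cubicPoly a ∣ .C (a 3) * .X ^ 2 + .C (a 1)) : a 3 = 0 := by
  by_contra h3
  have hne : Polynomial.C (a 3) * Polynomial.X ^ 2 + Polynomial.C (a 1) ≠ 0 := by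
    intro h0
    have := congrArg (Polynomial.coeff · 2) h0
    simp [Polynomial.coeff_C, h3] at this
  have h1 := Polynomial.natDegree_le_of_dvd h hne
  have h2 : (Polynomial.C (a 3) * Polynomial.X ^ 2 + Polynomial.C (a 1)).natDegree ≤ 2 := by
    compute_degree
  have h4 := (coeff_cubicPoly a).2.2.2
  rw [Polynomial.coeff_eq_zero_of_natDegree_lt (by omega)] at h4
  exact h3 h4.symm

theorem pW_ne_zero [IsAlgClosed K] (hc : SmoothCoeffs c) (hv : VanishesOnLine c) : pW c ≠ 0 := by
  intro h0
  have hid : pA c * (.C (c 0 1 3) * .X ^ 2 + .C (c 0 1 1)) +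
      pB c * (.C (c 1 0 3) * .X ^ 2 + .C (c 1 0 1)) = 0 := by
    rw [← h0]
    simp only [pA, pB, pW, mn, cubicPoly, Polynomial.C_add, Polynomial.C_mul]
    grind
  have hcop := (hv.coprime hc).isCoprime
  have ha : c 1 0 3 = 0 := by
    refine lead_eq_zero_of_dvd_derivative (a := c 1 0) (hcop.dvd_of_dvd_mul_left ?_)
    exact ⟨-(.C (c 0 1 3) * .X ^ 2 + .C (c 0 1 1)), by rw [pA, pB] at hid; linear_combination hid⟩
  refine (hv.coprime hc).lead ha (lead_eq_zero_of_dvd_derivative (a := c 0 1) ?_)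
  refine hcop.symm.dvd_of_dvd_mul_left ?_
  exact ⟨-(.C (c 1 0 3) * .X ^ 2 + .C (c 1 0 1)), by rw [pA, pB] at hid; linear_combination hid⟩

theorem sq_dvd_pW {s : K} (h : (pW c).eval s = 0) :
    (Polynomial.X - Polynomial.C s) ^ 2 ∣ pW c := by
  have hC : Polynomial.C ((pW c).eval s) = 0 := by rw [h, Polynomial.C_0]
  refine ⟨.C (mn c 2 3) * (.X ^ 2 - .C s ^ 2) + .C (mn c 0 3 + mn c 1 2), ?_⟩
  rw [← sub_zero (pW c), ← hC]
  simp only [pW, Polynomial.eval_add, Polynomial.eval_mul, Polynomial.eval_C, Polynomial.eval_X,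
    Polynomial.eval_pow, Polynomial.C_add, Polynomial.C_mul, Polynomial.C_pow]
  grind

theorem dvd_of_eval_eq_zero {P : Polynomial K} {s : K} (h : P.eval s = 0) :
    Polynomial.X - Polynomial.C s ∣ P := Polynomial.dvd_iff_isRoot.2 h

theorem mul_dvd_pI₂ {s : K} (hW : (pW c).eval s = 0) (hq : (pq c).eval s = 0) :
    (Polynomial.X - Polynomial.C s) ^ 2 ∣ pI c ∧ ((pA₂ c).eval s = 0 →
    (Polynomial.X - Polynomial.C s) ^ 3 ∣ pI c) := by
  obtain ⟨u, hu⟩ := sq_dvd_pW hW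
  obtain ⟨v, hv⟩ := dvd_of_eval_eq_zero hq
  refine ⟨⟨(.X - .C s) ^ 2 * u ^ 2 * pl c + (.X - .C s) * u * v * pQ c 1 + v ^ 2 * pA₂ c, ?_⟩,
    fun hA => ?_⟩
  · rw [pI, hu, hv]; ring
  · obtain ⟨t, ht⟩ := dvd_of_eval_eq_zero hA
    refine ⟨(.X - .C s) * u ^ 2 * pl c + u * v * pQ c 1 + v ^ 2 * t, ?_⟩
    rw [pI, hu, hv, ht]; ring

/-- The set of parameters of the lines meeting `x = y = 0`. -/
def lineParams (c : ℕ → ℕ → ℕ → K) : Set (K × K) := {p | IsLineAt c p.1 p.2}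

theorem card_fibre_le_three [IsAlgClosed K] (hc : SmoothCoeffs c) (hv : VanishesOnLine c) {s : K}
    {S : Finset K} (hS : ∀ μ ∈ S, IsLineAt c s μ) : S.card ≤ 3 := by
  by_cases hW : (pW c).eval s = 0
  · by_cases hA : (pA₂ c).eval s = 0
    · exact card_le_three_of_cubic (Or.inl (pA₃_ne_zero hc hv hW hA)) fun μ hμ => (hS μ hμ).2.2
    · exact (card_le_two_of_quadratic hA fun μ hμ => (hS μ hμ).2.1).trans (by norm_num)
  · exact (card_le_one_of_linear hW fun μ hμ => (hS μ hμ).1).trans (by norm_num)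

theorem ncard_lineParams_of_pI_ne_zero [IsAlgClosed K] (hc : SmoothCoeffs c)
    (hv : VanishesOnLine c) (hfin : (lineParams c).Finite) (hI : pI c ≠ 0) :
    (lineParams c).ncard ≤ 18 := by
  refine (ncard_le_natDegree_add _ hfin (pI c) ∅ fun s S hS hne => Or.inl ?_).trans
    (by simpa using natDegree_pI)
  obtain ⟨μ, hμ⟩ := hne
  have hS' : ∀ μ ∈ S, IsLineAt c s μ := hS
  have hm := hS' μ hμ
  have hI0 : (pI c).eval s = 0 := by
    have h1 := hm.1
    have h2 := hm.2.1
    simp only [pI, Polynomial.eval_add, Polynomial.eval_mul, Polynomial.eval_pow]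
    generalize (pW c).eval s = W at *
    generalize (pq c).eval s = q at *
    generalize (pA₂ c).eval s = A at *
    generalize (pQ c 1).eval s = q' at *
    generalize (pl c).eval s = l at *
    grind
  by_cases hW : (pW c).eval s = 0
  · have hq : (pq c).eval s = 0 := by simpa [hW] using hm.1
    obtain ⟨h2, h3⟩ := mul_dvd_pI₂ hW hq
    by_cases hA : (pA₂ c).eval s = 0
    · exact (card_fibre_le_three hc hv hS').trans (le_rootMultiplicity_of_dvd hI (h3 hA))
    · exact (card_le_two_of_quadratic hA fun μ hμ => (hS' μ hμ).2.1).trans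
        (le_rootMultiplicity_of_dvd hI h2)
  · refine (card_le_one_of_linear hW fun μ hμ => (hS' μ hμ).1).trans
      (le_rootMultiplicity_of_dvd hI (by rw [pow_one]; exact dvd_of_eval_eq_zero hI0))

end CharTwo

end Generic

section Shear
variable {K : Type*} [Field K]

theorem quartic_smul (c : ℕ → ℕ → ℕ → K) (m x y z w : K) :
    quartic c (m * x) (m * y) (m * z) (m * w) = m ^ 4 * quartic c x y z w := by
  simp only [quartic]; ring

theorem VanishesOnLine.linear_part [CharP K 2] {c : ℕ → ℕ → ℕ → K} (hv : VanishesOnLine c)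
    (x y z w z' w' : K) : ∃ r : Polynomial K, ∀ X : K,
      quartic c (X * x) (X * y) (z + X * z') (w + X * w') =
        0 + X * (x * cubic (c 1 0) z w + y * cubic (c 0 1) z w) + X ^ 2 * r.eval X := by
  obtain ⟨r, hr⟩ := taylor_line (quarticPoly c) ![0, 0, z, w] ![x, y, z', w']
  refine ⟨r, fun X => ?_⟩
  obtain ⟨d0, d1, d2, d3⟩ := eval_pderiv_quarticPoly c ![0, 0, z, w]
  have e0 := hv 0 (by norm_num)
  have e1 := hv 1 (by norm_num)
  have e2 := hv 2 (by norm_num)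
  have e3 := hv 3 (by norm_num)
  have e4 := hv 4 (by norm_num)
  have h0 : eval ![0, 0, z, w] (quarticPoly c) = 0 := by
    rw [eval_quarticPoly]; simp [quartic, e0, e1, e2, e3, e4]
  have h1 : ∑ i, (![x, y, z', w'] i) * eval ![0, 0, z, w] (pderiv i (quarticPoly c)) =
      x * cubic (c 1 0) z w + y * cubic (c 0 1) z w := by
    simp [Fin.sum_univ_four, d0, d1, d2, d3, quarticX, quarticY, quarticZ, quarticW, e1, e3, cubic]
    ring
  rw [← h0, ← h1, ← hr, eval_quarticPoly]
  simp

theorem linear_part_eq [CharP K 2] [Infinite K] {c c' : ℕ → ℕ → ℕ → K} (hv : VanishesOnLine c)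
    (hv' : VanishesOnLine c') {x y z w z' w' x₁ y₁ z₁ w₁ z₁' w₁' : K}
    (h : ∀ X : K, quartic c (X * x) (X * y) (z + X * z') (w + X * w') =
      quartic c' (X * x₁) (X * y₁) (z₁ + X * z₁') (w₁ + X * w₁')) :
    x * cubic (c 1 0) z w + y * cubic (c 0 1) z w =
      x₁ * cubic (c' 1 0) z₁ w₁ + y₁ * cubic (c' 0 1) z₁ w₁ := by
  obtain ⟨r, hr⟩ := hv.linear_part x y z w z' w'
  obtain ⟨r', hr'⟩ := hv'.linear_part x₁ y₁ z₁ w₁ z₁' w₁'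
  exact linear_coeff_unique fun X => by rw [← hr, ← hr', h]

theorem cubic_coeffs [Infinite K] {a : ℕ → K} {d0 d1 d2 d3 : K}
    (h : ∀ z, cubic a z 1 = d3 * z ^ 3 + d2 * z ^ 2 + d1 * z + d0) :
    a 0 = d0 ∧ a 1 = d1 ∧ a 2 = d2 ∧ a 3 = d3 := by
  obtain ⟨h0, h1, h2, h3, -⟩ := coeffs_eq_zero_of_forall (a0 := a 0 - d0)
    (a1 := a 1 - d1) (a2 := a 2 - d2) (a3 := a 3 - d3) (a4 := 0) fun z => by
      have := h z
      simp only [cubic] at this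
      linear_combination this
  exact ⟨sub_eq_zero.1 h0, sub_eq_zero.1 h1, sub_eq_zero.1 h2, sub_eq_zero.1 h3⟩

variable [CharP K 2] [Infinite K] {c c' : ℕ → ℕ → ℕ → K} {κ : K}

theorem shear_cubics (hv : VanishesOnLine c) (hv' : VanishesOnLine c')
    (h : ∀ x y z w, quartic c' x y z w = quartic c x y z (w + κ * z)) (z w : K) :
    cubic (c' 1 0) z w = cubic (c 1 0) z (w + κ * z) ∧
      cubic (c' 0 1) z w = cubic (c 0 1) z (w + κ * z) := by
  constructor
  · have := linear_part_eq hv' hv (x := 1) (y := 0) (z := z) (w := w) (z' := 0) (w' := 0)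
      (x₁ := 1) (y₁ := 0) (z₁ := z) (w₁ := w + κ * z) (z₁' := 0) (w₁' := 0) fun X => by
        rw [h]; congr 1; ring
    simpa using this
  · have := linear_part_eq hv' hv (x := 0) (y := 1) (z := z) (w := w) (z' := 0) (w' := 0)
      (x₁ := 0) (y₁ := 1) (z₁ := z) (w₁ := w + κ * z) (z₁' := 0) (w₁' := 0) fun X => by
        rw [h]; congr 1; ring
    simpa using this

theorem shear_coeffs {a a' : ℕ → K} (h : ∀ z w, cubic a' z w = cubic a z (w + κ * z)) :
    a' 0 = a 0 ∧ a' 1 = a 1 + κ * a 0 ∧ a' 2 = a 2 + κ ^ 2 * a 0 ∧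
      a' 3 = a 3 + κ * a 2 + κ ^ 2 * a 1 + κ ^ 3 * a 0 := by
  have h2 : (2 : K) = 0 := CharTwo.two_eq_zero
  refine cubic_coeffs fun z => ?_
  rw [h, cubic]
  linear_combination (a 1 * κ * z ^ 2 + a 0 * κ * z + a 0 * κ ^ 2 * z ^ 2) * h2

theorem shear_pW (hv : VanishesOnLine c) (hv' : VanishesOnLine c')
    (h : ∀ x y z w, quartic c' x y z w = quartic c x y z (w + κ * z)) (s t : K)
    (ht : t * (1 + κ * s) = 1) : (pW c').eval (t * s) = t ^ 4 * (pW c).eval s := by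
  obtain ⟨a0, a1, a2, a3⟩ := shear_coeffs fun z w => (shear_cubics hv hv' h z w).1
  obtain ⟨b0, b1, b2, b3⟩ := shear_coeffs fun z w => (shear_cubics hv hv' h z w).2
  have ht' : t = 1 + κ * (t * s) := by
    linear_combination ht - t * κ * s * CharTwo.two_eq_zero (R := K)
  simp only [pW, mn, Polynomial.eval_add, Polynomial.eval_mul, Polynomial.eval_C,
    Polynomial.eval_X, Polynomial.eval_pow, a0, a1, a2, a3, b0, b1, b2, b3]
  grind

theorem pI_eval_of_isLine {s μ : K} (h1 : (pW c).eval s * μ + (pq c).eval s = 0)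
    (h2 : (pA₂ c).eval s * μ ^ 2 + (pQ c 1).eval s * μ + (pl c).eval s = 0) :
    (pI c).eval s = 0 := by
  simp only [pI, Polynomial.eval_add, Polynomial.eval_mul, Polynomial.eval_pow]
  generalize (pW c).eval s = W at *
  generalize (pq c).eval s = q at *
  generalize (pA₂ c).eval s = A at *
  generalize (pQ c 1).eval s = q' at *
  generalize (pl c).eval s = l at *
  grind

theorem exists_osculating {s : K} (hW : (pW c).eval s ≠ 0) (hI : (pI c).eval s = 0) :
    ∃ μ, (pW c).eval s * μ + (pq c).eval s = 0 ∧
      (pA₂ c).eval s * μ ^ 2 + (pQ c 1).eval s * μ + (pl c).eval s = 0 := by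
  simp only [pI, Polynomial.eval_add, Polynomial.eval_mul, Polynomial.eval_pow] at hI
  have h2 : (2 : K) = 0 := CharTwo.two_eq_zero
  refine ⟨(pq c).eval s / (pW c).eval s, ?_, ?_⟩
  · field_simp
    linear_combination (pq c).eval s * h2
  · field_simp
    linear_combination hI

theorem shear_pI_eval (hv : VanishesOnLine c) (hv' : VanishesOnLine c')
    (h : ∀ x y z w, quartic c' x y z w = quartic c x y z (w + κ * z)) (s t : K)
    (ht : t * (1 + κ * s) = 1) (hW : (pW c).eval s ≠ 0) (hI : (pI c').eval (t * s) = 0) :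
    (pI c).eval s = 0 := by
  have ht0 : t ≠ 0 := by rintro rfl; simp at ht
  have ht' : 1 + κ * (t * s) = t := by
    linear_combination - ht + (t * κ * s) * CharTwo.two_eq_zero (R := K)
  have hW' : (pW c').eval (t * s) ≠ 0 := by
    rw [shear_pW hv hv' h s t ht]
    exact mul_ne_zero (pow_ne_zero _ ht0) hW
  obtain ⟨ν, h1, h2⟩ := exists_osculating hW' hI
  have hX : ∀ X, quartic c' (X * (pB c').eval (t * s)) (X * (pA c').eval (t * s)) (t * s + X * ν) 1
      = X ^ 4 * ((pA₃ c').eval (t * s) * ν ^ 3 + (pQ c' 2).eval (t * s) * ν ^ 2 +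
        (pL c' 1).eval (t * s) * ν + (pK c').eval (t * s)) := by
    intro X
    rw [tangent_expansion hv', h1, h2]
    ring
  generalize (pA₃ c').eval (t * s) * ν ^ 3 + (pQ c' 2).eval (t * s) * ν ^ 2 +
        (pL c' 1).eval (t * s) * ν + (pK c').eval (t * s) = k at hX
  have cub : ∀ a : ℕ → K, cubic a (t * s) t = t ^ 3 * cubic a s 1 := by
    intro a; simp only [cubic]; ring
  obtain ⟨ha, hb⟩ := shear_cubics hv hv' h (t * s) 1
  rw [ht', cub] at ha hb
  simp only [pA, pB, eval_cubicPoly, ha, hb] at hX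
  have hA : (pA c).eval s = cubic (c 1 0) s 1 := eval_cubicPoly _ _
  have hB : (pB c).eval s = cubic (c 0 1) s 1 := eval_cubicPoly _ _
  rw [← hA, ← hB] at hX
  obtain ⟨μ, hμ⟩ : ∃ μ, t ^ 4 * μ = ν := ⟨ν / t ^ 4, by field_simp⟩
  have key : ∀ Y, 1 + κ * t * μ * Y ≠ 0 →
      quartic c (Y * (pB c).eval s) (Y * (pA c).eval s) (s + Y * μ) 1 = Y ^ 4 * (k / t ^ 12) := by
    intro Y hD
    obtain ⟨m, hm⟩ : ∃ m, m * (1 + κ * t * μ * Y) = t :=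
      ⟨t / (1 + κ * t * μ * Y), div_mul_cancel₀ _ hD⟩
    have hm0 : m ≠ 0 := by rintro rfl; exact ht0 (by rw [← hm, zero_mul])
    obtain ⟨X, hXY⟩ : ∃ X, X * t ^ 3 = m * Y := ⟨m * Y / t ^ 3, by field_simp⟩
    have e := hX X
    have h2 : (2 : K) = 0 := CharTwo.two_eq_zero
    have hm2 : m + κ * X * ν = t := by linear_combination hm + κ * t * μ * hXY - κ * X * hμ
    have e3 : t * s + X * ν = m * (s + Y * μ) := by
      linear_combination (-s) * hm2 - X * (1 + κ * s) * hμ + X * t ^ 3 * μ * ht + μ * hXY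
    have e4 : 1 + κ * (t * s + X * ν) = m := by
      linear_combination ht' - hm2 + κ * X * ν * h2
    rw [h, e3, ← e3, e4, e3] at e
    have e5 : quartic c (m * (Y * (pB c).eval s)) (m * (Y * (pA c).eval s)) (m * (s + Y * μ))
        (m * 1) = X ^ 4 * k := by
      rw [← e]
      congr 1
      · linear_combination -(pB c).eval s * hXY
      · linear_combination -(pA c).eval s * hXY
      · ring
    rw [quartic_smul] at e5
    have : (X * t ^ 3) ^ 4 * k = m ^ 4 * (Y ^ 4 * k) := by rw [hXY]; ring
    field_simp
    refine mul_left_cancel₀ (pow_ne_zero 4 hm0) ?_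
    linear_combination t ^ 12 * e5 + this
  have hcoef : ∀ Y, Y * (1 + κ * t * μ * Y) * (((pW c).eval s * μ + (pq c).eval s) +
      Y * ((pA₂ c).eval s * μ ^ 2 + (pQ c 1).eval s * μ + (pl c).eval s) +
      Y ^ 2 * ((pA₃ c).eval s * μ ^ 3 + (pQ c 2).eval s * μ ^ 2 + (pL c 1).eval s * μ +
        (pK c).eval s - k / t ^ 12)) = 0 := by
    intro Y
    by_cases hY : Y = 0
    · simp [hY]
    by_cases hD : 1 + κ * t * μ * Y = 0
    · simp [hD]
    have := key Y hD
    rw [tangent_expansion hv] at this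
    refine mul_eq_zero_of_right _ (mul_left_cancel₀ (pow_ne_zero 2 hY) ?_)
    linear_combination this
  generalize (pA₃ c).eval s * μ ^ 3 + (pQ c 2).eval s * μ ^ 2 + (pL c 1).eval s * μ +
        (pK c).eval s - k / t ^ 12 = e₃ at hcoef
  obtain ⟨-, h1, h2, -, -⟩ := coeffs_eq_zero_of_forall (a0 := 0)
    (a1 := (pW c).eval s * μ + (pq c).eval s)
    (a2 := (pA₂ c).eval s * μ ^ 2 + (pQ c 1).eval s * μ + (pl c).eval s +
      κ * t * μ * ((pW c).eval s * μ + (pq c).eval s))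
    (a3 := e₃ + κ * t * μ * ((pA₂ c).eval s * μ ^ 2 + (pQ c 1).eval s * μ + (pl c).eval s))
    (a4 := κ * t * μ * e₃) fun Y => by linear_combination hcoef Y
  rw [h1, mul_zero, add_zero] at h2
  exact pI_eval_of_isLine h1 h2

/-- Vanishing of the eliminant is invariant under shears of the line. -/
theorem shear_pI [IsAlgClosed K] (hc : SmoothCoeffs c) (hv : VanishesOnLine c)
    (hv' : VanishesOnLine c')
    (h : ∀ x y z w, quartic c' x y z w = quartic c x y z (w + κ * z)) (hI : pI c' = 0) :
    pI c = 0 := by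
  have hz : pI c * (pW c * (1 + .C κ * .X)) = 0 := Polynomial.funext fun s => by
    simp only [Polynomial.eval_mul, Polynomial.eval_add, Polynomial.eval_one, Polynomial.eval_C,
      Polynomial.eval_X, Polynomial.eval_zero]
    by_cases hW : (pW c).eval s = 0
    · simp [hW]
    by_cases hs : 1 + κ * s = 0
    · simp [hs]
    rw [shear_pI_eval hv hv' h s _ (inv_mul_cancel₀ hs) hW (by rw [hI, Polynomial.eval_zero]),
      zero_mul]
  refine (mul_eq_zero.1 hz).resolve_right (mul_ne_zero (pW_ne_zero hc hv) fun h0 => ?_)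
  have := congrArg (Polynomial.eval 0) h0
  simp at this

end Shear

section Span
variable {K : Type*} [Field K]

theorem pair_independent (b : Module.Basis (Fin 4) K (Fin 4 → K)) (z w : K)
    (h : z • b 2 + w • b 3 = 0) : z = 0 ∧ w = 0 :=
  (pt_eq_zero.1 (show pt b 0 0 z w = 0 by simpa [pt] using h)).2.2

theorem span_basis_eq {b b' : Module.Basis (Fin 4) K (Fin 4 → K)}
    (h2 : b' 2 ∈ Submodule.span K {b 2, b 3}) (h3 : b' 3 ∈ Submodule.span K {b 2, b 3}) :
    Submodule.span K {b' 2, b' 3} = Submodule.span K {b 2, b 3} :=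
  span_pair_eq (finrank_span_pair (pair_independent b)) h2 h3 (pair_independent b')

theorem shear_rel {F : MvPolynomial (Fin 4) K} {b b' : Module.Basis (Fin 4) K (Fin 4 → K)}
    {c c' : ℕ → ℕ → ℕ → K} {κ : K} (hb : Coords F b c) (hb' : Coords F b' c')
    (h : ∀ x y z w, pt b' x y z w = pt b x y z (w + κ * z)) (x y z w : K) :
    quartic c' x y z w = quartic c x y z (w + κ * z) := by
  rw [← hb.2, ← hb'.2, h]

theorem coords_vanishesOnLine [Infinite K] {F : MvPolynomial (Fin 4) K}
    {b : Module.Basis (Fin 4) K (Fin 4 → K)} {c : ℕ → ℕ → ℕ → K} (hb : Coords F b c)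
    (hl : Submodule.span K {b 2, b 3} ∈ lines F) : VanishesOnLine c :=
  hb.vanishesOnLine hl (Submodule.subset_span (by simp)) (Submodule.subset_span (by simp))

end Span

section Valency
variable {K : Type*} [Field K] [IsAlgClosed K] [CharP K 2] {F : MvPolynomial (Fin 4) K}
  {b : Module.Basis (Fin 4) K (Fin 4 → K)} {c : ℕ → ℕ → ℕ → K}

theorem finite_lineParams (hF : IsSmoothQuartic F) (hb : Coords F b c) (hv : VanishesOnLine c) :
    (lineParams c).Finite := by
  have : Infinite K := IsAlgClosed.instInfinite
  refine Set.Finite.of_injOn (f := fun p : K × K => lineAt b c p.1 p.2) ?_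
    (lineAt_injective hb.1 hv).injOn (finite_lines hF)
  intro p hp
  exact lineAt_mem_lines hF.hom hb hv hp

theorem finite_nbrs (hF : IsSmoothQuartic F) (W : Submodule K (Fin 4 → K)) :
    (nbrs F W).Finite := (finite_lines hF).subset fun _ h => h.1

/-- The neighbours of a line which avoid its point at infinity are parametrized. -/
theorem ncard_nbrs_avoiding_le (hF : IsSmoothQuartic F) (hb : Coords F b c)
    (hv : VanishesOnLine c) :
    {W ∈ nbrs F (Submodule.span K {b 2, b 3}) | b 2 ∉ W}.ncard ≤ (lineParams c).ncard := by
  have : Infinite K := IsAlgClosed.instInfinite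
  refine (Set.ncard_le_ncard ?_ ((finite_lineParams hF hb hv).image _)).trans
    (Set.ncard_image_le (f := fun p : K × K => lineAt b c p.1 p.2) (finite_lineParams hF hb hv))
  rintro W ⟨hW, h2⟩
  obtain ⟨s, μ, h, rfl⟩ := exists_lineAt hb hv hW h2
  exact ⟨(s, μ), h, rfl⟩

theorem ncard_nbrs_le (hF : IsSmoothQuartic F) (hb : Coords F b c) (hv : VanishesOnLine c)
    (h2 : ∀ W ∈ lines F, W ≠ Submodule.span K {b 2, b 3} → b 2 ∉ W) :
    (nbrs F (Submodule.span K {b 2, b 3})).ncard ≤ (lineParams c).ncard := by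
  have h := ncard_nbrs_avoiding_le hF hb hv
  rwa [show {W ∈ nbrs F (Submodule.span K {b 2, b 3}) | b 2 ∉ W} =
    nbrs F (Submodule.span K {b 2, b 3}) from Set.sep_eq_self_iff_mem_true.2 fun W hW =>
      h2 W hW.1 hW.2.1] at h

/-- A line can be sheared so that its point at infinity is on no other line. -/
theorem exists_shear (hF : IsSmoothQuartic F) (b : Module.Basis (Fin 4) K (Fin 4 → K))
    {S : Set K} (hS : S.Finite) : ∃ κ ∉ S, ∃ b' : Module.Basis (Fin 4) K (Fin 4 → K),
      (∀ x y z w, pt b' x y z w = pt b x y z (w + κ * z)) ∧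
      Submodule.span K {b' 2, b' 3} = Submodule.span K {b 2, b 3} ∧
      ∀ W ∈ lines F, W ≠ Submodule.span K {b' 2, b' 3} → b' 2 ∉ W := by
  have : Infinite K := IsAlgClosed.instInfinite
  obtain ⟨κ, hκ⟩ := ((finite_bad_points (finite_lines hF) b).union hS).exists_notMem
  obtain ⟨b', hb'⟩ := exists_basis ![b 0, b 1, b 2 + κ • b 3, b 3] (by
    intro x y z w h
    have h' : pt b x y z (w + κ * z) = 0 := by
      rw [← h]; simp only [pt, Matrix.cons_val]; module
    obtain ⟨hx, hy, hz, hw⟩ := pt_eq_zero.1 h'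
    exact ⟨hx, hy, hz, by simpa [hz] using hw⟩)
  have e2 : b' 2 = b 2 + κ • b 3 := hb' 2
  have e3 : b' 3 = b 3 := hb' 3
  have hspan : Submodule.span K {b' 2, b' 3} = Submodule.span K {b 2, b 3} := by
    refine span_basis_eq ?_ ?_
    · exact Submodule.mem_span_pair.2 ⟨1, κ, by rw [e2, one_smul]⟩
    · exact Submodule.mem_span_pair.2 ⟨0, 1, by rw [e3]; module⟩
  refine ⟨κ, fun h => hκ (Or.inr h), b', fun x y z w => ?_, hspan, fun W hW hne h2 => hκ (Or.inl ?_)⟩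
  · simp only [pt, show b' 0 = b 0 from hb' 0, show b' 1 = b 1 from hb' 1, e2, e3]
    module
  · exact ⟨W, hW, hspan ▸ hne, e2 ▸ h2⟩

theorem ncard_nbrs_of_pI_ne_zero (hF : IsSmoothQuartic F) (hb : Coords F b c)
    (hl : Submodule.span K {b 2, b 3} ∈ lines F) (hI : pI c ≠ 0) :
    (nbrs F (Submodule.span K {b 2, b 3})).ncard ≤ 18 := by
  have : Infinite K := IsAlgClosed.instInfinite
  obtain ⟨κ, -, b', h1, h2, h3⟩ := exists_shear hF b (S := ∅) Set.finite_empty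
  obtain ⟨c', hc'⟩ := hF.coords b'
  have hv := coords_vanishesOnLine hb hl
  have hv' := coords_vanishesOnLine hc' (h2 ▸ hl)
  rw [← h2]
  refine (ncard_nbrs_le hF hc' hv' h3).trans
    (ncard_lineParams_of_pI_ne_zero hc'.1 hv' (finite_lineParams hF hc' hv') fun h0 => hI ?_)
  exact shear_pI hb.1 hv hv' (shear_rel hb hc' h1) h0

end Valency

section Integral
variable {K : Type*} [Field K]

/-- `K[X]` is integrally closed, for quadratic equations. -/
theorem dvd_of_quadratic {a w p r : Polynomial K} (hw : w ≠ 0)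
    (h : a ^ 2 + p * w * a + r * w ^ 2 = 0) : w ∣ a := by
  classical
  obtain ⟨a', ha⟩ := EuclideanDomain.gcd_dvd_left a w
  obtain ⟨w', hw'⟩ := EuclideanDomain.gcd_dvd_right a w
  have hg : EuclideanDomain.gcd a w ≠ 0 := fun h0 => hw (by rw [hw', h0, zero_mul])
  have hcop : IsCoprime a' w' := by
    have e := EuclideanDomain.gcd_eq_gcd_ab a w
    generalize EuclideanDomain.gcd a w = g at *
    generalize EuclideanDomain.gcdA a w = x at *
    generalize EuclideanDomain.gcdB a w = y at *
    subst ha hw'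
    refine ⟨x, y, mul_left_cancel₀ hg ?_⟩
    linear_combination -e
  generalize EuclideanDomain.gcd a w = g at *
  subst ha hw'
  have h' : a' ^ 2 + p * w' * a' + r * w' ^ 2 = 0 := by
    refine mul_left_cancel₀ (pow_ne_zero 2 hg) ?_
    linear_combination h
  have : w' ∣ a' * a' := ⟨-(p * a' + r * w'), by linear_combination h'⟩
  have := hcop.symm.dvd_of_dvd_mul_left this
  have hu : IsUnit w' := hcop.symm.isUnit_of_dvd' dvd_rfl this
  exact mul_dvd_mul_left g hu.dvd

end Integral

section Reduced
variable {K : Type*} [Field K] {c : ℕ → ℕ → ℕ → K}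

/-- The eliminant in the degenerate case. -/
noncomputable def pJ (c : ℕ → ℕ → ℕ → K) (τ θ : Polynomial K) : Polynomial K :=
  pA₃ c * θ ^ 3 + pQ c 2 * θ ^ 2 * τ + pL c 1 * θ * τ ^ 2 + pK c * τ ^ 3

theorem natDegree_pJ {τ θ : Polynomial K} (hτ : τ.natDegree ≤ 1) (hθ : θ.natDegree ≤ 5) :
    (pJ c τ θ).natDegree ≤ 17 := by
  have := natDegree_pA₃ (c := c)
  have := natDegree_pQ (c := c) 2
  have := natDegree_pL (c := c) 1
  have := natDegree_pK (c := c)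
  rw [pJ]; compute_degree <;> omega

variable [IsAlgClosed K] [CharP K 2]

theorem ncard_lineParams_of_reduced (hc : SmoothCoeffs c) (hv : VanishesOnLine c)
    (hfin : (lineParams c).Finite) {τ θ A : Polynomial K} (hτ : τ.natDegree ≤ 1)
    (hτ0 : τ ≠ 0) (hθ : θ.natDegree ≤ 5) (hq : pq c * τ = pW c * θ) (hA : pA₂ c = τ * A)
    (hl : pl c * τ + pQ c 1 * θ + A * θ ^ 2 = 0) {E : Finset K}
    (hE : ∀ s, (pW c).eval s = 0 → s ∈ E) (hA0 : ∀ s, (pW c).eval s = 0 → A.eval s ≠ 0)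
    (hτW : ∀ s, τ.eval s = 0 → (pW c).eval s = 0) :
    (lineParams c).ncard ≤ 17 + E.card := by
  have hq' : ∀ s, (pq c).eval s * τ.eval s = (pW c).eval s * θ.eval s := fun s => by
    simpa using congrArg (Polynomial.eval s) hq
  have hA' : ∀ s, (pA₂ c).eval s = τ.eval s * A.eval s := fun s => by
    simpa using congrArg (Polynomial.eval s) hA
  have hl' : ∀ s, (pl c).eval s * τ.eval s + (pQ c 1).eval s * θ.eval s +
      A.eval s * θ.eval s ^ 2 = 0 := fun s => by
    simpa using congrArg (Polynomial.eval s) hl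
  have hJ' : ∀ s, (pJ c τ θ).eval s = (pA₃ c).eval s * θ.eval s ^ 3 +
      (pQ c 2).eval s * θ.eval s ^ 2 * τ.eval s + (pL c 1).eval s * θ.eval s * τ.eval s ^ 2 +
      (pK c).eval s * τ.eval s ^ 3 := fun s => by simp [pJ]
  have htwo : (2 : K) = 0 := CharTwo.two_eq_zero
  have h2 : ∀ s, τ.eval s ≠ 0 → (pA₂ c).eval s * (θ.eval s / τ.eval s) ^ 2 +
      (pQ c 1).eval s * (θ.eval s / τ.eval s) + (pl c).eval s = 0 := by
    intro s hs
    rw [hA']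
    field_simp
    linear_combination hl' s
  have h3 : ∀ s, τ.eval s ≠ 0 → ((pA₃ c).eval s * (θ.eval s / τ.eval s) ^ 3 +
      (pQ c 2).eval s * (θ.eval s / τ.eval s) ^ 2 + (pL c 1).eval s * (θ.eval s / τ.eval s) +
      (pK c).eval s = 0 ↔ (pJ c τ θ).eval s = 0) := by
    intro s hs
    have : (pJ c τ θ).eval s = τ.eval s ^ 3 * ((pA₃ c).eval s * (θ.eval s / τ.eval s) ^ 3 +
      (pQ c 2).eval s * (θ.eval s / τ.eval s) ^ 2 + (pL c 1).eval s * (θ.eval s / τ.eval s) +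
      (pK c).eval s) := by
      rw [hJ']; field_simp
    rw [this, mul_eq_zero, or_iff_right (pow_ne_zero 3 hs)]
  have hJ : pJ c τ θ ≠ 0 := by
    intro h0
    refine Set.infinite_of_injOn_mapsTo (f := fun s : K => (s, θ.eval s / τ.eval s))
      (s := (τ.rootSet K)ᶜ) ?_ ?_ (Set.Finite.infinite_compl (τ.rootSet_finite K)) hfin
    · intro s _ s' _ h
      exact congrArg Prod.fst h
    · intro s hs
      have hs : τ.eval s ≠ 0 := by
        simpa [Polynomial.mem_rootSet, hτ0] using hs
      refine ⟨?_, h2 s hs, (h3 s hs).2 (by rw [h0, Polynomial.eval_zero])⟩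
      show (pW c).eval s * (θ.eval s / τ.eval s) + (pq c).eval s = 0
      field_simp
      linear_combination hq' s + (pW c).eval s * θ.eval s * htwo
  refine (ncard_le_natDegree_add _ hfin (pJ c τ θ) E fun s S hS hne => ?_).trans
    (Nat.add_le_add_right (natDegree_pJ hτ hθ) _)
  have hS' : ∀ μ ∈ S, IsLineAt c s μ := hS
  have hone : (pJ c τ θ).eval s = 0 → 1 ≤ (pJ c τ θ).rootMultiplicity s := fun h =>
    le_rootMultiplicity_of_dvd hJ (by rw [pow_one]; exact dvd_of_eval_eq_zero h)
  by_cases hW : (pW c).eval s = 0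
  · refine Or.inr ⟨hE s hW, ?_⟩
    by_cases ht : τ.eval s = 0
    · by_cases hθ0 : θ.eval s = 0
      · refine (card_fibre_le_three hc hv hS').trans (Nat.le_succ_of_le ?_)
        refine le_rootMultiplicity_of_dvd hJ ?_
        obtain ⟨u, hu⟩ := dvd_of_eval_eq_zero ht
        obtain ⟨v, hv⟩ := dvd_of_eval_eq_zero hθ0
        refine ⟨pA₃ c * v ^ 3 + pQ c 2 * v ^ 2 * u + pL c 1 * v * u ^ 2 + pK c * u ^ 3, ?_⟩
        rw [pJ, hu, hv]; ring
      · refine (card_le_one_of_linear (a := (pQ c 1).eval s) (b := (pl c).eval s) ?_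
          fun μ hμ => ?_).trans (Nat.le_add_left _ _)
        · intro h0
          have := hl' s
          simp only [h0, ht, mul_zero, zero_mul, zero_add] at this
          exact mul_ne_zero (hA0 s hW) (pow_ne_zero 2 hθ0) this
        · have := (hS' μ hμ).2.1
          rwa [hA', ht, zero_mul, zero_mul, zero_add] at this
    · have hA2 : (pA₂ c).eval s ≠ 0 := by rw [hA']; exact mul_ne_zero ht (hA0 s hW)
      classical
      by_cases hm : θ.eval s / τ.eval s ∈ S
      · refine (card_le_two_of_quadratic hA2 fun μ hμ => (hS' μ hμ).2.1).trans ?_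
        exact Nat.succ_le_succ (hone ((h3 s ht).1 (hS' _ hm).2.2))
      · have := card_le_two_of_quadratic (S := insert (θ.eval s / τ.eval s) S) hA2 fun μ hμ => by
          rcases Finset.mem_insert.1 hμ with rfl | hμ
          · exact h2 s ht
          · exact (hS' μ hμ).2.1
        rw [Finset.card_insert_of_notMem hm] at this
        omega
  · left
    refine (card_le_one_of_linear hW fun μ hμ => (hS' μ hμ).1).trans (hone ?_)
    have ht : τ.eval s ≠ 0 := fun h => hW (hτW s h)
    obtain ⟨μ, hμ⟩ := hne
    obtain ⟨e1, -, e3⟩ := hS' μ hμ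
    refine (h3 s ht).1 ?_
    have : θ.eval s / τ.eval s = μ := by
      rw [div_eq_iff ht]
      refine mul_left_cancel₀ hW ?_
      linear_combination - hq' s + τ.eval s * e1 - (pW c).eval s * μ * τ.eval s * htwo
    rwa [this]

theorem exists_pW_eq (h : mn c 2 3 ≠ 0) : ∃ s₁ s₂ : K,
    pW c = .C (mn c 2 3) * ((.X - .C s₁) * (.X - .C s₂)) ^ 2 ∧
    mn c 0 3 + mn c 1 2 = mn c 2 3 * (s₁ + s₂) ^ 2 ∧ mn c 0 1 = mn c 2 3 * (s₁ * s₂) ^ 2 := by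
  obtain ⟨s₁, h1⟩ := IsAlgClosed.exists_root (pW c) (by
    intro hd
    have h4 : (pW c).coeff 4 = mn c 2 3 := by
      rw [pW]; compute_degree!
    rw [Polynomial.coeff_eq_zero_of_degree_lt (by rw [hd]; norm_num)] at h4
    exact h h4.symm)
  obtain ⟨d, hd⟩ := IsAlgClosed.exists_pow_nat_eq (s₁ ^ 2 + (mn c 0 3 + mn c 1 2) / mn c 2 3)
    (n := 2) two_pos
  have htwo : (2 : K) = 0 := CharTwo.two_eq_zero
  have hd' : mn c 2 3 * (d ^ 2 - s₁ ^ 2) = mn c 0 3 + mn c 1 2 := by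
    rw [hd]; field_simp; ring
  have e1 : mn c 0 3 + mn c 1 2 = mn c 2 3 * (s₁ + d) ^ 2 := by
    linear_combination -hd' - mn c 2 3 * (s₁ ^ 2 + s₁ * d) * htwo
  have e2 : mn c 0 1 = mn c 2 3 * (s₁ * d) ^ 2 := by
    simp only [Polynomial.IsRoot.def, pW, Polynomial.eval_add, Polynomial.eval_mul,
      Polynomial.eval_C, Polynomial.eval_X, Polynomial.eval_pow] at h1
    rw [e1] at h1
    linear_combination h1 - mn c 2 3 * (s₁ ^ 4 + s₁ ^ 3 * d + s₁ ^ 2 * d ^ 2) * htwo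
  refine ⟨s₁, d, ?_, e1, e2⟩
  rw [pW, e1, e2]
  simp only [Polynomial.C_add, Polynomial.C_mul, Polynomial.C_pow]
  grind

theorem mn_pluecker : mn c 0 1 * mn c 2 3 + mn c 0 2 * mn c 1 3 + mn c 0 3 * mn c 1 2 = 0 := by
  simp only [mn]; grind

/-- Unless the residual cubics are cubes, the degenerate case has at most nineteen lines. -/
theorem ncard_lineParams_of_pI_eq_zero (hc : SmoothCoeffs c) (hv : VanishesOnLine c)
    (hfin : (lineParams c).Finite) (hm : mn c 2 3 ≠ 0) (hI : pI c = 0) :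
    (lineParams c).ncard ≤ 19 ∨ ∃ s₁ s₂, s₁ ≠ s₂ ∧ (pW c).eval s₁ = 0 ∧ (pW c).eval s₂ = 0 ∧
      (pA₂ c).eval s₁ = 0 ∧ (pA₂ c).eval s₂ = 0 := by
  classical
  obtain ⟨s₁, s₂, hW, e1, e2⟩ := exists_pW_eq hm
  have hroot : ∀ s, (pW c).eval s = 0 ↔ s = s₁ ∨ s = s₂ := by
    intro s
    rw [hW]
    simp [hm, sub_eq_zero]
  have hdeg : (pW c).natDegree = 4 := by
    rw [pW]; compute_degree!
  have hW0 := pW_ne_zero hc hv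
  obtain ⟨y, hy⟩ : pW c ∣ pA₂ c * pq c := by
    refine dvd_of_quadratic (p := pQ c 1) (r := pA₂ c * pl c) hW0 ?_
    rw [pI] at hI
    linear_combination pA₂ c * hI
  have main : ∀ τ A : Polynomial K, τ.natDegree ≤ 1 → τ ≠ 0 → pA₂ c = τ * A →
      (∀ s, (pW c).eval s = 0 → A.eval s ≠ 0) → (∀ s, τ.eval s = 0 → (pW c).eval s = 0) →
      (lineParams c).ncard ≤ 19 := by
    intro τ A hτ hτ0 hA hA0 hτW
    have hcop : IsCoprime (pW c) A := by
      have hlin : ∀ s, (pW c).eval s = 0 → IsCoprime (Polynomial.X - Polynomial.C s) A := by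
        intro s hs
        refine (Polynomial.irreducible_X_sub_C s).coprime_iff_not_dvd.2 fun h => hA0 s hs ?_
        exact Polynomial.dvd_iff_isRoot.1 h
      rw [hW]
      rw [isCoprime_mul_unit_left_left (Polynomial.isUnit_C.2 hm.isUnit)]
      refine IsCoprime.pow_left (IsCoprime.mul_left ?_ ?_)
      · exact hlin _ ((hroot _).2 (Or.inl rfl))
      · exact hlin _ ((hroot _).2 (Or.inr rfl))
    obtain ⟨θ, hθ⟩ : pW c ∣ pq c * τ := by
      refine hcop.dvd_of_dvd_mul_left ⟨y, ?_⟩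
      rw [← hy, hA]; ring
    have hθd : θ.natDegree ≤ 5 := by
      by_cases h0 : θ = 0
      · simp [h0]
      have h1 := congrArg Polynomial.natDegree hθ
      rw [Polynomial.natDegree_mul hW0 h0, hdeg] at h1
      have h2 := Polynomial.natDegree_mul_le (p := pq c) (q := τ)
      have := natDegree_pq (c := c)
      omega
    have hl : pl c * τ + pQ c 1 * θ + A * θ ^ 2 = 0 := by
      refine mul_left_cancel₀ (mul_ne_zero hτ0 (pow_ne_zero 2 hW0)) ?_
      rw [pI, hA] at hI
      linear_combination τ ^ 2 * hI - (pW c * pQ c 1 * τ + τ * A * (pq c * τ + pW c * θ)) * hθ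
    refine (ncard_lineParams_of_reduced hc hv hfin hτ hτ0 hθd hθ hA hl (E := {s₁, s₂})
      (fun s hs => by simpa using (hroot s).1 hs) hA0 hτW).trans ?_
    have := Finset.card_le_two (a := s₁) (b := s₂)
    omega
  have half : ∀ a b : K, a ≠ b → (pA₂ c).eval a = 0 → (pA₂ c).eval b ≠ 0 →
      mn c 0 3 + mn c 1 2 = mn c 2 3 * (a + b) ^ 2 →
      (∀ s, (pW c).eval s = 0 ↔ s = a ∨ s = b) → (lineParams c).ncard ≤ 19 := by
    intro a b hab ha hb he hr
    have hfac : pA₂ c = (.X - .C a) *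
        (.C (mn c 1 3) * .X + .C (mn c 1 3 * a + (mn c 0 3 + mn c 1 2))) := by
      have hC : Polynomial.C ((pA₂ c).eval a) = 0 := by rw [ha, Polynomial.C_0]
      rw [← sub_zero (pA₂ c), ← hC]
      simp only [pA₂, Polynomial.eval_add, Polynomial.eval_mul, Polynomial.eval_C,
        Polynomial.eval_X, Polynomial.eval_pow, Polynomial.C_add, Polynomial.C_mul,
        Polynomial.C_pow]
      ring
    refine main _ _ (by rw [Polynomial.natDegree_X_sub_C]) (Polynomial.X_sub_C_ne_zero a) hfac
      (fun s hs => ?_) fun s hs => (hr s).2 (Or.inl ?_)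
    · rcases (hr s).1 hs with rfl | rfl
      · have hne : mn c 2 3 * (s + b) ^ 2 ≠ 0 := by
          refine mul_ne_zero hm (pow_ne_zero 2 fun h => hab ?_)
          exact CharTwo.add_eq_zero.1 h
        rw [← he] at hne
        simp only [Polynomial.eval_add, Polynomial.eval_mul, Polynomial.eval_C, Polynomial.eval_X]
        rwa [← add_assoc, CharTwo.add_self_eq_zero, zero_add]
      · intro h0
        rw [hfac, Polynomial.eval_mul, h0, mul_zero] at hb
        exact hb rfl
    · simpa [sub_eq_zero] using hs
  by_cases h1 : (pA₂ c).eval s₁ = 0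
  · by_cases h12 : s₁ = s₂
    · subst h12
      have hW1 := (hroot s₁).2 (Or.inl rfl)
      refine absurd ?_ (pA₃_ne_zero hc hv hW1 h1)
      refine pow_eq_zero_iff two_ne_zero |>.1 ?_
      have hp := mn_pluecker (c := c)
      rw [e2] at hp
      have e1' : mn c 0 3 = mn c 1 2 := by
        refine CharTwo.add_eq_zero.1 ?_
        rw [e1, CharTwo.add_self_eq_zero]; ring
      simp only [pA₂, pA₃, Polynomial.eval_add, Polynomial.eval_mul, Polynomial.eval_C,
        Polynomial.eval_X, Polynomial.eval_pow] at h1 ⊢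
      rw [e1'] at hp h1 ⊢
      clear hW hroot main half hdeg hy e1 e2 hW1 hI
      generalize mn c 1 2 = a at *
      generalize mn c 1 3 = d at *
      generalize mn c 0 2 = e at *
      generalize mn c 2 3 = f at *
      grind
    · by_cases h2 : (pA₂ c).eval s₂ = 0
      · exact Or.inr ⟨s₁, s₂, h12, (hroot _).2 (Or.inl rfl), (hroot _).2 (Or.inr rfl), h1, h2⟩
      · exact Or.inl (half s₁ s₂ h12 h1 h2 e1 hroot)
  · by_cases h2 : (pA₂ c).eval s₂ = 0
    · refine Or.inl (half s₂ s₁ ?_ h2 h1 (by rw [e1, add_comm s₁]) fun s => by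
        rw [hroot, or_comm])
      rintro rfl
      exact h1 h2
    · refine Or.inl (main 1 (pA₂ c) (by simp) one_ne_zero (one_mul _).symm (fun s hs => ?_)
        fun s hs => by simp at hs)
      rcases (hroot s).1 hs with rfl | rfl
      · exact h1
      · exact h2

end Reduced

section Ext
variable {K : Type*} [Field K] [Infinite K]

theorem coeffs_eq_zero_of_forall' {a : ℕ → K}
    (h : ∀ z : K, a 0 + a 1 * z + a 2 * z ^ 2 + a 3 * z ^ 3 + a 4 * z ^ 4 = 0) (k : ℕ) (hk : k ≤ 4) :
    a k = 0 := by
  obtain ⟨h0, h1, h2, h3, h4⟩ := coeffs_eq_zero_of_forall h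
  interval_cases k <;> assumption

theorem quartic_eq_zero {c : ℕ → ℕ → ℕ → K} (h : ∀ x y z w, quartic c x y z w = 0)
    (i j k : ℕ) (hijk : i + j + k ≤ 4) : c i j k = 0 := by
  let e : ℕ → ℕ → ℕ → K := fun i j k => if i + j + k ≤ 4 then c i j k else 0
  let ez : ℕ → ℕ → K → K := fun i j z =>
    e i j 0 + e i j 1 * z + e i j 2 * z ^ 2 + e i j 3 * z ^ 3 + e i j 4 * z ^ 4
  let ey : ℕ → K → K → K := fun i y z =>
    ez i 0 z + ez i 1 z * y + ez i 2 z * y ^ 2 + ez i 3 z * y ^ 3 + ez i 4 z * y ^ 4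
  have h1 : ∀ x y z, ey 0 y z + ey 1 y z * x + ey 2 y z * x ^ 2 + ey 3 y z * x ^ 3 +
      ey 4 y z * x ^ 4 = 0 := fun x y z => by
    rw [← h x y z 1]
    simp [ey, ez, e, quartic]
    ring
  have h2 : e i j k = 0 :=
    coeffs_eq_zero_of_forall' (fun z => coeffs_eq_zero_of_forall' (a := fun j => ez i j z) (fun y =>
      coeffs_eq_zero_of_forall' (a := fun i => ey i y z) (fun x => h1 x y z) i (by omega)) j
        (by omega)) k (by omega)
  simpa [e, hijk] using h2

theorem quartic_ext {c d : ℕ → ℕ → ℕ → K} (h : ∀ x y z w, quartic c x y z w = quartic d x y z w)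
    (i j k : ℕ) (hijk : i + j + k ≤ 4) : c i j k = d i j k := by
  refine sub_eq_zero.1 (quartic_eq_zero (c := fun i j k => c i j k - d i j k) (fun x y z w => ?_)
    i j k hijk)
  rw [← sub_eq_zero.2 (h x y z w)]
  simp only [quartic]
  ring

end Ext

section Triple
variable {K : Type*} [Field K] [IsAlgClosed K] [CharP K 2] {F : MvPolynomial (Fin 4) K}
  {b : Module.Basis (Fin 4) K (Fin 4 → K)} {c : ℕ → ℕ → ℕ → K}

theorem exists_shear_mn_ne_zero (hF : IsSmoothQuartic F) (hb : Coords F b c)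
    (hl : Submodule.span K {b 2, b 3} ∈ lines F) :
    ∃ (b' : Module.Basis (Fin 4) K (Fin 4 → K)) (c' : ℕ → ℕ → ℕ → K), Coords F b' c' ∧
      Submodule.span K {b' 2, b' 3} = Submodule.span K {b 2, b 3} ∧ mn c' 2 3 ≠ 0 ∧
      ∀ W ∈ lines F, W ≠ Submodule.span K {b' 2, b' 3} → b' 2 ∉ W := by
  have : Infinite K := IsAlgClosed.instInfinite
  have hv := coords_vanishesOnLine hb hl
  let R : Polynomial K := .C (mn c 0 1) * .X ^ 4 + .C (mn c 0 3 + mn c 1 2) * .X ^ 2 +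
    .C (mn c 2 3)
  have hR : R ≠ 0 := by
    intro h0
    have e0 : R.coeff 0 = mn c 2 3 := by simp [R, Polynomial.coeff_X_pow]
    have e2 : R.coeff 2 = mn c 0 3 + mn c 1 2 := by
      simp only [R, Polynomial.coeff_add, Polynomial.coeff_C_mul_X_pow, Polynomial.coeff_C]
      simp
    have e4 : R.coeff 4 = mn c 0 1 := by simp only [R]; compute_degree!
    rw [h0, Polynomial.coeff_zero] at e0 e2 e4
    exact pW_ne_zero hb.1 hv (by simp [pW, ← e0, ← e2, ← e4])
  obtain ⟨κ, hκ, b', h1, h2, h3⟩ := exists_shear hF b (Polynomial.finite_setOfPred_isRoot hR)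
  obtain ⟨c', hc'⟩ := hF.coords b'
  have hv' := coords_vanishesOnLine hc' (h2 ▸ hl)
  refine ⟨b', c', hc', h2, fun h0 => hκ ?_, h3⟩
  have hs := shear_rel hb hc' h1
  obtain ⟨a0, a1, a2, a3⟩ := shear_coeffs fun z w => (shear_cubics hv hv' hs z w).1
  obtain ⟨b0, b1, b2, b3⟩ := shear_coeffs fun z w => (shear_cubics hv hv' hs z w).2
  simp only [mn, a2, a3, b2, b3] at h0
  simp only [Set.mem_ofPred_eq, Polynomial.IsRoot, R, mn, Polynomial.eval_add, Polynomial.eval_mul,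
    Polynomial.eval_C, Polynomial.eval_X, Polynomial.eval_pow]
  grind

/-- Coordinates in which the tangent planes along the line cut it in two triple points. -/
def CubeForm (c : ℕ → ℕ → ℕ → K) : Prop :=
  c 1 0 0 = 0 ∧ c 1 0 1 = 0 ∧ c 1 0 2 = 0 ∧ c 1 0 3 = 1 ∧
    c 0 1 0 = 1 ∧ c 0 1 1 = 0 ∧ c 0 1 2 = 0 ∧ c 0 1 3 = 0

theorem exists_cubeForm (hF : IsSmoothQuartic F) (hb : Coords F b c)
    (hl : Submodule.span K {b 2, b 3} ∈ lines F) {s₁ s₂ : K} (hs : s₁ ≠ s₂)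
    (hW₁ : (pW c).eval s₁ = 0) (hW₂ : (pW c).eval s₂ = 0) (hA₁ : (pA₂ c).eval s₁ = 0)
    (hA₂ : (pA₂ c).eval s₂ = 0) :
    ∃ (b' : Module.Basis (Fin 4) K (Fin 4 → K)) (c' : ℕ → ℕ → ℕ → K), Coords F b' c' ∧
      Submodule.span K {b' 2, b' 3} = Submodule.span K {b 2, b 3} ∧ CubeForm c' := by
  have : Infinite K := IsAlgClosed.instInfinite
  have hv := coords_vanishesOnLine hb hl
  have n₁ := pA₃_ne_zero hb.1 hv hW₁ hA₁
  have n₂ := pA₃_ne_zero hb.1 hv hW₂ hA₂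
  have p₁ := polar_of_triple hW₁ hA₁
  have p₂ := polar_of_triple hW₂ hA₂
  have h2 : (2 : K) = 0 := CharTwo.two_eq_zero
  generalize (pA₃ c).eval s₁ = m₁ at *
  generalize (pA₃ c).eval s₂ = m₂ at *
  generalize (pA c).eval s₁ = A₁ at *
  generalize (pA c).eval s₂ = A₂ at *
  generalize (pB c).eval s₁ = B₁ at *
  generalize (pB c).eval s₂ = B₂ at *
  have hs' : s₁ - s₂ ≠ 0 := sub_ne_zero.2 hs
  obtain ⟨δ, hδ⟩ : ∃ δ, δ * (s₁ - s₂) = 1 := ⟨(s₁ - s₂)⁻¹, inv_mul_cancel₀ hs'⟩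
  let u : Fin 4 → Fin 4 → K := ![pt b (B₁ / m₁) (A₁ / m₁) 0 0, pt b (B₂ / m₂) (A₂ / m₂) 0 0,
    pt b 0 0 (δ * s₂) δ, pt b 0 0 (δ * s₁) δ]
  have hu : ∀ x y z w : K, x • u 0 + y • u 1 + z • u 2 + w • u 3 =
      pt b (x * (B₁ / m₁) + y * (B₂ / m₂)) (x * (A₁ / m₁) + y * (A₂ / m₂))
        (δ * (s₂ * z + s₁ * w)) (δ * (z + w)) := fun x y z w => by
    simp only [u, pt, Matrix.cons_val]; module
  have key : ∀ x y z w : K, (x * (B₁ / m₁) + y * (B₂ / m₂)) * cubic (c 1 0) z w +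
      (x * (A₁ / m₁) + y * (A₂ / m₂)) * cubic (c 0 1) z w =
      x * (z - s₁ * w) ^ 3 + y * (z - s₂ * w) ^ 3 := fun x y z w => by
    have e₁ := p₁ z w
    have e₂ := p₂ z w
    field_simp
    linear_combination x * m₂ * e₁ + y * m₁ * e₂
  obtain ⟨b', hb'⟩ := exists_basis u (by
    intro x y z w h
    rw [hu] at h
    obtain ⟨e0, e1, e2, e3⟩ := pt_eq_zero.1 h
    have hδ0 : δ ≠ 0 := by rintro rfl; simp at hδ
    have f2 := (mul_eq_zero.1 e2).resolve_left hδ0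
    have f3 := (mul_eq_zero.1 e3).resolve_left hδ0
    have k1 := key x y s₂ 1
    have k2 := key x y s₁ 1
    rw [e0, e1] at k1 k2
    have hs3 : s₂ - s₁ ≠ 0 := sub_ne_zero.2 (Ne.symm hs)
    refine ⟨?_, ?_, ?_, ?_⟩
    · have : x * (s₂ - s₁) ^ 3 = 0 := by linear_combination -k1
      exact (mul_eq_zero.1 this).resolve_right (pow_ne_zero _ hs3)
    · have : y * (s₁ - s₂) ^ 3 = 0 := by linear_combination -k2
      exact (mul_eq_zero.1 this).resolve_right (pow_ne_zero _ hs')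
    · have : z * (s₂ - s₁) = 0 := by linear_combination f2 - s₁ * f3
      exact (mul_eq_zero.1 this).resolve_right hs3
    · have : w * (s₁ - s₂) = 0 := by linear_combination f2 - s₂ * f3
      exact (mul_eq_zero.1 this).resolve_right hs')
  obtain ⟨c', hc'⟩ := hF.coords b'
  have hspan : Submodule.span K {b' 2, b' 3} = Submodule.span K {b 2, b 3} := by
    refine span_basis_eq ?_ ?_
    · exact Submodule.mem_span_pair.2 ⟨δ * s₂, δ, by rw [hb']; simp [u, pt]⟩
    · exact Submodule.mem_span_pair.2 ⟨δ * s₁, δ, by rw [hb']; simp [u, pt]⟩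
  have hpt : ∀ x y z w, pt b' x y z w = pt b (x * (B₁ / m₁) + y * (B₂ / m₂))
      (x * (A₁ / m₁) + y * (A₂ / m₂)) (δ * (s₂ * z + s₁ * w)) (δ * (z + w)) := fun x y z w => by
    rw [← hu, pt, hb', hb', hb', hb']
  have hv' := coords_vanishesOnLine hc' (hspan ▸ hl)
  have lin : ∀ x y z w, x * cubic (c' 1 0) z w + y * cubic (c' 0 1) z w = x * z ^ 3 + y * w ^ 3 := by
    intro x y z w
    rw [linear_part_eq hv' hv (x₁ := x * (B₁ / m₁) + y * (B₂ / m₂))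
      (y₁ := x * (A₁ / m₁) + y * (A₂ / m₂)) (z₁ := δ * (s₂ * z + s₁ * w)) (w₁ := δ * (z + w))
      (z' := 0) (w' := 0) (z₁' := 0) (w₁' := 0) (fun X => ?_), key]
    · have e₁ : δ * (s₂ * z + s₁ * w) - s₁ * (δ * (z + w)) = - z := by
        linear_combination - z * hδ
      have e₂ : δ * (s₂ * z + s₁ * w) - s₂ * (δ * (z + w)) = w := by
        linear_combination w * hδ
      rw [e₁, e₂]
      linear_combination - x * z ^ 3 * h2
    · rw [← hb.2, ← hc'.2, hpt]
      refine congrArg (fun v => eval v F) ?_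
      congr 1 <;> ring
  obtain ⟨a0, a1, a2, a3⟩ := cubic_coeffs (a := c' 1 0) (d0 := 0) (d1 := 0) (d2 := 0) (d3 := 1)
    fun z => by have := lin 1 0 z 1; linear_combination this
  obtain ⟨b0, b1, b2, b3⟩ := cubic_coeffs (a := c' 0 1) (d0 := 1) (d1 := 0) (d2 := 0) (d3 := 0)
    fun z => by have := lin 0 1 z 1; linear_combination this
  exact ⟨b', c', hc', hspan, a0, a1, a2, a3, b0, b1, b2, b3⟩

end Triple

section Square
variable {K : Type*} [Field K] [CharP K 2] {F : MvPolynomial (Fin 4) K}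
  {b : Module.Basis (Fin 4) K (Fin 4 → K)} {c : ℕ → ℕ → ℕ → K}

theorem quadratic_part [Infinite K] (hv : VanishesOnLine c) {x y z w a0 a1 a2 a3 a4 : K}
    (h : ∀ X : K, quartic c (X * x) (X * y) z w =
      a0 + a1 * X + a2 * X ^ 2 + a3 * X ^ 3 + a4 * X ^ 4) :
    x ^ 2 * (c 2 0 2 * z ^ 2 + c 2 0 1 * z * w + c 2 0 0 * w ^ 2) +
      x * y * (c 1 1 2 * z ^ 2 + c 1 1 1 * z * w + c 1 1 0 * w ^ 2) +
      y ^ 2 * (c 0 2 2 * z ^ 2 + c 0 2 1 * z * w + c 0 2 0 * w ^ 2) = a2 := by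
  have e0 := hv 0 (by norm_num)
  have e1 := hv 1 (by norm_num)
  have e2 := hv 2 (by norm_num)
  have e3 := hv 3 (by norm_num)
  have e4 := hv 4 (by norm_num)
  have key := coeffs_eq_zero_of_forall (a0 := - a0)
    (a1 := x * cubic (c 1 0) z w + y * cubic (c 0 1) z w - a1)
    (a2 := x ^ 2 * (c 2 0 2 * z ^ 2 + c 2 0 1 * z * w + c 2 0 0 * w ^ 2) +
      x * y * (c 1 1 2 * z ^ 2 + c 1 1 1 * z * w + c 1 1 0 * w ^ 2) +
      y ^ 2 * (c 0 2 2 * z ^ 2 + c 0 2 1 * z * w + c 0 2 0 * w ^ 2) - a2)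
    (a3 := x ^ 3 * (c 3 0 1 * z + c 3 0 0 * w) + x ^ 2 * y * (c 2 1 1 * z + c 2 1 0 * w) +
      x * y ^ 2 * (c 1 2 1 * z + c 1 2 0 * w) + y ^ 3 * (c 0 3 1 * z + c 0 3 0 * w) - a3)
    (a4 := c 4 0 0 * x ^ 4 + c 3 1 0 * x ^ 3 * y + c 2 2 0 * x ^ 2 * y ^ 2 + c 1 3 0 * x * y ^ 3 +
      c 0 4 0 * y ^ 4 - a4) fun X => by
      have := h X
      simp only [quartic, e0, e1, e2, e3, e4] at this
      simp only [cubic]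
      linear_combination this
  exact sub_eq_zero.1 key.2.2.1

theorem CubeForm.polys (h : CubeForm c) : pA c = .X ^ 3 ∧ pB c = 1 ∧ pW c = .X ^ 2 ∧
    pA₂ c = .X ∧ pA₃ c = 1 := by
  obtain ⟨a0, a1, a2, a3, b0, b1, b2, b3⟩ := h
  simp [pA, pB, cubicPoly, pW, pA₂, pA₃, mn, a0, a1, a2, a3, b0, b1, b2, b3]

/-- The normal form `x z³ + y w³ + z w h(x, y) + k(x, y)`. -/
structure ZForm (c : ℕ → ℕ → ℕ → K) : Prop where
  vanishes : VanishesOnLine c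
  cube : CubeForm c
  quad : c 2 0 0 = 0 ∧ c 2 0 2 = 0 ∧ c 1 1 0 = 0 ∧ c 1 1 2 = 0 ∧ c 0 2 0 = 0 ∧ c 0 2 2 = 0
  cub : c 3 0 0 = 0 ∧ c 2 1 0 = 0 ∧ c 1 2 0 = 0 ∧ c 0 3 0 = 0 ∧
    c 3 0 1 = 0 ∧ c 2 1 1 = 0 ∧ c 1 2 1 = 0 ∧ c 0 3 1 = 0

theorem ZForm.quartic_eq (h : ZForm c) (x y z w : K) : quartic c x y z w =
    x * z ^ 3 + y * w ^ 3 + z * w * (c 2 0 1 * x ^ 2 + c 1 1 1 * x * y + c 0 2 1 * y ^ 2) +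
      (c 4 0 0 * x ^ 4 + c 3 1 0 * x ^ 3 * y + c 2 2 0 * x ^ 2 * y ^ 2 + c 1 3 0 * x * y ^ 3 +
        c 0 4 0 * y ^ 4) := by
  have e0 := h.vanishes 0 (by norm_num)
  have e1 := h.vanishes 1 (by norm_num)
  have e2 := h.vanishes 2 (by norm_num)
  have e3 := h.vanishes 3 (by norm_num)
  have e4 := h.vanishes 4 (by norm_num)
  obtain ⟨a0, a1, a2, a3, b0, b1, b2, b3⟩ := h.cube
  obtain ⟨q1, q2, q3, q4, q5, q6⟩ := h.quad
  obtain ⟨l1, l2, l3, l4, l5, l6, l7, l8⟩ := h.cub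
  simp only [quartic, e0, e1, e2, e3, e4, a0, a1, a2, a3, b0, b1, b2, b3, q1, q2, q3, q4, q5, q6,
    l1, l2, l3, l4, l5, l6, l7, l8]
  ring

theorem ZForm.of_pI_eq_zero (hv : VanishesOnLine c) (hc : CubeForm c) (h1 : c 2 0 2 = 0)
    (h2 : c 1 1 0 = 0) (h3 : c 1 1 2 = 0) (h4 : c 0 2 0 = 0) (hI : pI c = 0) : ZForm c := by
  obtain ⟨hA, hB, hW, hA₂, -⟩ := hc.polys
  have hQ0 : pQ c 0 = .C (c 2 0 0) := by simp [pQ, hA, hB, h2, h4]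
  have hQ2 : pQ c 2 = .C (c 0 2 2) * .X ^ 6 := by simp [pQ, hA, hB, h1, h3, ← pow_mul]
  have e0 : c 2 0 0 = 0 := by
    have h := congrArg (fun p : Polynomial K => p.coeff 1) hI
    have : pI c = .X * .C (c 2 0 0 ^ 2) + .X ^ 2 * (.X ^ 2 * pl c + pq c * pQ c 1 +
        .X * (.C (c 0 2 2) * .X ^ 7 + pQ c 1) ^ 2) := by
      rw [pI, hW, hA₂, pq, hQ0, hQ2]
      simp only [map_pow]
      grind
    rw [this] at h
    simp only [Polynomial.coeff_zero, Polynomial.coeff_add, Polynomial.coeff_X_mul,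
      Polynomial.coeff_X_pow_mul', Polynomial.coeff_C_zero] at h
    simpa using h
  have hq : pq c = .C (c 0 2 2) * .X ^ 8 + pQ c 1 * .X := by
    rw [pq, hQ0, hQ2, e0]; simp; ring
  have e2 : c 0 2 2 = 0 := by
    have h := congrArg (fun p : Polynomial K => p.coeff 17) hI
    have h6 : (pQ c 1).natDegree ≤ 6 := by
      simp only [pQ, hA, hB]; compute_degree
    have h10 : (pl c).natDegree ≤ 10 := by
      simp only [pl, pL, hA, hB]; compute_degree
    have hd : (.X ^ 4 * pl c + .X ^ 10 * .C (c 0 2 2) * pQ c 1 : Polynomial K).natDegree ≤ 16 := by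
      compute_degree <;> omega
    have : pI c = .C (c 0 2 2 ^ 2) * .X ^ 17 + (.X ^ 4 * pl c + .X ^ 10 * .C (c 0 2 2) * pQ c 1) := by
      rw [pI, hW, hA₂, hq]
      simp only [map_pow]
      grind
    rw [this] at h
    simp only [Polynomial.coeff_add, Polynomial.coeff_C_mul_X_pow] at h
    rw [← Polynomial.coeff_add, Polynomial.coeff_eq_zero_of_natDegree_lt (lt_of_le_of_lt hd (by norm_num))] at h
    simpa using h
  have hl : pl c = 0 := by
    have : pI c = .X ^ 4 * pl c := by
      rw [pI, hW, hA₂, hq, e2]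
      simp only [map_zero]
      grind
    rw [this] at hI
    exact (mul_eq_zero.1 hI).resolve_left (pow_ne_zero _ Polynomial.X_ne_zero)
  refine ⟨hv, hc, ⟨e0, h1, h2, h3, h4, e2⟩, ?_⟩
  have hco : ∀ n, (pl c).coeff n = 0 := fun n => by rw [hl, Polynomial.coeff_zero]
  have hl' : pl c = .C (c 3 0 1) * .X ^ 1 + .C (c 2 1 1) * .X ^ 4 + .C (c 1 2 1) * .X ^ 7 +
      .C (c 0 3 1) * .X ^ 10 + .C (c 3 0 0) * .X ^ 0 + .C (c 2 1 0) * .X ^ 3 +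
      .C (c 1 2 0) * .X ^ 6 + .C (c 0 3 0) * .X ^ 9 := by
    simp only [pl, pL, hA, hB]; ring
  rw [hl'] at hco
  simp only [Polynomial.coeff_add, Polynomial.coeff_C_mul_X_pow] at hco
  have f0 := hco 0
  have f1 := hco 1
  have f3 := hco 3
  have f4 := hco 4
  have f6 := hco 6
  have f7 := hco 7
  have f9 := hco 9
  have f10 := hco 10
  norm_num at f0 f1 f3 f4 f6 f7 f9 f10
  exact ⟨f0, f3, f6, f9, f1, f4, f7, f10⟩

end Square

section ZForm
variable {K : Type*} [Field K] [IsAlgClosed K] [CharP K 2] {F : MvPolynomial (Fin 4) K}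
  {b : Module.Basis (Fin 4) K (Fin 4 → K)} {c : ℕ → ℕ → ℕ → K}

theorem quadratic_coeffs {a0 a1 a2 d0 d1 d2 : K}
    (h : ∀ z : K, a2 * z ^ 2 + a1 * z + a0 = d2 * z ^ 2 + d1 * z + d0) :
    a0 = d0 ∧ a1 = d1 ∧ a2 = d2 := by
  have : Infinite K := IsAlgClosed.instInfinite
  obtain ⟨h0, h1, h2, -, -⟩ := coeffs_eq_zero_of_forall (a0 := a0 - d0)
    (a1 := a1 - d1) (a2 := a2 - d2) (a3 := 0) (a4 := 0) fun z => by
      linear_combination h z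
  exact ⟨sub_eq_zero.1 h0, sub_eq_zero.1 h1, sub_eq_zero.1 h2⟩

theorem exists_shifted_cubeForm (hF : IsSmoothQuartic F) (hb : Coords F b c)
    (hv : VanishesOnLine c) (hc : CubeForm c) :
    ∃ (b' : Module.Basis (Fin 4) K (Fin 4 → K)) (c' : ℕ → ℕ → ℕ → K), Coords F b' c' ∧
      Submodule.span K {b' 2, b' 3} = Submodule.span K {b 2, b 3} ∧ VanishesOnLine c' ∧
      CubeForm c' ∧ c' 2 0 2 = 0 ∧ c' 1 1 0 = 0 ∧ c' 1 1 2 = 0 ∧ c' 0 2 0 = 0 := by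
  have : Infinite K := IsAlgClosed.instInfinite
  have h2 : (2 : K) = 0 := CharTwo.two_eq_zero
  let P : K → K → K := fun x y => c 2 0 2 * x + c 1 1 2 * y
  let R : K → K → K := fun x y => c 1 1 0 * x + c 0 2 0 * y
  let u : Fin 4 → Fin 4 → K := ![b 0 + c 2 0 2 • b 2 + c 1 1 0 • b 3,
    b 1 + c 1 1 2 • b 2 + c 0 2 0 • b 3, b 2, b 3]
  have hu : ∀ x y z w : K, x • u 0 + y • u 1 + z • u 2 + w • u 3 =
      pt b x y (z + P x y) (w + R x y) := fun x y z w => by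
    simp only [u, pt, Matrix.cons_val, P, R]; module
  obtain ⟨b', hb'⟩ := exists_basis u (by
    intro x y z w h
    rw [hu] at h
    obtain ⟨rfl, rfl, e2, e3⟩ := pt_eq_zero.1 h
    simpa [P, R] using And.intro e2 e3)
  have hpt : ∀ x y z w, pt b' x y z w = pt b x y (z + P x y) (w + R x y) := fun x y z w => by
    rw [← hu, pt, hb', hb', hb', hb']
  obtain ⟨c', hc'⟩ := hF.coords b'
  have e2 : b' 2 = b 2 := hb' 2
  have e3 : b' 3 = b 3 := hb' 3
  have hq : ∀ x y z w, quartic c' x y z w = quartic c x y (z + P x y) (w + R x y) :=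
    fun x y z w => by rw [← hb.2, ← hc'.2, hpt]
  have hv' : VanishesOnLine c' := vanishesOnLine_of_forall fun z => by
    have h0 := hv 0 (by norm_num)
    have h1 := hv 1 (by norm_num)
    have h2 := hv 2 (by norm_num)
    have h3 := hv 3 (by norm_num)
    have h4 := hv 4 (by norm_num)
    rw [hq]
    simp [P, R, quartic, h0, h1, h2, h3, h4]
  have hlin : ∀ x y z w, x * cubic (c' 1 0) z w + y * cubic (c' 0 1) z w =
      x * cubic (c 1 0) z w + y * cubic (c 0 1) z w := fun x y z w =>
    linear_part_eq hv' hv (z' := 0) (w' := 0) (z₁' := P x y) (w₁' := R x y) fun X => by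
      rw [hq]; congr 1 <;> simp only [P, R] <;> ring
  have hcc := hc
  obtain ⟨a0, a1, a2, a3, b0, b1, b2, b3⟩ := hcc
  have hcube : CubeForm c' := by
    obtain ⟨f0, f1, f2, f3⟩ := cubic_coeffs (a := c' 1 0) (d0 := 0) (d1 := 0) (d2 := 0) (d3 := 1)
      fun z => by
        have := hlin 1 0 z 1
        simp only [cubic, a0, a1, a2, a3] at this
        simp only [cubic]; linear_combination this
    obtain ⟨g0, g1, g2, g3⟩ := cubic_coeffs (a := c' 0 1) (d0 := 1) (d1 := 0) (d2 := 0) (d3 := 0)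
      fun z => by
        have := hlin 0 1 z 1
        simp only [cubic, b0, b1, b2, b3] at this
        simp only [cubic]; linear_combination this
    exact ⟨f0, f1, f2, f3, g0, g1, g2, g3⟩
  have hquad : ∀ x y z w, x ^ 2 * (c' 2 0 2 * z ^ 2 + c' 2 0 1 * z * w + c' 2 0 0 * w ^ 2) +
      x * y * (c' 1 1 2 * z ^ 2 + c' 1 1 1 * z * w + c' 1 1 0 * w ^ 2) +
      y ^ 2 * (c' 0 2 2 * z ^ 2 + c' 0 2 1 * z * w + c' 0 2 0 * w ^ 2) =
      z ^ 2 * (c 0 2 2 * y ^ 2) + z * w * (c 2 0 1 * x ^ 2 + c 1 1 1 * x * y + c 0 2 1 * y ^ 2) +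
        w ^ 2 * (c 2 0 0 * x ^ 2) := by
    intro x y z w
    let Q2 := c 2 0 2 * x ^ 2 + c 1 1 2 * x * y + c 0 2 2 * y ^ 2
    let Q1 := c 2 0 1 * x ^ 2 + c 1 1 1 * x * y + c 0 2 1 * y ^ 2
    let Q0 := c 2 0 0 * x ^ 2 + c 1 1 0 * x * y + c 0 2 0 * y ^ 2
    let L1 := c 3 0 1 * x ^ 3 + c 2 1 1 * x ^ 2 * y + c 1 2 1 * x * y ^ 2 + c 0 3 1 * y ^ 3
    let L0 := c 3 0 0 * x ^ 3 + c 2 1 0 * x ^ 2 * y + c 1 2 0 * x * y ^ 2 + c 0 3 0 * y ^ 3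
    let k := c 4 0 0 * x ^ 4 + c 3 1 0 * x ^ 3 * y + c 2 2 0 * x ^ 2 * y ^ 2 + c 1 3 0 * x * y ^ 3 +
      c 0 4 0 * y ^ 4
    refine quadratic_part hv' (a0 := 0) (a1 := x * z ^ 3 + y * w ^ 3)
      (a3 := x * z * P x y ^ 2 + y * w * R x y ^ 2 + Q1 * (z * R x y + w * P x y) + L1 * z + L0 * w)
      (a4 := x * P x y ^ 3 + y * R x y ^ 3 + Q2 * P x y ^ 2 + Q1 * P x y * R x y + Q0 * R x y ^ 2 +
        L1 * P x y + L0 * R x y + k) fun X => ?_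
    have h0 := hv 0 (by norm_num)
    have h1 := hv 1 (by norm_num)
    have h2 := hv 2 (by norm_num)
    have h3 := hv 3 (by norm_num)
    have h4 := hv 4 (by norm_num)
    rw [hq]
    have eP : P (X * x) (X * y) = X * P x y := by simp only [P]; ring
    have eR : R (X * x) (X * y) = X * R x y := by simp only [R]; ring
    have hP : P x y = c 2 0 2 * x + c 1 1 2 * y := rfl
    have hR : R x y = c 1 1 0 * x + c 0 2 0 * y := rfl
    rw [eP, eR]
    simp only [quartic, h0, h1, h2, h3, h4, a0, a1, a2, a3, b0, b1, b2, b3, Q2, Q1, Q0, L1, L0, k]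
    generalize P x y = p at *
    generalize R x y = r at *
    have h2 : (2 : K) = 0 := CharTwo.two_eq_zero
    linear_combination (X ^ 2 * z ^ 2 * x) * hP + X ^ 2 * w ^ 2 * y * hR +
      (w * X ^ 3 * r * (y * x * c 1 1 0 + y ^ 2 * c 0 2 0 + x ^ 2 * c 2 0 0) +
        w * X ^ 3 * r ^ 2 * y + w ^ 2 * X ^ 2 * (r * y + y * x * c 1 1 0 + y ^ 2 * c 0 2 0) +
        X ^ 2 * z ^ 2 * (p * x + y * x * c 1 1 2 + x ^ 2 * c 2 0 2) +
        X ^ 3 * z * p * (y * x * c 1 1 2 + y ^ 2 * c 0 2 2 + x ^ 2 * c 2 0 2) +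
        X ^ 3 * z * p ^ 2 * x) * h2
  have hx := fun z => hquad 1 0 z 1
  have hy := fun z => hquad 0 1 z 1
  have hxy := fun z => hquad 1 1 z 1
  obtain ⟨x0, x1, x2⟩ := quadratic_coeffs (a0 := c' 2 0 0) (a1 := c' 2 0 1) (a2 := c' 2 0 2)
    (d0 := c 2 0 0) (d1 := c 2 0 1) (d2 := 0) fun z => by linear_combination hx z
  obtain ⟨y0, y1, y2⟩ := quadratic_coeffs (a0 := c' 0 2 0) (a1 := c' 0 2 1) (a2 := c' 0 2 2)
    (d0 := 0) (d1 := c 0 2 1) (d2 := c 0 2 2) fun z => by linear_combination hy z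
  obtain ⟨z0, -, z2⟩ := quadratic_coeffs (a0 := c' 1 1 0) (a1 := c' 1 1 1) (a2 := c' 1 1 2)
    (d0 := 0) (d1 := c 1 1 1) (d2 := 0) fun z => by
      have := hxy z
      rw [x0, x1, x2, y0, y1, y2] at this
      linear_combination this
  exact ⟨b', c', hc', by rw [e2, e3], hv', hcube, x2, z0, z2, y0⟩

theorem exists_zForm (hF : IsSmoothQuartic F) (hb : Coords F b c)
    (hl : Submodule.span K {b 2, b 3} ∈ lines F) (hc : CubeForm c) :
    (nbrs F (Submodule.span K {b 2, b 3})).ncard ≤ 18 ∨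
    ∃ (b' : Module.Basis (Fin 4) K (Fin 4 → K)) (c' : ℕ → ℕ → ℕ → K), Coords F b' c' ∧
      Submodule.span K {b' 2, b' 3} = Submodule.span K {b 2, b 3} ∧ ZForm c' := by
  have : Infinite K := IsAlgClosed.instInfinite
  obtain ⟨b', c', h1, h2, h3, h4, h5, h6, h7, h8⟩ :=
    exists_shifted_cubeForm hF hb (coords_vanishesOnLine hb hl) hc
  by_cases hI : pI c' = 0
  · exact Or.inr ⟨b', c', h1, h2, ZForm.of_pI_eq_zero h3 h4 h5 h6 h7 h8 hI⟩
  · left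
    rw [← h2] at hl ⊢
    exact ncard_nbrs_of_pI_ne_zero hF h1 hl hI

/-- The equations of the lines meeting the axis of a surface in normal form. -/
theorem ZForm.isLineAt (h : ZForm c) (s μ : K) : IsLineAt c s μ ↔
    s ^ 2 * μ + s * (pQ c 1).eval s = 0 ∧ s * μ ^ 2 + (pQ c 1).eval s * μ = 0 ∧
      μ ^ 3 + (pK c).eval s = 0 := by
  obtain ⟨hA, hB, hW, hA₂, hA₃⟩ := h.cube.polys
  obtain ⟨q1, q2, q3, q4, q5, q6⟩ := h.quad
  obtain ⟨l1, l2, l3, l4, l5, l6, l7, l8⟩ := h.cub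
  simp [IsLineAt, hW, hA₂, hA₃, pq, pl, pL, l1, l2, l3, l4, l5, l6, l7, l8,
    show pQ c 0 = 0 by simp [pQ, q1, q3, q5], show pQ c 2 = 0 by simp [pQ, q2, q4, q6], mul_comm]

theorem ZForm.evals (h : ZForm c) (s : K) :
    (pQ c 1).eval s = c 2 0 1 + c 1 1 1 * s ^ 3 + c 0 2 1 * s ^ 6 ∧
    (pK c).eval s = c 4 0 0 + c 3 1 0 * s ^ 3 + c 2 2 0 * s ^ 6 + c 1 3 0 * s ^ 9 +
      c 0 4 0 * s ^ 12 := by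
  obtain ⟨hA, hB, -⟩ := h.cube.polys
  simp [pQ, pK, hA, hB, ← pow_mul]

theorem ZForm.card_zero_fibre (hc : SmoothCoeffs c) (h : ZForm c) {S : Finset K}
    (hS : ∀ μ ∈ S, IsLineAt c 0 μ) :
    S.card ≤ 3 ∧ (c 2 0 1 ≠ 0 → S.card ≤ 1 ∧ (c 4 0 0 ≠ 0 → S.card = 0)) := by
  refine ⟨card_fibre_le_three hc h.vanishes hS, fun h0 => ?_⟩
  have h1 : ∀ μ ∈ S, μ = 0 ∧ c 4 0 0 = 0 := fun μ hμ => by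
    obtain ⟨-, e2, e3⟩ := (h.isLineAt 0 μ).1 (hS μ hμ)
    obtain ⟨f1, f2⟩ := h.evals 0
    rw [f1] at e2
    rw [f2] at e3
    have : μ = 0 := by simpa [h0] using e2
    subst this
    simpa using e3
  refine ⟨Finset.card_le_one.2 fun x hx y hy => (h1 x hx).1.trans (h1 y hy).1.symm, fun h4 => ?_⟩
  exact Finset.card_eq_zero.2 (Finset.eq_empty_of_forall_notMem fun μ hμ => h4 (h1 μ hμ).2)

theorem ZForm.ncard_lineParams (hc : SmoothCoeffs c) (h : ZForm c) (hfin : (lineParams c).Finite) :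
    (lineParams c).ncard ≤ 19 ∧ ((c 2 0 1 ≠ 0 → c 4 0 0 ≠ 0) → (lineParams c).ncard ≤ 18) ∧
      (c 0 2 1 = 0 → (lineParams c).ncard ≤ 16) := by
  classical
  have : Infinite K := IsAlgClosed.instInfinite
  obtain ⟨hA, hB, -⟩ := h.cube.polys
  let R := pQ c 1 ^ 3 + .X ^ 3 * pK c
  have hR : R ≠ 0 := by
    intro h0
    have hx : ∀ s : K, s ≠ 0 → (s, (pQ c 1).eval s / s) ∈ lineParams c := by
      intro s hs
      have he := congrArg (Polynomial.eval s) h0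
      simp only [R, Polynomial.eval_add, Polynomial.eval_mul, Polynomial.eval_pow,
        Polynomial.eval_X, Polynomial.eval_zero] at he
      refine (h.isLineAt _ _).2 ⟨?_, ?_, ?_⟩
      · field_simp; grind
      · field_simp; grind
      · field_simp; linear_combination he
    have hinj : Set.InjOn (fun s : K => (s, (pQ c 1).eval s / s)) {0}ᶜ :=
      fun a _ b _ hab => (Prod.mk.inj hab).1
    exact ((Set.finite_singleton (0 : K)).infinite_compl.image hinj)
      (hfin.subset (Set.image_subset_iff.2 fun s hs => hx s hs))
  have hroot : ∀ s μ, s ≠ 0 → IsLineAt c s μ → R.eval s = 0 := by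
    intro s μ hs hμ
    obtain ⟨e1, e2, e3⟩ := (h.isLineAt s μ).1 hμ
    simp only [R, Polynomial.eval_add, Polynomial.eval_mul, Polynomial.eval_pow, Polynomial.eval_X]
    generalize (pQ c 1).eval s = H at *
    have : s * μ + H = 0 := by
      refine (mul_eq_zero.1 ?_).resolve_left hs
      linear_combination e1
    grind
  have hmain : (lineParams c).ncard ≤
      R.natDegree + (if c 2 0 1 ≠ 0 ∧ c 4 0 0 = 0 then {0} else ∅ : Finset K).card := by
    refine ncard_le_natDegree_add _ hfin R _ fun s S hS hne => ?_
    have hS' : ∀ μ ∈ S, IsLineAt c s μ := hS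
    by_cases hs : s = 0
    · subst hs
      obtain ⟨f1, f2⟩ := h.card_zero_fibre hc hS'
      by_cases h0 : c 2 0 1 = 0
      · left
        refine f1.trans ((Polynomial.le_rootMultiplicity_iff hR).2 ?_)
        rw [Polynomial.C_0, sub_zero]
        have : Polynomial.X ∣ pQ c 1 := by
          rw [Polynomial.X_dvd_iff, Polynomial.coeff_zero_eq_eval_zero, (h.evals 0).1]
          simp [h0]
        exact dvd_add (pow_dvd_pow_of_dvd this 3) (dvd_mul_right _ _)
      · by_cases h4 : c 4 0 0 = 0
        · exact Or.inr ⟨by simp [h0, h4], (f2 h0).1.trans (by omega)⟩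
        · exact Or.inl (((f2 h0).2 h4).le.trans (by omega))
    · left
      obtain ⟨μ₀, hμ₀⟩ := hne
      exact le_trans (card_le_one_of_linear (a := s ^ 2) (b := s * (pQ c 1).eval s)
        (pow_ne_zero 2 hs) fun μ hμ => ((h.isLineAt s μ).1 (hS' μ hμ)).1)
        ((Polynomial.rootMultiplicity_pos hR).2 (hroot s μ₀ hs (hS' μ₀ hμ₀)))
  have hQ6 : (pQ c 1).natDegree ≤ 6 := by
    simp only [pQ, hA, hB]; compute_degree
  have hK12 : (pK c).natDegree ≤ 12 := by
    simp only [pK, hA, hB]; compute_degree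
  have hd : R.natDegree ≤ 18 := by
    simp only [R]; compute_degree <;> omega
  have hE : (if c 2 0 1 ≠ 0 ∧ c 4 0 0 = 0 then {0} else ∅ : Finset K).card ≤ 1 := by
    split_ifs <;> simp
  refine ⟨by omega, fun hne => ?_, fun h1 => ?_⟩
  · rw [if_neg (fun hh => hne hh.1 hh.2)] at hmain
    simp only [Finset.card_empty] at hmain
    omega
  · have hQ3 : (pQ c 1).natDegree ≤ 3 := by
      simp only [pQ, hA, hB, h1]; simp; compute_degree
    have hd : R.natDegree ≤ 15 := by
      simp only [R]; compute_degree <;> omega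
    omega

/-- The coefficients after exchanging `x, y` and `z, w`. -/
def swapCoeffs (c : ℕ → ℕ → ℕ → K) : ℕ → ℕ → ℕ → K := fun i j k => c j i (4 - i - j - k)

omit [IsAlgClosed K] [CharP K 2] in
theorem quartic_swap (c : ℕ → ℕ → ℕ → K) (x y z w : K) :
    quartic (swapCoeffs c) x y z w = quartic c y x w z := by
  simp only [quartic, swapCoeffs]
  norm_num
  ring

theorem Coords.swap (hF : IsSmoothQuartic F) (hb : Coords F b c) :
    ∃ b' : Module.Basis (Fin 4) K (Fin 4 → K), b' 2 = b 3 ∧ b' 3 = b 2 ∧ b' 0 = b 1 ∧ b' 1 = b 0 ∧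
      Coords F b' (swapCoeffs c) := by
  have : Infinite K := IsAlgClosed.instInfinite
  obtain ⟨b', hb'⟩ := exists_basis ![b 1, b 0, b 3, b 2] (by
    intro x y z w h
    have : pt b y x w z = 0 := by rw [← h]; simp only [pt, Matrix.cons_val]; module
    obtain ⟨h1, h2, h3, h4⟩ := pt_eq_zero.1 this
    exact ⟨h2, h1, h4, h3⟩)
  have e0 : b' 0 = b 1 := hb' 0
  have e1 : b' 1 = b 0 := hb' 1
  have e2 : b' 2 = b 3 := hb' 2
  have e3 : b' 3 = b 2 := hb' 3
  obtain ⟨c', hc'⟩ := hF.coords b'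
  have hq : ∀ x y z w, quartic c' x y z w = quartic (swapCoeffs c) x y z w := fun x y z w => by
    rw [quartic_swap, ← hb.2, ← hc'.2]
    refine congrArg (fun v => eval v F) ?_
    simp only [pt, e0, e1, e2, e3]
    module
  have hcc : ∀ i j k, i + j + k ≤ 4 → c' i j k = swapCoeffs c i j k := quartic_ext hq
  refine ⟨b', e2, e3, e0, e1, fun x y z w h0 h1 h2 h3 h4 => hc'.1 x y z w ?_ ?_ ?_ ?_ ?_,
    fun x y z w => by rw [hc'.2, hq]⟩
  · rwa [hq]
  · rw [← h1]; simp only [quarticX]; simp (disch := norm_num) only [hcc]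
  · rw [← h2]; simp only [quarticY]; simp (disch := norm_num) only [hcc]
  · rw [← h3]; simp only [quarticZ]; simp (disch := norm_num) only [hcc]
  · rw [← h4]; simp only [quarticW]; simp (disch := norm_num) only [hcc]

omit [IsAlgClosed K] [CharP K 2] in
theorem ZForm.swap (h : ZForm c) : ZForm (swapCoeffs c) := by
  obtain ⟨a0, a1, a2, a3, b0, b1, b2, b3⟩ := h.cube
  obtain ⟨q1, q2, q3, q4, q5, q6⟩ := h.quad
  obtain ⟨l1, l2, l3, l4, l5, l6, l7, l8⟩ := h.cub
  refine ⟨fun k hk => h.vanishes (4 - k) (by omega), ?_, ?_, ?_⟩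
  · exact ⟨b3, b2, b1, b0, a3, a2, a1, a0⟩
  · exact ⟨q6, q5, q4, q3, q2, q1⟩
  · exact ⟨l8, l7, l6, l5, l4, l3, l2, l1⟩

end ZForm

section Bases
variable {K : Type*} [Field K]

theorem exists_notMem_span (s : Finset (Fin 4 → K)) (hs : s.card ≤ 3) :
    ∃ x, x ∉ Submodule.span K (s : Set (Fin 4 → K)) := by
  by_contra! h
  have h1 := finrank_span_finset_le_card (R := K) s
  rw [Set.finrank, Submodule.eq_top_iff'.2 h, finrank_top, Module.finrank_fin_fun] at h1
  omega

theorem exists_basis_of_triple {u v w : Fin 4 → K}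
    (h : ∀ x y z : K, x • u + y • v + z • w = 0 → x = 0 ∧ y = 0 ∧ z = 0) :
    ∃ b : Module.Basis (Fin 4) K (Fin 4 → K), b 1 = u ∧ b 2 = v ∧ b 3 = w := by
  classical
  obtain ⟨t, ht⟩ := exists_notMem_span {u, v, w} Finset.card_le_three
  obtain ⟨b, hb⟩ := exists_basis ![t, u, v, w] (by
    intro x y z w' h0
    simp only [Matrix.cons_val] at h0
    have hx : x = 0 := by
      by_contra hx
      refine ht ?_
      have : t = (- y / x) • u + (- z / x) • v + (- w' / x) • w := by
        have : x • t = (-y) • u + (-z) • v + (-w') • w := by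
          rw [← sub_eq_zero, ← h0]; module
        rw [← inv_smul_smul₀ hx t, this]
        simp only [smul_add, smul_smul, div_eq_inv_mul]
      rw [this]
      refine Submodule.add_mem _ (Submodule.add_mem _ ?_ ?_) ?_ <;>
        exact Submodule.smul_mem _ _ (Submodule.subset_span (by simp))
    subst hx
    refine ⟨rfl, h _ _ _ ?_⟩
    rw [← h0]; module)
  exact ⟨b, hb 1, hb 2, hb 3⟩

theorem exists_basis_of_pair {u v : Fin 4 → K}
    (h : ∀ x y : K, x • u + y • v = 0 → x = 0 ∧ y = 0) :
    ∃ b : Module.Basis (Fin 4) K (Fin 4 → K), b 2 = u ∧ b 3 = v := by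
  classical
  obtain ⟨t, ht⟩ := exists_notMem_span {u, v} (Finset.card_le_two.trans (by norm_num))
  obtain ⟨b, -, h2, h3⟩ := exists_basis_of_triple (u := t) (v := u) (w := v) (by
    intro x y z h0
    have hx : x = 0 := by
      by_contra hx
      refine ht ?_
      have : t = (- y / x) • u + (- z / x) • v := by
        have : x • t = (-y) • u + (-z) • v := by
          rw [← sub_eq_zero, ← h0]; module
        rw [← inv_smul_smul₀ hx t, this]
        simp only [smul_add, smul_smul, div_eq_inv_mul]
      rw [this]
      refine Submodule.add_mem _ ?_ ?_ <;>
        exact Submodule.smul_mem _ _ (Submodule.subset_span (by simp))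
    subst hx
    refine ⟨rfl, h _ _ ?_⟩
    rw [← h0]; module)
  exact ⟨b, h2, h3⟩

theorem exists_adapted_basis {W : Submodule K (Fin 4 → K)} (hW : Module.finrank K W = 2) :
    ∃ b : Module.Basis (Fin 4) K (Fin 4 → K), Submodule.span K {b 2, b 3} = W := by
  obtain ⟨u, hu, v, hv, h⟩ := exists_pair hW
  obtain ⟨b, rfl, rfl⟩ := exists_basis_of_pair h
  exact ⟨b, span_pair_eq hW hu hv h⟩

end Bases

section Bound
variable {K : Type*} [Field K] [IsAlgClosed K] [CharP K 2] {F : MvPolynomial (Fin 4) K}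
  {b : Module.Basis (Fin 4) K (Fin 4 → K)} {c : ℕ → ℕ → ℕ → K}

theorem exists_lineAt_zero (hb : Coords F b c) (hv : VanishesOnLine c)
    {W : Submodule K (Fin 4 → K)} (hW : W ∈ nbrs F (Submodule.span K {b 2, b 3})) (h3 : b 3 ∈ W) :
    ∃ μ, IsLineAt c 0 μ ∧ lineAt b c 0 μ = W := by
  have : Infinite K := IsAlgClosed.instInfinite
  have h2 : b 2 ∉ W := fun h2 => hW.2.1 (span_pair_eq hW.1.1 h2 h3 (pair_independent b)).symm
  obtain ⟨s, μ, h, rfl⟩ := exists_lineAt hb hv hW h2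
  obtain ⟨m, n, hmn⟩ := mem_lineAt.1 h3
  have e3 : b 3 = pt b 0 0 0 1 := by simp [pt]
  obtain ⟨f0, f1, f2, rfl⟩ := pt_inj (hmn.trans e3)
  have hn : n = 0 := by
    rcases pA_pB_ne_zero hb.1 hv s with h' | h'
    · exact (mul_eq_zero.1 f1).resolve_right h'
    · exact (mul_eq_zero.1 f0).resolve_right h'
  have hs : s = 0 := by simpa [hn] using f2
  subst hs
  exact ⟨μ, h, rfl⟩

theorem exists_zero_fibre (hF : IsSmoothQuartic F) (hb : Coords F b c) (hv : VanishesOnLine c) :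
    ∃ S : Finset K, (∀ μ ∈ S, IsLineAt c 0 μ) ∧
      {W ∈ nbrs F (Submodule.span K {b 2, b 3}) | b 3 ∈ W}.ncard ≤ S.card := by
  classical
  have hfin : {μ : K | IsLineAt c 0 μ}.Finite :=
    (finite_lineParams hF hb hv).preimage (f := fun μ : K => ((0 : K), μ))
      (fun _ _ _ _ h => (Prod.mk.inj h).2)
  refine ⟨hfin.toFinset, fun μ hμ => by simpa using hμ, ?_⟩
  rw [← Set.ncard_eq_toFinset_card _ hfin]
  refine (Set.ncard_le_ncard ?_ (hfin.image _)).trans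
    (Set.ncard_image_le (f := fun μ => lineAt b c 0 μ) hfin)
  rintro W ⟨hW, h3⟩
  exact exists_lineAt_zero hb hv hW h3

theorem ZForm.ncard_nbrs (hF : IsSmoothQuartic F) (hb : Coords F b c) (h : ZForm c) :
    (nbrs F (Submodule.span K {b 2, b 3})).ncard ≤ 19 ∨
      ((nbrs F (Submodule.span K {b 2, b 3})).ncard ≤ 20 ∧
        c 2 0 1 ≠ 0 ∧ c 4 0 0 = 0 ∧ c 0 2 1 ≠ 0 ∧ c 0 4 0 = 0) := by
  obtain ⟨b', e2, e3, -, -, hb'⟩ := hb.swap hF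
  have hz' := h.swap
  obtain ⟨S, hS, hS'⟩ := exists_zero_fibre hF hb' hz'.vanishes
  rw [e2, e3, Set.pair_comm] at hS'
  have h1 := ncard_nbrs_avoiding_le hF hb h.vanishes
  have hsum : (nbrs F (Submodule.span K {b 2, b 3})).ncard ≤
      {W ∈ nbrs F (Submodule.span K {b 2, b 3}) | b 2 ∈ W}.ncard +
      {W ∈ nbrs F (Submodule.span K {b 2, b 3}) | b 2 ∉ W}.ncard := by
    refine (Set.ncard_le_ncard (fun W hW => ?_) ?_).trans (Set.ncard_union_le _ _)
    · by_cases h2 : b 2 ∈ W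
      · exact Or.inl ⟨hW, h2⟩
      · exact Or.inr ⟨hW, h2⟩
    · exact ((finite_nbrs hF _).subset (Set.sep_subset _ _)).union
        ((finite_nbrs hF _).subset (Set.sep_subset _ _))
  obtain ⟨m1, m2, m3⟩ := h.ncard_lineParams hb.1 (finite_lineParams hF hb h.vanishes)
  obtain ⟨g1, g2⟩ := hz'.card_zero_fibre hb'.1 hS
  have g2' : c 0 2 1 ≠ 0 → S.card ≤ 1 ∧ (c 0 4 0 ≠ 0 → S.card = 0) := g2
  by_cases k1 : c 0 2 1 = 0
  · have := m3 k1; omega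
  obtain ⟨g3, g4⟩ := g2' k1
  by_cases k2 : c 0 4 0 = 0
  · by_cases k3 : c 2 0 1 ≠ 0 ∧ c 4 0 0 = 0
    · exact Or.inr ⟨by omega, k3.1, k3.2, k1, k2⟩
    · have := m2 fun h3 h4 => k3 ⟨h3, h4⟩
      omega
  · have := g4 k2; omega

/-- A line on a smooth quartic meets at most nineteen others, with one exception. -/
theorem ncard_nbrs_le_or_special (hF : IsSmoothQuartic F) {W : Submodule K (Fin 4 → K)}
    (hW : W ∈ lines F) : (nbrs F W).ncard ≤ 19 ∨ ((nbrs F W).ncard ≤ 20 ∧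
      ∃ (b : Module.Basis (Fin 4) K (Fin 4 → K)) (c : ℕ → ℕ → ℕ → K), Coords F b c ∧
        Submodule.span K {b 2, b 3} = W ∧ ZForm c ∧
        c 2 0 1 ≠ 0 ∧ c 4 0 0 = 0 ∧ c 0 2 1 ≠ 0 ∧ c 0 4 0 = 0) := by
  have : Infinite K := IsAlgClosed.instInfinite
  obtain ⟨b₀, rfl⟩ := exists_adapted_basis hW.1
  obtain ⟨c₀, hb₀⟩ := hF.coords b₀
  obtain ⟨b, c, hb, hspan, hm, hoff⟩ := exists_shear_mn_ne_zero hF hb₀ hW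
  rw [← hspan] at hW ⊢
  have hv := coords_vanishesOnLine hb hW
  by_cases hI : pI c = 0
  swap
  · have := ncard_nbrs_of_pI_ne_zero hF hb hW hI
    omega
  have hle := ncard_nbrs_le hF hb hv hoff
  obtain h19 | ⟨s₁, s₂, hs, hW₁, hW₂, hA₁, hA₂⟩ :=
    ncard_lineParams_of_pI_eq_zero hb.1 hv (finite_lineParams hF hb hv) hm hI
  · omega
  obtain ⟨b', c', hb', hspan', hcube⟩ := exists_cubeForm hF hb hW hs hW₁ hW₂ hA₁ hA₂
  rw [← hspan'] at hW ⊢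
  obtain h18 | ⟨b'', c'', hb'', hspan'', hz⟩ := exists_zForm hF hb' hW hcube
  · omega
  rw [← hspan''] at hW ⊢
  obtain h19 | ⟨h20, h⟩ := hz.ncard_nbrs hF hb''
  · exact Or.inl h19
  · exact Or.inr ⟨h20, b'', c'', hb'', rfl, hz, h⟩

end Bound

section Coplanar
variable {K : Type*} [Field K] [IsAlgClosed K] [CharP K 2] {F : MvPolynomial (Fin 4) K}
  {b : Module.Basis (Fin 4) K (Fin 4 → K)} {c : ℕ → ℕ → ℕ → K} {β γ e k₂ k₃ : K}

/-- The eliminant `pI` of a line coplanar with the axis of a normal form, in terms of the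
coefficients of that form. -/
def coplanarI {R : Type*} [CommRing R] (X β γ e k₂ k₃ : R) : R :=
  let A := (e ^ 3 + k₂) * X ^ 3 + β * e * X ^ 2 + β * X + 1
  let B := e ^ 2 * X ^ 3 + e * X ^ 2 + X
  let W := (β * e ^ 3 + e * k₂ + e ^ 4) * X ^ 4 + e ^ 2 * X ^ 2 + 1
  let A₂ := (β * e ^ 2 + e ^ 3 + k₂) * X ^ 2 + e ^ 2 * X + e
  let q₂ := (k₂ + k₃) * B ^ 2 + e * A ^ 2
  let q₁ := e * γ * B ^ 2 + β * A * B + A ^ 2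
  let q := q₂ * X ^ 2 + q₁ * X + γ * B ^ 2
  W ^ 2 * ((k₃ * B ^ 3 + A ^ 3) * X + γ * A * B ^ 2) + W * q * q₁ + q ^ 2 * A₂

theorem coplanarI_low {R : Type*} [CommRing R] [CharP R 2] (X β γ e k₂ k₃ : R) :
    ∃ r, coplanarI X β γ e k₂ k₃ = β * X ^ 2 + X ^ 3 * r := by
  let A := (e ^ 3 + k₂) * X ^ 3 + β * e * X ^ 2 + β * X + 1
  let B := e ^ 2 * X ^ 3 + e * X ^ 2 + X
  let q₂ := (k₂ + k₃) * B ^ 2 + e * A ^ 2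
  let q₁ := e * γ * B ^ 2 + β * A * B + A ^ 2
  let q := q₂ * X ^ 2 + q₁ * X + γ * B ^ 2
  let l := (k₃ * B ^ 3 + A ^ 3) * X + γ * A * B ^ 2
  obtain ⟨a, ha⟩ : ∃ a, A = 1 + β * X + X ^ 2 * a :=
    ⟨(e ^ 3 + k₂) * X + β * e, by simp only [A]; ring⟩
  obtain ⟨y, hB⟩ : ∃ y, B = X + X ^ 2 * y := ⟨e ^ 2 * X + e, by simp only [B]; ring⟩
  obtain ⟨u, hu⟩ : ∃ u, q₁ = 1 + β * X + X ^ 2 * u := by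
    refine ⟨e * γ * (1 + X * y) ^ 2 + β * y + β * (β + X * a) * (1 + X * y) + (β + X * a) ^ 2, ?_⟩
    simp only [q₁, ha, hB]; clear ha hB; grind
  obtain ⟨v, hv'⟩ : ∃ v, q = X + (β + γ + e) * X ^ 2 + X ^ 3 * v := by
    refine ⟨u + γ * y ^ 2 * X + (k₂ + k₃) * X * (1 + X * y) ^ 2 + e * X * (β + X * a) ^ 2, ?_⟩
    simp only [q, hu, q₂, ha, hB]; clear ha hB hu; grind
  obtain ⟨w, hw⟩ : ∃ w, l = X + (β + γ) * X ^ 2 + X ^ 3 * w := by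
    refine ⟨a + (β + X * a) ^ 2 + X * (β + X * a) ^ 3 + k₃ * X * (1 + X * y) ^ 3 +
      γ * (X * y ^ 2 + (β + X * a) * (1 + X * y) ^ 2), ?_⟩
    simp only [l, ha, hB]; clear ha hB hu hv'; grind
  have key : coplanarI X β γ e k₂ k₃ = ((β * e ^ 3 + e * k₂ + e ^ 4) * X ^ 4 +
      e ^ 2 * X ^ 2 + 1) ^ 2 * l +
      ((β * e ^ 3 + e * k₂ + e ^ 4) * X ^ 4 + e ^ 2 * X ^ 2 + 1) * q * q₁ +
      q ^ 2 * ((β * e ^ 2 + e ^ 3 + k₂) * X ^ 2 + e ^ 2 * X + e) := rfl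
  rw [key, hw, hv', hu]
  generalize β * e ^ 3 + e * k₂ + e ^ 4 = m
  generalize β * e ^ 2 + e ^ 3 + k₂ = n
  clear hw hv' hu ha hB key
  clear_value A B q₂ q₁ q l
  refine ⟨w + v + u + X ^ 2 * (e ^ 2 + m * X ^ 2) ^ 2 * (1 + X * (β + γ + X * w)) +
    (β + γ + e + X * v) * (β + X * u) +
    (e ^ 2 + m * X ^ 2) * (1 + X * (β + γ + e + X * v)) * (1 + X * (β + X * u)) +
    (e ^ 2 + n * X) + X * (β + γ + e + X * v) ^ 2 * (e + X * (e ^ 2 + n * X)), ?_⟩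
  grind

set_option maxHeartbeats 1000000 in
theorem coplanarI_low' {R : Type*} [CommRing R] [CharP R 2] (X γ e k₂ k₃ : R) :
    ∃ r, coplanarI X 0 γ e k₂ k₃ = k₂ * X ^ 4 +
      (e * k₂ + e * k₃ + e ^ 3 * γ + e ^ 4 + γ * k₂) * X ^ 5 + X ^ 6 * r := by
  have : coplanarI X 0 γ e k₂ k₃ = k₂ * X ^ 4 +
      (e * k₂ + e * k₃ + e ^ 3 * γ + e ^ 4 + γ * k₂) * X ^ 5 + X ^ 6 * (
      (e * γ * k₃ + e ^ 3 * γ ^ 2 + e ^ 4 * γ + γ ^ 2 * k₂) * X ^ 0 + (e ^ 2 * γ * k₂ + e ^ 3 * k₃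
      + e ^ 5 * γ + e ^ 6 + k₂ ^ 2) * X ^ 1 + (e * k₂ * k₃ + e * k₃ ^ 2 + e ^ 3 * γ * k₂ + e ^ 3 *
      γ * k₃ + e ^ 6 * γ + e ^ 7 + γ * k₂ ^ 2) * X ^ 2 + (e ^ 2 * k₃ ^ 2 + e ^ 3 * γ ^ 2 * k₂ + e
      ^ 6 * γ ^ 2 + e ^ 8) * X ^ 3 + (e ^ 2 * γ * k₂ * k₃ + e ^ 2 * γ * k₂ ^ 2 + e ^ 3 * k₂ * k₃ +
      e ^ 3 * k₂ ^ 2 + e ^ 3 * k₃ ^ 2 + e ^ 4 * γ ^ 2 * k₂ + e ^ 7 * γ ^ 2 + e ^ 9 + k₂ * k₃ ^ 2 +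
      k₂ ^ 2 * k₃ + k₂ ^ 3) * X ^ 4 + (e ^ 4 * k₂ ^ 2 + e ^ 6 * γ * k₂ + e ^ 7 * k₃ + e ^ 9 * γ +
      e ^ 10) * X ^ 5 + (e * γ * k₂ ^ 3 + e ^ 2 * k₂ ^ 2 * k₃ + e ^ 2 * k₂ ^ 3 + e ^ 5 * k₂ * k₃ +
      e ^ 5 * k₂ ^ 2 + e ^ 5 * k₃ ^ 2 + e ^ 7 * γ * k₂ + e ^ 7 * γ * k₃ + e ^ 10 * γ + e ^ 11) * X
      ^ 6 + (e ^ 2 * γ * k₂ ^ 3 + e ^ 3 * k₂ ^ 2 * k₃ + e ^ 5 * γ * k₂ ^ 2 + e ^ 6 * k₂ ^ 2 + e ^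
      6 * k₃ ^ 2 + e ^ 7 * γ ^ 2 * k₂ + e ^ 10 * γ ^ 2 + e ^ 12 + k₂ ^ 4) * X ^ 7 + (e * k₂ ^ 3 *
      k₃ + e * k₂ ^ 4 + e ^ 4 * k₂ * k₃ ^ 2 + e ^ 4 * k₂ ^ 2 * k₃ + e ^ 4 * k₂ ^ 3 + e ^ 6 * γ *
      k₂ * k₃ + e ^ 6 * γ * k₂ ^ 2 + e ^ 7 * k₂ * k₃ + e ^ 7 * k₂ ^ 2 + e ^ 7 * k₃ ^ 2 + e ^ 8 * γ
      ^ 2 * k₂ + e ^ 11 * γ ^ 2 + e ^ 13) * X ^ 8 + (e ^ 2 * k₂ ^ 4 + e ^ 4 * γ * k₂ ^ 3 + e ^ 5 *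
      k₂ ^ 2 * k₃ + e ^ 7 * γ * k₂ ^ 2 + e ^ 10 * γ * k₂ + e ^ 11 * k₃ + e ^ 13 * γ + e ^ 14) * X
      ^ 9 + (e ^ 3 * k₂ ^ 3 * k₃ + e ^ 8 * γ * k₂ ^ 2 + e ^ 9 * k₂ * k₃ + e ^ 9 * k₃ ^ 2 + e ^ 11
      * γ * k₂ + e ^ 11 * γ * k₃ + e ^ 12 * k₂ + e ^ 14 * γ + e ^ 15 + k₂ ^ 5) * X ^ 10 + (e * k₂
      ^ 5 + e ^ 6 * γ * k₂ ^ 3 + e ^ 7 * k₂ ^ 2 * k₃ + e ^ 9 * γ * k₂ ^ 2 + e ^ 10 * k₂ ^ 2 + e ^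
      10 * k₃ ^ 2 + e ^ 11 * γ ^ 2 * k₂ + e ^ 12 * γ * k₂ + e ^ 13 * k₂ + e ^ 13 * k₃ + e ^ 14 * γ
      ^ 2 + e ^ 15 * γ) * X ^ 11 + (e ^ 2 * k₂ ^ 5 + e ^ 5 * k₂ ^ 3 * k₃ + e ^ 7 * γ * k₂ ^ 3 + e
      ^ 8 * k₂ * k₃ ^ 2 + e ^ 10 * γ * k₂ * k₃ + e ^ 11 * k₂ * k₃ + e ^ 11 * k₃ ^ 2 + e ^ 13 * γ *
      k₃ + e ^ 16 * γ + e ^ 17) * X ^ 12) := by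
    unfold coplanarI
    grind
  exact ⟨_, this⟩

/-- The coefficients of a normal form in coordinates adapted to a line coplanar with its axis. -/
def coplanarCoeffs (β γ e k₂ k₃ : K) : ℕ → ℕ → ℕ → K
  | 0, 1, 1 => 1
  | 0, 1, 2 => e
  | 0, 1, 3 => e ^ 2
  | 0, 2, 1 => 1
  | 0, 2, 2 => e
  | 0, 3, 1 => 1
  | 1, 0, 0 => 1
  | 1, 0, 1 => β
  | 1, 0, 2 => β * e
  | 1, 0, 3 => e ^ 3 + k₂
  | 1, 1, 1 => β
  | 2, 0, 0 => γ
  | 2, 0, 1 => e * γ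
  | 2, 0, 2 => k₂ + k₃
  | 2, 1, 0 => γ
  | 3, 0, 1 => k₃
  | _, _, _ => 0

theorem pI_coplanarCoeffs (h : ∀ i j k, i + j + k ≤ 4 → c i j k = coplanarCoeffs β γ e k₂ k₃ i j k) :
    pI c = coplanarI .X (.C β) (.C γ) (.C e) (.C k₂) (.C k₃) := by
  simp (disch := norm_num) only [pI, pW, pl, pq, pQ, pA₂, pL, pA, pB, cubicPoly, mn, h,
    coplanarCoeffs]
  simp only [coplanarI, map_add, map_mul, map_pow, map_zero, map_one]
  grind

theorem coplanar_pI_ne_zero {α β γ e k₁ k₂ k₃ : K} (hc : SmoothCoeffs c)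
    (he : e = α + β + γ) (hk : k₁ + k₂ + k₃ = e ^ 3)
    (hq : ∀ x y z w, quartic c x y z w = z * (y + w + e * z) ^ 3 + (x + z) * w ^ 3 +
      (y + w + e * z) * w * (α * z ^ 2 + β * z * (x + z) + γ * (x + z) ^ 2) +
      (k₁ * z ^ 3 * (x + z) + k₂ * z ^ 2 * (x + z) ^ 2 + k₃ * z * (x + z) ^ 3)) : pI c ≠ 0 := by
  have : Infinite K := IsAlgClosed.instInfinite
  have h := quartic_ext (c := c) (d := coplanarCoeffs β γ e k₂ k₃) fun x y z w => by
    rw [hq]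
    simp only [quartic, coplanarCoeffs]
    obtain rfl : α = e + β + γ := by grind
    obtain rfl : k₁ = e ^ 3 + k₂ + k₃ := by grind
    clear hq hk he
    grind
  intro hI
  rw [pI_coplanarCoeffs h] at hI
  have hv : VanishesOnLine c := fun k hk => by
    rw [h 0 0 k (by omega)]; rfl
  have hβ : β = 0 := by
    obtain ⟨r, hr⟩ := coplanarI_low (Polynomial.X : Polynomial K) (.C β) (.C γ) (.C e) (.C k₂) (.C k₃)
    rw [hI] at hr
    have := congrArg (fun p : Polynomial K => p.coeff 2) hr
    simpa [Polynomial.coeff_X_pow_mul'] using this.symm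
  rw [hβ, map_zero] at hI
  obtain ⟨r, hr⟩ := coplanarI_low' (Polynomial.X : Polynomial K) (.C γ) (.C e) (.C k₂) (.C k₃)
  rw [hI] at hr
  simp only [← map_pow, ← map_mul, ← map_add] at hr
  obtain ⟨m, hm⟩ : ∃ m, m = e * k₂ + e * k₃ + e ^ 3 * γ + e ^ 4 + γ * k₂ := ⟨_, rfl⟩
  rw [← hm] at hr
  have hk₂ : k₂ = 0 := by
    have := congrArg (fun p : Polynomial K => p.coeff 4) hr
    simpa [Polynomial.coeff_X_pow_mul'] using this.symm
  have h5 : e * k₃ + e ^ 3 * γ + e ^ 4 = 0 := by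
    have := congrArg (fun p : Polynomial K => p.coeff 5) hr
    have hm0 : m = 0 := by simpa [Polynomial.coeff_X_pow_mul'] using this.symm
    rw [hm0, hk₂] at hm
    linear_combination -hm
  have he0 : e ≠ 0 := by
    rintro rfl
    refine (hv.coprime hc).lead ?_ ?_
    · rw [h 1 0 3 (by norm_num)]; simp [coplanarCoeffs, hk₂]
    · rw [h 0 1 3 (by norm_num)]; simp [coplanarCoeffs]
  have hk₃ : k₃ = e ^ 2 * γ + e ^ 3 := by
    have : e * (k₃ + e ^ 2 * γ + e ^ 3) = 0 := by linear_combination h5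
    have := (mul_eq_zero.1 this).resolve_left he0
    grind
  have hz := hc 0 e 1 e
  simp (disch := norm_num) only [quartic, quarticX, quarticY, quarticZ, quarticW, h, coplanarCoeffs,
    hβ, hk₂, hk₃] at hz
  refine one_ne_zero (hz ?_ ?_ ?_ ?_ ?_).2.2.1 <;> clear hq hr hI hc h <;> grind

end Coplanar

section CoplanarLines
variable {K : Type*} [Field K] [IsAlgClosed K] [CharP K 2] {F : MvPolynomial (Fin 4) K}
  {b : Module.Basis (Fin 4) K (Fin 4 → K)} {c : ℕ → ℕ → ℕ → K}

theorem ZForm.ncard_nbrs_lineAt (hF : IsSmoothQuartic F) (hb : Coords F b c) (h : ZForm c)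
    (h4 : c 4 0 0 = 0) (h4' : c 0 4 0 = 0) {s μ : K} (hs : s ≠ 0) (hl : IsLineAt c s μ) :
    (nbrs F (lineAt b c s μ)).ncard ≤ 18 := by
  have : Infinite K := IsAlgClosed.instInfinite
  obtain ⟨hA, hB, -⟩ := h.cube.polys
  have hW := lineAt_mem_lines hF.hom hb h.vanishes hl
  obtain ⟨e1, -, e3⟩ := (h.isLineAt s μ).1 hl
  obtain ⟨f1, f2⟩ := h.evals s
  rw [f1] at e1
  rw [f2, h4, h4'] at e3
  obtain ⟨t, ht⟩ : ∃ t, s * t = 1 := ⟨s⁻¹, mul_inv_cancel₀ hs⟩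
  have h2 : (2 : K) = 0 := CharTwo.two_eq_zero
  have r3 : t ^ 3 * s ^ 3 = 1 := by rw [← mul_pow, mul_comm, ht, one_pow]
  have r5 : s * t ^ 6 = t ^ 5 := by linear_combination t ^ 5 * ht
  have r2 : s * t ^ 3 = t ^ 2 := by linear_combination t ^ 2 * ht
  have r1 : s ^ 7 * t ^ 6 = s := by linear_combination s * (t ^ 3 * s ^ 3 + 1) * r3
  have r4 : s ^ 2 * t ^ 6 = t ^ 4 := by linear_combination t ^ 4 * (s * t + 1) * ht
  have r6 : s ^ 4 * t ^ 6 = t ^ 2 := by linear_combination t ^ 3 * s * r3 + r2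
  have r9 : s ^ 3 * t ^ 12 = t ^ 9 := by linear_combination t ^ 9 * r3
  have r12 : s ^ 6 * t ^ 12 = t ^ 6 := by linear_combination t ^ 6 * (t ^ 3 * s ^ 3 + 1) * r3
  have r13 : s ^ 9 * t ^ 12 = t ^ 3 := by
    linear_combination t ^ 3 * ((t ^ 3 * s ^ 3) ^ 2 + t ^ 3 * s ^ 3 + 1) * r3
  let e := t ^ 4 * μ
  let u : Fin 4 → Fin 4 → K := ![b 1, s • b 2, t ^ 3 • b 0 + b 1 + (s * e) • b 2, s • b 2 + b 3]
  have hu : ∀ x y z w : K, x • u 0 + y • u 1 + z • u 2 + w • u 3 =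
      pt b (t ^ 3 * z) (x + z) (s * (y + w + e * z)) w := fun x y z w => by
    simp only [u, pt, Matrix.cons_val]; module
  have ht0 : t ≠ 0 := right_ne_zero_of_mul_eq_one ht
  obtain ⟨b', hb'⟩ := exists_basis u (by
    intro x y z w h0
    rw [hu] at h0
    obtain ⟨g0, g1, g2, rfl⟩ := pt_eq_zero.1 h0
    obtain rfl := (mul_eq_zero.1 g0).resolve_left (pow_ne_zero 3 ht0)
    have := (mul_eq_zero.1 g2).resolve_left hs
    simp only [add_zero, mul_zero] at g1 this
    exact ⟨g1, this, rfl, rfl⟩)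
  have hpt : ∀ x y z w, pt b' x y z w = pt b (t ^ 3 * z) (x + z) (s * (y + w + e * z)) w :=
    fun x y z w => by rw [← hu, pt, hb', hb', hb', hb']
  obtain ⟨c', hc'⟩ := hF.coords b'
  have hspan : Submodule.span K {b' 2, b' 3} = lineAt b c s μ := by
    refine span_pair_eq hW.1 ?_ ?_ (pair_independent b')
    · refine mem_lineAt.2 ⟨0, t ^ 3, ?_⟩
      rw [hb', hA, hB]
      simp only [u, pt, Matrix.cons_val, Polynomial.eval_pow, Polynomial.eval_X, Polynomial.eval_one]
      rw [r3, show s * e = t ^ 3 * μ by simp only [e]; linear_combination (t ^ 3 * μ) * ht]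
      module
    · exact mem_lineAt.2 ⟨1, 0, by rw [hb']; simp [u, pt]⟩
  have hq : ∀ x y z w, quartic c' x y z w =
      quartic c (t ^ 3 * z) (x + z) (s * (y + w + e * z)) w := fun x y z w => by
    rw [← hb.2, ← hc'.2, hpt]
  have hI := coplanar_pI_ne_zero (α := c 2 0 1 * t ^ 5) (β := c 1 1 1 * t ^ 2) (γ := c 0 2 1 * s)
    (e := e) (k₁ := c 3 1 0 * t ^ 9) (k₂ := c 2 2 0 * t ^ 6) (k₃ := c 1 3 0 * t ^ 3) hc'.1
    (by
      simp only [e]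
      linear_combination t ^ 6 * e1 - μ * r4 - c 2 0 1 * r5 - c 1 1 1 * r6 - c 0 2 1 * r1 -
        (c 2 0 1 * t ^ 5 + c 1 1 1 * t ^ 2 + c 0 2 1 * s) * h2)
    (by
      simp only [e]
      linear_combination t ^ 12 * e3 - c 3 1 0 * r9 - c 2 2 0 * r12 - c 1 3 0 * r13 -
        (t ^ 12 * μ ^ 3) * h2)
    (fun x y z w => by
      rw [hq, h.quartic_eq, h4, h4']
      linear_combination (z * (y + w + e * z) ^ 3) * r3 + (y + w + e * z) * w *
        (c 2 0 1 * z ^ 2 * r5 + c 1 1 1 * z * (x + z) * r2))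
  rw [← hspan] at hW ⊢
  exact ncard_nbrs_of_pI_ne_zero hF hc' hW hI

theorem ZForm.eq_of_zero_fibre (h : ZForm c) (h2 : c 2 0 1 ≠ 0) {μ μ' : K} (hμ : IsLineAt c 0 μ)
    (hμ' : IsLineAt c 0 μ') : μ = μ' := by
  have key : ∀ {ν}, IsLineAt c 0 ν → ν = 0 := fun {ν} hν => by
    have := ((h.isLineAt 0 ν).1 hν).2.1
    rw [(h.evals 0).1] at this
    simpa [h2] using this
  rw [key hμ, key hμ']

theorem map_lineAt (φ : (Fin 4 → K) →ₗ[K] K) (h2 : φ (b 2) = 0) {s μ : K}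
    (h : lineAt b c s μ ≤ LinearMap.ker φ) :
    φ (b 0) * (pB c).eval s + φ (b 1) * (pA c).eval s = 0 := by
  have := h (mem_lineAt.2 ⟨0, 1, rfl⟩)
  rw [LinearMap.mem_ker] at this
  simp only [pt, map_add, map_smul, h2, smul_eq_mul] at this
  linear_combination this

theorem ZForm.eq_lineAt_zero (hb : Coords F b c) (h : ZForm c) {φ : (Fin 4 → K) →ₗ[K] K}
    (hφ2 : φ (b 2) = 0) (hφ0 : φ (b 0) = 0) (hφ1 : φ (b 1) ≠ 0) {W : Submodule K (Fin 4 → K)}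
    (hW : W ∈ nbrs F (Submodule.span K {b 2, b 3})) (h2 : b 2 ∉ W) (hWφ : W ≤ LinearMap.ker φ) :
    ∃ μ, IsLineAt c 0 μ ∧ lineAt b c 0 μ = W := by
  have : Infinite K := IsAlgClosed.instInfinite
  obtain ⟨hA, hB, -⟩ := h.cube.polys
  obtain ⟨s, μ, hl, rfl⟩ := exists_lineAt hb h.vanishes hW h2
  have := map_lineAt φ hφ2 hWφ
  rw [hA, hB, hφ0] at this
  have hs : s = 0 := by simpa [hφ1] using this
  subst hs
  exact ⟨μ, hl, rfl⟩

/-- Two coplanar neighbours of an exceptional line have at most eighteen neighbours. -/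
theorem ZForm.ncard_nbrs_of_coplanar (hF : IsSmoothQuartic F) (hb : Coords F b c) (h : ZForm c)
    (h21 : c 2 0 1 ≠ 0) (h4 : c 4 0 0 = 0) (h21' : c 0 2 1 ≠ 0) (h4' : c 0 4 0 = 0)
    {φ : (Fin 4 → K) →ₗ[K] K} (hφ : φ ≠ 0) (hlφ : Submodule.span K {b 2, b 3} ≤ LinearMap.ker φ)
    {W W' : Submodule K (Fin 4 → K)}
    (hW : W ∈ nbrs F (Submodule.span K {b 2, b 3})) (hWφ : W ≤ LinearMap.ker φ)
    (hW' : W' ∈ nbrs F (Submodule.span K {b 2, b 3})) (hWφ' : W' ≤ LinearMap.ker φ) (hne : W ≠ W') :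
    (nbrs F W).ncard ≤ 18 := by
  have : Infinite K := IsAlgClosed.instInfinite
  have hφ2 : φ (b 2) = 0 := hlφ (Submodule.subset_span (by simp))
  have hφ3 : φ (b 3) = 0 := hlφ (Submodule.subset_span (by simp))
  obtain ⟨b', e2, e3, e0, e1, hb'⟩ := hb.swap hF
  have hz' := h.swap
  have hsp : Submodule.span K {b 2, b 3} = Submodule.span K {b' 2, b' 3} := by
    rw [e2, e3, Set.pair_comm]
  -- a line through `b 2` lies in the plane `x = 0`
  have key : ∀ {V}, V ∈ nbrs F (Submodule.span K {b 2, b 3}) → V ≤ LinearMap.ker φ → b 2 ∈ V →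
      φ (b 1) = 0 ∧ ∃ μ, IsLineAt (swapCoeffs c) 0 μ ∧ lineAt b' (swapCoeffs c) 0 μ = V := by
    intro V hV hVφ h2
    rw [hsp] at hV
    rw [← e3] at h2
    obtain ⟨μ, hμ, rfl⟩ := exists_lineAt_zero hb' hz'.vanishes hV h2
    have := map_lineAt φ (e2 ▸ hφ3) hVφ
    obtain ⟨hA, hB, -⟩ := hz'.cube.polys
    rw [hA, hB, e0] at this
    exact ⟨by simpa using this, μ, hμ, rfl⟩
  have hor : φ (b 0) ≠ 0 ∨ φ (b 1) ≠ 0 := by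
    by_contra! h0
    exact hφ (b.ext fun i => by fin_cases i <;> simp [h0, hφ2, hφ3])
  by_cases h2 : b 2 ∈ W
  · obtain ⟨h1, μ, hμ, rfl⟩ := key hW hWφ h2
    have h0 := hor.resolve_right (not_not.2 h1)
    by_cases h2' : b 2 ∈ W'
    · obtain ⟨-, μ', hμ', rfl⟩ := key hW' hWφ' h2'
      exact absurd (by rw [hz'.eq_of_zero_fibre h21' hμ hμ']) hne
    · obtain ⟨s, ν, hl, rfl⟩ := exists_lineAt hb h.vanishes hW' h2'
      obtain ⟨hA, hB, -⟩ := h.cube.polys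
      have := map_lineAt φ hφ2 hWφ'
      rw [hA, hB, h1] at this
      simp [h0] at this
  · obtain ⟨s, μ, hl, rfl⟩ := exists_lineAt hb h.vanishes hW h2
    by_cases hs : s = 0
    · subst hs
      obtain ⟨hA, hB, -⟩ := h.cube.polys
      have h0 : φ (b 0) = 0 := by
        have := map_lineAt φ hφ2 hWφ
        rw [hA, hB] at this
        simpa using this
      have h1 := hor.resolve_left (not_not.2 h0)
      have h2' : b 2 ∉ W' := fun h2' => h1 (key hW' hWφ' h2').1
      obtain ⟨μ', hμ', rfl⟩ := h.eq_lineAt_zero hb hφ2 h0 h1 hW' h2' hWφ'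
      exact absurd (by rw [h.eq_of_zero_fibre h21 hl hμ']) hne
    · exact h.ncard_nbrs_lineAt hF hb h4 h4' hs hl

end CoplanarLines

section Planes
variable {K : Type*} [Field K]

theorem finrank_ker_ge {φ : (Fin 4 → K) →ₗ[K] K} : 3 ≤ Module.finrank K (LinearMap.ker φ) := by
  have h := LinearMap.finrank_range_add_finrank_ker φ
  have := Submodule.finrank_le (LinearMap.range φ)
  rw [Module.finrank_self] at this
  rw [Module.finrank_fin_fun] at h
  omega

theorem finrank_ker_of_ne_zero {φ : (Fin 4 → K) →ₗ[K] K} (hφ : φ ≠ 0) :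
    Module.finrank K (LinearMap.ker φ) = 3 := by
  have h := LinearMap.finrank_range_add_finrank_ker φ
  rw [LinearMap.range_eq_top.2 (LinearMap.surjective hφ), finrank_top, Module.finrank_self,
    Module.finrank_fin_fun] at h
  omega

theorem finrank_inf_ge (φ ψ : (Fin 4 → K) →ₗ[K] K) :
    2 ≤ Module.finrank K (LinearMap.ker φ ⊓ LinearMap.ker ψ : Submodule K (Fin 4 → K)) := by
  have h := Submodule.finrank_sup_add_finrank_inf_eq (LinearMap.ker φ) (LinearMap.ker ψ)
  have h1 := finrank_ker_ge (φ := φ)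
  have h2 := finrank_ker_ge (φ := ψ)
  have h3 := Submodule.finrank_le (LinearMap.ker φ ⊔ LinearMap.ker ψ)
  rw [Module.finrank_fin_fun] at h3
  omega

theorem exists_mem_ker {W : Submodule K (Fin 4 → K)} (hW : Module.finrank K W = 2)
    (φ : (Fin 4 → K) →ₗ[K] K) : ∃ v ∈ W, φ v = 0 ∧ v ≠ 0 := by
  obtain ⟨u, hu, v, hv, h⟩ := exists_pair hW
  by_cases h0 : φ u = 0
  · exact ⟨u, hu, h0, fun h' => one_ne_zero (h 1 0 (by simp [h'])).1⟩
  · refine ⟨(- φ v) • u + φ u • v, W.add_mem (W.smul_mem _ hu) (W.smul_mem _ hv), ?_, fun h' =>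
      h0 (h _ _ h').2⟩
    simp only [map_add, map_smul, smul_eq_mul]
    ring

theorem exists_common {φ : (Fin 4 → K) →ₗ[K] K} (hφ : φ ≠ 0) {W W' : Submodule K (Fin 4 → K)}
    (hW : Module.finrank K W = 2) (hW' : Module.finrank K W' = 2) (h : W ≤ LinearMap.ker φ)
    (h' : W' ≤ LinearMap.ker φ) : ∃ v ∈ W, v ∈ W' ∧ v ≠ 0 := by
  have h1 := Submodule.finrank_sup_add_finrank_inf_eq W W'
  have h2 := Submodule.finrank_mono (sup_le h h')
  rw [finrank_ker_of_ne_zero hφ] at h2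
  have h3 : W ⊓ W' ≠ ⊥ := fun h0 => by
    rw [h0, finrank_bot] at h1
    omega
  obtain ⟨v, hv, h0⟩ := Submodule.exists_mem_ne_zero_of_ne_bot h3
  exact ⟨v, hv.1, hv.2, h0⟩

theorem inf_ker_eq {φ ψ : (Fin 4 → K) →ₗ[K] K} (hφ : φ ≠ 0) {v : Fin 4 → K} (hv : φ v = 0)
    (hv' : ψ v ≠ 0) :
    Module.finrank K (LinearMap.ker φ ⊓ LinearMap.ker ψ : Submodule K (Fin 4 → K)) = 2 := by
  have h1 := finrank_inf_ge φ ψ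
  have h2 : LinearMap.ker φ ⊓ LinearMap.ker ψ < LinearMap.ker φ :=
    lt_of_le_of_ne inf_le_left fun h => hv' (h.ge hv).2
  have h3 := Submodule.finrank_lt_finrank_of_lt h2
  rw [finrank_ker_of_ne_zero hφ] at h3
  omega

theorem exists_triple (φ ψ : (Fin 4 → K) →ₗ[K] K) :
    ∃ b : Module.Basis (Fin 4) K (Fin 4 → K), φ (b 1) = 0 ∧ φ (b 2) = 0 ∧ φ (b 3) = 0 ∧
      ψ (b 2) = 0 ∧ ψ (b 3) = 0 := by
  obtain ⟨f, hf⟩ := exists_linearIndependent_of_le_finrank (finrank_inf_ge φ ψ)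
  have hf2 : ∀ x y : K, x • (f 0 : Fin 4 → K) + y • (f 1 : Fin 4 → K) = 0 → x = 0 ∧ y = 0 := by
    intro x y h
    have := Fintype.linearIndependent_iff.1 hf ![x, y]
      (by rw [Fin.sum_univ_two]; exact Subtype.ext (by simpa using h))
    exact ⟨this 0, this 1⟩
  obtain ⟨d, hd, hd'⟩ : ∃ d ∈ LinearMap.ker φ,
      d ∉ Submodule.span K {(f 0 : Fin 4 → K), (f 1 : Fin 4 → K)} := by
    by_contra! h
    have h1 := Submodule.finrank_mono (show LinearMap.ker φ ≤ _ from h)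
    rw [finrank_span_pair hf2] at h1
    have := finrank_ker_ge (φ := φ)
    omega
  obtain ⟨b, b1, b2, b3⟩ := exists_basis_of_triple (u := d) (v := f 0) (w := f 1) (by
    intro x y z h
    have hx : x = 0 := by
      by_contra hx
      refine hd' (Submodule.mem_span_pair.2 ⟨x⁻¹ * (-y), x⁻¹ * (-z), ?_⟩)
      have : x • d = (-y) • (f 0 : Fin 4 → K) + (-z) • (f 1 : Fin 4 → K) := by
        rw [← sub_eq_zero, ← h]; module
      rw [← inv_smul_smul₀ hx d, this]
      module
    rw [hx, zero_smul, zero_add] at h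
    exact ⟨hx, hf2 y z h⟩)
  refine ⟨b, ?_, ?_, ?_, ?_, ?_⟩
  · rw [b1]; exact hd
  · rw [b2]; exact (f 0).2.1
  · rw [b3]; exact (f 1).2.1
  · rw [b2]; exact (f 0).2.2
  · rw [b3]; exact (f 1).2.2

variable [IsAlgClosed K] [CharP K 2] {F : MvPolynomial (Fin 4) K}

/-- A plane section of a smooth quartic contains no double line. -/
theorem no_double_line (hF : IsSmoothQuartic F) {ι : Type*} {φ ψ : (Fin 4 → K) →ₗ[K] K}
    (χ : ι → (Fin 4 → K) →ₗ[K] K) (s : Finset ι) (κ : K)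
    (h : ∀ v, φ v = 0 → eval v F = κ * ψ v ^ 2 * ∏ k ∈ s, χ k v) : False := by
  have : Infinite K := IsAlgClosed.instInfinite
  obtain ⟨b, h1, h2, h3, g2, g3⟩ := exists_triple φ ψ
  obtain ⟨c, hb⟩ := hF.coords b
  have key : ∀ y z w, quartic c 0 y z w = y ^ 2 * (κ * ψ (b 1) ^ 2 *
      ∏ k ∈ s, (χ k (z • b 2 + w • b 3) + y * χ k (b 1))) := fun y z w => by
    have e : pt b 0 y z w = y • b 1 + (z • b 2 + w • b 3) := by simp only [pt]; module
    rw [← hb.2, h _ (by simp [pt, h1, h2, h3]), e]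
    simp only [map_add, map_smul, g2, g3, smul_eq_mul, mul_zero, add_zero]
    simp only [add_comm]
    ring
  have hv : VanishesOnLine c := vanishesOnLine_of_forall fun z => by simp [key]
  have h01 : ∀ z w, cubic (c 0 1) z w = 0 := fun z w => by
    refine linear_coeff_unique (a := 0) (a' := 0) (r := Polynomial.C (c 0 2 2 * z ^ 2 +
      c 0 2 1 * z * w + c 0 2 0 * w ^ 2) + Polynomial.X * Polynomial.C (c 0 3 1 * z + c 0 3 0 * w) +
        Polynomial.X ^ 2 * Polynomial.C (c 0 4 0))
      (r' := Polynomial.C (κ * ψ (b 1) ^ 2) * ∏ k ∈ s, (Polynomial.C (χ k (z • b 2 + w • b 3)) +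
        Polynomial.X * Polynomial.C (χ k (b 1)))) fun y => ?_
    have h0 := fun k hk => hv k hk
    have e0 := h0 0 (by norm_num)
    have e1 := h0 1 (by norm_num)
    have e2 := h0 2 (by norm_num)
    have e3 := h0 3 (by norm_num)
    have e4 := h0 4 (by norm_num)
    have := key y z w
    rw [quartic] at this
    simp only [Polynomial.eval_add, Polynomial.eval_mul, Polynomial.eval_C, Polynomial.eval_X,
      Polynomial.eval_pow, Polynomial.eval_prod, mul_zero, add_zero]
    rw [zero_add, ← this, cubic, e0, e1, e2, e3, e4]
    ring
  exact (hv.coprime hb.1).not_all_zero (α := 0) (Or.inr one_ne_zero) fun z w => by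
    rw [h01, mul_zero, zero_mul, zero_add]

end Planes

section PlaneSections
variable {K : Type*} [Field K]

theorem exists_pair_of_mem {W : Submodule K (Fin 4 → K)} (hW : Module.finrank K W = 2)
    {p : Fin 4 → K} (h0 : p ≠ 0) :
    ∃ v ∈ W, ∀ z w : K, z • v + w • p = 0 → z = 0 ∧ w = 0 := by
  obtain ⟨v, hv, hvp⟩ : ∃ v ∈ W, v ∉ Submodule.span K {p} := by
    by_contra! h
    have h1 := Submodule.finrank_mono (show W ≤ _ from h)
    rw [hW, finrank_span_singleton h0] at h1
    omega
  refine ⟨v, hv, fun z w h => ?_⟩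
  have hz : z = 0 := by
    by_contra hz
    refine hvp (Submodule.mem_span_singleton.2 ⟨-(z⁻¹ * w), ?_⟩)
    rw [← sub_eq_zero, ← smul_zero (-z⁻¹), ← h, smul_add, smul_smul, neg_mul, inv_mul_cancel₀ hz]
    module
  rw [hz, zero_smul, zero_add] at h
  exact ⟨hz, (smul_eq_zero.1 h).resolve_right h0⟩

theorem exists_plane_basis {φ : (Fin 4 → K) →ₗ[K] K} (hφ : φ ≠ 0) {W W' : Submodule K (Fin 4 → K)}
    (hW : Module.finrank K W = 2) (hW' : Module.finrank K W' = 2) (h : W ≤ LinearMap.ker φ)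
    (h' : W' ≤ LinearMap.ker φ) (hne : W ≠ W') :
    ∃ b : Module.Basis (Fin 4) K (Fin 4 → K), φ (b 0) ≠ 0 ∧ b 3 ∈ W ∧ b 3 ∈ W' ∧ b 2 ∈ W ∧
      b 1 ∈ W' := by
  obtain ⟨p, hp, hp', h0⟩ := exists_common hφ hW hW' h h'
  obtain ⟨u, hu, hup⟩ := exists_pair_of_mem hW h0
  obtain ⟨v, hv, hvp⟩ := exists_pair_of_mem hW' h0
  obtain ⟨b, rfl, rfl, rfl⟩ := exists_basis_of_triple (u := v) (v := u) (w := p) (by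
    intro x y z h
    have hx : x = 0 := by
      by_contra hx
      have hv' : v ∈ W := by
        have : v = x⁻¹ • ((-y) • u + (-z) • p) := by
          rw [eq_inv_smul_iff₀ hx, ← sub_eq_zero, ← h]; module
        rw [this]
        exact W.smul_mem _ (W.add_mem (W.smul_mem _ hu) (W.smul_mem _ hp))
      exact hne ((span_pair_eq hW hv' hp hvp).symm.trans (span_pair_eq hW' hv hp' hvp))
    rw [hx, zero_smul, zero_add] at h
    exact ⟨hx, hup y z h⟩)
  refine ⟨b, fun h0 => hφ (b.ext fun i => ?_), hp, hp', hu, hv⟩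
  fin_cases i
  · simpa using h0
  · simpa using h' hv
  · simpa using h hu
  · simpa using h hp

theorem exists_eq_pt_ker {φ : (Fin 4 → K) →ₗ[K] K} {b : Module.Basis (Fin 4) K (Fin 4 → K)}
    (h0 : φ (b 0) ≠ 0) (h1 : φ (b 1) = 0) (h2 : φ (b 2) = 0) (h3 : φ (b 3) = 0) {v : Fin 4 → K}
    (hv : φ v = 0) : v = pt b 0 (b.coord 1 v) (b.coord 2 v) (b.coord 3 v) := by
  obtain ⟨x, y, z, w, rfl⟩ := exists_eq_pt b v
  simp only [pt, map_add, map_smul, h1, h2, h3, smul_eq_mul, mul_zero, add_zero] at hv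
  rw [(mul_eq_zero.1 hv).resolve_right h0]
  simp [pt]

variable [IsAlgClosed K] [CharP K 2] {F : MvPolynomial (Fin 4) K}

theorem section_of_triangle (c : ℕ → ℕ → ℕ → K) (hy : ∀ z w, quartic c 0 0 z w = 0)
    (hz : ∀ y w, quartic c 0 y 0 w = 0) (hw : ∀ y z, quartic c 0 y z 0 = 0) (y z w : K) :
    quartic c 0 y z w = y * z * w * (c 0 2 1 * y + c 0 1 2 * z + c 0 1 1 * w) := by
  have : Infinite K := IsAlgClosed.instInfinite
  obtain ⟨p0, p1, p2, p3, p4⟩ := coeffs_eq_zero_of_forall (a0 := c 0 0 0) (a1 := c 0 0 1)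
    (a2 := c 0 0 2) (a3 := c 0 0 3) (a4 := c 0 0 4) fun z => by
      have := hy z 1
      simp only [quartic] at this
      linear_combination this
  obtain ⟨q0, q1, q2, q3, q4⟩ := coeffs_eq_zero_of_forall (a0 := c 0 0 0) (a1 := c 0 1 0)
    (a2 := c 0 2 0) (a3 := c 0 3 0) (a4 := c 0 4 0) fun y => by
      have := hz y 1
      simp only [quartic] at this
      linear_combination this
  obtain ⟨r0, r1, r2, r3, r4⟩ := coeffs_eq_zero_of_forall (a0 := c 0 0 4) (a1 := c 0 1 3)
    (a2 := c 0 2 2) (a3 := c 0 3 1) (a4 := c 0 4 0) fun y => by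
      have := hw y 1
      simp only [quartic] at this
      linear_combination this
  simp only [quartic, p0, p1, p2, p3, p4, q1, q2, q3, q4, r1, r2, r3]
  ring

theorem section_of_pencil (c : ℕ → ℕ → ℕ → K) (hy : ∀ z w, quartic c 0 0 z w = 0)
    (hz : ∀ y w, quartic c 0 y 0 w = 0) (hyz : ∀ y w, quartic c 0 y y w = 0) (y z w : K) :
    quartic c 0 y z w = y * z * (y + z) * (c 0 3 1 * y + c 0 1 3 * z + c 0 2 1 * w) := by
  have : Infinite K := IsAlgClosed.instInfinite
  have h2 : (2 : K) = 0 := CharTwo.two_eq_zero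
  obtain ⟨p0, p1, p2, p3, p4⟩ := coeffs_eq_zero_of_forall (a0 := c 0 0 0) (a1 := c 0 0 1)
    (a2 := c 0 0 2) (a3 := c 0 0 3) (a4 := c 0 0 4) fun z => by
      have := hy z 1
      simp only [quartic] at this
      linear_combination this
  obtain ⟨q0, q1, q2, q3, q4⟩ := coeffs_eq_zero_of_forall (a0 := c 0 0 0) (a1 := c 0 1 0)
    (a2 := c 0 2 0) (a3 := c 0 3 0) (a4 := c 0 4 0) fun y => by
      have := hz y 1
      simp only [quartic] at this
      linear_combination this
  obtain ⟨r0, r1, r2, -, -⟩ := coeffs_eq_zero_of_forall (a0 := c 0 3 1 + c 0 2 2 + c 0 1 3)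
    (a1 := c 0 2 1 + c 0 1 2) (a2 := c 0 1 1) (a3 := (0 : K)) (a4 := (0 : K)) fun w => by
      have := hyz 1 w
      simp only [quartic, p0, p1, p2, p3, p4, q1, q2, q3, q4] at this
      linear_combination this
  simp only [quartic, p0, p1, p2, p3, p4, q1, q2, q3, q4, r2]
  linear_combination y ^ 2 * z ^ 2 * r0 + y * z ^ 2 * w * r1 -
    y * z ^ 2 * (c 0 3 1 * y + c 0 1 3 * y + c 0 2 1 * w) * h2

/-- A plane containing three lines of the surface meets it in the union of four lines. -/
theorem exists_four_factors (hF : IsSmoothQuartic F) {φ : (Fin 4 → K) →ₗ[K] K} (hφ : φ ≠ 0)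
    {W W' W'' : Submodule K (Fin 4 → K)} (hW : W ∈ lines F) (hW' : W' ∈ lines F)
    (hW'' : W'' ∈ lines F) (h : W ≤ LinearMap.ker φ) (h' : W' ≤ LinearMap.ker φ)
    (h'' : W'' ≤ LinearMap.ker φ) (h12 : W ≠ W') (h13 : W ≠ W'') (h23 : W' ≠ W'') :
    ∃ ψ : Fin 4 → (Fin 4 → K) →ₗ[K] K, ∀ v, φ v = 0 → eval v F = ∏ i, ψ i v := by
  obtain ⟨b, b0, w3, w3', w2, w1'⟩ := exists_plane_basis hφ hW.1 hW'.1 h h' h12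
  by_cases hp : b 3 ∈ W''
  · obtain ⟨v, hv, hvp⟩ := exists_pair_of_mem hW''.1 (b.ne_zero 3)
    have e := exists_eq_pt_ker b0 (h' w1') (h w2) (h w3) (h'' hv)
    have hy : b.coord 1 v ≠ 0 := fun h0 => h13 <| by
      rw [h0] at e
      have hvW : v ∈ W := by
        rw [e]; simpa [pt] using W.add_mem (W.smul_mem _ w2) (W.smul_mem _ w3)
      exact (span_pair_eq hW.1 hvW w3 hvp).symm.trans (span_pair_eq hW''.1 hv hp hvp)
    have hz : b.coord 2 v ≠ 0 := fun h0 => h23 <| by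
      rw [h0] at e
      have hvW : v ∈ W' := by
        rw [e]; simpa [pt] using W'.add_mem (W'.smul_mem _ w1') (W'.smul_mem _ w3')
      exact (span_pair_eq hW'.1 hvW w3' hvp).symm.trans (span_pair_eq hW''.1 hv hp hvp)
    generalize b.coord 1 v = α at *
    generalize b.coord 2 v = β at *
    generalize b.coord 3 v = γ at *
    let u : Fin 4 → Fin 4 → K := ![b 0, α • b 1 + γ • b 3, β • b 2, b 3]
    have hu : ∀ x y z w : K, x • u 0 + y • u 1 + z • u 2 + w • u 3 =
        pt b x (y * α) (z * β) (y * γ + w) := fun x y z w => by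
      simp only [u, pt, Matrix.cons_val]; module
    obtain ⟨b', hb'⟩ := exists_basis u (by
      intro x y z w h0
      rw [hu] at h0
      obtain ⟨g0, g1, g2, g3⟩ := pt_eq_zero.1 h0
      obtain rfl := (mul_eq_zero.1 g1).resolve_right hy
      obtain rfl := (mul_eq_zero.1 g2).resolve_right hz
      exact ⟨g0, rfl, rfl, by simpa using g3⟩)
    have hpt : ∀ x y z w, pt b' x y z w = pt b x (y * α) (z * β) (y * γ + w) :=
      fun x y z w => by rw [← hu, pt, hb', hb', hb', hb']
    obtain ⟨c, hc⟩ := hF.coords b'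
    have key := section_of_pencil c
      (fun z w => by
        rw [← hc.2, hpt]
        refine hW.2 _ ?_
        simpa [pt] using W.add_mem (W.smul_mem (z * β) w2) (W.smul_mem w w3))
      (fun y w => by
        rw [← hc.2, hpt]
        refine hW'.2 _ ?_
        simpa [pt] using W'.add_mem (W'.smul_mem (y * α) w1') (W'.smul_mem (y * γ + w) w3'))
      (fun y w => by
        rw [← hc.2, hpt]
        refine hW''.2 _ ?_
        have : pt b 0 (y * α) (y * β) (y * γ + w) = y • v + w • b 3 := by
          rw [e, pt, pt]; module
        rw [this]
        exact W''.add_mem (W''.smul_mem _ hv) (W''.smul_mem _ hp))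
    refine ⟨![b'.coord 1, b'.coord 2, b'.coord 1 + b'.coord 2, c 0 3 1 • b'.coord 1 +
      c 0 1 3 • b'.coord 2 + c 0 2 1 • b'.coord 3], fun v hv => ?_⟩
    have e' := exists_eq_pt_ker (b := b') (φ := φ) (by simpa [hb', u] using b0)
      (by simp [hb', u, show φ (b 1) = 0 from h' w1', show φ (b 3) = 0 from h w3])
      (by simp [hb', u, show φ (b 2) = 0 from h w2])
      (by simp [hb', u, show φ (b 3) = 0 from h w3]) hv
    conv_lhs => rw [e', hc.2, key]
    rw [Fin.prod_univ_four]
    rfl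
  · obtain ⟨q, hqW, hq, hq0⟩ := exists_common hφ hW.1 hW''.1 h h''
    obtain ⟨r, hrW, hr, hr0⟩ := exists_common hφ hW'.1 hW''.1 h' h''
    obtain ⟨α, γ, rfl⟩ := Submodule.mem_span_pair.1
      ((span_pair_eq hW.1 w2 w3 (pair_independent b)).ge hqW)
    obtain ⟨β, δ, rfl⟩ := Submodule.mem_span_pair.1
      ((span_pair_eq hW'.1 w1' w3' (fun z w h0 => by
        have := pt_eq_zero (b := b) (x := 0) (y := z) (z := 0) (w := w)
        simp only [pt, zero_smul, zero_add, add_zero] at this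
        exact ⟨(this.1 h0).2.1, (this.1 h0).2.2.2⟩)).ge hrW)
    have hα : α ≠ 0 := by
      rintro rfl
      rw [zero_smul, zero_add] at hq hq0
      have : γ ≠ 0 := by rintro rfl; simp at hq0
      exact hp ((W''.smul_mem_iff this).1 hq)
    have hβ : β ≠ 0 := by
      rintro rfl
      rw [zero_smul, zero_add] at hr hr0
      have : δ ≠ 0 := by rintro rfl; simp at hr0
      exact hp ((W''.smul_mem_iff this).1 hr)
    let u : Fin 4 → Fin 4 → K := ![b 0, β • b 1 + δ • b 3, α • b 2 + γ • b 3, b 3]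
    have hu : ∀ x y z w : K, x • u 0 + y • u 1 + z • u 2 + w • u 3 =
        pt b x (y * β) (z * α) (y * δ + z * γ + w) := fun x y z w => by
      simp only [u, pt, Matrix.cons_val]; module
    obtain ⟨b', hb'⟩ := exists_basis u (by
      intro x y z w h0
      rw [hu] at h0
      obtain ⟨g0, g1, g2, g3⟩ := pt_eq_zero.1 h0
      obtain rfl := (mul_eq_zero.1 g1).resolve_right hβ
      obtain rfl := (mul_eq_zero.1 g2).resolve_right hα
      exact ⟨g0, rfl, rfl, by simpa using g3⟩)
    have hpt : ∀ x y z w, pt b' x y z w = pt b x (y * β) (z * α) (y * δ + z * γ + w) :=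
      fun x y z w => by rw [← hu, pt, hb', hb', hb', hb']
    obtain ⟨c, hc⟩ := hF.coords b'
    have key := section_of_triangle c
      (fun z w => by
        rw [← hc.2, hpt]
        refine hW.2 _ ?_
        simpa [pt] using W.add_mem (W.smul_mem (z * α) w2) (W.smul_mem (z * γ + w) w3))
      (fun y w => by
        rw [← hc.2, hpt]
        refine hW'.2 _ ?_
        simpa [pt] using W'.add_mem (W'.smul_mem (y * β) w1') (W'.smul_mem (y * δ + w) w3'))
      (fun y z => by
        rw [← hc.2, hpt]
        refine hW''.2 _ ?_
        have : pt b 0 (y * β) (z * α) (y * δ + z * γ + 0) =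
            y • (β • b 1 + δ • b 3) + z • (α • b 2 + γ • b 3) := by
          rw [pt]; module
        rw [this]
        exact W''.add_mem (W''.smul_mem _ hr) (W''.smul_mem _ hq))
    refine ⟨![b'.coord 1, b'.coord 2, b'.coord 3, c 0 2 1 • b'.coord 1 +
      c 0 1 2 • b'.coord 2 + c 0 1 1 • b'.coord 3], fun v hv => ?_⟩
    have f1 : φ (b 1) = 0 := h' w1'
    have f2 : φ (b 2) = 0 := h w2
    have f3 : φ (b 3) = 0 := h w3
    have e' := exists_eq_pt_ker (b := b') (φ := φ) (by simpa [hb', u] using b0)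
      (by simp [hb', u, f1, f3]) (by simp [hb', u, f2, f3]) (by simp [hb', u, f3]) hv
    conv_lhs => rw [e', hc.2, key]
    rw [Fin.prod_univ_four]
    rfl

end PlaneSections

section FourLines
variable {K : Type*} [Field K] [IsAlgClosed K] [CharP K 2] {F : MvPolynomial (Fin 4) K}

theorem injective_of_factors (hF : IsSmoothQuartic F) {φ : (Fin 4 → K) →ₗ[K] K}
    {ψ : Fin 4 → (Fin 4 → K) →ₗ[K] K} (h : ∀ v, φ v = 0 → eval v F = ∏ i, ψ i v)
    (hψ : ∀ i, ∃ v, φ v = 0 ∧ ψ i v ≠ 0) :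
    Function.Injective fun i => LinearMap.ker φ ⊓ LinearMap.ker (ψ i) := by
  intro i j hij
  by_contra hne
  obtain ⟨v, hv, hv'⟩ := hψ i
  have key : ∀ u, φ u = 0 → ψ j u = ψ j v / ψ i v * ψ i u := fun u hu => by
    have hm : u - (ψ i u / ψ i v) • v ∈ LinearMap.ker φ ⊓ LinearMap.ker (ψ i) := by
      refine ⟨?_, ?_⟩
      · simp [hu, hv]
      · simp [hv']
    have : ψ j (u - (ψ i u / ψ i v) • v) = 0 := (hij.le hm).2
    rw [map_sub, map_smul, sub_eq_zero, smul_eq_mul] at this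
    rw [this]
    ring
  refine no_double_line hF (φ := φ) (ψ := ψ i) ψ ((Finset.univ.erase i).erase j) (ψ j v / ψ i v)
    fun u hu => ?_
  rw [h u hu, ← Finset.mul_prod_erase _ _ (Finset.mem_univ i),
    ← Finset.mul_prod_erase _ _ (Finset.mem_erase.2 ⟨Ne.symm hne, Finset.mem_univ j⟩), key u hu]
  ring

theorem sum_le_of_special {v : Fin 4 → ℕ} (h : ∀ i, v i ≤ 20)
    (hs : ∀ i, v i ≤ 19 ∨ ∀ j ≠ i, v j ≤ 18) : ∑ i, (v i - 2) ≤ 68 := by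
  rw [Fin.sum_univ_four]
  have h0 := hs 0
  have h1 := hs 1
  have h2 := hs 2
  have h3 := hs 3
  simp only [ne_eq, Fin.forall_fin_succ, IsEmpty.forall_iff, Fin.isValue] at h0 h1 h2 h3 h
  simp at h0 h1 h2 h3 h
  omega

theorem ncard_lines_of_factors (hF : IsSmoothQuartic F) {φ : (Fin 4 → K) →ₗ[K] K} (hφ : φ ≠ 0)
    {ψ : Fin 4 → (Fin 4 → K) →ₗ[K] K} (h : ∀ v, φ v = 0 → eval v F = ∏ i, ψ i v) :
    (lines F).ncard ≤ 68 := by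
  have hψ : ∀ i, ∃ v, φ v = 0 ∧ ψ i v ≠ 0 := fun i => by
    by_contra! h0
    refine no_double_line hF (φ := φ) (ψ := 0) ψ ∅ 0 fun v hv => ?_
    rw [h v hv, Finset.prod_eq_zero (Finset.mem_univ i) (h0 v hv)]
    simp
  set W : Fin 4 → Submodule K (Fin 4 → K) := fun i => LinearMap.ker φ ⊓ LinearMap.ker (ψ i)
    with hW
  have hinj : Function.Injective W := injective_of_factors hF h hψ
  have hl : ∀ i, W i ∈ lines F := fun i => by
    obtain ⟨v, hv, hv'⟩ := hψ i
    exact ⟨inf_ker_eq hφ hv hv', fun u hu => by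
      rw [h u hu.1, Finset.prod_eq_zero (Finset.mem_univ i) (show ψ i u = 0 from hu.2)]⟩
  have hker : ∀ i, W i ≤ LinearMap.ker φ := fun i => inf_le_left
  have hmeet : ∀ i j, i ≠ j → W j ∈ nbrs F (W i) := fun i j hij =>
    ⟨hl j, fun e => hij (hinj e).symm, exists_common hφ (hl j).1 (hl i).1 (hker j) (hker i)⟩
  have hcover : lines F ⊆ ⋃ i ∈ (Finset.univ : Finset (Fin 4)),
      insert (W i) (nbrs F (W i) \ W '' {j | j ≠ i}) := by
    intro V hV
    obtain ⟨v, hv, hv0, hne⟩ := exists_mem_ker hV.1 φ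
    have h0 := hV.2 v hv
    rw [h v hv0, Finset.prod_eq_zero_iff] at h0
    obtain ⟨i, -, hi⟩ := h0
    simp only [Finset.mem_univ, Set.iUnion_true, Set.mem_iUnion]
    by_cases hVW : ∃ j, W j = V
    · obtain ⟨j, rfl⟩ := hVW
      exact ⟨j, Set.mem_insert _ _⟩
    · refine ⟨i, Set.mem_insert_of_mem _ ⟨⟨hV, fun e => hVW ⟨i, e.symm⟩, v, hv, ⟨hv0, hi⟩, hne⟩, ?_⟩⟩
      rintro ⟨j, -, e⟩
      exact hVW ⟨j, e⟩
  have hcard : ∀ i, (insert (W i) (nbrs F (W i) \ W '' {j | j ≠ i})).ncard ≤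
      (nbrs F (W i)).ncard - 2 := fun i => by
    have h3 : (W '' {j | j ≠ i}).ncard = 3 := by
      rw [Set.ncard_image_of_injective _ hinj,
        show {j : Fin 4 | j ≠ i} = ((Finset.univ.erase i : Finset (Fin 4)) : Set (Fin 4)) by
          ext; simp, Set.ncard_coe_finset]
      simp
    have hsub : W '' {j | j ≠ i} ⊆ nbrs F (W i) := by
      rintro _ ⟨j, hj, rfl⟩
      exact hmeet i j (Ne.symm hj)
    have h4 := Set.ncard_sdiff hsub ((finite_nbrs hF _).subset hsub)
    have h5 := Set.ncard_insert_le (W i) (nbrs F (W i) \ W '' {j | j ≠ i})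
    have h6 := Set.ncard_le_ncard hsub (finite_nbrs hF _)
    omega
  refine (Set.ncard_le_ncard hcover (Set.Finite.biUnion (Finset.finite_toSet _) fun i _ =>
    ((finite_nbrs hF _).sdiff).insert _)).trans ((Finset.set_ncard_biUnion_le _ _).trans
    ((Finset.sum_le_sum fun i _ => hcard i).trans (sum_le_of_special ?_ ?_)))
  · intro i
    rcases ncard_nbrs_le_or_special hF (hl i) with h1 | h1
    · omega
    · exact h1.1
  · intro i
    rcases ncard_nbrs_le_or_special hF (hl i) with h1 | ⟨-, b, c, hb, hsp, hz, g1, g2, g3, g4⟩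
    · exact Or.inl h1
    · right
      intro j hj
      obtain ⟨k, hki, hkj⟩ : ∃ k, k ≠ i ∧ k ≠ j := by
        revert hj; clear * -; revert i j; decide
      have hm := fun j hj => hsp.symm ▸ hmeet i j hj
      exact hz.ncard_nbrs_of_coplanar hF hb g1 g2 g3 g4 hφ (hsp.le.trans (hker i)) (hm j hj.symm)
        (hker j) (hm k hki.symm) (hker k) (fun e => hkj (hinj e).symm)

/-- A smooth quartic with three coplanar lines contains at most 68 lines. -/
theorem ncard_lines_of_coplanar (hF : IsSmoothQuartic F) {φ : (Fin 4 → K) →ₗ[K] K} (hφ : φ ≠ 0)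
    {W W' W'' : Submodule K (Fin 4 → K)} (hW : W ∈ lines F) (hW' : W' ∈ lines F)
    (hW'' : W'' ∈ lines F) (h : W ≤ LinearMap.ker φ) (h' : W' ≤ LinearMap.ker φ)
    (h'' : W'' ≤ LinearMap.ker φ) (h12 : W ≠ W') (h13 : W ≠ W'') (h23 : W' ≠ W'') :
    (lines F).ncard ≤ 68 := by
  obtain ⟨ψ, hψ⟩ := exists_four_factors hF hφ hW hW' hW'' h h' h'' h12 h13 h23
  exact ncard_lines_of_factors hF hφ hψ

end FourLines

section NoTriple
variable {K : Type*} [Field K] [IsAlgClosed K] [CharP K 2] {F : MvPolynomial (Fin 4) K}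

/-- No plane contains three lines of the surface. -/
def NoTriple (F : MvPolynomial (Fin 4) K) : Prop :=
  ∀ φ : (Fin 4 → K) →ₗ[K] K, φ ≠ 0 → ∀ W ∈ lines F, ∀ W' ∈ lines F, ∀ W'' ∈ lines F,
    W ≤ LinearMap.ker φ → W' ≤ LinearMap.ker φ → W'' ≤ LinearMap.ker φ →
    W ≠ W' → W ≠ W'' → W' = W''

/-- The differential of `F` at `v`. -/
noncomputable def grad (F : MvPolynomial (Fin 4) K) (v : Fin 4 → K) : (Fin 4 → K) →ₗ[K] K :=
  ∑ i, eval v (pderiv i F) • LinearMap.proj i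

omit [IsAlgClosed K] [CharP K 2] in
theorem grad_apply (v d : Fin 4 → K) : grad F v d = ∑ i, d i * eval v (pderiv i F) := by
  simp [grad, mul_comm]

omit [IsAlgClosed K] [CharP K 2] in
theorem grad_ne_zero (hF : IsSmoothQuartic F) {v : Fin 4 → K} (hv : v ≠ 0) (h : eval v F = 0) :
    grad F v ≠ 0 := fun h0 => by
  obtain ⟨i, hi⟩ := hF.smooth v hv h
  refine hi ?_
  have := LinearMap.congr_fun h0 (Pi.single i 1)
  rw [grad_apply, Finset.sum_eq_single i (fun j _ hj => by simp [Pi.single_eq_of_ne hj])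
    (by simp)] at this
  simpa using this

omit [CharP K 2] in
theorem le_ker_grad {W : Submodule K (Fin 4 → K)} (hW : W ∈ lines F) {v : Fin 4 → K}
    (hv : v ∈ W) : W ≤ LinearMap.ker (grad F v) := fun d hd => by
  obtain ⟨r, hr⟩ := taylor_line F v d
  rw [LinearMap.mem_ker, grad_apply]
  refine linear_coeff_unique (a := eval v F) (a' := 0) (r := r) (r' := 0) fun X => ?_
  rw [← hr X, hW.2 _ (W.add_mem hv (W.smul_mem X hd))]
  simp

omit [CharP K 2] in
theorem NoTriple.eq_of_common (hN : NoTriple F) (hF : IsSmoothQuartic F)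
    {W W' W'' : Submodule K (Fin 4 → K)} (hW : W ∈ lines F) (hW' : W' ∈ lines F)
    (hW'' : W'' ∈ lines F) {v : Fin 4 → K} (hv : v ≠ 0) (h : v ∈ W) (h' : v ∈ W') (h'' : v ∈ W'')
    (h1 : W ≠ W') (h2 : W ≠ W'') : W' = W'' :=
  hN _ (grad_ne_zero hF hv (hW.2 v h)) W hW W' hW' W'' hW'' (le_ker_grad hW h) (le_ker_grad hW' h')
    (le_ker_grad hW'' h'') h1 h2

end NoTriple

section Resultant
variable {R : Type*} [CommRing R]

/-- The resultant of the binary forms with coefficients `q 0, q 1, q 2` and `f 0, …, f 4`. -/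
def res24 (q f : ℕ → R) : R :=
  f 4 ^ 2 * q 0 ^ 4 + f 3 ^ 2 * q 0 ^ 3 * q 2 + f 2 ^ 2 * q 0 ^ 2 * q 2 ^ 2 +
    f 1 ^ 2 * q 0 * q 2 ^ 3 + f 0 ^ 2 * q 2 ^ 4 - f 4 * f 3 * q 0 ^ 3 * q 1 +
    f 4 * f 2 * q 0 ^ 2 * (q 1 ^ 2 - 2 * q 0 * q 2) -
    f 4 * f 1 * q 0 * (q 1 ^ 3 - 3 * q 0 * q 1 * q 2) +
    f 4 * f 0 * (q 1 ^ 4 - 4 * q 0 * q 1 ^ 2 * q 2 + 2 * q 0 ^ 2 * q 2 ^ 2) -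
    f 3 * f 2 * q 0 ^ 2 * q 1 * q 2 + f 3 * f 1 * q 0 * q 2 * (q 1 ^ 2 - 2 * q 0 * q 2) -
    f 3 * f 0 * q 2 * (q 1 ^ 3 - 3 * q 0 * q 1 * q 2) - f 2 * f 1 * q 0 * q 1 * q 2 ^ 2 +
    f 2 * f 0 * q 2 ^ 2 * (q 1 ^ 2 - 2 * q 0 * q 2) - f 1 * f 0 * q 1 * q 2 ^ 3

/-- The coefficients of the binary quadratic form `q (z + κ w, w)`. -/
def shear2 (κ : R) (q : ℕ → R) : ℕ → R
  | 0 => q 0 + κ * q 1 + κ ^ 2 * q 2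
  | 1 => q 1 + 2 * κ * q 2
  | 2 => q 2
  | _ => 0

/-- The coefficients of the binary quartic form `f (z + κ w, w)`. -/
def shear4 (κ : R) (f : ℕ → R) : ℕ → R
  | 0 => f 0 + κ * f 1 + κ ^ 2 * f 2 + κ ^ 3 * f 3 + κ ^ 4 * f 4
  | 1 => f 1 + 2 * κ * f 2 + 3 * κ ^ 2 * f 3 + 4 * κ ^ 3 * f 4
  | 2 => f 2 + 3 * κ * f 3 + 6 * κ ^ 2 * f 4
  | 3 => f 3 + 4 * κ * f 4
  | 4 => f 4
  | _ => 0

theorem res24_shear (κ : R) (q f : ℕ → R) : res24 (shear2 κ q) (shear4 κ f) = res24 q f := by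
  simp only [res24, shear2, shear4]
  ring

/-- The coefficients of the product of two binary quadratic forms. -/
def mulForm (q k : ℕ → R) : ℕ → R
  | 0 => q 0 * k 0
  | 1 => q 0 * k 1 + q 1 * k 0
  | 2 => q 0 * k 2 + q 1 * k 1 + q 2 * k 0
  | 3 => q 1 * k 2 + q 2 * k 1
  | 4 => q 2 * k 2
  | _ => 0

theorem res24_mul_add (q k f : ℕ → R) (τ : R) :
    res24 q (fun i => mulForm q k i + τ * f i) = τ ^ 2 * res24 q f := by
  simp only [res24, mulForm]
  ring

theorem dvd_res24_of_root {q f : ℕ → R} {τ x : R} (hq : τ ∣ q 0 + q 1 * x + q 2 * x ^ 2)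
    (hf : τ ∣ f 0 + f 1 * x + f 2 * x ^ 2 + f 3 * x ^ 3 + f 4 * x ^ 4) : τ ∣ res24 q f := by
  rw [← res24_shear x]
  obtain ⟨a, ha⟩ := hq
  obtain ⟨b, hb⟩ := hf
  have ha' : shear2 x q 0 = τ * a := by rw [← ha, shear2]; ring
  have hb' : shear4 x f 0 = τ * b := by rw [← hb, shear4]; ring
  simp only [res24, ha', hb']
  generalize shear2 x q 1 = q1, shear2 x q 2 = q2, shear4 x f 1 = f1, shear4 x f 2 = f2,
    shear4 x f 3 = f3, shear4 x f 4 = f4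
  rw [← Ideal.mem_span_singleton, ← Ideal.Quotient.eq_zero_iff_mem]
  have hτ : Ideal.Quotient.mk (Ideal.span {τ}) τ = 0 :=
    Ideal.Quotient.eq_zero_iff_mem.2 (Ideal.mem_span_singleton_self τ)
  simp [hτ]

/-- A degenerate common root forces a double zero of the resultant. -/
theorem sq_dvd_res24 {q f : ℕ → R} {τ : R} (h0 : τ ∣ q 0) (hf0 : τ ^ 2 ∣ f 0) (hf1 : τ ∣ f 1) :
    τ ^ 2 ∣ res24 q f := by
  obtain ⟨a, ha⟩ := h0
  obtain ⟨b, hb⟩ := hf0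
  obtain ⟨d, hd⟩ := hf1
  refine ⟨f 4 ^ 2 * (τ ^ 2 * a ^ 4) + f 3 ^ 2 * (τ * a ^ 3) * q 2 + f 2 ^ 2 * a ^ 2 * q 2 ^ 2 +
    τ * d ^ 2 * a * q 2 ^ 3 + τ ^ 2 * b ^ 2 * q 2 ^ 4 - f 4 * f 3 * (τ * a ^ 3) * q 1 +
    f 4 * f 2 * a ^ 2 * (q 1 ^ 2 - 2 * q 0 * q 2) -
    f 4 * d * a * (q 1 ^ 3 - 3 * q 0 * q 1 * q 2) +
    f 4 * b * (q 1 ^ 4 - 4 * q 0 * q 1 ^ 2 * q 2 + 2 * q 0 ^ 2 * q 2 ^ 2) -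
    f 3 * f 2 * a ^ 2 * q 1 * q 2 + f 3 * d * a * q 2 * (q 1 ^ 2 - 2 * q 0 * q 2) -
    f 3 * b * q 2 * (q 1 ^ 3 - 3 * q 0 * q 1 * q 2) - f 2 * d * a * q 1 * q 2 ^ 2 +
    f 2 * b * q 2 ^ 2 * (q 1 ^ 2 - 2 * q 0 * q 2) - τ * d * b * q 1 * q 2 ^ 3, ?_⟩
  simp only [res24, ha, hb, hd]
  ring

theorem sq_dvd_res24_of_ends {q f : ℕ → R} {τ : R} (h0 : τ ^ 2 ∣ q 0) (hf0 : τ ^ 2 ∣ f 0) :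
    τ ^ 2 ∣ res24 q f := by
  obtain ⟨a, ha⟩ := h0
  obtain ⟨b, hb⟩ := hf0
  have := dvd_res24_of_root (q := q) (f := f) (τ := τ ^ 2) (x := 0) (by simp [ha]) (by simp [hb])
  exact this

theorem res24_map {S : Type*} [CommRing S] (g : R →+* S) (q f : ℕ → R) :
    g (res24 q f) = res24 (fun i => g (q i)) fun i => g (f i) := by
  have h2 : g 2 = 2 := map_ofNat g 2
  have h3 : g 3 = 3 := map_ofNat g 3
  have h4 : g 4 = 4 := map_ofNat g 4
  simp [res24, h2, h3, h4]

end Resultant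

section Degree
variable {K : Type*} [Field K]
open Polynomial

theorem natDegree_res24_le {q f : ℕ → K[X]} {α β δ : ℕ}
    (hq : ∀ i, i ≤ 2 → (q i).natDegree ≤ β + i * δ)
    (hf : ∀ i, i ≤ 4 → (f i).natDegree ≤ α + i * δ) :
    (res24 q f).natDegree ≤ 4 * β + 2 * α + 8 * δ := by
  have q0 := hq 0 (by omega)
  have q1 := hq 1 (by omega)
  have q2 := hq 2 (by omega)
  have f0 := hf 0 (by omega)
  have f1 := hf 1 (by omega)
  have f2 := hf 2 (by omega)
  have f3 := hf 3 (by omega)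
  have f4 := hf 4 (by omega)
  clear hq hf
  have hadd : ∀ {p r : K[X]} {n : ℕ}, p.natDegree ≤ n → r.natDegree ≤ n → (p + r).natDegree ≤ n :=
    natDegree_add_le_of_degree_le
  have hsub : ∀ {p r : K[X]} {n : ℕ}, p.natDegree ≤ n → r.natDegree ≤ n → (p - r).natDegree ≤ n :=
    fun hp hr => (natDegree_sub_le_of_le hp hr).trans (by simp)
  have hn : ∀ (m : ℕ) [m.AtLeastTwo] {p r : K[X]} {k l : ℕ}, p.natDegree ≤ k → r.natDegree ≤ l →
      (ofNat(m) * p * r).natDegree ≤ k + l := fun m _ p r k l hp hr =>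
    natDegree_mul_le_of_le ((natDegree_mul_le_of_le (natDegree_ofNat m).le hp).trans (by simp)) hr
  have h1 : (q 1 ^ 2 - 2 * q 0 * q 2).natDegree ≤ 2 * β + 2 * δ :=
    hsub ((natDegree_pow_le_of_le 2 q1).trans (by omega)) ((hn 2 q0 q2).trans (by omega))
  have h2 : (q 1 ^ 3 - 3 * q 0 * q 1 * q 2).natDegree ≤ 3 * β + 3 * δ :=
    hsub ((natDegree_pow_le_of_le 3 q1).trans (by omega))
      ((natDegree_mul_le_of_le (hn 3 q0 q1) q2).trans (by omega))
  have h3 : (q 1 ^ 4 - 4 * q 0 * q 1 ^ 2 * q 2 + 2 * q 0 ^ 2 * q 2 ^ 2).natDegree ≤ 4 * β + 4 * δ :=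
    hadd (hsub ((natDegree_pow_le_of_le 4 q1).trans (by omega))
      ((natDegree_mul_le_of_le (hn 4 q0 (natDegree_pow_le_of_le 2 q1)) q2).trans (by omega)))
      ((hn 2 (natDegree_pow_le_of_le 2 q0) (natDegree_pow_le_of_le 2 q2)).trans (by omega))
  unfold res24
  generalize q 1 ^ 2 - 2 * q 0 * q 2 = a1 at *
  generalize q 1 ^ 3 - 3 * q 0 * q 1 * q 2 = a2 at *
  generalize q 1 ^ 4 - 4 * q 0 * q 1 ^ 2 * q 2 + 2 * q 0 ^ 2 * q 2 ^ 2 = a3 at *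
  have M : ∀ {p r : K[X]} {k l : ℕ}, p.natDegree ≤ k → r.natDegree ≤ l →
      (p * r).natDegree ≤ k + l := natDegree_mul_le_of_le
  have P : ∀ {p : K[X]} {k : ℕ} (m : ℕ), p.natDegree ≤ k → (p ^ m).natDegree ≤ m * k :=
    fun m h => natDegree_pow_le_of_le m h
  exact hsub (hadd (hsub (hsub (hadd (hsub (hadd (hsub (hadd (hsub (hadd (hadd (hadd (hadd
    ((M (P 2 f4) (P 4 q0)).trans (by omega))
    ((M (M (P 2 f3) (P 3 q0)) q2).trans (by omega)))
    ((M (M (P 2 f2) (P 2 q0)) (P 2 q2)).trans (by omega)))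
    ((M (M (P 2 f1) q0) (P 3 q2)).trans (by omega)))
    ((M (P 2 f0) (P 4 q2)).trans (by omega)))
    ((M (M (M f4 f3) (P 3 q0)) q1).trans (by omega)))
    ((M (M (M f4 f2) (P 2 q0)) h1).trans (by omega)))
    ((M (M (M f4 f1) q0) h2).trans (by omega)))
    ((M (M f4 f0) h3).trans (by omega)))
    ((M (M (M (M f3 f2) (P 2 q0)) q1) q2).trans (by omega)))
    ((M (M (M (M f3 f1) q0) q2) h1).trans (by omega)))
    ((M (M (M f3 f0) q2) h2).trans (by omega)))
    ((M (M (M (M f2 f1) q0) q1) (P 2 q2)).trans (by omega)))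
    ((M (M (M f2 f0) (P 2 q2)) h1).trans (by omega)))
    ((M (M (M f1 f0) q1) (P 3 q2)).trans (by omega))

end Degree

section Gradient
variable {K : Type*} [Field K] [IsAlgClosed K] [CharP K 2] {F : MvPolynomial (Fin 4) K}
  {b : Module.Basis (Fin 4) K (Fin 4 → K)} {c : ℕ → ℕ → ℕ → K}

theorem Coords.grad_eq (h : Coords F b c) (x y z w α β γ δ : K) :
    grad F (pt b x y z w) (pt b α β γ δ) = α * quarticX c x y z w + β * quarticY c x y z w +
      γ * quarticZ c x y z w + δ * quarticW c x y z w := by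
  obtain ⟨r, hr⟩ := taylor_line F (pt b x y z w) (pt b α β γ δ)
  obtain ⟨r', hr'⟩ := taylor_line (quarticPoly c) ![x, y, z, w] ![α, β, γ, δ]
  rw [grad_apply]
  refine (linear_coeff_unique (a := eval (pt b x y z w) F) (r := r) (r' := r')
    (a' := eval ![x, y, z, w] (quarticPoly c))
    (b' := ∑ i, ![α, β, γ, δ] i * eval ![x, y, z, w] (pderiv i (quarticPoly c)))
    fun X => ?_).trans ?_
  · rw [← hr, ← hr', eval_quarticPoly]
    have : pt b x y z w + X • pt b α β γ δ = pt b (x + X * α) (y + X * β) (z + X * γ) (w + X * δ) := by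
      simp only [pt]; module
    rw [this, h.2]
    simp
  · obtain ⟨h0, h1, h2, h3⟩ := eval_pderiv_quarticPoly c ![x, y, z, w]
    rw [Fin.sum_univ_four, h0, h1, h2, h3]
    simp

/-- Along the line `W` the differential of `F`, restricted to `W`, has no polar part. -/
def Inert (F : MvPolynomial (Fin 4) K) (W : Submodule K (Fin 4 → K)) : Prop :=
  ∀ p ∈ W, ∀ d ∈ W, ∀ v, ∃ e, ∀ X : K, grad F (v + X • p) d = grad F v d + X ^ 2 * e

theorem inert_of_coords (h : Coords F b c) (hv : VanishesOnLine c) (h0 : c 2 0 1 = 0)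
    (h1 : c 1 1 1 = 0) (h2 : c 0 2 1 = 0) : Inert F (Submodule.span K {b 2, b 3}) := by
  intro p hp d hd v
  obtain ⟨z1, w1, rfl⟩ := Submodule.mem_span_pair.1 hp
  obtain ⟨z2, w2, rfl⟩ := Submodule.mem_span_pair.1 hd
  obtain ⟨x, y, z, w, rfl⟩ := exists_eq_pt b v
  refine ⟨z2 * ((c 0 1 1 * y + c 1 0 1 * x) * w1 ^ 2 + (c 0 1 3 * y + c 1 0 3 * x) * z1 ^ 2) +
    w2 * ((c 0 1 0 * y + c 1 0 0 * x) * w1 ^ 2 + (c 0 1 2 * y + c 1 0 2 * x) * z1 ^ 2),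
    fun X => ?_⟩
  have e1 : pt b x y z w + X • (z1 • b 2 + w1 • b 3) = pt b x y (z + X * z1) (w + X * w1) := by
    simp only [pt]; module
  have e2 : z2 • b 2 + w2 • b 3 = pt b 0 0 z2 w2 := by simp only [pt]; module
  have v1 := hv 1 (by norm_num)
  have v3 := hv 3 (by norm_num)
  rw [e1, e2, h.grad_eq, h.grad_eq]
  simp only [quarticZ, quarticW, v1, v3, h0, h1, h2]
  have h2 : (2 : K) = 0 := CharTwo.two_eq_zero
  linear_combination (z2 * ((c 0 1 1 * y + c 1 0 1 * x) * w * w1 +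
    (c 0 1 3 * y + c 1 0 3 * x) * z * z1) * X + w2 * ((c 0 1 0 * y + c 1 0 0 * x) * w * w1 +
    (c 0 1 2 * y + c 1 0 2 * x) * z * z1) * X) * h2

/-- A line with at least five neighbours has a neighbour that is not inert. -/
theorem ncard_nbrs_of_inert (hF : IsSmoothQuartic F) (hN : NoTriple F)
    {W : Submodule K (Fin 4 → K)} (hb : W ∈ lines F) (hi : ∀ n ∈ nbrs F W, Inert F n) :
    (nbrs F W).ncard ≤ 4 := by
  have : Infinite K := IsAlgClosed.instInfinite
  obtain ⟨b₀, rfl⟩ := exists_adapted_basis hb.1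
  obtain ⟨-, -, b, -, hspan, hoff⟩ := exists_shear hF b₀ (S := ∅) Set.finite_empty
  rw [← hspan] at hb hi ⊢
  obtain ⟨c, hc⟩ := hF.coords b
  have hv := coords_vanishesOnLine hc hb
  have hlin : ∀ n ∈ nbrs F (Submodule.span K {b 2, b 3}), ∃ s μ, lineAt b c s μ = n := fun n hn =>
    let ⟨s, μ, _, h⟩ := exists_lineAt hc hv hn (hoff n hn.1 hn.2.1)
    ⟨s, μ, h⟩
  choose! s μ hs using hlin
  have hpt : ∀ n ∈ nbrs F (Submodule.span K {b 2, b 3}), pt b 0 0 (s n) 1 ∈ n := fun n hn => by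
    have := mem_lineAt (b := b) (c := c) (s := s n) (μ := μ n) (v := pt b 0 0 (s n) 1) |>.2
      ⟨1, 0, by simp⟩
    rwa [hs n hn] at this
  have hinj : Set.InjOn s (nbrs F (Submodule.span K {b 2, b 3})) := fun n hn m hm hnm => by
    refine hN.eq_of_common hF hb hn.1 hm.1 (v := pt b 0 0 (s n) 1) (fun h0 => ?_)
      (Submodule.mem_span_pair.2 ⟨s n, 1, by simp [pt]⟩) (hpt n hn) (hnm ▸ hpt m hm)
      hn.2.1.symm hm.2.1.symm
    exact one_ne_zero (pt_eq_zero.1 h0).2.2.2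
  set R : Polynomial K := pB c * (.C (c 1 0 3) * .X + .C (c 1 0 2)) +
    pA c * (.C (c 0 1 3) * .X + .C (c 0 1 2)) with hR
  have hroot : ∀ n ∈ nbrs F (Submodule.span K {b 2, b 3}), R.eval (s n) = 0 := fun n hn => by
    have hd := mem_lineAt (b := b) (c := c) (s := s n) (μ := μ n)
      (v := pt b ((pB c).eval (s n)) ((pA c).eval (s n)) (μ n) 0) |>.2 ⟨0, 1, by simp⟩
    rw [hs n hn] at hd
    obtain ⟨e, he⟩ := hi n hn _ (hpt n hn) _ hd (pt b 0 0 1 0)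
    have key : ∀ X : K, 0 + X * R.eval (s n) + X ^ 2 * (Polynomial.C
        ((pB c).eval (s n) * (c 1 0 3 * s n ^ 2 + c 1 0 1) +
          (pA c).eval (s n) * (c 0 1 3 * s n ^ 2 + c 0 1 1) - e) + Polynomial.X * Polynomial.C
          ((pB c).eval (s n) * cubic (c 1 0) (s n) 1 +
          (pA c).eval (s n) * cubic (c 0 1) (s n) 1)).eval X =
        0 + X * 0 + X ^ 2 * (0 : Polynomial K).eval X := fun X => by
      have e1 : pt b 0 0 1 0 + X • pt b 0 0 (s n) 1 = pt b 0 0 (1 + X * s n) X := by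
        simp only [pt]; module
      have := he X
      rw [e1, hc.grad_eq, hc.grad_eq] at this
      simp only [quarticX, quarticY, quarticZ, quarticW, hv 1 (by norm_num), hv 3 (by norm_num)]
        at this
      simp only [hR, cubic, Polynomial.eval_add, Polynomial.eval_mul, Polynomial.eval_C,
        Polynomial.eval_X, Polynomial.eval_zero]
      have h2 : (2 : K) = 0 := CharTwo.two_eq_zero
      linear_combination this - (X * s n * ((pB c).eval (s n) * c 1 0 3 + (pA c).eval (s n) * c 0 1 3)
        + X ^ 2 * s n * ((pB c).eval (s n) * (c 1 0 3 * s n + c 1 0 2) +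
          (pA c).eval (s n) * (c 0 1 3 * s n + c 0 1 2))) * h2
    exact linear_coeff_unique key
  classical
  by_contra! hlt
  have hdeg : R.natDegree ≤ 4 := by
    have := natDegree_pA (c := c)
    have := natDegree_pB (c := c)
    rw [hR]
    compute_degree; omega
  have hR0 : R = 0 := by
    refine Polynomial.eq_zero_of_natDegree_lt_card_of_eval_eq_zero' R
      ((finite_nbrs hF (Submodule.span K {b 2, b 3})).toFinset.image s) (fun x hx => ?_) ?_
    · obtain ⟨n, hn, rfl⟩ := Finset.mem_image.1 hx
      exact hroot n (by simpa using hn)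
    · rw [Finset.card_image_of_injOn (by rwa [Set.Finite.coe_toFinset]),
        ← Set.ncard_eq_toFinset_card _ (finite_nbrs hF _)]
      omega
  have hsyz := (hv.coprime hc.1).no_linear_syzygy (t0 := c 0 1 3) (t2 := c 0 1 2) (t1 := c 1 0 3)
    (t3 := c 1 0 2)
  have haff : ∀ z, (c 0 1 3 * z + c 0 1 2) * cubic (c 1 0) z 1 +
      (c 1 0 3 * z + c 1 0 2) * cubic (c 0 1) z 1 = 0 := fun z => by
    have := congrArg (Polynomial.eval z) hR0
    simp only [hR, pA, pB, Polynomial.eval_add, Polynomial.eval_mul, Polynomial.eval_C,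
      Polynomial.eval_X, eval_cubicPoly, Polynomial.eval_zero] at this
    linear_combination this
  obtain ⟨h0, h1, h2, h3, h4⟩ := coeffs_eq_zero_of_forall
    (a0 := c 0 1 2 * c 1 0 0 + c 1 0 2 * c 0 1 0)
    (a1 := c 0 1 3 * c 1 0 0 + c 0 1 2 * c 1 0 1 + c 1 0 3 * c 0 1 0 + c 1 0 2 * c 0 1 1)
    (a2 := c 0 1 3 * c 1 0 1 + c 0 1 2 * c 1 0 2 + c 1 0 3 * c 0 1 1 + c 1 0 2 * c 0 1 2)
    (a3 := c 0 1 3 * c 1 0 2 + c 0 1 2 * c 1 0 3 + c 1 0 3 * c 0 1 2 + c 1 0 2 * c 0 1 3)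
    (a4 := c 0 1 3 * c 1 0 3 + c 1 0 3 * c 0 1 3) fun z => by
      rw [← haff z]; simp only [cubic]; ring
  obtain ⟨e1, e2, e3, e4⟩ := hsyz fun z w => by
    simp only [cubic]
    linear_combination w ^ 4 * h0 + z * w ^ 3 * h1 + z ^ 2 * w ^ 2 * h2 + z ^ 3 * w * h3 + z ^ 4 * h4
  exact one_ne_zero (hv.coprime hc.1 1 0 (by simp [cubic, e2]) (by simp [cubic, e1])).1

end Gradient

section Forms
variable {R : Type*} [CommRing R]

theorem res24_congr {q q' f f' : ℕ → R} (hq : ∀ i ≤ 2, q i = q' i) (hf : ∀ i ≤ 4, f i = f' i) :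
    res24 q f = res24 q' f' := by
  simp only [res24, hq 0 (by simp), hq 1 (by simp), hq 2 (by simp), hf 0 (by simp), hf 1 (by simp),
    hf 2 (by simp), hf 3 (by simp), hf 4 (by simp)]

theorem sq_dvd_res24_of_mulForm {q f k : ℕ → R} {τ : R} (h : ∀ i ≤ 4, τ ∣ f i - mulForm q k i) :
    τ ^ 2 ∣ res24 q f := by
  choose! e he using h
  refine ⟨res24 q e, ?_⟩
  rw [← res24_mul_add q k]
  exact res24_congr (fun _ _ => rfl) fun i hi => by rw [← he i hi]; ring

/-- The coefficients of the product of a binary cubic and a binary linear form. -/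
def prodForm (a l : ℕ → R) : ℕ → R
  | 0 => a 0 * l 0
  | 1 => a 0 * l 1 + a 1 * l 0
  | 2 => a 1 * l 1 + a 2 * l 0
  | 3 => a 2 * l 1 + a 3 * l 0
  | 4 => a 3 * l 1
  | _ => 0

/-- The correction of the binary quartic form `g` by the coefficient `h`. -/
def corrForm (h : R) (g : ℕ → R) : ℕ → R
  | 0 => g 1 ^ 2 + h ^ 2 * g 0
  | 1 => h ^ 2 * g 1
  | 2 => h ^ 2 * g 2
  | 3 => h ^ 2 * g 3
  | 4 => g 3 ^ 2 + h ^ 2 * g 4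
  | _ => 0

/-- The coefficients of the binary linear form `l (z + κ w, w)`. -/
def shear1 (κ : R) (l : ℕ → R) : ℕ → R
  | 0 => l 0 + κ * l 1
  | 1 => l 1
  | _ => 0

/-- The coefficients of the binary cubic form `a (z + κ w, w)`, in characteristic two. -/
def shear3 (κ : R) (a : ℕ → R) : ℕ → R
  | 0 => a 0 + κ * a 1 + κ ^ 2 * a 2 + κ ^ 3 * a 3
  | 1 => a 1 + κ ^ 2 * a 3
  | 2 => a 2 + κ * a 3
  | 3 => a 3
  | _ => 0

/-- A discriminant detecting the planes in which the residual cubic `a + x q + x² l` splits. -/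
def residualDisc (a q l : ℕ → R) : R := res24 q (corrForm (q 1) (prodForm a l))

theorem corrForm_prodForm_shear [CharP R 2] (κ h : R) (a l : ℕ → R) (i : ℕ) (hi : i ≤ 4) :
    corrForm h (prodForm (shear3 κ a) (shear1 κ l)) i = shear4 κ (corrForm h (prodForm a l)) i := by
  have hc : i = 0 ∨ i = 1 ∨ i = 2 ∨ i = 3 ∨ i = 4 := by omega
  rcases hc with rfl | rfl | rfl | rfl | rfl <;>
    simp only [corrForm, prodForm, shear1, shear3, shear4]
  all_goals (generalize a 0 = a0, a 1 = a1, a 2 = a2, a 3 = a3, l 0 = l0, l 1 = l1; clear hi; grind)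

theorem shear2_one [CharP R 2] (κ : R) (q : ℕ → R) : shear2 κ q 1 = q 1 := by
  have h2 : (2 : R) = 0 := CharTwo.two_eq_zero
  simp only [shear2]; linear_combination κ * q 2 * h2

theorem residualDisc_shear [CharP R 2] (κ : R) (a q l : ℕ → R) :
    residualDisc (shear3 κ a) (shear2 κ q) (shear1 κ l) = residualDisc a q l := by
  rw [residualDisc, residualDisc, ← res24_shear κ q, shear2_one]
  exact res24_congr (fun _ _ => rfl) fun i hi => corrForm_prodForm_shear κ _ a l i hi

theorem sq_dvd_residualDisc_of_zero {a q l : ℕ → R} {τ : R} (ha : τ ∣ a 0) (hq : τ ∣ q 0)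
    (hl : τ ∣ l 0) : τ ^ 2 ∣ residualDisc a q l := by
  obtain ⟨a', ha⟩ := ha
  obtain ⟨l', hl⟩ := hl
  refine sq_dvd_res24 hq ?_ ?_
  · refine ⟨(a' * l 1 + a 1 * l') ^ 2 + q 1 ^ 2 * (a' * l'), ?_⟩
    simp only [corrForm, prodForm, ha, hl]; ring
  · refine ⟨q 1 ^ 2 * (a' * l 1 + a 1 * l'), ?_⟩
    simp only [corrForm, prodForm, ha, hl]; ring

/-- If `g = u (q + u)` then the correction of `g` is divisible by `q`. -/
theorem corrForm_eq_mulForm [CharP R 2] {q g u : ℕ → R} (h0 : g 0 = u 0 ^ 2 + u 0 * q 0)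
    (h1 : g 1 = u 0 * q 1 + u 1 * q 0) (h2 : g 2 = u 1 ^ 2 + u 0 * q 2 + u 1 * q 1 + u 2 * q 0)
    (h3 : g 3 = u 1 * q 2 + u 2 * q 1) (h4 : g 4 = u 2 ^ 2 + u 2 * q 2) (i : ℕ) (hi : i ≤ 4) :
    corrForm (q 1) g i = mulForm q (fun j => u 1 ^ 2 * q j + q 1 ^ 2 * u j) i := by
  have hc : i = 0 ∨ i = 1 ∨ i = 2 ∨ i = 3 ∨ i = 4 := by omega
  rcases hc with rfl | rfl | rfl | rfl | rfl <;> simp only [corrForm, mulForm, h0, h1, h2, h3, h4]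
  all_goals
    generalize u 0 = u0, u 1 = u1, u 2 = u2, q 0 = q0, q 1 = q1, q 2 = q2
    clear h0 h1 h2 h3 h4 hi
    grind

end Forms

section Splitting
variable {K : Type*} [Field K] [CharP K 2]

theorem exists_linear_root_of_factor {a q l u : ℕ → K} (hl : l 0 ≠ 0)
    (h0 : prodForm a l 0 = u 0 ^ 2 + u 0 * q 0) (h1 : prodForm a l 1 = u 0 * q 1 + u 1 * q 0)
    (h2 : prodForm a l 2 = u 1 ^ 2 + u 0 * q 2 + u 1 * q 1 + u 2 * q 0)
    (h3 : prodForm a l 3 = u 1 * q 2 + u 2 * q 1)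
    (hu : u 0 * l 1 ^ 2 + u 1 * l 0 * l 1 + u 2 * l 0 ^ 2 = 0) :
    ∃ m n : K, a 0 = m * q 0 + m ^ 2 * l 0 ∧ a 1 = m * q 1 + n * q 0 + m ^ 2 * l 1 ∧
      a 2 = m * q 2 + n * q 1 + n ^ 2 * l 0 ∧ a 3 = n * q 2 + n ^ 2 * l 1 := by
  have two : (2 : K) = 0 := CharTwo.two_eq_zero
  simp only [prodForm] at h0 h1 h2 h3
  generalize a 0 = a0, a 1 = a1, a 2 = a2, a 3 = a3, q 0 = q0, q 1 = q1, q 2 = q2, u 0 = u0,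
    u 1 = u1, u 2 = u2, l 0 = l0, l 1 = l1 at *
  obtain ⟨m, rfl⟩ : ∃ m, u0 = m * l0 := ⟨u0 / l0, by field_simp⟩
  obtain ⟨n, rfl⟩ : ∃ n, u1 = m * l1 + n * l0 := ⟨(u1 - m * l1) / l0, by field_simp; ring⟩
  obtain rfl : u2 = n * l1 := by
    apply mul_right_cancel₀ (pow_ne_zero 2 hl)
    linear_combination hu - (m * l0 * l1 ^ 2 + n * l0 ^ 2 * l1) * two
  obtain rfl : a0 = m * q0 + m ^ 2 * l0 := by
    apply mul_right_cancel₀ hl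
    linear_combination h0
  obtain rfl : a1 = m * q1 + n * q0 + m ^ 2 * l1 := by
    apply mul_right_cancel₀ hl
    linear_combination h1 - m ^ 2 * l0 * l1 * two
  obtain rfl : a2 = m * q2 + n * q1 + n ^ 2 * l0 := by
    apply mul_right_cancel₀ hl
    linear_combination h2 + m * n * l0 * l1 * two
  refine ⟨m, n, rfl, rfl, rfl, ?_⟩
  apply mul_right_cancel₀ hl
  linear_combination h3 - n ^ 2 * l0 * l1 * two

theorem exists_factor [IsAlgClosed K] {q g : ℕ → K} (hq0 : q 0 = 0) (hq1 : q 1 ≠ 0)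
    (h0 : corrForm (q 1) g 0 = 0)
    (h1 : q 1 ^ 3 * corrForm (q 1) g 4 + q 1 ^ 2 * q 2 * corrForm (q 1) g 3 +
      q 1 * q 2 ^ 2 * corrForm (q 1) g 2 + q 2 ^ 3 * corrForm (q 1) g 1 = 0) :
    ∃ u : ℕ → K, g 0 = u 0 ^ 2 + u 0 * q 0 ∧ g 1 = u 0 * q 1 + u 1 * q 0 ∧
      g 2 = u 1 ^ 2 + u 0 * q 2 + u 1 * q 1 + u 2 * q 0 ∧ g 3 = u 1 * q 2 + u 2 * q 1 ∧
      g 4 = u 2 ^ 2 + u 2 * q 2 := by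
  have two : (2 : K) = 0 := CharTwo.two_eq_zero
  simp only [corrForm] at h0 h1
  generalize q 0 = q0, q 1 = h, q 2 = q2, g 0 = g0, g 1 = g1, g 2 = g2, g 3 = g3, g 4 = g4 at *
  obtain ⟨u0, hu0⟩ := IsAlgClosed.exists_pow_nat_eq g0 (n := 2) two_pos
  obtain ⟨u1, hu1⟩ : ∃ u1, u1 ^ 2 + h * u1 + (g2 + u0 * q2) = 0 := by
    obtain ⟨x, hx⟩ := IsAlgClosed.exists_root
      (.X ^ 2 + .C h * .X + .C (g2 + u0 * q2) : Polynomial K) (by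
        have : (.X ^ 2 + .C h * .X + .C (g2 + u0 * q2) : Polynomial K).degree = 2 := by
          compute_degree!
        rw [this]; norm_num)
    exact ⟨x, by simpa using hx⟩
  have e1 : g1 = u0 * h := by
    have : (g1 + u0 * h) ^ 2 = 0 := by
      linear_combination h0 + h ^ 2 * hu0 + (g1 * u0 * h) * two
    have := pow_eq_zero_iff two_ne_zero |>.1 this
    linear_combination this - u0 * h * two
  obtain ⟨u2, rfl⟩ : ∃ u2, g3 = u1 * q2 + u2 * h := ⟨(g3 - u1 * q2) / h, by field_simp; ring⟩
  refine ⟨fun i => if i = 0 then u0 else if i = 1 then u1 else u2, ?_⟩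
  simp only [hq0, if_true, one_ne_zero, if_false, OfNat.ofNat_ne_zero, OfNat.ofNat_ne_one]
  have e2 : g2 = u1 ^ 2 + u0 * q2 + u1 * h := by
    linear_combination hu1 - (u1 ^ 2 + h * u1 + u0 * q2) * two
  subst e1 e2 hu0
  refine ⟨by ring, by ring, by ring, trivial, ?_⟩
  apply mul_right_cancel₀ (pow_ne_zero 5 hq1)
  clear hu1 h0
  grind

/-- A residual cubic with degenerate discriminant contains a line. -/
theorem exists_linear_root [IsAlgClosed K] {a q l : ℕ → K} (hl : l 0 ≠ 0) (hq0 : q 0 = 0)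
    (hq1 : q 1 ≠ 0) (h0 : corrForm (q 1) (prodForm a l) 0 = 0)
    (h1 : q 1 ^ 3 * corrForm (q 1) (prodForm a l) 4 + q 1 ^ 2 * q 2 * corrForm (q 1) (prodForm a l) 3 +
      q 1 * q 2 ^ 2 * corrForm (q 1) (prodForm a l) 2 +
      q 2 ^ 3 * corrForm (q 1) (prodForm a l) 1 = 0) :
    ∃ m n : K, a 0 = m * q 0 + m ^ 2 * l 0 ∧ a 1 = m * q 1 + n * q 0 + m ^ 2 * l 1 ∧
      a 2 = m * q 2 + n * q 1 + n ^ 2 * l 0 ∧ a 3 = n * q 2 + n ^ 2 * l 1 := by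
  obtain ⟨u, e0, e1, e2, e3, e4⟩ := exists_factor hq0 hq1 h0 h1
  have key : (u 0 * l 1 ^ 2 + u 1 * l 0 * l 1 + u 2 * l 0 ^ 2) *
      ((u 0 + q 0) * l 1 ^ 2 + (u 1 + q 1) * l 0 * l 1 + (u 2 + q 2) * l 0 ^ 2) = 0 := by
    simp only [prodForm] at e0 e1 e2 e3 e4
    clear h0 h1 hl hq1 hq0
    generalize a 0 = a0, a 1 = a1, a 2 = a2, a 3 = a3, q 0 = q0, q 1 = q1, q 2 = q2, u 0 = u0,
      u 1 = u1, u 2 = u2, l 0 = l0, l 1 = l1 at *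
    have two : (2 : K) = 0 := CharTwo.two_eq_zero
    linear_combination (-l1 ^ 4) * e0 - l0 * l1 ^ 3 * e1 - l0 ^ 2 * l1 ^ 2 * e2 - l0 ^ 3 * l1 * e3 -
      l0 ^ 4 * e4 + (a0 * l0 * l1 ^ 4 + a1 * l0 ^ 2 * l1 ^ 3 + a2 * l0 ^ 3 * l1 ^ 2 + a3 * l0 ^ 4 * l1 +
        u0 * u1 * l0 * l1 ^ 3 + u0 * u2 * l0 ^ 2 * l1 ^ 2 + u1 * u2 * l0 ^ 3 * l1) * two
  rcases mul_eq_zero.1 key with h | h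
  · exact exists_linear_root_of_factor hl e0 e1 e2 e3 h
  · have two : (2 : K) = 0 := CharTwo.two_eq_zero
    exact exists_linear_root_of_factor (u := fun i => u i + q i) hl
      (e0.trans (by linear_combination (-u 0 * q 0 - q 0 ^ 2) * two))
      (e1.trans (by linear_combination (-q 0 * q 1) * two))
      (e2.trans (by linear_combination (-u 1 * q 1 - q 1 ^ 2 - q 0 * q 2) * two))
      (e3.trans (by linear_combination (-q 1 * q 2) * two)) h

end Splitting

section Residual
variable {R : Type*} [CommRing R]

/-- The coefficients of the binary cubic form `∂F/∂x` on the line `x = y = 0`, in the plane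
`y = t x`. -/
def resA (c : ℕ → ℕ → ℕ → R) (t : R) (k : ℕ) : R := c 1 0 k + t * c 0 1 k

/-- The coefficients of the quadratic term of the residual cubic in the plane `y = t x`. -/
def resQ (c : ℕ → ℕ → ℕ → R) (t : R) (k : ℕ) : R := c 2 0 k + t * c 1 1 k + t ^ 2 * c 0 2 k

/-- The coefficients of the linear term of the residual cubic in the plane `y = t x`. -/
def resL (c : ℕ → ℕ → ℕ → R) (t : R) (k : ℕ) : R :=
  c 3 0 k + t * c 2 1 k + t ^ 2 * c 1 2 k + t ^ 3 * c 0 3 k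

theorem residualDisc_map {S : Type*} [CommRing S] (g : R →+* S) (a q l : ℕ → R) :
    g (residualDisc a q l) =
      residualDisc (fun i => g (a i)) (fun i => g (q i)) fun i => g (l i) := by
  rw [residualDisc, residualDisc, res24_map]
  refine res24_congr (fun _ _ => rfl) fun i hi => ?_
  have hc : i = 0 ∨ i = 1 ∨ i = 2 ∨ i = 3 ∨ i = 4 := by omega
  rcases hc with rfl | rfl | rfl | rfl | rfl <;> simp [corrForm, prodForm]

/-- In characteristic two, the first order expansion of the resultant at a common root. -/
theorem dvd_of_res24_eq_zero [CharP R 2] [IsDomain R] {q f : ℕ → R} {τ d e : R} (hτ : τ ≠ 0)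
    (hq : q 0 = τ * e) (hf : f 0 = τ * d) (h : res24 q f = 0) :
    τ ∣ (d * q 1 + e * f 1) *
      (f 4 * q 1 ^ 3 + f 3 * q 1 ^ 2 * q 2 + f 2 * q 1 * q 2 ^ 2 + f 1 * q 2 ^ 3) := by
  have h2 : (2 : R) = 0 := CharTwo.two_eq_zero
  refine ⟨-(f 4 ^ 2 * τ ^ 2 * e ^ 4 + f 3 ^ 2 * τ * e ^ 3 * q 2 + f 2 ^ 2 * e ^ 2 * q 2 ^ 2 +
    d ^ 2 * q 2 ^ 4 - f 4 * f 3 * τ * e ^ 3 * q 1 + f 4 * f 2 * e ^ 2 * q 1 ^ 2 -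
    f 3 * f 2 * e ^ 2 * q 1 * q 2 + f 4 * f 1 * e ^ 2 * q 1 * q 2 + f 3 * d * e * q 1 * q 2 ^ 2), ?_⟩
  refine mul_left_cancel₀ hτ ?_
  simp only [res24, hq, hf] at h
  generalize q 1 = q1, q 2 = q2, f 1 = f1, f 2 = f2, f 3 = f3, f 4 = f4 at *
  clear hq hf hτ
  grind
end Residual

section Field
variable {K : Type*} [Field K]

theorem exists_common_root [IsAlgClosed K] {q f : ℕ → K} (hq : q 2 ≠ 0) (h : res24 q f = 0) :
    ∃ κ, shear2 κ q 0 = 0 ∧ shear4 κ f 0 = 0 := by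
  obtain ⟨r, hr⟩ := IsAlgClosed.exists_root (.C (q 2) * .X ^ 2 + .C (q 1) * .X + .C (q 0))
    (by rw [Polynomial.degree_quadratic hq]; simp)
  have hr : shear2 r q 0 = 0 := by
    simp only [Polynomial.IsRoot, Polynomial.eval_add, Polynomial.eval_mul, Polynomial.eval_pow,
      Polynomial.eval_C, Polynomial.eval_X] at hr
    simp only [shear2]; linear_combination hr
  by_cases hf : shear4 r f 0 = 0
  · exact ⟨r, hr, hf⟩
  rw [← res24_shear r] at h
  obtain ⟨m, hm⟩ : ∃ m, m * q 2 = q 1 + 2 * r * q 2 := ⟨(q 1 + 2 * r * q 2) / q 2, by field_simp⟩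
  have key : shear4 r f 0 * (q 2 ^ 4 * shear4 (r - m) f 0) = 0 := by
    rw [← h, res24, hr]
    simp only [shear2, ← hm]
    simp only [shear4]
    ring
  refine ⟨r - m, ?_, ?_⟩
  · simp only [shear2] at hr ⊢; linear_combination hr + m * hm
  · simpa [hf, hq] using key

theorem quartic_residual {c : ℕ → ℕ → ℕ → K} (hv : VanishesOnLine c)
    (hm : c 4 0 0 = 0 ∧ c 3 1 0 = 0 ∧ c 2 2 0 = 0 ∧ c 1 3 0 = 0 ∧ c 0 4 0 = 0) (t x z w : K) :
    quartic c x (t * x) z w = x * (cubic (resA c t) z w +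
      x * (resQ c t 2 * z ^ 2 + resQ c t 1 * z * w + resQ c t 0 * w ^ 2) +
      x ^ 2 * (resL c t 1 * z + resL c t 0 * w)) := by
  obtain ⟨h1, h2, h3, h4, h5⟩ := hm
  simp only [quartic, cubic, resA, resQ, resL, hv 0 (by simp), hv 1 (by simp), hv 2 (by simp),
    hv 3 (by simp), hv 4 (by simp), h1, h2, h3, h4, h5]
  ring

noncomputable def polyA (c : ℕ → ℕ → ℕ → K) : ℕ → Polynomial K :=
  resA (fun i j k => .C (c i j k)) .X

noncomputable def polyQ (c : ℕ → ℕ → ℕ → K) : ℕ → Polynomial K :=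
  resQ (fun i j k => .C (c i j k)) .X

noncomputable def polyL (c : ℕ → ℕ → ℕ → K) : ℕ → Polynomial K :=
  resL (fun i j k => .C (c i j k)) .X

theorem eval_polyA (c : ℕ → ℕ → ℕ → K) (t : K) (k : ℕ) : (polyA c k).eval t = resA c t k := by
  simp [polyA, resA]; ring

theorem eval_polyQ (c : ℕ → ℕ → ℕ → K) (t : K) (k : ℕ) : (polyQ c k).eval t = resQ c t k := by
  simp [polyQ, resQ]; ring

theorem eval_polyL (c : ℕ → ℕ → ℕ → K) (t : K) (k : ℕ) : (polyL c k).eval t = resL c t k := by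
  simp [polyL, resL]; ring

theorem natDegree_residualDisc_le {A Q L : ℕ → Polynomial K} {α β δ γ : ℕ}
    (hA : ∀ k, (A k).natDegree ≤ α) (hQ : ∀ k, (Q k).natDegree ≤ β) (hL : ∀ k, (L k).natDegree ≤ δ)
    (h1 : 2 * (α + δ) ≤ γ) (h2 : 2 * β + (α + δ) ≤ γ) :
    (residualDisc A Q L).natDegree ≤ 4 * β + 2 * γ := by
  have hadd : ∀ {p r : Polynomial K} {n : ℕ}, p.natDegree ≤ n → r.natDegree ≤ n →
      (p + r).natDegree ≤ n := Polynomial.natDegree_add_le_of_degree_le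
  have hG : ∀ i ≤ 4, (prodForm A L i).natDegree ≤ α + δ := fun i hi => by
    have M : ∀ j k, (A j * L k).natDegree ≤ α + δ := fun j k =>
      Polynomial.natDegree_mul_le_of_le (hA j) (hL k)
    have hc : i = 0 ∨ i = 1 ∨ i = 2 ∨ i = 3 ∨ i = 4 := by omega
    rcases hc with rfl | rfl | rfl | rfl | rfl <;> simp only [prodForm]
    exacts [M _ _, hadd (M _ _) (M _ _), hadd (M _ _) (M _ _), hadd (M _ _) (M _ _), M _ _]
  have hh : ∀ i ≤ 4, (Q 1 ^ 2 * prodForm A L i).natDegree ≤ γ := fun i hi =>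
    (Polynomial.natDegree_mul_le_of_le (Polynomial.natDegree_pow_le_of_le 2 (hQ 1)) (hG i hi)).trans
      (by omega)
  have hg : ∀ i ≤ 4, (prodForm A L i ^ 2).natDegree ≤ γ := fun i hi =>
    (Polynomial.natDegree_pow_le_of_le 2 (hG i hi)).trans (by omega)
  have hf : ∀ i, i ≤ 4 → (corrForm (Q 1) (prodForm A L) i).natDegree ≤ γ + i * 0 := fun i hi => by
    clear hG
    generalize prodForm A L = g at *
    rw [mul_zero, add_zero]
    have hc : i = 0 ∨ i = 1 ∨ i = 2 ∨ i = 3 ∨ i = 4 := by omega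
    rcases hc with rfl | rfl | rfl | rfl | rfl <;> simp only [corrForm]
    exacts [hadd (hg _ (by simp)) (hh _ (by simp)), hh _ (by simp), hh _ (by simp), hh _ (by simp),
      hadd (hg _ (by simp)) (hh _ (by simp))]
  have := natDegree_res24_le (β := β) (fun i _ => (hQ i).trans (by omega)) hf
  simpa [residualDisc] using this

/-- The residual discriminant, as a polynomial in the plane parameter. -/
noncomputable def resDisc (c : ℕ → ℕ → ℕ → K) : Polynomial K :=
  residualDisc (polyA c) (polyQ c) (polyL c)

theorem eval_resDisc (c : ℕ → ℕ → ℕ → K) (t : K) :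
    (resDisc c).eval t = residualDisc (resA c t) (resQ c t) (resL c t) := by
  rw [resDisc, ← Polynomial.coe_evalRingHom, residualDisc_map]
  simp only [Polynomial.coe_evalRingHom, eval_polyA, eval_polyQ, eval_polyL]

theorem natDegree_resDisc_le (c : ℕ → ℕ → ℕ → K) : (resDisc c).natDegree ≤ 24 := by
  refine natDegree_residualDisc_le (α := 1) (β := 2) (δ := 3) (γ := 8) (fun k => ?_) (fun k => ?_)
    (fun k => ?_) (by simp) (by simp)
  · simp only [polyA, resA]; compute_degree
  · simp only [polyQ, resQ]; compute_degree
  · simp only [polyL, resL]; compute_degree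

variable [CharP K 2]

theorem quartic_residual_shear {c : ℕ → ℕ → ℕ → K} (hv : VanishesOnLine c)
    (hm : c 4 0 0 = 0 ∧ c 3 1 0 = 0 ∧ c 2 2 0 = 0 ∧ c 1 3 0 = 0 ∧ c 0 4 0 = 0) (t κ x z w : K) :
    quartic c x (t * x) (z + κ * w) w = x * (cubic (shear3 κ (resA c t)) z w +
      x * (resQ c t 2 * z ^ 2 + resQ c t 1 * z * w + shear2 κ (resQ c t) 0 * w ^ 2) +
      x ^ 2 * (resL c t 1 * z + shear1 κ (resL c t) 0 * w)) := by
  have h2 : (2 : K) = 0 := CharTwo.two_eq_zero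
  rw [quartic_residual hv hm]
  simp only [cubic, shear3, shear2, shear1]
  linear_combination x * (resA c t 3 * κ * z * w * (z + κ * w) + resA c t 2 * κ * z * w ^ 2 +
    x * resQ c t 2 * κ * z * w) * h2

theorem sq_dvd_residualDisc {A' Q' L' : ℕ → Polynomial K} {A Q L : ℕ → K} {t μ : K}
    (eA : ∀ i ≤ 3, (A' i).eval t = A i) (eQ : ∀ i ≤ 2, (Q' i).eval t = Q i)
    (eL : ∀ i ≤ 1, (L' i).eval t = L i) (k1 : A 0 = 0) (k2 : μ * A 1 + Q 0 = 0)
    (k3 : μ ^ 2 * A 2 + μ * Q 1 + L 0 = 0) (k4 : μ * (μ ^ 2 * A 3 + μ * Q 2 + L 1) = 0) :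
    (Polynomial.X - Polynomial.C t) ^ 2 ∣ residualDisc A' Q' L' := by
  have hd : ∀ p : Polynomial K, p.eval t = 0 → Polynomial.X - Polynomial.C t ∣ p :=
    fun p hp => Polynomial.dvd_iff_isRoot.2 hp
  by_cases hμ : μ = 0
  · subst hμ
    refine sq_dvd_residualDisc_of_zero (hd _ ?_) (hd _ ?_) (hd _ ?_)
    · rw [eA 0 (by simp), k1]
    · rw [eQ 0 (by simp)]; linear_combination k2
    · rw [eL 0 (by simp)]; linear_combination k3
  have k5 : μ ^ 2 * A 3 + μ * Q 2 + L 1 = 0 := by simpa [hμ] using k4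
  obtain ⟨ν, hν⟩ : ∃ ν, μ * ν = 1 := ⟨μ⁻¹, mul_inv_cancel₀ hμ⟩
  have h2 : (2 : K) = 0 := CharTwo.two_eq_zero
  have e1 : A 1 = ν * Q 0 := by linear_combination ν * k2 - A 1 * hν - ν * Q 0 * h2
  have e2 : A 2 = ν * Q 1 + ν ^ 2 * L 0 := by
    linear_combination ν ^ 2 * k3 - A 2 * (μ * ν + 1) * hν - ν * Q 1 * hν - ν * Q 1 * h2 -
      ν ^ 2 * L 0 * h2
  have e3 : A 3 = ν * Q 2 + ν ^ 2 * L 1 := by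
    linear_combination ν ^ 2 * k5 - A 3 * (μ * ν + 1) * hν - ν * Q 2 * hν - ν * Q 2 * h2 -
      ν ^ 2 * L 1 * h2
  let u : ℕ → K := fun i => if i = 1 then ν * L 0 else if i = 2 then ν * L 1 else 0
  have u0 : u 0 = 0 := by simp [u]
  have u1 : u 1 = ν * L 0 := by simp [u]
  have u2 : u 2 = ν * L 1 := by simp [u]
  have main : ∀ i ≤ 4, corrForm (Q 1) (prodForm A L) i =
      mulForm Q (fun j => u 1 ^ 2 * Q j + Q 1 ^ 2 * u j) i := by
    refine corrForm_eq_mulForm ?_ ?_ ?_ ?_ ?_ <;> simp only [prodForm, u0, u1, u2, k1, e1, e2, e3]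
    · ring
    · ring
    · ring
    · linear_combination ν ^ 2 * L 0 * L 1 * h2
    · ring
  refine sq_dvd_res24_of_mulForm (k := fun j => .C (u 1 ^ 2 * Q j + Q 1 ^ 2 * u j)) fun i hi => hd _ ?_
  have := main i hi
  clear_value u
  clear u0 u1 u2 e1 e2 e3 k1 k2 k3 k4 k5 main
  have hc : i = 0 ∨ i = 1 ∨ i = 2 ∨ i = 3 ∨ i = 4 := by omega
  rcases hc with rfl | rfl | rfl | rfl | rfl <;>
    simp only [corrForm, prodForm, mulForm] at this <;>
    simp only [corrForm, prodForm, mulForm, Polynomial.eval_sub, Polynomial.eval_add,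
      Polynomial.eval_mul, Polynomial.eval_pow, Polynomial.eval_C, eA 0 (by simp), eA 1 (by simp),
      eA 2 (by simp), eA 3 (by simp), eQ 0 (by simp), eQ 1 (by simp), eQ 2 (by simp), eL 0 (by simp),
      eL 1 (by simp)] <;> rw [this, sub_self]

/-- A line meeting both the line and the vertex line gives a double zero of the discriminant. -/
theorem sq_dvd_resDisc [Infinite K] {c : ℕ → ℕ → ℕ → K} (hv : VanishesOnLine c)
    (hm : c 4 0 0 = 0 ∧ c 3 1 0 = 0 ∧ c 2 2 0 = 0 ∧ c 1 3 0 = 0 ∧ c 0 4 0 = 0) {t κ μ : K}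
    (h : ∀ n, quartic c n (t * n) (κ + n * μ) 1 = 0) :
    (Polynomial.X - Polynomial.C t) ^ 2 ∣ resDisc c := by
  set A := shear3 κ (resA c t) with hA
  set Q := shear2 κ (resQ c t) with hQ
  set L := shear1 κ (resL c t) with hL
  have hQ1 : Q 1 = resQ c t 1 := shear2_one _ _
  have key : ∀ n, 0 + A 0 * n + (μ * A 1 + Q 0) * n ^ 2 + (μ ^ 2 * A 2 + μ * Q 1 + L 0) * n ^ 3 +
      (μ * (μ ^ 2 * A 3 + μ * Q 2 + L 1)) * n ^ 4 = 0 := fun n => by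
    have := h n
    rw [show κ + n * μ = n * μ + κ * 1 by ring, quartic_residual_shear hv hm, ← hA, ← hQ,
      ← hL, ← hQ1, show resQ c t 2 = Q 2 from rfl, show resL c t 1 = L 1 from rfl] at this
    simp only [cubic] at this
    linear_combination this
  obtain ⟨-, k1, k2, k3, k4⟩ := coeffs_eq_zero_of_forall key
  rw [resDisc, ← residualDisc_shear (.C κ)]
  refine sq_dvd_residualDisc (fun i hi => ?_) (fun i hi => ?_) (fun i hi => ?_) k1 k2 k3 k4
  · have hc : i = 0 ∨ i = 1 ∨ i = 2 ∨ i = 3 := by omega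
    rcases hc with rfl | rfl | rfl | rfl <;> simp only [shear3, A, eval_polyA, Polynomial.eval_add,
      Polynomial.eval_mul, Polynomial.eval_pow, Polynomial.eval_C]
  · have hc : i = 0 ∨ i = 1 ∨ i = 2 := by omega
    rcases hc with rfl | rfl | rfl <;> simp only [shear2, Q, eval_polyQ, Polynomial.eval_add,
      Polynomial.eval_mul, Polynomial.eval_pow, Polynomial.eval_C, Polynomial.eval_ofNat]
  · have hc : i = 0 ∨ i = 1 := by omega
    rcases hc with rfl | rfl <;> simp only [shear1, L, eval_polyL, Polynomial.eval_add,
      Polynomial.eval_mul, Polynomial.eval_C]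
end Field

section Field
variable {K : Type*} [Field K]

theorem residual_lin_ne_zero {c : ℕ → ℕ → ℕ → K} (hc : SmoothCoeffs c)
    (hm : c 4 0 0 = 0 ∧ c 3 1 0 = 0 ∧ c 2 2 0 = 0 ∧ c 1 3 0 = 0 ∧ c 0 4 0 = 0) {t : K}
    (h0 : resL c t 0 = 0) (h1 : resL c t 1 = 0) : False := by
  obtain ⟨m1, m2, m3, m4, m5⟩ := hm
  simp only [resL] at h0 h1
  refine one_ne_zero (hc 1 t 0 0 ?_ ?_ ?_ ?_ ?_).1
  · simp only [quartic, m1, m2, m3, m4, m5]; ring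
  · simp only [quarticX, m2, m4]; ring
  · simp only [quarticY, m2, m4]; ring
  · simp only [quarticZ]; linear_combination h1
  · simp only [quarticW]; linear_combination h0

variable [CharP K 2]

theorem singular_of_residual {c : ℕ → ℕ → ℕ → K} (hc : SmoothCoeffs c) (hv : VanishesOnLine c)
    (hm : c 4 0 0 = 0 ∧ c 3 1 0 = 0 ∧ c 2 2 0 = 0 ∧ c 1 3 0 = 0 ∧ c 0 4 0 = 0) {t κ x : K}
    (h0 : shear2 κ (resQ c t) 0 = 0)
    (h1 : shear3 κ (resA c t) 0 + x ^ 2 * shear1 κ (resL c t) 0 = 0)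
    (h2 : shear3 κ (resA c t) 1 + x * resQ c t 1 + x ^ 2 * resL c t 1 = 0)
    (h3 : c 0 1 0 + κ * c 0 1 1 + κ ^ 2 * c 0 1 2 + κ ^ 3 * c 0 1 3 +
      x * (c 1 1 0 + κ * c 1 1 1 + κ ^ 2 * c 1 1 2) +
      x ^ 2 * (c 2 1 0 + κ * c 2 1 1 + t ^ 2 * (c 0 3 0 + κ * c 0 3 1)) = 0) : False := by
  have hF : quartic c x (t * x) κ 1 = 0 := by
    have := quartic_residual_shear hv hm t κ x 0 1
    rw [show (0 : K) + κ * 1 = κ by ring] at this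
    rw [this, h0]
    simp only [cubic]
    linear_combination x * h1
  have e2 : (2 : K) = 0 := CharTwo.two_eq_zero
  obtain ⟨m1, m2, m3, m4, m5⟩ := hm
  have v0 := hv 0 (by simp)
  have v1 := hv 1 (by simp)
  have v2 := hv 2 (by simp)
  have v3 := hv 3 (by simp)
  have v4 := hv 4 (by simp)
  have hY : quarticY c x (t * x) κ 1 = 0 := by
    rw [← h3]; simp only [quarticY, m2, m4]; ring
  have hZ : quarticZ c x (t * x) κ 1 = 0 := by
    simp only [quarticZ, v1, v3]
    simp only [shear3, resA, resQ, resL] at h2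
    linear_combination x * h2
  have hX : quarticX c x (t * x) κ 1 = 0 := by
    have : quarticX c x (t * x) κ 1 + t * quarticY c x (t * x) κ 1 = 0 := by
      simp only [quarticX, quarticY, m2, m4]
      simp only [shear3, shear1, resA, resL] at h1
      linear_combination h1 + (x * t * (c 1 1 0 + κ * c 1 1 1 + κ ^ 2 * c 1 1 2)) * e2
    rw [hY] at this
    linear_combination this
  have hW : quarticW c x (t * x) κ 1 = 0 := by
    have : quarticW c x (t * x) κ 1 = x * quarticX c x (t * x) κ 1 +
        t * x * quarticY c x (t * x) κ 1 + κ * quarticZ c x (t * x) κ 1 := by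
      simp only [quarticX, quarticY, quarticZ, quarticW, m2, m4, v1, v3]
      clear h0 h1 h2 h3 hF hX hY hZ hc hv m1 m2 m3 m4 m5 v0 v1 v2 v3 v4
      generalize c 1 0 0 = a1, c 1 0 1 = a2, c 1 0 2 = a3, c 1 0 3 = a4, c 0 1 0 = a5, c 0 1 1 = a6,
        c 0 1 2 = a7, c 0 1 3 = a8, c 1 1 0 = a9, c 1 1 1 = b1, c 1 1 2 = b2, c 1 2 0 = b3,
        c 1 2 1 = b4, c 3 0 0 = b5, c 3 0 1 = b6, c 0 3 0 = b7, c 0 3 1 = b8, c 2 1 0 = b9,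
        c 2 1 1 = d1, c 0 2 1 = d2, c 2 0 1 = d3
      grind
    rw [this, hX, hY, hZ]; ring
  exact one_ne_zero (hc _ _ _ _ hF hX hY hZ hW).2.2.2

theorem resDisc_ne_zero [IsAlgClosed K] {c : ℕ → ℕ → ℕ → K} (hc : SmoothCoeffs c)
    (hv : VanishesOnLine c)
    (hm : c 4 0 0 = 0 ∧ c 3 1 0 = 0 ∧ c 2 2 0 = 0 ∧ c 1 3 0 = 0 ∧ c 0 4 0 = 0) {t : K}
    (hq1 : resQ c t 1 ≠ 0) (hq2 : resQ c t 2 ≠ 0)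
    (h1 : ∀ m n : K, (∀ z w, quartic c (m * w + n * z) (t * (m * w + n * z)) z w = 0) →
      m = 0 ∧ n = 0)
    (h2 : ∀ κ, ¬ ∀ x w, quartic c x (t * x) (κ * w) w = 0) : resDisc c ≠ 0 := by
  intro hΔ
  have e2 : (2 : K) = 0 := CharTwo.two_eq_zero
  have hres : res24 (resQ c t) (corrForm (resQ c t 1) (prodForm (resA c t) (resL c t))) = 0 := by
    change residualDisc _ _ _ = 0
    rw [← eval_resDisc, hΔ, Polynomial.eval_zero]
  obtain ⟨κ, hκ, hf⟩ := exists_common_root hq2 hres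
  rw [← corrForm_prodForm_shear _ _ _ _ _ (by simp)] at hf
  rw [resDisc, ← residualDisc_shear (.C κ), residualDisc] at hΔ
  set A' := shear3 (.C κ) (polyA c) with hA'
  set Q' := shear2 (.C κ) (polyQ c) with hQ'
  set L' := shear1 (.C κ) (polyL c) with hL'
  set A := shear3 κ (resA c t) with hA
  set Q := shear2 κ (resQ c t) with hQ
  set L := shear1 κ (resL c t) with hL
  have hQ1 : Q 1 = resQ c t 1 := shear2_one _ _
  rw [← hQ1] at hf hq1
  have eA0 : (A' 0).eval t = A 0 := by simp [hA', hA, shear3, eval_polyA]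
  have eA1 : (A' 1).eval t = A 1 := by simp [hA', hA, shear3, eval_polyA]
  have eA2 : (A' 2).eval t = A 2 := by simp [hA', hA, shear3, eval_polyA]
  have eA3 : (A' 3).eval t = A 3 := by simp [hA', hA, shear3, eval_polyA]
  have eQ0 : (Q' 0).eval t = Q 0 := by simp [hQ', hQ, shear2, eval_polyQ]
  have eQ1 : (Q' 1).eval t = Q 1 := by simp [hQ', hQ, shear2, eval_polyQ]
  have eQ2 : (Q' 2).eval t = Q 2 := by simp [hQ', hQ, shear2, eval_polyQ]
  have eL0 : (L' 0).eval t = L 0 := by simp [hL', hL, shear1, eval_polyL]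
  have eL1 : (L' 1).eval t = L 1 := by simp [hL', hL, shear1, eval_polyL]
  have hplane : ∀ x z w, quartic c x (t * x) (z + κ * w) w = x * (cubic A z w +
      x * (Q 2 * z ^ 2 + Q 1 * z * w + Q 0 * w ^ 2) + x ^ 2 * (L 1 * z + L 0 * w)) := fun x z w => by
    rw [quartic_residual_shear hv hm, hQ1]; rfl
  have hfa : (A 0 * L 1 + A 1 * L 0) ^ 2 + Q 1 ^ 2 * (A 0 * L 0) = 0 := hf
  have hL0 : L 0 ≠ 0 := fun h => by
    rw [h] at hfa
    have hAL : A 0 * L 1 = 0 := by simpa using hfa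
    rcases mul_eq_zero.1 hAL with h' | h'
    · refine h2 κ fun x w => ?_
      have := hplane x 0 w
      rw [zero_add] at this
      rw [this, hκ, h]
      simp only [cubic, h']; ring
    · refine residual_lin_ne_zero hc hm (t := t) ?_ h'
      have : resL c t 0 + κ * resL c t 1 = 0 := h
      rwa [show resL c t 1 = 0 from h', mul_zero, add_zero] at this
  obtain ⟨e, he⟩ : Polynomial.X - Polynomial.C t ∣ Q' 0 :=
    Polynomial.dvd_iff_isRoot.2 (eQ0.trans hκ)
  obtain ⟨d, hd⟩ : Polynomial.X - Polynomial.C t ∣ corrForm (Q' 1) (prodForm A' L') 0 := by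
    refine Polynomial.dvd_iff_isRoot.2 ?_
    rw [Polynomial.IsRoot, ← hfa]
    simp [corrForm, prodForm, eA0, eA1, eL0, eL1, eQ1]
  have hder : ∀ p r : Polynomial K, p = (Polynomial.X - Polynomial.C t) * r →
      (Polynomial.derivative p).eval t = r.eval t := fun p r h => by simp [h]
  have hkey := dvd_of_res24_eq_zero (Polynomial.X_sub_C_ne_zero t) he hd hΔ
  rw [Polynomial.dvd_iff_isRoot, Polynomial.IsRoot, Polynomial.eval_mul, mul_eq_zero] at hkey
  rcases hkey with hkey | hkey
  · obtain ⟨x, hx⟩ : ∃ x, x * (Q 1 * L 0) = A 0 * L 1 + A 1 * L 0 :=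
      ⟨(A 0 * L 1 + A 1 * L 0) / (Q 1 * L 0), div_mul_cancel₀ _ (mul_ne_zero hq1 hL0)⟩
    have hxx : A 0 + x ^ 2 * L 0 = 0 := by
      refine mul_left_cancel₀ (mul_ne_zero (pow_ne_zero 2 hq1) hL0) ?_
      linear_combination hfa + (x * Q 1 * L 0 + (A 0 * L 1 + A 1 * L 0)) * hx
    have hed := hder _ _ he
    have hdd := hder _ _ hd
    have qD : (Polynomial.derivative (Q' 0)).eval t = c 1 1 0 + κ * c 1 1 1 + κ ^ 2 * c 1 1 2 := by
      simp [hQ', shear2, polyQ, resQ, Polynomial.derivative_pow]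
      linear_combination t * (c 0 2 0 + κ * c 0 2 1 + κ ^ 2 * c 0 2 2) * e2
    have aD : (Polynomial.derivative (A' 0)).eval t =
        c 0 1 0 + κ * c 0 1 1 + κ ^ 2 * c 0 1 2 + κ ^ 3 * c 0 1 3 := by
      simp [hA', shear3, polyA, resA, Polynomial.derivative_pow]
    have lD : (Polynomial.derivative (L' 0)).eval t =
        c 2 1 0 + κ * c 2 1 1 + t ^ 2 * (c 0 3 0 + κ * c 0 3 1) := by
      simp [hL', shear1, polyL, resL, Polynomial.derivative_pow]
      linear_combination (t * (c 1 2 0 + κ * c 1 2 1) + t ^ 2 * (c 0 3 0 + κ * c 0 3 1)) * e2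
    refine singular_of_residual hc hv hm (x := x) hκ hxx ?_ ?_
    · rw [← hQ1, show resL c t 1 = L 1 from rfl, ← hA]
      refine mul_left_cancel₀ hL0 ?_
      linear_combination hx + L 1 * hxx + A 1 * L 0 * e2
    · rw [← qD, ← aD, ← lD]
      have hdd' : Polynomial.eval t d = Q 1 ^ 2 * ((Polynomial.derivative (A' 0)).eval t * L 0 +
          A 0 * (Polynomial.derivative (L' 0)).eval t) := by
        rw [← hdd]
        simp only [corrForm, prodForm, Polynomial.derivative_add, Polynomial.derivative_mul,
          Polynomial.derivative_sq, Polynomial.eval_add, Polynomial.eval_mul, Polynomial.eval_C,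
          Polynomial.eval_pow, eA0, eL0, eQ1]
        rw [e2]; ring
      rw [Polynomial.eval_add, Polynomial.eval_mul, Polynomial.eval_mul, ← hed, hdd', eQ1,
        corrForm, Polynomial.eval_mul, Polynomial.eval_pow, eQ1, prodForm, Polynomial.eval_add,
        Polynomial.eval_mul, Polynomial.eval_mul, eA0, eA1, eL0, eL1, ← hx] at hkey
      refine mul_left_cancel₀ (mul_ne_zero (pow_ne_zero 3 hq1) hL0) ?_
      linear_combination hkey - Q 1 ^ 3 * (Polynomial.derivative (L' 0)).eval t * hxx +
        Q 1 ^ 3 * x ^ 2 * L 0 * (Polynomial.derivative (L' 0)).eval t * e2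
  · obtain ⟨m, n, l0, l1, l2, l3⟩ := exists_linear_root (a := A) (q := Q) (l := L) hL0 hκ hq1 hf (by
      rw [← hkey]
      simp [corrForm, prodForm, eA0, eA1, eA2, eA3, eL0, eL1, eQ1, eQ2]
      ring)
    have hmn := h1 (m + n * κ) n fun z w => by
      have := hplane (m * w + n * (z + κ * w)) (z + κ * w) w
      rw [show z + κ * w + κ * w = z by linear_combination κ * w * e2] at this
      rw [show (m + n * κ) * w + n * z = m * w + n * (z + κ * w) by ring, this]
      generalize z + κ * w = y
      simp only [cubic, l0, l1, l2, l3]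
      linear_combination (m * w + n * y) ^ 2 * (Q 2 * y ^ 2 + Q 1 * y * w + Q 0 * w ^ 2) * e2 +
        (m * w + n * y) * ((m ^ 2 * w ^ 2 + n ^ 2 * y ^ 2 + m * n * w * y) * (L 1 * y + L 0 * w)) * e2
    obtain ⟨hm', rfl⟩ := hmn
    rw [zero_mul, add_zero] at hm'
    subst hm'
    have a3 : resA c t 3 = 0 := by rw [show resA c t 3 = A 3 from rfl, l3]; ring
    have a2 : resA c t 2 = 0 := by
      have : resA c t 2 + κ * resA c t 3 = 0 := by
        rw [show resA c t 2 + κ * resA c t 3 = A 2 from rfl, l2]; ring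
      simpa [a3] using this
    have a1 : resA c t 1 = 0 := by
      have : resA c t 1 + κ ^ 2 * resA c t 3 = 0 := by
        rw [show resA c t 1 + κ ^ 2 * resA c t 3 = A 1 from rfl, l1]; ring
      simpa [a3] using this
    have a0 : resA c t 0 = 0 := by
      have : resA c t 0 + κ * resA c t 1 + κ ^ 2 * resA c t 2 + κ ^ 3 * resA c t 3 = 0 := by
        rw [show resA c t 0 + κ * resA c t 1 + κ ^ 2 * resA c t 2 + κ ^ 3 * resA c t 3 = A 0 from rfl,
          l0]
        ring
      simpa [a1, a2, a3] using this
    refine (hv.coprime hc).not_all_zero (α := 1) (β := t) (.inl one_ne_zero) fun z w => ?_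
    simp only [resA] at a0 a1 a2 a3
    simp only [cubic]
    linear_combination z ^ 3 * a3 + z ^ 2 * w * a2 + z * w ^ 2 * a1 + w ^ 3 * a0
end Field

section Residual
variable {K : Type*} [Field K]

theorem sum_le_natDegree_of_dvd {ι : Type*} {p : Polynomial K} (hp : p ≠ 0) (s : Finset ι) {a : ι → K}
    (ha : Set.InjOn a s) (k : ι → ℕ)
    (h : ∀ i ∈ s, (Polynomial.X - Polynomial.C (a i)) ^ k i ∣ p) : ∑ i ∈ s, k i ≤ p.natDegree := by
  have hd : ∏ i ∈ s, (Polynomial.X - Polynomial.C (a i)) ^ k i ∣ p := by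
    refine Finset.prod_dvd_of_coprime (fun i hi j hj hij => ?_) h
    refine IsCoprime.pow ?_
    have hne : a j - a i ≠ 0 := sub_ne_zero.2 fun e => hij (ha hj hi e).symm
    exact ⟨.C (a j - a i)⁻¹, -.C (a j - a i)⁻¹, by
      rw [show Polynomial.C (a j - a i)⁻¹ * (Polynomial.X - Polynomial.C (a i)) +
        -Polynomial.C (a j - a i)⁻¹ * (Polynomial.X - Polynomial.C (a j)) =
        Polynomial.C ((a j - a i)⁻¹ * (a j - a i)) by simp only [map_mul, map_sub]; ring,
        inv_mul_cancel₀ hne, map_one]⟩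
  have := Polynomial.natDegree_le_of_dvd hd hp
  rwa [Polynomial.natDegree_prod_of_monic _ _ fun i _ => (Polynomial.monic_X_sub_C _).pow _,
    Finset.sum_congr rfl fun i _ => by
      rw [Polynomial.natDegree_pow, Polynomial.natDegree_X_sub_C, mul_one]] at this

theorem mem_lines_of_pair {F : MvPolynomial (Fin 4) K} {u v : Fin 4 → K}
    (h : ∀ z w : K, z • u + w • v = 0 → z = 0 ∧ w = 0)
    (h0 : ∀ z w : K, eval (z • u + w • v) F = 0) : Submodule.span K {u, v} ∈ lines F :=
  ⟨finrank_span_pair h, fun x hx => by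
    obtain ⟨z, w, rfl⟩ := Submodule.mem_span_pair.1 hx; exact h0 z w⟩

theorem coord_pt {b : Module.Basis (Fin 4) K (Fin 4 → K)} (x y z w : K) (i : Fin 4) :
    b.coord i (pt b x y z w) = ![x, y, z, w] i := by
  fin_cases i <;> simp [pt]

theorem exists_resQ_zero_finite [Infinite K] {c : ℕ → ℕ → ℕ → K} {k : ℕ} (h : ∃ t, resQ c t k ≠ 0) :
    {t | resQ c t k = 0}.Finite := by
  have h0 : polyQ c k ≠ 0 := fun h0 => by
    obtain ⟨t, ht⟩ := h
    exact ht (by rw [← eval_polyQ, h0, Polynomial.eval_zero])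
  refine (Polynomial.finite_setOfPred_isRoot h0).subset fun t ht => ?_
  simpa [Polynomial.IsRoot, eval_polyQ] using ht

variable [IsAlgClosed K] [CharP K 2] {F : MvPolynomial (Fin 4) K}

theorem ncard_nbrs_le_twelve_of_coords (hF : IsSmoothQuartic F) (hN : NoTriple F)
    {b : Module.Basis (Fin 4) K (Fin 4 → K)} {c : ℕ → ℕ → ℕ → K} (hc : Coords F b c)
    (hl : Submodule.span K {b 2, b 3} ∈ lines F) (hm : ∀ x y, eval (pt b x y 0 0) F = 0)
    (hoff : ∀ W ∈ lines F, W ≠ Submodule.span K {b 2, b 3} → b 2 ∉ W)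
    (hx : ∀ n ∈ nbrs F (Submodule.span K {b 2, b 3}), ∀ y z w, pt b 0 y z w ∈ n → y = 0)
    (hq1 : ∃ t, resQ c t 1 ≠ 0) (hq2 : ∃ t, resQ c t 2 ≠ 0) :
    (nbrs F (Submodule.span K {b 2, b 3})).ncard ≤ 12 := by
  have : Infinite K := IsAlgClosed.instInfinite
  classical
  set W := Submodule.span K {b 2, b 3} with hW
  have hv : VanishesOnLine c := coords_vanishesOnLine hc hl
  have hm' : c 4 0 0 = 0 ∧ c 3 1 0 = 0 ∧ c 2 2 0 = 0 ∧ c 1 3 0 = 0 ∧ c 0 4 0 = 0 := by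
    have h4 : ∀ y : K, c 4 0 0 + c 3 1 0 * y + c 2 2 0 * y ^ 2 + c 1 3 0 * y ^ 3 +
        c 0 4 0 * y ^ 4 = 0 := fun y => by
      rw [← hm 1 y, hc.2]; simp only [quartic]; ring
    exact coeffs_eq_zero_of_forall h4
  have hex : ∀ n ∈ nbrs F W, ∃ t κ μ : K, pt b 0 0 κ 1 ∈ n ∧ pt b 1 t μ 0 ∈ n ∧
      ∀ v ∈ n, ∃ p q : K, v = p • pt b 0 0 κ 1 + q • pt b 1 t μ 0 := fun n hn => by
    obtain ⟨s, μ, -, hs⟩ := exists_lineAt hc hv hn (hoff n hn.1 hn.2.1)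
    have hd := mem_lineAt (b := b) (c := c) (s := s) (μ := μ)
      (v := pt b ((pB c).eval s) ((pA c).eval s) μ 0) |>.2 ⟨0, 1, by simp⟩
    have hd0 := mem_lineAt (b := b) (c := c) (s := s) (μ := μ) (v := pt b 0 0 s 1) |>.2
      ⟨1, 0, by simp⟩
    have hB : (pB c).eval s ≠ 0 := fun h0 => by
      rw [h0, hs] at hd
      have := hx n hn _ _ _ hd
      rcases pA_pB_ne_zero hc.1 hv s with h | h
      exacts [h this, h h0]
    refine ⟨(pA c).eval s / (pB c).eval s, s, μ / (pB c).eval s, hs ▸ hd0, ?_, fun v hv => ?_⟩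
    · have := n.smul_mem ((pB c).eval s)⁻¹ (hs ▸ hd)
      convert this using 1
      simp only [pt, smul_add, smul_smul, inv_mul_cancel₀ hB, div_eq_inv_mul, mul_zero]
    · rw [← hs] at hv
      obtain ⟨p, q, rfl⟩ := mem_lineAt.1 hv
      refine ⟨p, q * (pB c).eval s, ?_⟩
      simp only [pt, smul_add, smul_smul]
      rw [mul_assoc q _ (_ / _), mul_div_cancel₀ _ hB, mul_assoc q _ (μ / _),
        mul_div_cancel₀ _ hB]
      module
  choose! t κ μ hκ ht hspan using hex
  let φ : K → (Fin 4 → K) →ₗ[K] K := fun t => b.coord 1 - t • b.coord 0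
  have hφpt : ∀ t x y z w, φ t (pt b x y z w) = y - t * x := fun t x y z w => by
    simp only [φ, LinearMap.sub_apply, LinearMap.smul_apply, coord_pt]; simp
  have hφ : ∀ t, φ t ≠ 0 := fun t h => by
    have := hφpt t 0 1 0 0
    rw [h] at this; simp at this
  have hWφ : ∀ t, W ≤ LinearMap.ker (φ t) := fun t v hv => by
    obtain ⟨z, w, rfl⟩ := Submodule.mem_span_pair.1 hv
    have := hφpt t 0 0 z w
    simpa [pt] using this
  have hnφ : ∀ n ∈ nbrs F W, n ≤ LinearMap.ker (φ (t n)) := fun n hn v hv => by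
    obtain ⟨p, q, rfl⟩ := hspan n hn v hv
    simp [hφpt]
  have hinj : Set.InjOn t (nbrs F W) := fun n hn n' hn' h =>
    hN _ (hφ (t n)) W hl n hn.1 n' hn'.1 (hWφ _) (hnφ n hn) (h ▸ hnφ n' hn') hn.2.1.symm
      hn'.2.1.symm
  have hdvd : ∀ n ∈ nbrs F W, (Polynomial.X - Polynomial.C (t n)) ^ 2 ∣ resDisc c := fun n hn => by
    refine sq_dvd_resDisc hv hm' (κ := κ n) (μ := μ n) fun r => ?_
    rw [← hc.2]
    refine hn.1.2 _ ?_
    convert n.add_mem (hκ n hn) (n.smul_mem r (ht n hn)) using 1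
    simp only [pt]; module
  have hΔ : resDisc c ≠ 0 := by
    obtain ⟨s, hs⟩ := (((exists_resQ_zero_finite hq1).union (exists_resQ_zero_finite hq2)).union
      ((finite_nbrs hF W).image t)).exists_notMem
    simp only [Set.mem_union, Set.mem_ofPred_eq, not_or] at hs
    obtain ⟨⟨hs1, hs2⟩, hs3⟩ := hs
    have honly : ∀ L ∈ lines F, L ≤ LinearMap.ker (φ s) → L = W := fun L hL hLφ => by
      by_contra hne
      obtain ⟨v, hvW, hvL, hv0⟩ := exists_common (hφ s) hl.1 hL.1 (hWφ s) hLφ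
      have hn : L ∈ nbrs F W := ⟨hL, hne, v, hvL, hvW, hv0⟩
      have := hLφ (ht L hn)
      rw [LinearMap.mem_ker, hφpt] at this
      exact hs3 ⟨L, hn, by linear_combination this⟩
    have hWx : ∀ x y z w, pt b x y z w ∈ W → x = 0 := fun x y z w h => by
      obtain ⟨p, q, h⟩ := Submodule.mem_span_pair.1 h
      have e : pt b x y (z - p) (w - q) = 0 := by
        rw [← sub_eq_zero] at h
        rw [← neg_eq_zero, ← h]; simp only [pt]; module
      exact (pt_eq_zero.1 e).1
    refine resDisc_ne_zero hc.1 hv hm' hs1 hs2 (fun m n h => ?_) fun κ' h => ?_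
    · have e : ∀ z w : K, z • pt b n (s * n) 1 0 + w • pt b m (s * m) 0 1 =
          pt b (m * w + n * z) (s * (m * w + n * z)) z w := fun z w => by
        simp only [pt]; module
      have hL := mem_lines_of_pair (F := F) (u := pt b n (s * n) 1 0) (v := pt b m (s * m) 0 1)
        (fun z w h => by
          rw [e] at h
          exact (pt_eq_zero.1 h).2.2) fun z w => by rw [e, hc.2, h]
      have := honly _ hL fun v hv => by
        obtain ⟨z, w, rfl⟩ := Submodule.mem_span_pair.1 hv
        rw [e, LinearMap.mem_ker, hφpt]; ring
      refine ⟨hWx _ _ _ _ (this ▸ Submodule.subset_span (by simp) :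
        pt b m (s * m) 0 1 ∈ W), hWx _ _ _ _ (this ▸ Submodule.subset_span (by simp) :
        pt b n (s * n) 1 0 ∈ W)⟩
    · have e : ∀ z w : K, z • pt b 1 s 0 0 + w • pt b 0 0 κ' 1 =
          pt b z (s * z) (κ' * w) w := fun z w => by
        simp only [pt]; module
      have hL := mem_lines_of_pair (F := F) (u := pt b 1 s 0 0) (v := pt b 0 0 κ' 1)
        (fun z w h => by
          rw [e] at h
          exact ⟨(pt_eq_zero.1 h).1, (pt_eq_zero.1 h).2.2.2⟩) fun z w => by rw [e, hc.2, h]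
      have := honly _ hL fun v hv => by
        obtain ⟨z, w, rfl⟩ := Submodule.mem_span_pair.1 hv
        rw [e, LinearMap.mem_ker, hφpt]; ring
      exact one_ne_zero (hWx _ _ _ _ (this ▸ Submodule.subset_span (by simp) :
        pt b 1 s 0 0 ∈ W))
  have hsum := sum_le_natDegree_of_dvd hΔ (finite_nbrs hF W).toFinset (a := t)
    (by rwa [Set.Finite.coe_toFinset]) (fun _ => 2) (fun n hn => hdvd n (by simpa using hn))
  rw [Finset.sum_const, smul_eq_mul] at hsum
  have := natDegree_resDisc_le c
  rw [Set.ncard_eq_toFinset_card _ (finite_nbrs hF _)]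
  omega

end Residual

section Residual
variable {K : Type*} [Field K]

theorem quartic_shear_coeff [Infinite K] {c c' : ℕ → ℕ → ℕ → K} {κ : K}
    (h : ∀ x y z w, quartic c' x y z w = quartic c x y z (w + κ * z)) (i j k : ℕ)
    (hijk : i + j + k ≤ 4) : c' i j k =
      ∑ l ∈ Finset.range (k + 1), c i j l * κ ^ (k - l) * ((4 - i - j - l).choose (k - l) : ℕ) := by
  refine quartic_ext (d := fun i j k => ∑ l ∈ Finset.range (k + 1),
    c i j l * κ ^ (k - l) * ((4 - i - j - l).choose (k - l) : ℕ)) (fun x y z w => ?_) i j k hijk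
  rw [h]
  simp [quartic, Finset.sum_range_succ, Nat.choose]
  ring

theorem finite_setOf_quadratic {a0 a1 a2 : K} (h : a1 ≠ 0) :
    {κ : K | a0 + κ * a1 + κ ^ 2 * a2 = 0}.Finite := by
  have h0 : (.C a0 + .C a1 * .X + .C a2 * .X ^ 2 : Polynomial K) ≠ 0 := fun h0 => h (by
    simpa [Polynomial.coeff_X, Polynomial.coeff_C, Polynomial.coeff_X_pow] using
      congrArg (fun p => p.coeff 1) h0)
  refine (Polynomial.finite_setOfPred_isRoot h0).subset fun κ hκ => ?_
  simp only [Set.mem_ofPred_eq, Polynomial.IsRoot.def, Polynomial.eval_add, Polynomial.eval_mul,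
    Polynomial.eval_C, Polynomial.eval_X, Polynomial.eval_pow] at hκ ⊢
  linear_combination hκ

theorem exists_basis_of_skew {W W' : Submodule K (Fin 4 → K)} (hW : Module.finrank K W = 2)
    (hW' : Module.finrank K W' = 2) (h : ∀ v ∈ W, v ∈ W' → v = 0) :
    ∃ b : Module.Basis (Fin 4) K (Fin 4 → K), b 0 ∈ W' ∧ b 1 ∈ W' ∧ b 2 ∈ W ∧ b 3 ∈ W := by
  obtain ⟨u, hu, v, hv, huv⟩ := exists_pair hW'
  obtain ⟨u', hu', v', hv', huv'⟩ := exists_pair hW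
  obtain ⟨b, hb⟩ := exists_basis ![u, v, u', v'] fun x y z w e => by
    simp only [Matrix.cons_val] at e
    have h1 : z • u' + w • v' = 0 := by
      refine h _ (W.add_mem (W.smul_mem _ hu') (W.smul_mem _ hv')) ?_
      have : z • u' + w • v' = -(x • u + y • v) := by
        rw [eq_neg_iff_add_eq_zero, ← e]; module
      rw [this]
      exact W'.neg_mem (W'.add_mem (W'.smul_mem _ hu) (W'.smul_mem _ hv))
    have h2 : x • u + y • v = 0 := by
      have e' : x • u + y • v + (z • u' + w • v') = 0 := by rw [← e]; module
      rwa [h1, add_zero] at e'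
    exact ⟨(huv _ _ h2).1, (huv _ _ h2).2, (huv' _ _ h1).1, (huv' _ _ h1).2⟩
  exact ⟨b, by simpa [hb] using hu, by simpa [hb] using hv, by simpa [hb] using hu',
    by simpa [hb] using hv'⟩

theorem span_eq_of_mem {W : Submodule K (Fin 4 → K)} (hW : Module.finrank K W = 2)
    {b : Module.Basis (Fin 4) K (Fin 4 → K)} (h2 : b 2 ∈ W) (h3 : b 3 ∈ W) :
    Submodule.span K {b 2, b 3} = W :=
  span_pair_eq hW h2 h3 (pair_independent b)

variable [IsAlgClosed K] [CharP K 2] {F : MvPolynomial (Fin 4) K}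

/-- A line that is not inert has at most twelve neighbours. -/
theorem ncard_nbrs_le_twelve (hF : IsSmoothQuartic F) (hN : NoTriple F)
    {W m : Submodule K (Fin 4 → K)} (hl : W ∈ lines F) (hi : ¬ Inert F W) (hm : m ∈ lines F)
    (hmW : m ≠ W) (hmn : m ∉ nbrs F W) : (nbrs F W).ncard ≤ 12 := by
  have : Infinite K := IsAlgClosed.instInfinite
  obtain ⟨b₀, h0, h1, h2, h3⟩ := exists_basis_of_skew hl.1 hm.1 fun v hv hv' => by
    by_contra hv0
    exact hmn ⟨hm, hmW, v, hv', hv, hv0⟩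
  have hspan₀ := span_eq_of_mem hl.1 h2 h3
  obtain ⟨lam, hlam⟩ := ((finite_nbrs hF W).biUnion
    (t := fun n => {lam : K | ∃ z w, pt b₀ lam 1 z w ∈ n}) fun n hn => by
      refine Set.Subsingleton.finite ?_
      rintro x ⟨z, w, hx⟩ x' ⟨z', w', hx'⟩
      obtain ⟨hnl, -, p, hpn, hp, hp0⟩ := hn
      rw [← hspan₀] at hp
      obtain ⟨α, β, rfl⟩ := Submodule.mem_span_pair.1 hp
      have hsp := span_pair_eq hnl.1 hx hpn fun y' t e => by
        have e' : pt b₀ (y' * x) y' (y' * z + t * α) (y' * w + t * β) = 0 := by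
          rw [← e]; simp only [pt]; module
        have hy := (pt_eq_zero.1 e').2.1
        rw [hy, zero_smul, zero_add] at e
        exact ⟨hy, (smul_eq_zero.1 e).resolve_right hp0⟩
      rw [← hsp] at hx'
      obtain ⟨y', t, e⟩ := Submodule.mem_span_pair.1 hx'
      have e' : pt b₀ (y' * x - x') (y' - 1) (y' * z + t * α - z') (y' * w + t * β - w') = 0 := by
        rw [← sub_eq_zero] at e
        rw [← e]; simp only [pt]; module
      have h1 := (pt_eq_zero.1 e').1
      have h2 := (pt_eq_zero.1 e').2.1
      linear_combination h1 - x * h2).exists_notMem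
  simp only [Set.mem_iUnion, Set.mem_ofPred_eq, not_exists] at hlam
  let u : Fin 4 → Fin 4 → K := ![b₀ 0, b₀ 1 + lam • b₀ 0, b₀ 2, b₀ 3]
  have hu : ∀ x y z w : K, x • u 0 + y • u 1 + z • u 2 + w • u 3 = pt b₀ (x + lam * y) y z w :=
    fun x y z w => by simp only [u, pt, Matrix.cons_val]; module
  obtain ⟨b₁, hb₁⟩ := exists_basis u fun x y z w h => by
    rw [hu] at h
    obtain ⟨h1, h2, h3, h4⟩ := pt_eq_zero.1 h
    exact ⟨by linear_combination h1 - lam * h2, h2, h3, h4⟩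
  have hpt₁ : ∀ x y z w, pt b₁ x y z w = pt b₀ (x + lam * y) y z w := fun x y z w => by
    rw [← hu, pt, hb₁, hb₁, hb₁, hb₁]
  have hspan₁ : Submodule.span K {b₁ 2, b₁ 3} = W :=
    span_eq_of_mem hl.1 (by simpa [hb₁, u] using h2) (by simpa [hb₁, u] using h3)
  obtain ⟨c₁, hc₁⟩ := hF.coords b₁
  have hne : c₁ 2 0 1 ≠ 0 ∨ c₁ 1 1 1 ≠ 0 ∨ c₁ 0 2 1 ≠ 0 := by
    by_contra! hne
    exact hi (hspan₁ ▸ inert_of_coords hc₁ (coords_vanishesOnLine hc₁ (hspan₁ ▸ hl)) hne.1 hne.2.1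
      hne.2.2)
  have hfin : {κ : K | c₁ 2 0 2 + κ * c₁ 2 0 1 + κ ^ 2 * c₁ 2 0 0 = 0 ∧
      c₁ 1 1 2 + κ * c₁ 1 1 1 + κ ^ 2 * c₁ 1 1 0 = 0 ∧
      c₁ 0 2 2 + κ * c₁ 0 2 1 + κ ^ 2 * c₁ 0 2 0 = 0}.Finite := by
    rcases hne with h | h | h
    · exact (finite_setOf_quadratic h).subset fun κ hκ => hκ.1
    · exact (finite_setOf_quadratic h).subset fun κ hκ => hκ.2.1
    · exact (finite_setOf_quadratic h).subset fun κ hκ => hκ.2.2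
  obtain ⟨κ, hκ, b, hpt, hspan, hoff⟩ := exists_shear hF b₁ hfin
  obtain ⟨c, hc⟩ := hF.coords b
  have hsh := quartic_shear_coeff (shear_rel hc₁ hc hpt)
  have hspanW := hspan.trans hspan₁
  rw [hspanW] at hoff
  have e2 : (2 : K) = 0 := CharTwo.two_eq_zero
  have hQ : ∀ k, (¬ (c 2 0 k = 0 ∧ c 1 1 k = 0 ∧ c 0 2 k = 0)) → ∃ t, resQ c t k ≠ 0 :=
    fun k hk => by
      by_contra! h
      obtain ⟨h0, h1, h2, -, -⟩ := coeffs_eq_zero_of_forall (a0 := c 2 0 k) (a1 := c 1 1 k)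
        (a2 := c 0 2 k) (a3 := 0) (a4 := 0) fun t => by have := h t; simp only [resQ] at this; linear_combination this
      exact hk ⟨h0, h1, h2⟩
  subst hspanW
  refine ncard_nbrs_le_twelve_of_coords hF hN hc hl (fun x y => ?_) hoff (fun n hn y z w h => ?_)
    (hQ 1 ?_) (hQ 2 ?_)
  · refine hm.2 _ ?_
    rw [hpt, hpt₁]
    simp only [pt, mul_zero, add_zero, zero_smul]
    exact m.add_mem (m.smul_mem _ h0) (m.smul_mem _ h1)
  · by_contra hy
    rw [hpt, hpt₁] at h
    refine hlam n hn (y⁻¹ * z) (y⁻¹ * (w + κ * z)) ?_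
    convert n.smul_mem y⁻¹ h using 1
    simp only [pt, smul_add, smul_smul, zero_add, mul_left_comm y⁻¹ lam y, inv_mul_cancel₀ hy,
      mul_one]
  · rw [hsh 2 0 1 (by simp), hsh 1 1 1 (by simp), hsh 0 2 1 (by simp)]
    simp only [Finset.sum_range_succ, Finset.sum_range_zero]
    norm_num
    intro h h' h''
    rcases hne with h0 | h0 | h0
    · exact h0 (by linear_combination h - c₁ 2 0 0 * κ * e2)
    · exact h0 (by linear_combination h' - c₁ 1 1 0 * κ * e2)
    · exact h0 (by linear_combination h'' - c₁ 0 2 0 * κ * e2)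
  · rw [hsh 2 0 2 (by simp), hsh 1 1 2 (by simp), hsh 0 2 2 (by simp)]
    simp only [Finset.sum_range_succ, Finset.sum_range_zero]
    norm_num
    intro h h' h''
    exact hκ ⟨by linear_combination h, by linear_combination h', by linear_combination h''⟩

end Residual

section Expansion
variable {A : Type*} [CommRing A]

open scoped Polynomial in
/-- The linear form `a + b X + d Y`, with `Y` as the outer variable. -/
noncomputable def expandLin (a b d : A) : A[X][X] :=
  Polynomial.C (.C a + .C b * .X) + .C (.C d) * Polynomial.X

/-- The coefficient of `X ^ i * Y ^ j` in the value of a quartic form at `P + X N + Y M`. -/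
noncomputable def expand (c : ℕ → ℕ → ℕ → A) (P N M : Fin 4 → A) (i j : ℕ) : A :=
  ((quartic (fun i j k => Polynomial.C (Polynomial.C (c i j k))) (expandLin (P 0) (N 0) (M 0))
    (expandLin (P 1) (N 1) (M 1)) (expandLin (P 2) (N 2) (M 2))
    (expandLin (P 3) (N 3) (M 3))).coeff j).coeff i

theorem quartic_eq_sum (c : ℕ → ℕ → ℕ → A) (x y z w : A) : quartic c x y z w =
    ∑ i ∈ Finset.range 5, ∑ j ∈ Finset.range (5 - i), ∑ k ∈ Finset.range (5 - i - j),
      c i j k * (x ^ i * (y ^ j * (z ^ k * w ^ (4 - i - j - k)))) := by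
  simp [quartic, Finset.sum_range_succ]
  ring

section Graded
open scoped Polynomial

/-- All coefficients of `G` lie in the prescribed additive subgroups. -/
def Graded (T : ℕ → ℕ → AddSubgroup A) (G : A[X][X]) : Prop :=
  ∀ i j, (G.coeff j).coeff i ∈ T i j

variable {T : ℕ → ℕ → ℕ → AddSubgroup A}

theorem Graded.mul (hT : ∀ k i j k' i' j' a b, a ∈ T k i j → b ∈ T k' i' j' →
    a * b ∈ T (k + k') (i + i') (j + j')) {k k' : ℕ} {G H : A[X][X]} (hG : Graded (T k) G)
    (hH : Graded (T k') H) : Graded (T (k + k')) (G * H) := fun i j => by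
  rw [Polynomial.coeff_mul, Polynomial.finsetSum_coeff]
  refine AddSubgroup.sum_mem _ fun p hp => ?_
  rw [Polynomial.coeff_mul]
  refine AddSubgroup.sum_mem _ fun q hq => ?_
  rw [← Finset.HasAntidiagonal.mem_antidiagonal.1 hp,
    ← Finset.HasAntidiagonal.mem_antidiagonal.1 hq]
  exact hT _ _ _ _ _ _ _ _ (hG _ _) (hH _ _)

theorem graded_C {a : A} (ha : a ∈ T 0 0 0) : Graded (T 0) (.C (.C a) : A[X][X]) := fun i j => by
  rw [Polynomial.coeff_C]
  split_ifs with h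
  · rw [Polynomial.coeff_C]
    split_ifs with h'
    · rwa [h, h']
    · exact zero_mem _
  · simp

theorem Graded.pow (hT : ∀ k i j k' i' j' a b, a ∈ T k i j → b ∈ T k' i' j' →
    a * b ∈ T (k + k') (i + i') (j + j')) (h1 : (1 : A) ∈ T 0 0 0) {G : A[X][X]}
    (hG : Graded (T 1) G) : ∀ n, Graded (T n) (G ^ n)
  | 0 => by simpa using graded_C h1
  | n + 1 => by rw [pow_succ]; exact (Graded.pow hT h1 hG n).mul hT hG

theorem graded_sum {ι : Type*} {T : ℕ → ℕ → AddSubgroup A} (s : Finset ι) {G : ι → A[X][X]}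
    (h : ∀ i ∈ s, Graded T (G i)) : Graded T (∑ i ∈ s, G i) := fun i j => by
  rw [Polynomial.finsetSum_coeff, Polynomial.finsetSum_coeff]
  exact AddSubgroup.sum_mem _ fun l hl => h l hl i j

theorem graded_expandLin {a b d : A} (ha : a ∈ T 1 0 0) (hb : b ∈ T 1 1 0) (hd : d ∈ T 1 0 1) :
    Graded (T 1) (expandLin a b d) := fun i j => by
  rw [expandLin, Polynomial.coeff_add, Polynomial.coeff_C, Polynomial.coeff_C_mul,
    Polynomial.coeff_X, Polynomial.coeff_add]
  refine add_mem ?_ ?_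
  · split_ifs with h
    · rw [h, Polynomial.coeff_add, Polynomial.coeff_C, Polynomial.coeff_C_mul, Polynomial.coeff_X]
      refine add_mem ?_ ?_
      · split_ifs with h
        · rwa [h]
        · exact zero_mem _
      · split_ifs with h
        · rwa [← h, mul_one]
        · rw [mul_zero]; exact zero_mem _
    · simp
  · split_ifs with h
    · rw [mul_one, ← h, Polynomial.coeff_C]
      split_ifs with h
      · rwa [h]
      · exact zero_mem _
    · simp

theorem expand_mem (hT : ∀ k i j k' i' j' a b, a ∈ T k i j → b ∈ T k' i' j' →
    a * b ∈ T (k + k') (i + i') (j + j')) (h1 : (1 : A) ∈ T 0 0 0) {c : ℕ → ℕ → ℕ → A}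
    (hc : ∀ i j k, c i j k ∈ T 0 0 0) {P N M : Fin 4 → A} (hP : ∀ v, P v ∈ T 1 0 0)
    (hN : ∀ v, N v ∈ T 1 1 0) (hM : ∀ v, M v ∈ T 1 0 1) (i j : ℕ) :
    expand c P N M i j ∈ T 4 i j := by
  have hl : ∀ v, Graded (T 1) (expandLin (P v) (N v) (M v)) := fun v =>
    graded_expandLin (hP v) (hN v) (hM v)
  have : Graded (T 4) (quartic (fun i j k => Polynomial.C (Polynomial.C (c i j k))) (expandLin (P 0) (N 0) (M 0))
    (expandLin (P 1) (N 1) (M 1)) (expandLin (P 2) (N 2) (M 2))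
    (expandLin (P 3) (N 3) (M 3))) := by
    rw [quartic_eq_sum]
    refine graded_sum _ fun i hi => graded_sum _ fun j hj => graded_sum _ fun k hk => ?_
    rw [Finset.mem_range] at hi hj hk
    have := (graded_C (hc i j k)).mul hT (((hl 0).pow hT h1 i).mul hT (((hl 1).pow hT h1 j).mul hT
      (((hl 2).pow hT h1 k).mul hT ((hl 3).pow hT h1 (4 - i - j - k)))))
    rwa [show 0 + (i + (j + (k + (4 - i - j - k)))) = 4 by omega] at this
  exact this i j

end Graded

theorem expand_eq_zero (c : ℕ → ℕ → ℕ → A) (P N M : Fin 4 → A) {i j : ℕ} (h : 4 < i + j) :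
    expand c P N M i j = 0 := by
  let T : ℕ → ℕ → ℕ → AddSubgroup A := fun k i j => if k < i + j then ⊥ else ⊤
  have hT : ∀ {k i j}, i + j ≤ k → ∀ a, a ∈ T k i j := fun {k i j} h a => by
    simp only [T, if_neg (not_lt.2 h), AddSubgroup.mem_top]
  have := expand_mem (T := T) (fun k i j k' i' j' a b ha hb => ?_) (hT (by simp) _)
    (fun i j k => hT (by simp) _) (fun v => hT (by simp) (P v)) (fun v => hT (by simp) (N v))
    (fun v => hT (by simp) (M v)) (c := c) i j
  · simpa only [T, if_pos h, AddSubgroup.mem_bot] using this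
  · by_cases h : k < i + j
    · simp only [T, if_pos h, AddSubgroup.mem_bot] at ha
      rw [ha, zero_mul]; exact zero_mem _
    · by_cases h' : k' < i' + j'
      · simp only [T, if_pos h', AddSubgroup.mem_bot] at hb
        rw [hb, mul_zero]; exact zero_mem _
      · exact hT (by omega) _

theorem quartic_map {B : Type*} [CommRing B] (g : A →+* B) (c : ℕ → ℕ → ℕ → A) (x y z w : A) :
    g (quartic c x y z w) = quartic (fun i j k => g (c i j k)) (g x) (g y) (g z) (g w) := by
  simp [quartic]

theorem expand_map {B : Type*} [CommRing B] (g : A →+* B) (c : ℕ → ℕ → ℕ → A)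
    (P N M : Fin 4 → A) (i j : ℕ) : g (expand c P N M i j) =
      expand (fun i j k => g (c i j k)) (fun v => g (P v)) (fun v => g (N v)) (fun v => g (M v))
        i j := by
  have hl : ∀ a b d : A, Polynomial.mapRingHom (Polynomial.mapRingHom g) (expandLin a b d) =
      expandLin (g a) (g b) (g d) := fun a b d => by simp [expandLin]
  rw [expand, expand, ← Polynomial.coeff_map, ← Polynomial.coe_mapRingHom, ← Polynomial.coeff_map,
    ← Polynomial.coe_mapRingHom, quartic_map, hl, hl, hl, hl]
  simp

theorem quartic_expand (c : ℕ → ℕ → ℕ → A) (P N M : Fin 4 → A) (x y : A) :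
    quartic c (P 0 + x * N 0 + y * M 0) (P 1 + x * N 1 + y * M 1) (P 2 + x * N 2 + y * M 2)
      (P 3 + x * N 3 + y * M 3) =
      ∑ j ∈ Finset.range 5, ∑ i ∈ Finset.range 5, expand c P N M i j * x ^ i * y ^ j := by
  set G := quartic (fun i j k => Polynomial.C (Polynomial.C (c i j k))) (expandLin (P 0) (N 0) (M 0))
    (expandLin (P 1) (N 1) (M 1)) (expandLin (P 2) (N 2) (M 2))
    (expandLin (P 3) (N 3) (M 3)) with hG
  have hdeg : ∀ j, (G.coeff j).natDegree < 5 := fun j => by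
    refine Nat.lt_succ_of_le (Polynomial.natDegree_le_iff_coeff_eq_zero.2 fun i hi => ?_)
    exact expand_eq_zero c P N M (i := i) (j := j) (by omega)
  have hdeg' : G.natDegree < 5 := by
    refine Nat.lt_succ_of_le (Polynomial.natDegree_le_iff_coeff_eq_zero.2 fun j hj => ?_)
    ext i
    exact expand_eq_zero c P N M (i := i) (j := j) (by omega)
  have h1 : (G.eval (.C y)).eval x = ∑ j ∈ Finset.range 5, ∑ i ∈ Finset.range 5,
      expand c P N M i j * x ^ i * y ^ j := by
    rw [Polynomial.eval_eq_sum_range' hdeg', Polynomial.eval_finsetSum]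
    refine Finset.sum_congr rfl fun j _ => ?_
    rw [Polynomial.eval_mul, Polynomial.eval_eq_sum_range' (hdeg j), Polynomial.eval_pow,
      Polynomial.eval_C, Finset.sum_mul]
    rfl
  rw [← h1, hG, ← Polynomial.coe_evalRingHom, ← Polynomial.coe_evalRingHom, quartic_map,
    quartic_map]
  congr 1 <;> simp [expandLin] <;> ring

theorem quartic_expand_line (c : ℕ → ℕ → ℕ → A) (P N M : Fin 4 → A) (x y t : A) :
    quartic c (P 0 + t * (x * N 0 + y * M 0)) (P 1 + t * (x * N 1 + y * M 1))
      (P 2 + t * (x * N 2 + y * M 2)) (P 3 + t * (x * N 3 + y * M 3)) =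
      expand c P N M 0 0 + (expand c P N M 1 0 * x + expand c P N M 0 1 * y) * t +
      (expand c P N M 2 0 * x ^ 2 + expand c P N M 1 1 * x * y + expand c P N M 0 2 * y ^ 2) * t ^ 2 +
      (expand c P N M 3 0 * x ^ 3 + expand c P N M 2 1 * x ^ 2 * y + expand c P N M 1 2 * x * y ^ 2 +
        expand c P N M 0 3 * y ^ 3) * t ^ 3 +
      (expand c P N M 4 0 * x ^ 4 + expand c P N M 3 1 * x ^ 3 * y +
        expand c P N M 2 2 * x ^ 2 * y ^ 2 + expand c P N M 1 3 * x * y ^ 3 +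
        expand c P N M 0 4 * y ^ 4) * t ^ 4 := by
  have h := quartic_expand c P N M (t * x) (t * y)
  have h0 := fun {i j} h => expand_eq_zero c P N M (i := i) (j := j) h
  simp only [Finset.sum_range_succ, Finset.sum_range_zero] at h
  rw [h0 (i := 4) (j := 1) (by simp), h0 (i := 3) (j := 2) (by simp), h0 (i := 4) (j := 2) (by simp),
    h0 (i := 2) (j := 3) (by simp), h0 (i := 3) (j := 3) (by simp), h0 (i := 4) (j := 3) (by simp),
    h0 (i := 1) (j := 4) (by simp), h0 (i := 2) (j := 4) (by simp), h0 (i := 3) (j := 4) (by simp),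
    h0 (i := 4) (j := 4) (by simp)] at h
  simp only [mul_add, ← add_assoc, ← mul_assoc]
  rw [h]
  ring

end Expansion

section Forms
variable {R : Type*} [CommRing R]

theorem res24_reverse (q f : ℕ → R) :
    res24 (fun i => q (2 - i)) (fun i => f (4 - i)) = res24 q f := by
  simp only [res24, Nat.sub_zero, Nat.sub_self, Nat.reduceSub]
  ring

theorem res24_eq_zero_of_root {q f : ℕ → R} {x : R} (hq : q 0 * x ^ 2 + q 1 * x + q 2 = 0)
    (hf : f 0 * x ^ 4 + f 1 * x ^ 3 + f 2 * x ^ 2 + f 3 * x + f 4 = 0) : res24 q f = 0 := by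
  rw [← res24_reverse, ← zero_dvd_iff]
  exact dvd_res24_of_root (x := x) (zero_dvd_iff.2 (by rw [← hq]; simp; ring))
    (zero_dvd_iff.2 (by rw [← hf]; simp; ring))

/-- The binary quadratic form made of the terms of degree two. -/
def expandQ (φ : ℕ → ℕ → R) (i : ℕ) : R := φ (2 - i) i

/-- The binary quartic form `φ₄ + l Y φ₃`. -/
def expandF (l : R) (φ : ℕ → ℕ → R) : ℕ → R
  | 0 => φ 4 0
  | 1 => φ 3 1 + l * φ 3 0
  | 2 => φ 2 2 + l * φ 2 1
  | 3 => φ 1 3 + l * φ 1 2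
  | 4 => φ 0 4 + l * φ 0 3
  | _ => 0

variable {K : Type*} [Field K]

theorem exists_mulForm {q f : ℕ → K} {x x' : K} (hq : q 0 ≠ 0) (hx : x ≠ x')
    (h : q 0 * x ^ 2 + q 1 * x + q 2 = 0) (h' : q 0 * x' ^ 2 + q 1 * x' + q 2 = 0)
    (hf : f 0 * x ^ 4 + f 1 * x ^ 3 + f 2 * x ^ 2 + f 3 * x + f 4 = 0)
    (hf' : f 0 * x' ^ 4 + f 1 * x' ^ 3 + f 2 * x' ^ 2 + f 3 * x' + f 4 = 0) :
    ∃ k : ℕ → K, ∀ i ≤ 4, f i = mulForm q k i := by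
  obtain ⟨k0, hk0⟩ : ∃ k0, f 0 = q 0 * k0 := ⟨f 0 / q 0, by field_simp⟩
  obtain ⟨k1, hk1⟩ : ∃ k1, f 1 = q 0 * k1 + q 1 * k0 := ⟨(f 1 - q 1 * k0) / q 0, by field_simp; ring⟩
  obtain ⟨k2, hk2⟩ : ∃ k2, f 2 = q 0 * k2 + q 1 * k1 + q 2 * k0 :=
    ⟨(f 2 - q 1 * k1 - q 2 * k0) / q 0, by field_simp; ring⟩
  have e : ∀ x, q 0 * x ^ 2 + q 1 * x + q 2 = 0 →
      f 0 * x ^ 4 + f 1 * x ^ 3 + f 2 * x ^ 2 + f 3 * x + f 4 = 0 →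
      (f 3 - (q 1 * k2 + q 2 * k1)) * x + (f 4 - q 2 * k2) = 0 := fun x h hf => by
    linear_combination hf - (k0 * x ^ 2 + k1 * x + k2) * h - x ^ 4 * hk0 - x ^ 3 * hk1 - x ^ 2 * hk2
  have e1 := e x h hf
  have e2 := e x' h' hf'
  have e3 : f 3 - (q 1 * k2 + q 2 * k1) = 0 := by
    have : (f 3 - (q 1 * k2 + q 2 * k1)) * (x - x') = 0 := by linear_combination e1 - e2
    exact (mul_eq_zero.1 this).resolve_right (sub_ne_zero.2 hx)
  rw [e3, zero_mul, zero_add] at e1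
  refine ⟨fun i => if i = 0 then k0 else if i = 1 then k1 else k2, fun i hi => ?_⟩
  interval_cases i <;> simp [mulForm]
  · exact hk0
  · exact hk1
  · exact hk2
  · linear_combination e3
  · linear_combination e1

theorem exists_res24_ne_zero [IsAlgClosed K] {φ : ℕ → ℕ → K}
    (hq : φ 2 0 ≠ 0 ∨ φ 2 0 = 0 ∧ φ 4 0 ≠ 0 ∧ (φ 1 1 ≠ 0 ∨ φ 0 2 ≠ 0))
    (hx : ∀ x, φ 2 0 * x ^ 2 + φ 1 1 * x + φ 0 2 = 0 →
      φ 3 0 * x ^ 3 + φ 2 1 * x ^ 2 + φ 1 2 * x + φ 0 3 = 0 →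
      φ 4 0 * x ^ 4 + φ 3 1 * x ^ 3 + φ 2 2 * x ^ 2 + φ 1 3 * x + φ 0 4 ≠ 0) :
    ∃ l, res24 (expandQ φ) (expandF l φ) ≠ 0 := by
  let f3 : K → K := fun x => φ 3 0 * x ^ 3 + φ 2 1 * x ^ 2 + φ 1 2 * x + φ 0 3
  let f4 : K → K := fun x => φ 4 0 * x ^ 4 + φ 3 1 * x ^ 3 + φ 2 2 * x ^ 2 + φ 1 3 * x + φ 0 4
  have hp : (.C (φ 2 0) * .X ^ 2 + .C (φ 1 1) * .X + .C (φ 0 2) : Polynomial K) ≠ 0 := fun h0 => by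
    have e2 : φ 2 0 = 0 := by
      simpa [Polynomial.coeff_X, Polynomial.coeff_C] using congrArg (fun p => p.coeff 2) h0
    have e1 : φ 1 1 = 0 := by
      simpa [Polynomial.coeff_X, Polynomial.coeff_C, e2] using congrArg (fun p => p.coeff 1) h0
    have e0 : φ 0 2 = 0 := by
      simpa [Polynomial.coeff_X, Polynomial.coeff_C, e1, e2] using congrArg (fun p => p.coeff 0) h0
    simp [e0, e1, e2] at hq
  have hfin : {x | φ 2 0 * x ^ 2 + φ 1 1 * x + φ 0 2 = 0}.Finite := by
    refine (Polynomial.finite_setOfPred_isRoot hp).subset fun x hx => ?_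
    simpa [Polynomial.IsRoot.def] using hx
  obtain ⟨l, hl⟩ := (hfin.image fun x => -f4 x / f3 x).exists_notMem
  have key : ∀ x, φ 2 0 * x ^ 2 + φ 1 1 * x + φ 0 2 = 0 → f4 x + l * f3 x ≠ 0 := fun x h h' => by
    by_cases h3 : f3 x = 0
    · refine hx x h h3 ?_
      rw [h3, mul_zero, add_zero] at h'
      exact h'
    · exact hl ⟨x, h, by
        show -f4 x / f3 x = l
        rw [div_eq_iff h3]; linear_combination -h'⟩
  refine ⟨l, fun h0 => ?_⟩
  by_cases h2 : φ 2 0 = 0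
  · obtain ⟨h4, h1⟩ := (hq.resolve_left (not_not.2 h2)).2
    by_cases h11 : φ 1 1 = 0
    · have h02 : φ 0 2 ≠ 0 := h1.resolve_left (not_not.2 h11)
      simp [res24, expandQ, expandF, h2, h11, h4, h02] at h0
    · obtain ⟨r, hr⟩ : ∃ r, φ 0 2 = -r * φ 1 1 := ⟨-φ 0 2 / φ 1 1, by field_simp⟩
      refine key r (by rw [h2, hr]; ring) ?_
      have : φ 4 0 * φ 1 1 ^ 4 * (f4 r + l * f3 r) = 0 := by
        rw [← h0, res24]
        simp only [expandQ, expandF, Nat.sub_zero, Nat.reduceSub, h2, hr, f4, f3]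
        ring
      simpa [h4, h11] using this
  · rw [← res24_reverse] at h0
    obtain ⟨κ, h, h'⟩ := exists_common_root (by simpa [expandQ] using h2) h0
    simp only [shear2, shear4, expandQ, expandF, Nat.sub_zero, Nat.reduceSub] at h h'
    exact key κ (by linear_combination h) (by simp only [f4, f3]; linear_combination h')

end Forms

section Incidence
variable {K : Type*} [Field K]

/-- The forms of degrees two and three, four vanish at a direction contained in the surface. -/
theorem expand_root [Infinite K] {c : ℕ → ℕ → ℕ → K} {P N M : Fin 4 → K} {x : K}
    (h : ∀ t, quartic c (P 0 + t * (x * N 0 + M 0)) (P 1 + t * (x * N 1 + M 1))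
      (P 2 + t * (x * N 2 + M 2)) (P 3 + t * (x * N 3 + M 3)) = 0) :
    expandQ (expand c P N M) 0 * x ^ 2 + expandQ (expand c P N M) 1 * x +
      expandQ (expand c P N M) 2 = 0 ∧ ∀ l, expandF l (expand c P N M) 0 * x ^ 4 +
      expandF l (expand c P N M) 1 * x ^ 3 + expandF l (expand c P N M) 2 * x ^ 2 +
      expandF l (expand c P N M) 3 * x + expandF l (expand c P N M) 4 = 0 := by
  obtain ⟨-, -, h2, h3, h4⟩ := coeffs_eq_zero_of_forall fun t => by
    have := quartic_expand_line c P N M x 1 t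
    simp only [one_mul, h t] at this
    exact this.symm
  simp only [expandQ, expandF, Nat.sub_zero, Nat.reduceSub]
  refine ⟨by linear_combination h2, fun l => by linear_combination h4 + l * h3⟩

/-- A direction on which the three forms vanish is contained in the surface. -/
theorem quartic_line_eq_zero {c : ℕ → ℕ → ℕ → K} {P N M : Fin 4 → K} {x : K}
    (h0 : expand c P N M 0 0 = 0) (h1 : expand c P N M 1 0 = 0) (h1' : expand c P N M 0 1 = 0)
    (h2 : expand c P N M 2 0 * x ^ 2 + expand c P N M 1 1 * x + expand c P N M 0 2 = 0)
    (h3 : expand c P N M 3 0 * x ^ 3 + expand c P N M 2 1 * x ^ 2 + expand c P N M 1 2 * x +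
      expand c P N M 0 3 = 0)
    (h4 : expand c P N M 4 0 * x ^ 4 + expand c P N M 3 1 * x ^ 3 + expand c P N M 2 2 * x ^ 2 +
      expand c P N M 1 3 * x + expand c P N M 0 4 = 0) (t : K) :
    quartic c (P 0 + t * (x * N 0 + M 0)) (P 1 + t * (x * N 1 + M 1))
      (P 2 + t * (x * N 2 + M 2)) (P 3 + t * (x * N 3 + M 3)) = 0 := by
  have := quartic_expand_line c P N M x 1 t
  simp only [one_mul] at this
  rw [this]
  linear_combination h0 + x * t * h1 + t * h1' + t ^ 2 * h2 + t ^ 3 * h3 + t ^ 4 * h4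

open scoped Polynomial

/-- The resultant cutting out the points `P s` lying on a line of the surface with tangent
directions `X N + Y M`. -/
noncomputable def lineRes (c : ℕ → ℕ → ℕ → K) (P N M : Fin 4 → K[X]) (l : K) : K[X] :=
  res24 (expandQ (expand (fun i j k => Polynomial.C (c i j k)) P N M))
    (expandF (Polynomial.C l) (expand (fun i j k => Polynomial.C (c i j k)) P N M))

theorem natDegree_expand_le (c : ℕ → ℕ → ℕ → K) {P N M : Fin 4 → K[X]} {p n m : ℕ}
    (hP : ∀ v, (P v).natDegree ≤ p) (hN : ∀ v, (N v).natDegree ≤ n) (hM : ∀ v, (M v).natDegree ≤ m)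
    {i j k : ℕ} (hk : k + i + j = 4) :
    (expand (fun i j k => Polynomial.C (c i j k)) P N M i j).natDegree ≤ k * p + i * n + j * m := by
  let T : ℕ → ℕ → ℕ → AddSubgroup K[X] := fun k i j =>
    { carrier := {a | ∀ d, a.coeff d ≠ 0 → d + (i + j) * p ≤ k * p + i * n + j * m}
      zero_mem' := fun d h => (h (Polynomial.coeff_zero d)).elim
      add_mem' := fun {a b} ha hb d h => by
        by_cases h' : a.coeff d = 0
        · exact hb d fun h'' => h (by rw [Polynomial.coeff_add, h', h'', add_zero])
        · exact ha d h'
      neg_mem' := fun {a} ha d h => ha d (by simpa using h) }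
  have hC : ∀ a : K, Polynomial.C a ∈ T 0 0 0 := fun a d h => by
    rw [Polynomial.coeff_C] at h
    split_ifs at h with h0
    · simp [h0]
    · exact (h rfl).elim
  have := expand_mem (T := T) (fun k i j k' i' j' a b ha hb d hd => ?_) (by simpa using hC 1)
    (fun i j k => hC (c i j k)) (P := P) (N := N) (M := M) (fun v d hd => ?_) (fun v d hd => ?_)
    (fun v d hd => ?_) i j
  · refine Polynomial.natDegree_le_iff_coeff_eq_zero.2 fun d hd => ?_
    by_contra h
    have h1 := this d h
    have : 4 * p = k * p + (i + j) * p := by rw [← hk]; ring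
    omega
  · rw [Polynomial.coeff_mul] at hd
    obtain ⟨⟨d1, d2⟩, hx, hne⟩ := Finset.exists_ne_zero_of_sum_ne_zero hd
    rw [Finset.HasAntidiagonal.mem_antidiagonal] at hx
    have h1 := ha d1 (left_ne_zero_of_mul hne)
    have h2 := hb d2 (right_ne_zero_of_mul hne)
    simp only at hx
    subst hx
    nlinarith
  · have := (Polynomial.le_natDegree_of_ne_zero hd).trans (hP v); omega
  · have := (Polynomial.le_natDegree_of_ne_zero hd).trans (hN v); omega
  · have := (Polynomial.le_natDegree_of_ne_zero hd).trans (hM v); omega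

theorem natDegree_lineRes_le (c : ℕ → ℕ → ℕ → K) {P N M : Fin 4 → K[X]} {p n m : ℕ}
    (hP : ∀ v, (P v).natDegree ≤ p) (hN : ∀ v, (N v).natDegree ≤ n) (hM : ∀ v, (M v).natDegree ≤ m)
    (hnm : n ≤ m) (hpm : p ≤ m) (l : K) : (lineRes c P N M l).natDegree ≤ 8 * (p + n + m) := by
  obtain ⟨δ, rfl⟩ := Nat.exists_eq_add_of_le hnm
  have hd := fun {i j k : ℕ} => natDegree_expand_le c hP hN hM (i := i) (j := j) (k := k)
  refine (natDegree_res24_le (α := 4 * n) (β := 2 * p + 2 * n) (δ := δ) (fun i hi => ?_)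
    fun i hi => ?_).trans (by omega)
  · refine (hd (k := 2) (by omega)).trans ?_
    interval_cases i <;> simp <;> omega
  · have h4 := fun {i j : ℕ} (h : i + j = 4) => hd (k := 0) (i := i) (j := j) (by omega)
    have h3 := fun {i j : ℕ} (h : i + j = 3) =>
      (Polynomial.natDegree_C_mul_le l _).trans (hd (k := 1) (i := i) (j := j) (by omega))
    interval_cases i <;> simp only [expandF]
    · exact (h4 rfl).trans (by omega)
    all_goals
      exact Polynomial.natDegree_add_le_of_degree_le ((h4 rfl).trans (by omega))
        ((h3 rfl).trans (by omega))

theorem eval_expand (c : ℕ → ℕ → ℕ → K) (P N M : Fin 4 → K[X]) (s : K) (i j : ℕ) :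
    (expand (fun i j k => Polynomial.C (c i j k)) P N M i j).eval s =
      expand c (fun v => (P v).eval s) (fun v => (N v).eval s) (fun v => (M v).eval s) i j := by
  have := expand_map (Polynomial.evalRingHom s) (fun i j k => Polynomial.C (c i j k)) P N M i j
  simpa using this

theorem eval_expandF (l : K) (φ : ℕ → ℕ → K[X]) (s : K) (i : ℕ) :
    (expandF (Polynomial.C l) φ i).eval s = expandF l (fun i j => (φ i j).eval s) i := by
  unfold expandF
  split <;> simp

theorem eval_lineRes (c : ℕ → ℕ → ℕ → K) (P N M : Fin 4 → K[X]) (l s : K) :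
    (lineRes c P N M l).eval s =
      res24 (expandQ (expand c (fun v => (P v).eval s) (fun v => (N v).eval s) fun v => (M v).eval s))
      (expandF l (expand c (fun v => (P v).eval s) (fun v => (N v).eval s)
        fun v => (M v).eval s)) := by
  have := res24_map (Polynomial.evalRingHom s) (expandQ (expand (fun i j k => Polynomial.C (c i j k)) P N M))
    (expandF (Polynomial.C l) (expand (fun i j k => Polynomial.C (c i j k)) P N M))
  simp only [Polynomial.coe_evalRingHom, eval_expandF, expandQ, eval_expand] at this
  exact this

theorem dvd_lineRes [Infinite K] {c : ℕ → ℕ → ℕ → K} {P N M : Fin 4 → K[X]} {s x : K}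
    (h : ∀ t, quartic c ((P 0).eval s + t * (x * (N 0).eval s + (M 0).eval s))
      ((P 1).eval s + t * (x * (N 1).eval s + (M 1).eval s))
      ((P 2).eval s + t * (x * (N 2).eval s + (M 2).eval s))
      ((P 3).eval s + t * (x * (N 3).eval s + (M 3).eval s)) = 0) (l : K) :
    Polynomial.X - Polynomial.C s ∣ lineRes c P N M l := by
  rw [Polynomial.dvd_iff_isRoot, Polynomial.IsRoot.def, eval_lineRes]
  obtain ⟨h1, h2⟩ := expand_root (P := fun v => (P v).eval s) (N := fun v => (N v).eval s)
    (M := fun v => (M v).eval s) h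
  exact res24_eq_zero_of_root h1 (h2 l)

theorem sq_dvd_lineRes [Infinite K] {c : ℕ → ℕ → ℕ → K} {P N M : Fin 4 → K[X]} {s x x' : K}
    (h : ∀ t, quartic c ((P 0).eval s + t * (x * (N 0).eval s + (M 0).eval s))
      ((P 1).eval s + t * (x * (N 1).eval s + (M 1).eval s))
      ((P 2).eval s + t * (x * (N 2).eval s + (M 2).eval s))
      ((P 3).eval s + t * (x * (N 3).eval s + (M 3).eval s)) = 0)
    (h' : ∀ t, quartic c ((P 0).eval s + t * (x' * (N 0).eval s + (M 0).eval s))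
      ((P 1).eval s + t * (x' * (N 1).eval s + (M 1).eval s))
      ((P 2).eval s + t * (x' * (N 2).eval s + (M 2).eval s))
      ((P 3).eval s + t * (x' * (N 3).eval s + (M 3).eval s)) = 0) (hx : x ≠ x')
    (h20 : expand c (fun v => (P v).eval s) (fun v => (N v).eval s) (fun v => (M v).eval s) 2 0 ≠ 0)
    (l : K) : (Polynomial.X - Polynomial.C s) ^ 2 ∣ lineRes c P N M l := by
  obtain ⟨h1, h2⟩ := expand_root (P := fun v => (P v).eval s) (N := fun v => (N v).eval s)
    (M := fun v => (M v).eval s) h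
  obtain ⟨h1', h2'⟩ := expand_root (P := fun v => (P v).eval s) (N := fun v => (N v).eval s)
    (M := fun v => (M v).eval s) h'
  obtain ⟨k, hk⟩ := exists_mulForm (by exact h20) hx h1 h1' (h2 l) (h2' l)
  refine sq_dvd_res24_of_mulForm (k := fun i => Polynomial.C (k i)) fun i hi => ?_
  rw [Polynomial.dvd_iff_isRoot, Polynomial.IsRoot.def, Polynomial.eval_sub, eval_expandF, sub_eq_zero]
  simp only [eval_expand]
  rw [hk i hi]
  interval_cases i <;> simp [mulForm, expandQ, eval_expand]

end Incidence

section Conic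
variable {K : Type*} [Field K]

/-- A ternary quadratic form. -/
def conic (a b e n1 n2 n3 : K) (v : Fin 3 → K) : K :=
  a * v 0 ^ 2 + b * v 1 ^ 2 + e * v 2 ^ 2 + n1 * v 1 * v 2 + n2 * v 0 * v 2 + n3 * v 0 * v 1

theorem exists_binary_zero [IsAlgClosed K] (a b e : K) :
    ∃ y z, (y ≠ 0 ∨ z ≠ 0) ∧ a * y ^ 2 + b * y * z + e * z ^ 2 = 0 := by
  by_cases ha : a = 0
  · exact ⟨1, 0, Or.inl one_ne_zero, by simp [ha]⟩
  · obtain ⟨r, hr⟩ := IsAlgClosed.exists_root (.C a * .X ^ 2 + .C b * .X + .C e)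
      (by rw [Polynomial.degree_quadratic ha]; simp)
    refine ⟨r, 1, Or.inr one_ne_zero, ?_⟩
    simp only [Polynomial.IsRoot, Polynomial.eval_add, Polynomial.eval_mul, Polynomial.eval_pow,
      Polynomial.eval_C, Polynomial.eval_X] at hr
    linear_combination hr

theorem exists_conic_normal_form [IsAlgClosed K] [CharP K 2] (a b e n1 n2 n3 : K) :
    (∃ u v : Fin 3 → K, (∀ s t : K, s • u + t • v = 0 → s = 0 ∧ t = 0) ∧
      ∀ s t : K, conic a b e n1 n2 n3 (s • u + t • v) = 0) ∨
    ∃ p' n p : Fin 3 → K, ∀ y z w : K,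
      conic a b e n1 n2 n3 (y • p' + z • n + w • p) = y * w + z ^ 2 := by
  have h2 : (2 : K) = 0 := CharTwo.two_eq_zero
  set Q := conic a b e n1 n2 n3 with hQ
  let B : (Fin 3 → K) → (Fin 3 → K) → K := fun u v => n1 * (u 1 * v 2 + u 2 * v 1) +
    n2 * (u 0 * v 2 + u 2 * v 0) + n3 * (u 0 * v 1 + u 1 * v 0)
  have hB : ∀ (y z w : K) (p n q : Fin 3 → K), Q (y • p + z • n + w • q) = y ^ 2 * Q p +
      z ^ 2 * Q n + w ^ 2 * Q q + y * z * B p n + y * w * B p q + z * w * B n q := by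
    intro y z w p n q
    simp only [hQ, B, conic, Pi.add_apply, Pi.smul_apply, smul_eq_mul]
    linear_combination (a * (y * z * p 0 * n 0 + y * w * p 0 * q 0 + z * w * n 0 * q 0) +
      b * (y * z * p 1 * n 1 + y * w * p 1 * q 1 + z * w * n 1 * q 1) +
      e * (y * z * p 2 * n 2 + y * w * p 2 * q 2 + z * w * n 2 * q 2) +
      y ^ 2 * (n1 * p 1 * p 2 + n2 * p 0 * p 2 + n3 * p 0 * p 1) * 0) * h2
  have hline : ∀ u v : Fin 3 → K, Q u = 0 → Q v = 0 → B u v = 0 → ∀ s t : K,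
      Q (s • u + t • v) = 0 := fun u v hu hv h s t => by
    have := hB s t 0 u v 0
    rw [zero_smul, add_zero] at this
    rw [this, hu, hv, h]; ring
  have hBN : ∀ v, B ![n1, n2, n3] v = 0 := fun v => by
    simp only [B, Matrix.cons_val]
    linear_combination (n1 * n2 * v 2 + n1 * n3 * v 1 + n2 * n3 * v 0) * h2
  have hsymm : ∀ u v, B u v = B v u := fun u v => by simp only [B]; ring
  by_cases hN : Q ![n1, n2, n3] = 0
  · left
    have key : ∀ i : Fin 3, ![n1, n2, n3] i ≠ 0 → (∃ v : Fin 3 → K, v i = 0 ∧ v ≠ 0 ∧ Q v = 0) →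
        ∃ u v : Fin 3 → K, (∀ s t : K, s • u + t • v = 0 → s = 0 ∧ t = 0) ∧
          ∀ s t : K, Q (s • u + t • v) = 0 := fun i hi ⟨v, hvi, hv0, hv⟩ => by
      refine ⟨![n1, n2, n3], v, fun s t h => ?_, hline _ _ hN hv (hBN v)⟩
      have hs : s = 0 := by
        have := congrFun h i
        rw [Pi.add_apply, Pi.smul_apply, Pi.smul_apply, hvi, smul_zero, add_zero] at this
        exact (mul_eq_zero.1 this).resolve_right hi
      rw [hs, zero_smul, zero_add] at h
      exact ⟨hs, (smul_eq_zero.1 h).resolve_right hv0⟩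
    obtain ⟨y1, z1, h1, q1⟩ := exists_binary_zero b n1 e
    obtain ⟨y2, z2, h2', q2⟩ := exists_binary_zero a n2 e
    obtain ⟨y3, z3, h3, q3⟩ := exists_binary_zero a n3 b
    have w1 : ![0, y1, z1] ≠ 0 ∧ Q ![0, y1, z1] = 0 := by
      refine ⟨fun h => ?_, by simp only [hQ, conic, Matrix.cons_val]; linear_combination q1⟩
      rcases h1 with h1 | h1
      · exact h1 (congrFun h 1)
      · exact h1 (congrFun h 2)
    have w2 : ![y2, 0, z2] ≠ 0 ∧ Q ![y2, 0, z2] = 0 := by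
      refine ⟨fun h => ?_, by simp only [hQ, conic, Matrix.cons_val]; linear_combination q2⟩
      rcases h2' with h1 | h1
      · exact h1 (congrFun h 0)
      · exact h1 (congrFun h 2)
    have w3 : ![y3, z3, 0] ≠ 0 ∧ Q ![y3, z3, 0] = 0 := by
      refine ⟨fun h => ?_, by simp only [hQ, conic, Matrix.cons_val]; linear_combination q3⟩
      rcases h3 with h1 | h1
      · exact h1 (congrFun h 0)
      · exact h1 (congrFun h 1)
    by_cases m1 : n1 = 0
    · by_cases m2 : n2 = 0
      · by_cases m3 : n3 = 0
        · have hB0 : ∀ u v, B u v = 0 := fun u v => by simp [B, m1, m2, m3]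
          by_cases hy : y1 = 0
          · refine ⟨_, _, fun s t h => ?_, hline _ _ w1.2 w3.2 (hB0 _ _)⟩
            have hs : s = 0 := by
              have := congrFun h 2
              simp only [Pi.add_apply, Pi.smul_apply, Matrix.cons_val, smul_eq_mul, mul_zero,
                add_zero, Pi.zero_apply] at this
              exact (mul_eq_zero.1 this).resolve_right (h1.resolve_left (not_not.2 hy))
            rw [hs, zero_smul, zero_add] at h
            exact ⟨hs, (smul_eq_zero.1 h).resolve_right w3.1⟩
          · refine ⟨_, _, fun s t h => ?_, hline _ _ w1.2 w2.2 (hB0 _ _)⟩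
            have hs : s = 0 := by
              have := congrFun h 1
              simp only [Pi.add_apply, Pi.smul_apply, Matrix.cons_val, smul_eq_mul, mul_zero,
                add_zero, Pi.zero_apply] at this
              exact (mul_eq_zero.1 this).resolve_right hy
            rw [hs, zero_smul, zero_add] at h
            exact ⟨hs, (smul_eq_zero.1 h).resolve_right w2.1⟩
        · exact key 2 m3 ⟨_, rfl, w3⟩
      · exact key 1 m2 ⟨_, rfl, w2⟩
    · exact key 0 m1 ⟨_, rfl, w1⟩
  · right
    obtain ⟨r, hr⟩ := IsAlgClosed.exists_pow_nat_eq (Q ![n1, n2, n3]) (n := 2) (by simp)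
    have hr0 : r ≠ 0 := fun h => hN (by rw [← hr, h]; ring)
    obtain ⟨y, z, hyz, q⟩ := exists_binary_zero a n3 b
    have hp : Q ![y, z, 0] = 0 := by
      simp only [hQ, conic, Matrix.cons_val]; linear_combination q
    obtain ⟨v, hv⟩ : ∃ v, B ![y, z, 0] v = 1 := by
      have e1 : ∀ t : K, B ![y, z, 0] ![t, 0, 0] = n3 * z * t := fun t => by
        simp only [B, Matrix.cons_val]; ring
      have e2 : ∀ t : K, B ![y, z, 0] ![0, t, 0] = n3 * y * t := fun t => by
        simp only [B, Matrix.cons_val]; ring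
      have e3 : ∀ t : K, B ![y, z, 0] ![0, 0, t] = (n1 * z + n2 * y) * t := fun t => by
        simp only [B, Matrix.cons_val]; ring
      by_cases k1 : n3 * z = 0
      · by_cases k2 : n3 * y = 0
        · by_cases k3 : n1 * z + n2 * y = 0
          · exfalso
            have m3 : n3 = 0 := by
              rcases hyz with h | h
              · exact (mul_eq_zero.1 k2).resolve_right h
              · exact (mul_eq_zero.1 k1).resolve_right h
            refine hN ?_
            have hq : Q ![n1, n2, n3] = a * n1 ^ 2 + b * n2 ^ 2 := by
              simp only [hQ, conic, Matrix.cons_val, m3]; ring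
            rw [m3] at q
            rcases hyz with h | h
            · refine (mul_eq_zero.1 (?_ : y ^ 2 * _ = 0)).resolve_left (pow_ne_zero 2 h)
              rw [hq]; linear_combination n1 ^ 2 * q + b * (n2 * y - n1 * z) * k3
            · refine (mul_eq_zero.1 (?_ : z ^ 2 * _ = 0)).resolve_left (pow_ne_zero 2 h)
              rw [hq]; linear_combination n2 ^ 2 * q + a * (n1 * z - n2 * y) * k3
          · exact ⟨_, by rw [e3, mul_inv_cancel₀ k3]⟩
        · exact ⟨_, by rw [e2, mul_inv_cancel₀ k2]⟩
      · exact ⟨_, by rw [e1, mul_inv_cancel₀ k1]⟩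
    set p : Fin 3 → K := ![y, z, 0] with hpdef
    have hBs : ∀ (s t : K) (u v w : Fin 3 → K), B (s • u + t • v) w = s * B u w + t * B v w := by
      intro s t u v w
      simp only [B, Pi.add_apply, Pi.smul_apply, smul_eq_mul]; ring
    have hpp : B p p = 0 := by
      simp only [B]; linear_combination (n1 * p 1 * p 2 + n2 * p 0 * p 2 + n3 * p 0 * p 1) * h2
    have hnv : ∀ v, B (r⁻¹ • ![n1, n2, n3]) v = 0 := fun v => by
      have := hBs r⁻¹ 0 ![n1, n2, n3] 0 v
      rw [zero_smul, add_zero] at this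
      rw [this, hBN]; ring
    have hn : Q (r⁻¹ • ![n1, n2, n3]) = 1 := by
      have := hB r⁻¹ 0 0 ![n1, n2, n3] 0 0
      simp only [zero_smul, add_zero] at this
      rw [this, ← hr]; field_simp; ring
    refine ⟨(1 : K) • v + Q v • p, r⁻¹ • ![n1, n2, n3], p, fun y z w => ?_⟩
    have h1 : Q ((1 : K) • v + Q v • p) = 0 := by
      have := hB 1 (Q v) 0 v p 0
      rw [zero_smul, add_zero] at this
      rw [this, hp, hsymm v p, hv]
      linear_combination Q v * h2
    rw [hB, h1, hn, hp, hsymm _ (r⁻¹ • _), hnv, hBs, hsymm v p, hv, hpp, hnv]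
    ring

theorem finite_conic_points {u0 u1 u2 : Fin 4 → K}
    (hu : ∀ y z w : K, y • u0 + z • u1 + w • u2 = 0 → y = 0 ∧ z = 0 ∧ w = 0)
    {n : Submodule K (Fin 4 → K)} (hn : Module.finrank K n = 2) :
    {s : K | u0 + s • u1 + s ^ 2 • u2 ∈ n}.Finite := by
  obtain ⟨i, hi⟩ : ∃ i, ![u0, u1, u2] i ∉ n := by
    by_contra! h
    have hli : LinearIndependent K fun i => (⟨![u0, u1, u2] i, h i⟩ : n) := by
      rw [Fintype.linearIndependent_iff]
      intro g hg
      have := congrArg Subtype.val hg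
      simp only [Fin.sum_univ_three, Submodule.coe_add, Submodule.coe_smul] at this
      obtain ⟨h0, h1, h2⟩ := hu (g 0) (g 1) (g 2) this
      intro i; fin_cases i
      exacts [h0, h1, h2]
    have := hli.fintype_card_le_finrank
    rw [hn, Fintype.card_fin] at this
    omega
  obtain ⟨f, hf, hnf⟩ := Submodule.exists_le_ker_of_notMem hi
  have hp : (.C (f u0) + .C (f u1) * .X + .C (f u2) * .X ^ 2 : Polynomial K) ≠ 0 := fun h0 => hf <| by
    have e0 : f u0 = 0 := by
      simpa [Polynomial.coeff_X, Polynomial.coeff_C] using congrArg (fun p => p.coeff 0) h0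
    have e1 : f u1 = 0 := by
      simpa [Polynomial.coeff_X, Polynomial.coeff_C, Polynomial.coeff_X_pow] using
        congrArg (fun p => p.coeff 1) h0
    have e2 : f u2 = 0 := by
      simpa [Polynomial.coeff_X, Polynomial.coeff_C, Polynomial.coeff_X_pow] using
        congrArg (fun p => p.coeff 2) h0
    fin_cases i
    exacts [e0, e1, e2]
  refine (Polynomial.finite_setOfPred_isRoot hp).subset fun s hs => ?_
  have := hnf hs
  simp only [LinearMap.mem_ker, map_add, map_smul, smul_eq_mul] at this
  simp only [Set.mem_ofPred_eq, Polynomial.IsRoot.def, Polynomial.eval_add, Polynomial.eval_mul,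
    Polynomial.eval_C, Polynomial.eval_X, Polynomial.eval_pow]
  linear_combination this

end Conic

section Conic
variable {K : Type*} [Field K] [IsAlgClosed K] [CharP K 2] {F : MvPolynomial (Fin 4) K}

theorem section_of_pair {c : ℕ → ℕ → ℕ → K} (hy : ∀ z w, quartic c 0 0 z w = 0)
    (hz : ∀ y w, quartic c 0 y 0 w = 0) (y z w : K) : quartic c 0 y z w = y * z *
      conic (c 0 3 1) (c 0 1 3) (c 0 1 1) (c 0 1 2) (c 0 2 1) (c 0 2 2) ![y, z, w] := by
  have : Infinite K := IsAlgClosed.instInfinite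
  obtain ⟨p0, p1, p2, p3, p4⟩ := coeffs_eq_zero_of_forall (a0 := c 0 0 0) (a1 := c 0 0 1)
    (a2 := c 0 0 2) (a3 := c 0 0 3) (a4 := c 0 0 4) fun z => by
      have := hy z 1
      simp only [quartic] at this
      linear_combination this
  obtain ⟨-, q1, q2, q3, q4⟩ := coeffs_eq_zero_of_forall (a0 := c 0 0 0) (a1 := c 0 1 0)
    (a2 := c 0 2 0) (a3 := c 0 3 0) (a4 := c 0 4 0) fun y => by
      have := hz y 1
      simp only [quartic] at this
      linear_combination this
  simp only [quartic, conic, p0, p1, p2, p3, p4, q1, q2, q3, q4, Matrix.cons_val]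
  ring

theorem exists_conic_basis (hF : IsSmoothQuartic F) (hN : NoTriple F)
    {W W' : Submodule K (Fin 4 → K)} (hW : W ∈ lines F) (hW' : W' ∈ lines F) (hne : W ≠ W')
    {o : Fin 4 → K} (hv : o ≠ 0) (hvW : o ∈ W) (hvW' : o ∈ W') :
    ∃ (b : Module.Basis (Fin 4) K (Fin 4 → K)) (c : ℕ → ℕ → ℕ → K) (α₁ ν₁ β₁ α₂ ν₂ β₂ : K),
      Coords F b c ∧ (∀ y z w, quartic c 0 y z w =
        (α₁ * y + ν₁ * z + β₁ * w) * (α₂ * y + ν₂ * z + β₂ * w) * (y * w + z ^ 2)) ∧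
      (∀ y z w, α₁ * y + ν₁ * z + β₁ * w = 0 → pt b 0 y z w ∈ W) ∧
      (∀ y z w, α₂ * y + ν₂ * z + β₂ * w = 0 → pt b 0 y z w ∈ W') ∧ ∀ n ∈ lines F, b 1 ∉ n := by
  have : Infinite K := IsAlgClosed.instInfinite
  have hφ := grad_ne_zero hF hv (hW.2 o hvW)
  obtain ⟨b, h0, h3, h3', h2, h1⟩ := exists_plane_basis hφ hW.1 hW'.1 (le_ker_grad hW hvW)
    (le_ker_grad hW' hvW') hne
  obtain ⟨c, hc⟩ := hF.coords b
  have hmW : ∀ z w, pt b 0 0 z w ∈ W := fun z w => by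
    have : pt b 0 0 z w = z • b 2 + w • b 3 := by simp only [pt]; module
    rw [this]; exact W.add_mem (W.smul_mem _ h2) (W.smul_mem _ h3)
  have hmW' : ∀ y w, pt b 0 y 0 w ∈ W' := fun y w => by
    have : pt b 0 y 0 w = y • b 1 + w • b 3 := by simp only [pt]; module
    rw [this]; exact W'.add_mem (W'.smul_mem _ h1) (W'.smul_mem _ h3')
  have hsec := section_of_pair (c := c) (fun z w => by rw [← hc.2]; exact hW.2 _ (hmW z w))
    fun y w => by rw [← hc.2]; exact hW'.2 _ (hmW' y w)
  let ι : (Fin 3 → K) → Fin 4 → K := fun v => pt b 0 (v 0) (v 1) (v 2)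
  have hι : ∀ v, eval (ι v) F = v 0 * v 1 *
      conic (c 0 3 1) (c 0 1 3) (c 0 1 1) (c 0 1 2) (c 0 2 1) (c 0 2 2) v := fun v => by
    rw [hc.2, hsec]
    simp only [conic, Matrix.cons_val]
  have hι0 : ∀ v, ι v = 0 → v = 0 := fun v h => by
    obtain ⟨-, e0, e1, e2⟩ := pt_eq_zero.1 h
    ext i; fin_cases i
    exacts [e0, e1, e2]
  have hadd : ∀ (s t : K) u v, s • ι u + t • ι v = ι (s • u + t • v) := fun s t u v => by
    simp only [ι, pt, Pi.add_apply, Pi.smul_apply, smul_eq_mul]; module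
  rcases exists_conic_normal_form (c 0 3 1) (c 0 1 3) (c 0 1 1) (c 0 1 2) (c 0 2 1) (c 0 2 2) with
    ⟨u, v, hind, hz⟩ | ⟨p', n, p, hQ⟩
  · exfalso
    have hm : Submodule.span K {ι u, ι v} ∈ lines F := mem_lines_of_pair
      (fun s t h => hind s t (hι0 _ (by rw [← hadd, h]))) fun s t => by
        rw [hadd, hι, hz, mul_zero]
    have hker : ∀ v, grad F o (ι v) = 0 := fun v => by
      have e1 := le_ker_grad hW' hvW' h1
      have e2 := le_ker_grad hW hvW h2
      have e3 := le_ker_grad hW hvW h3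
      rw [LinearMap.mem_ker] at e1 e2 e3
      simp only [ι, pt, map_add, map_smul, e1, e2, e3, smul_zero, add_zero, zero_smul, map_zero]
    have hle : Submodule.span K {ι u, ι v} ≤ LinearMap.ker (grad F o) := Submodule.span_le.2 (by
      rintro x (rfl | rfl)
      exacts [hker u, hker v])
    have hcon : ∀ x, ι x ∈ Submodule.span K {ι u, ι v} →
        conic (c 0 3 1) (c 0 1 3) (c 0 1 1) (c 0 1 2) (c 0 2 1) (c 0 2 2) x = 0 := fun x hx => by
      obtain ⟨s, t, hst⟩ := Submodule.mem_span_pair.1 hx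
      have : x = s • u + t • v := by
        refine sub_eq_zero.1 (hι0 _ ?_)
        have := hadd 1 (-1) x (s • u + t • v)
        rw [← hadd, ← hst, one_smul, neg_smul, one_smul, one_smul, neg_smul, one_smul] at this
        rw [sub_eq_add_neg, ← this, hadd]
        simp
      rw [this, hz]
    have hpt : ∀ v, b.coord 0 v = 0 → v = pt b 0 (b.coord 1 v) (b.coord 2 v) (b.coord 3 v) :=
      fun v hv => exists_eq_pt_ker (φ := b.coord 0) (by simp) (by simp) (by simp) (by simp) hv
    have main : W = Submodule.span K {ι u, ι v} ∨ W' = Submodule.span K {ι u, ι v} := by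
      by_contra! hcon
      exact hne (hN _ hφ _ hm _ hW _ hW' hle (le_ker_grad hW hvW) (le_ker_grad hW' hvW')
        hcon.1.symm hcon.2.symm)
    rcases main with h | h
    · have hq : ∀ z w, conic (c 0 3 1) (c 0 1 3) (c 0 1 1) (c 0 1 2) (c 0 2 1) (c 0 2 2)
          ![0, z, w] = 0 := fun z w => hcon _ (by rw [← h]; exact hmW z w)
      refine no_double_line hF (φ := b.coord 0) (ψ := b.coord 1) (fun i : Fin 2 =>
        ![b.coord 2, c 0 3 1 • b.coord 1 + c 0 2 1 • b.coord 3 + c 0 2 2 • b.coord 2] i) .univ 1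
        fun v hv => ?_
      conv_lhs => rw [hpt v hv]
      rw [hc.2, hsec, Fin.prod_univ_two]
      have := hq (b.coord 2 v) (b.coord 3 v)
      simp only [conic, Matrix.cons_val, LinearMap.add_apply, LinearMap.smul_apply,
        smul_eq_mul] at this ⊢
      linear_combination b.coord 1 v * b.coord 2 v * this
    · have hq : ∀ y w, conic (c 0 3 1) (c 0 1 3) (c 0 1 1) (c 0 1 2) (c 0 2 1) (c 0 2 2)
          ![y, 0, w] = 0 := fun y w => hcon _ (by rw [← h]; exact hmW' y w)
      refine no_double_line hF (φ := b.coord 0) (ψ := b.coord 2) (fun i : Fin 2 =>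
        ![b.coord 1, c 0 1 3 • b.coord 2 + c 0 1 2 • b.coord 3 + c 0 2 2 • b.coord 1] i) .univ 1
        fun v hv => ?_
      conv_lhs => rw [hpt v hv]
      rw [hc.2, hsec, Fin.prod_univ_two]
      have := hq (b.coord 1 v) (b.coord 3 v)
      simp only [conic, Matrix.cons_val, LinearMap.add_apply, LinearMap.smul_apply,
        smul_eq_mul] at this ⊢
      linear_combination b.coord 1 v * b.coord 2 v * this
  · have h2 : (2 : K) = 0 := CharTwo.two_eq_zero
    have hind : ∀ y z w : K, y • p' + z • n + w • p = 0 → y = 0 ∧ z = 0 ∧ w = 0 := by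
      intro y z w h
      have key : ∀ y' w' : K, (y + y') * (w + w') + z ^ 2 = y' * w' := fun y' w' => by
        have e : (y + y') • p' + z • n + (w + w') • p =
            y • p' + z • n + w • p + (y' • p' + (0 : K) • n + w' • p) := by module
        rw [← hQ, e, h, zero_add, hQ]; ring
      have k0 := key 0 0
      have k1 := key 1 0
      have k2 := key 0 1
      have hw : w = 0 := by linear_combination k1 - k0
      have hy : y = 0 := by linear_combination k2 - k0
      rw [hw, hy] at k0
      exact ⟨hy, by simpa using k0, hw⟩
    have hadd3 : ∀ (y z w : K) u v x, y • ι u + z • ι v + w • ι x =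
        ι (y • u + z • v + w • x) := fun y z w u v x => by
      have := hadd 1 w (y • u + z • v) x
      rw [one_smul, one_smul] at this
      rw [hadd, this]
    obtain ⟨s, hs⟩ := ((finite_lines hF).biUnion fun m (hm : m ∈ lines F) =>
      finite_conic_points (u0 := ι p') (u1 := ι n) (u2 := ι p) (fun y z w h =>
        hind y z w (hι0 _ (by rw [← hadd3, h]))) hm.1).exists_notMem
    simp only [Set.mem_iUnion, not_exists] at hs
    let q : Fin 3 → K := p' + s • n + s ^ 2 • p
    have hq : ι q = ι p' + s • ι n + s ^ 2 • ι p := by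
      have := hadd3 1 s (s ^ 2) p' n p
      rw [one_smul, one_smul] at this
      exact this.symm
    let u : Fin 4 → Fin 4 → K := ![b 0, ι q, ι n, ι p]
    have hu : ∀ x y z w : K, x • u 0 + y • u 1 + z • u 2 + w • u 3 =
        pt b x ((y • q + z • n + w • p) 0) ((y • q + z • n + w • p) 1)
          ((y • q + z • n + w • p) 2) := fun x y z w => by
      have e : pt b x ((y • q + z • n + w • p) 0) ((y • q + z • n + w • p) 1)
          ((y • q + z • n + w • p) 2) = x • b 0 + ι (y • q + z • n + w • p) := by
        simp only [ι, pt]; module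
      rw [e, ← hadd3]
      simp only [u, Matrix.cons_val, add_assoc]
    have hqe : ∀ y z w : K, y • q + z • n + w • p =
        y • p' + (z + s * y) • n + (w + s ^ 2 * y) • p := fun y z w => by simp only [q]; module
    obtain ⟨b', hb'⟩ := exists_basis u fun x y z w h => by
      rw [hu, pt_eq_zero] at h
      have h' := hind _ _ _ (by
        rw [← hqe]
        refine hι0 _ (pt_eq_zero.2 ⟨rfl, h.2⟩))
      obtain ⟨hy, hz, hw⟩ := h'
      refine ⟨h.1, hy, ?_, ?_⟩
      · simpa [hy] using hz
      · simpa [hy] using hw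
    have hpt : ∀ y z w, pt b' 0 y z w = ι (y • q + z • n + w • p) := fun y z w => by
      rw [pt, hb', hb', hb', hb', hu]
    obtain ⟨c', hc'⟩ := hF.coords b'
    refine ⟨b', c', q 0, n 0, p 0, q 1, n 1, p 1, hc', fun y z w => ?_, fun y z w h => ?_,
      fun y z w h => ?_, fun m hm => ?_⟩
    · rw [← hc'.2, hpt, hι, hqe, hQ, ← hqe]
      simp only [Pi.add_apply, Pi.smul_apply, smul_eq_mul]
      linear_combination (y * q 0 + z * n 0 + w * p 0) * (y * q 1 + z * n 1 + w * p 1) *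
        (s ^ 2 * y ^ 2 + s * y * z) * h2
    · rw [hpt]
      have e : (y • q + z • n + w • p) 0 = 0 := by
        simp only [Pi.add_apply, Pi.smul_apply, smul_eq_mul]; linear_combination h
      simp only [ι, e]
      exact hmW _ _
    · rw [hpt]
      have e : (y • q + z • n + w • p) 1 = 0 := by
        simp only [Pi.add_apply, Pi.smul_apply, smul_eq_mul]; linear_combination h
      simp only [ι, e]
      exact hmW' _ _
    · rw [hb']
      simp only [u, Matrix.cons_val, hq]
      exact hs m hm

end Conic

section Section
variable {A : Type*} [CommRing A]

/-- The coefficients of the product of two linear forms and the conic `y w + z ^ 2`. -/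
def sectionCoeff (α₁ ν₁ β₁ α₂ ν₂ β₂ : A) : ℕ → ℕ → A
  | 3, 0 => α₁ * α₂
  | 2, 2 => α₁ * α₂
  | 2, 1 => α₁ * ν₂ + ν₁ * α₂
  | 1, 3 => α₁ * ν₂ + ν₁ * α₂
  | 2, 0 => α₁ * β₂ + β₁ * α₂
  | 1, 2 => α₁ * β₂ + β₁ * α₂ + ν₁ * ν₂
  | 0, 4 => ν₁ * ν₂
  | 1, 1 => ν₁ * β₂ + β₁ * ν₂
  | 0, 3 => ν₁ * β₂ + β₁ * ν₂
  | 1, 0 => β₁ * β₂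
  | 0, 2 => β₁ * β₂
  | _, _ => 0

theorem quartic_sectionCoeff {c : ℕ → ℕ → ℕ → A} {α₁ ν₁ β₁ α₂ ν₂ β₂ : A}
    (hc : ∀ j k, j + k ≤ 4 → c 0 j k = sectionCoeff α₁ ν₁ β₁ α₂ ν₂ β₂ j k) (y z w : A) :
    quartic c 0 y z w =
      (α₁ * y + ν₁ * z + β₁ * w) * (α₂ * y + ν₂ * z + β₂ * w) * (y * w + z ^ 2) := by
  simp only [quartic, hc 0 0 (by omega), hc 0 1 (by omega), hc 0 2 (by omega), hc 0 3 (by omega),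
    hc 0 4 (by omega), hc 1 0 (by omega), hc 1 1 (by omega), hc 1 2 (by omega), hc 1 3 (by omega),
    hc 2 0 (by omega), hc 2 1 (by omega), hc 2 2 (by omega), hc 3 0 (by omega), hc 3 1 (by omega),
    hc 4 0 (by omega), sectionCoeff]
  ring

theorem map_sectionCoeff {B : Type*} [CommRing B] (g : A →+* B) (α₁ ν₁ β₁ α₂ ν₂ β₂ : A) (j k : ℕ) :
    g (sectionCoeff α₁ ν₁ β₁ α₂ ν₂ β₂ j k) =
      sectionCoeff (g α₁) (g ν₁) (g β₁) (g α₂) (g ν₂) (g β₂) j k := by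
  unfold sectionCoeff
  split <;> simp

theorem eq_sectionCoeff {K : Type*} [Field K] [Infinite K] {c : ℕ → ℕ → ℕ → K}
    {α₁ ν₁ β₁ α₂ ν₂ β₂ : K} (h : ∀ y z w, quartic c 0 y z w =
      (α₁ * y + ν₁ * z + β₁ * w) * (α₂ * y + ν₂ * z + β₂ * w) * (y * w + z ^ 2)) (j k : ℕ)
    (hjk : j + k ≤ 4) : c 0 j k = sectionCoeff α₁ ν₁ β₁ α₂ ν₂ β₂ j k := by
  have := quartic_ext (c := fun i j k => if i = 0 then c i j k else 0)
    (d := fun i j k => if i = 0 then sectionCoeff α₁ ν₁ β₁ α₂ ν₂ β₂ j k else 0)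
    (fun x y z w => ?_) 0 j k (by omega)
  · simpa using this
  · have e1 := h y z w
    rw [← quartic_sectionCoeff (c := fun i j k => if i = 0 then sectionCoeff α₁ ν₁ β₁ α₂ ν₂ β₂ j k
      else 0) (fun j k _ => by simp)] at e1
    simp only [quartic, if_true, one_ne_zero, OfNat.ofNat_ne_zero, if_false] at e1 ⊢
    linear_combination e1

theorem expand_eq_of_eq_sum {c : ℕ → ℕ → ℕ → A} {P N M : Fin 4 → A} {a : ℕ → ℕ → A}
    (h : quartic (fun i j k => Polynomial.C (Polynomial.C (c i j k))) (expandLin (P 0) (N 0) (M 0))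
      (expandLin (P 1) (N 1) (M 1)) (expandLin (P 2) (N 2) (M 2)) (expandLin (P 3) (N 3) (M 3)) =
      ∑ j ∈ Finset.range 5, ∑ i ∈ Finset.range 5,
        Polynomial.C (.C (a i j) * .X ^ i) * Polynomial.X ^ j) {i j : ℕ} (hi : i < 5) (hj : j < 5) :
    expand c P N M i j = a i j := by
  rw [expand, h]
  simp only [← Finset.sum_mul, ← map_sum, Polynomial.finsetSum_coeff, Polynomial.coeff_C_mul,
    Polynomial.coeff_X_pow, mul_ite, mul_one, mul_zero, Finset.sum_ite_eq, Finset.mem_range, hj,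
    if_true, hi]

/-- The coefficients of `(a₁ + ν₁ X + b₁ Y) (a₂ + ν₂ X + b₂ Y) (X ^ 2 + g Y + d Y ^ 2)`. -/
def sectionExpand (e₀₀ e₁₀ e₀₁ e₂₀ e₁₁ e₀₂ g d : A) : ℕ → ℕ → A
  | 0, 1 => e₀₀ * g
  | 2, 0 => e₀₀
  | 1, 1 => e₁₀ * g
  | 0, 2 => e₀₁ * g + e₀₀ * d
  | 3, 0 => e₁₀
  | 2, 1 => e₀₁ + e₂₀ * g
  | 1, 2 => e₁₀ * d + e₁₁ * g
  | 0, 3 => e₀₁ * d + e₀₂ * g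
  | 4, 0 => e₂₀
  | 3, 1 => e₁₁
  | 2, 2 => e₀₂ + e₂₀ * d
  | 1, 3 => e₁₁ * d
  | 0, 4 => e₀₂ * d
  | _, _ => 0

theorem expand_section (h2 : (2 : A) = 0) {c : ℕ → ℕ → ℕ → A} {α₁ ν₁ β₁ α₂ ν₂ β₂ a₁ b₁ a₂ b₂ s r t : A}
    (hc : ∀ j k, j + k ≤ 4 → c 0 j k = sectionCoeff α₁ ν₁ β₁ α₂ ν₂ β₂ j k)
    (ha₁ : a₁ = α₁ * s ^ 2 + ν₁ * s + β₁) (ha₂ : a₂ = α₂ * s ^ 2 + ν₂ * s + β₂)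
    (hb₁ : b₁ = α₁ * r + β₁ * t) (hb₂ : b₂ = α₂ * r + β₂ * t) {P N M : Fin 4 → A}
    (hP : P = ![0, s ^ 2, s, 1]) (hN : N = ![0, 0, 1, 0]) (hM : M = ![0, r, 0, t])
    {i j : ℕ} (hi : i < 5) (hj : j < 5) : expand c P N M i j =
      sectionExpand (a₁ * a₂) (a₁ * ν₂ + ν₁ * a₂) (a₁ * b₂ + b₁ * a₂) (ν₁ * ν₂)
        (ν₁ * b₂ + b₁ * ν₂) (b₁ * b₂) (r + s ^ 2 * t) (r * t) i j := by
  refine expand_eq_of_eq_sum ?_ hi hj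
  have h2' : (2 : Polynomial (Polynomial A)) = 0 := by
    have : Polynomial.C (Polynomial.C (2 : A)) = 0 := by rw [h2, map_zero, map_zero]
    rwa [map_ofNat, map_ofNat] at this
  have e0 : expandLin (P 0) (N 0) (M 0) = 0 := by simp [hP, hN, hM, expandLin]
  rw [e0, quartic_sectionCoeff (α₁ := .C (.C α₁)) (ν₁ := .C (.C ν₁)) (β₁ := .C (.C β₁))
    (α₂ := .C (.C α₂)) (ν₂ := .C (.C ν₂)) (β₂ := .C (.C β₂)) fun j k h => by
      rw [hc j k h, map_sectionCoeff, map_sectionCoeff]]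
  simp only [hP, hN, hM, expandLin, Finset.sum_range_succ, Finset.sum_range_zero, sectionExpand,
    Matrix.cons_val, ha₁, ha₂, hb₁, hb₂, map_add, map_mul, map_pow, map_zero, map_one]
  linear_combination (.C (.C α₁) * (.C (.C s) ^ 2 + .C (.C r) * .X) + .C (.C ν₁) * (.C (.C s) + .C .X) +
    .C (.C β₁) * (1 + .C (.C t) * .X)) * (.C (.C α₂) * (.C (.C s) ^ 2 + .C (.C r) * .X) +
    .C (.C ν₂) * (.C (.C s) + .C .X) + .C (.C β₂) * (1 + .C (.C t) * .X)) *
    (.C (.C s) ^ 2 + .C (.C s) * .C .X : Polynomial (Polynomial A)) * h2'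

theorem res24_section (h2 : (2 : A) = 0) {c : ℕ → ℕ → ℕ → A} {α₁ ν₁ β₁ α₂ ν₂ β₂ s r t : A}
    (hc : ∀ j k, j + k ≤ 4 → c 0 j k = sectionCoeff α₁ ν₁ β₁ α₂ ν₂ β₂ j k)
    (h : (α₁ * s ^ 2 + ν₁ * s + β₁) * (α₂ * s ^ 2 + ν₂ * s + β₂) = 0) {P N M : Fin 4 → A}
    (hP : P = ![0, s ^ 2, s, 1]) (hN : N = ![0, 0, 1, 0]) (hM : M = ![0, r, 0, t]) (l : A) :
    res24 (expandQ (expand c P N M)) (expandF l (expand c P N M)) = 0 := by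
  have he := fun {i j : ℕ} (hi : i < 5) (hj : j < 5) =>
    expand_section h2 hc rfl rfl rfl rfl hP hN hM hi hj
  set a₁ := α₁ * s ^ 2 + ν₁ * s + β₁
  set a₂ := α₂ * s ^ 2 + ν₂ * s + β₂
  set b₁ := α₁ * r + β₁ * t
  set b₂ := α₂ * r + β₂ * t
  have hE : ν₁ * ν₂ * (a₁ * b₂ + b₁ * a₂) ^ 2 + (ν₁ * b₂ + b₁ * ν₂) * (a₁ * ν₂ + ν₁ * a₂) *
      (a₁ * b₂ + b₁ * a₂) + b₁ * b₂ * (a₁ * ν₂ + ν₁ * a₂) ^ 2 = 0 := by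
    clear_value a₁ a₂ b₁ b₂
    clear he hc hP hN hM
    grind
  simp only [expandQ, expandF, res24, Nat.sub_zero, Nat.sub_self, Nat.reduceSub,
    he (show 0 < 5 by norm_num) (show 2 < 5 by norm_num), he (show 0 < 5 by norm_num) (show 3 < 5 by norm_num),
    he (show 0 < 5 by norm_num) (show 4 < 5 by norm_num), he (show 1 < 5 by norm_num) (show 1 < 5 by norm_num),
    he (show 1 < 5 by norm_num) (show 2 < 5 by norm_num), he (show 1 < 5 by norm_num) (show 3 < 5 by norm_num),
    he (show 2 < 5 by norm_num) (show 0 < 5 by norm_num), he (show 2 < 5 by norm_num) (show 1 < 5 by norm_num),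
    he (show 2 < 5 by norm_num) (show 2 < 5 by norm_num), he (show 3 < 5 by norm_num) (show 0 < 5 by norm_num),
    he (show 3 < 5 by norm_num) (show 1 < 5 by norm_num), he (show 4 < 5 by norm_num) (show 0 < 5 by norm_num),
    sectionExpand, h]
  generalize a₁ * ν₂ + ν₁ * a₂ = m₁ at *
  generalize a₁ * b₂ + b₁ * a₂ = m₂ at *
  generalize ν₁ * ν₂ = e₂₀ at *
  generalize ν₁ * b₂ + b₁ * ν₂ = e₁₁ at *
  generalize b₁ * b₂ = e₀₂ at *
  generalize r + s ^ 2 * t = g at *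
  generalize r * t = d at *
  linear_combination g ^ 4 * e₂₀ * (m₂ ^ 2 + d * m₁ ^ 2 + l * g * m₁ ^ 2) * (hE - e₁₁ * m₁ * m₂ * h2)

end Section

section Incidence
open scoped Polynomial
variable {K : Type*} [Field K]

/-- A count of points on the affine line, each counted at most twice. -/
theorem card_le_of_incidence {ι : Type*} (S : Finset ι) (a : ι → K) {p q : K[X]} (hp : p ≠ 0)
    (hq : ∀ i ∈ S, q.eval (a i) ≠ 0) (h1 : ∀ i ∈ S, Polynomial.X - Polynomial.C (a i) ∣ q * p)
    (h2 : ∀ i ∈ S, ∀ j ∈ S, i ≠ j → a i = a j → (Polynomial.X - Polynomial.C (a i)) ^ 2 ∣ q * p)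
    (h3 : ∀ i ∈ S, ∀ j ∈ S, ∀ k ∈ S, i ≠ j → i ≠ k → a i = a j → a i = a k → j = k) :
    S.card ≤ p.natDegree := by
  classical
  rw [Finset.card_eq_sum_card_image a S]
  refine sum_le_natDegree_of_dvd hp (S.image a) (a := id) (fun _ _ _ _ h => h) _ fun s hs => ?_
  obtain ⟨i, hi, rfl⟩ := Finset.mem_image.1 hs
  have hcop : IsCoprime (Polynomial.X - Polynomial.C (a i)) q :=
    (Polynomial.irreducible_X_sub_C _).coprime_iff_not_dvd.2 fun h =>
      hq i hi (Polynomial.dvd_iff_isRoot.1 h)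
  refine (hcop.pow_left (m := _)).dvd_of_dvd_mul_left ?_
  have hle : (S.filter fun j => a j = a i).card ≤ 2 := by
    by_contra! h
    obtain ⟨j, k, m, hj, hk, hm, hjk, hjm, hkm⟩ := Finset.two_lt_card_iff.1 h
    rw [Finset.mem_filter] at hj hk hm
    exact hkm (h3 j hj.1 k hk.1 m hm.1 hjk hjm (hj.2.trans hk.2.symm) (hj.2.trans hm.2.symm))
  rcases Nat.lt_or_ge (S.filter fun j => a j = a i).card 2 with h | h
  · exact (pow_dvd_pow _ (Nat.lt_succ_iff.1 h)).trans (by simpa using h1 i hi)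
  · obtain ⟨j, hj, k, hk, hjk⟩ := Finset.one_lt_card.1 h
    rw [Finset.mem_filter] at hj hk
    have := h2 j hj.1 k hk.1 hjk (hj.2.trans hk.2.symm)
    rw [hj.2] at this
    exact (pow_dvd_pow _ hle).trans this

variable {F : MvPolynomial (Fin 4) K} {b : Module.Basis (Fin 4) K (Fin 4 → K)}
  {c : ℕ → ℕ → ℕ → K}

theorem pt_add_smul (P N : Fin 4 → K) (t : K) : pt b (P 0) (P 1) (P 2) (P 3) +
    t • pt b (N 0) (N 1) (N 2) (N 3) =
      pt b (P 0 + t * N 0) (P 1 + t * N 1) (P 2 + t * N 2) (P 3 + t * N 3) := by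
  simp only [pt]; module

theorem Coords.expand_zero_zero (h : Coords F b c) (P N M : Fin 4 → K) :
    expand c P N M 0 0 = eval (pt b (P 0) (P 1) (P 2) (P 3)) F := by
  have := quartic_expand_line c P N M 0 0 0
  simp only [zero_mul, mul_zero, add_zero, ne_eq, OfNat.ofNat_ne_zero, not_false_eq_true, zero_pow] at this
  rw [h.2, this]

theorem Coords.expand_linear [Infinite K] (h : Coords F b c) (P N M : Fin 4 → K) (x y : K) :
    expand c P N M 1 0 * x + expand c P N M 0 1 * y = grad F (pt b (P 0) (P 1) (P 2) (P 3))
      (x • pt b (N 0) (N 1) (N 2) (N 3) + y • pt b (M 0) (M 1) (M 2) (M 3)) := by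
  obtain ⟨r, hr⟩ := taylor_line F (pt b (P 0) (P 1) (P 2) (P 3))
    (x • pt b (N 0) (N 1) (N 2) (N 3) + y • pt b (M 0) (M 1) (M 2) (M 3))
  rw [grad_apply]
  have key : ∀ u v w : K, ∃ r' : K[X], ∀ t, r'.eval t = u + v * t + w * t ^ 2 := fun u v w =>
    ⟨.C u + .C v * .X + .C w * .X ^ 2, fun t => by simp⟩
  obtain ⟨r', hr'⟩ := key (expand c P N M 2 0 * x ^ 2 +
    expand c P N M 1 1 * x * y + expand c P N M 0 2 * y ^ 2) (expand c P N M 3 0 * x ^ 3 +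
    expand c P N M 2 1 * x ^ 2 * y + expand c P N M 1 2 * x * y ^ 2 + expand c P N M 0 3 * y ^ 3)
    (expand c P N M 4 0 * x ^ 4 + expand c P N M 3 1 * x ^ 3 * y + expand c P N M 2 2 * x ^ 2 * y ^ 2 +
      expand c P N M 1 3 * x * y ^ 3 + expand c P N M 0 4 * y ^ 4)
  refine linear_coeff_unique (a := expand c P N M 0 0)
    (a' := eval (pt b (P 0) (P 1) (P 2) (P 3)) F) (r := r') (r' := r) fun t => ?_
  rw [← hr]
  have e : pt b (P 0) (P 1) (P 2) (P 3) +
      t • (x • pt b (N 0) (N 1) (N 2) (N 3) + y • pt b (M 0) (M 1) (M 2) (M 3)) =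
      pt b (P 0 + t * (x * N 0 + y * M 0)) (P 1 + t * (x * N 1 + y * M 1))
        (P 2 + t * (x * N 2 + y * M 2)) (P 3 + t * (x * N 3 + y * M 3)) := by
    simp only [pt]; module
  rw [e, h.2, quartic_expand_line, hr']
  ring

/-- A point whose tangent directions are spanned by `N` and `M` and which lies on no line. -/
theorem Coords.exists_res24_ne_zero [IsAlgClosed K] [Infinite K] (hF : IsSmoothQuartic F) (h : Coords F b c)
    {P N M : Fin 4 → K} (h0 : eval (pt b (P 0) (P 1) (P 2) (P 3)) F = 0)
    (hN : grad F (pt b (P 0) (P 1) (P 2) (P 3)) (pt b (N 0) (N 1) (N 2) (N 3)) = 0)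
    (hM : grad F (pt b (P 0) (P 1) (P 2) (P 3)) (pt b (M 0) (M 1) (M 2) (M 3)) = 0)
    (hind : ∀ x z w : K, (∀ i, z * P i + w * (x * N i + M i) = 0) → z = 0 ∧ w = 0)
    (hoff : ∀ n ∈ lines F, pt b (P 0) (P 1) (P 2) (P 3) ∉ n)
    (hq : expand c P N M 2 0 ≠ 0 ∨ expand c P N M 2 0 = 0 ∧ expand c P N M 4 0 ≠ 0 ∧
      (expand c P N M 1 1 ≠ 0 ∨ expand c P N M 0 2 ≠ 0)) :
    ∃ l, res24 (expandQ (expand c P N M)) (expandF l (expand c P N M)) ≠ 0 := by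
  refine QuarticLines.exists_res24_ne_zero hq fun x h2 h3 h4 => ?_
  have e0 := h.expand_zero_zero P N M
  have e1 := h.expand_linear P N M 1 0
  have e1' := h.expand_linear P N M 0 1
  rw [h0] at e0
  simp only [mul_one, mul_zero, add_zero, zero_add, one_smul, zero_smul, hN, hM] at e1 e1'
  have key := quartic_line_eq_zero e0 e1 e1' h2 h3 h4
  have hpt : ∀ t, pt b (P 0) (P 1) (P 2) (P 3) + t • pt b (x * N 0 + M 0) (x * N 1 + M 1)
      (x * N 2 + M 2) (x * N 3 + M 3) = pt b (P 0 + t * (x * N 0 + M 0)) (P 1 + t * (x * N 1 + M 1))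
        (P 2 + t * (x * N 2 + M 2)) (P 3 + t * (x * N 3 + M 3)) := fun t => by
    simp only [pt]; module
  refine hoff _ (mem_lines_of_pair (u := pt b (P 0) (P 1) (P 2) (P 3)) (v := pt b (x * N 0 + M 0)
    (x * N 1 + M 1) (x * N 2 + M 2) (x * N 3 + M 3)) (fun z w hzw => ?_)
    (eval_eq_zero_of_affine hF.hom fun t => ?_)) (Submodule.subset_span (by simp))
  · have : pt b (z * P 0 + w * (x * N 0 + M 0)) (z * P 1 + w * (x * N 1 + M 1))
        (z * P 2 + w * (x * N 2 + M 2)) (z * P 3 + w * (x * N 3 + M 3)) = 0 := by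
      rw [← hzw]; simp only [pt]; module
    obtain ⟨k0, k1, k2, k3⟩ := pt_eq_zero.1 this
    refine hind x z w fun i => ?_
    fin_cases i
    exacts [k0, k1, k2, k3]
  · rw [hpt, h.2, key]

end Incidence

section Meeting
open scoped Polynomial
variable {K : Type*} [Field K] {F : MvPolynomial (Fin 4) K}
  {b : Module.Basis (Fin 4) K (Fin 4 → K)} {c : ℕ → ℕ → ℕ → K}

theorem Coords.quartic_eq_zero_of_mem (h : Coords F b c) {n : Submodule K (Fin 4 → K)}
    (hn : n ∈ lines F) {P D : Fin 4 → K} (hP : pt b (P 0) (P 1) (P 2) (P 3) ∈ n)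
    (hD : pt b (D 0) (D 1) (D 2) (D 3) ∈ n) (t : K) :
    quartic c (P 0 + t * D 0) (P 1 + t * D 1) (P 2 + t * D 2) (P 3 + t * D 3) = 0 := by
  rw [← h.2, ← pt_add_smul]
  exact hn.2 _ (n.add_mem hP (n.smul_mem _ hD))

/-- The polynomial `∂F/∂x` at the points `y = s ^ 2 w, z = s w` splits into two pieces. -/
noncomputable def gradRho (c : ℕ → ℕ → ℕ → K) : K[X] :=
  .C (c 1 0 0) + .C (c 1 0 1) * .X + .C (c 1 0 2) * .X ^ 2 + .C (c 1 0 3) * .X ^ 3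

/-- The complement of `gradRho`. -/
noncomputable def gradTau (c : ℕ → ℕ → ℕ → K) : K[X] :=
  .C (c 1 1 0) + .C (c 1 1 1) * .X + .C (c 1 1 2 + c 1 2 0) * .X ^ 2 + .C (c 1 2 1) * .X ^ 3 +
    .C (c 1 3 0) * .X ^ 4

/-- The product of two linear forms on a parametrized conic. -/
noncomputable def conicForms (α₁ ν₁ β₁ α₂ ν₂ β₂ : K) : K[X] :=
  (.C α₁ * .X ^ 2 + .C ν₁ * .X + .C β₁) * (.C α₂ * .X ^ 2 + .C ν₂ * .X + .C β₂)

variable {α₁ ν₁ β₁ α₂ ν₂ β₂ : K}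

theorem natDegree_conicForms (h₁ : α₁ ≠ 0) (h₂ : α₂ ≠ 0) :
    (conicForms α₁ ν₁ β₁ α₂ ν₂ β₂).natDegree = 4 := by
  have hd := fun {α ν β : K} (h : α ≠ 0) => Polynomial.natDegree_quadratic (b := ν) (c := β) h
  rw [conicForms, Polynomial.natDegree_mul, hd h₁, hd h₂]
  · exact Polynomial.ne_zero_of_natDegree_gt (n := 0) (by rw [hd h₁]; omega)
  · exact Polynomial.ne_zero_of_natDegree_gt (n := 0) (by rw [hd h₂]; omega)

variable [IsAlgClosed K] [CharP K 2]

theorem Coords.grad_conic (h : Coords F b c)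
    (hs : ∀ j k, j + k ≤ 4 → c 0 j k = sectionCoeff α₁ ν₁ β₁ α₂ ν₂ β₂ j k) (s x y z w : K) :
    grad F (pt b 0 (s ^ 2) s 1) (pt b x y z w) =
      x * ((gradRho c).eval s + s ^ 2 * (gradTau c).eval s) +
        (y + s ^ 2 * w) * (conicForms α₁ ν₁ β₁ α₂ ν₂ β₂).eval s := by
  have h2 : (2 : K) = 0 := CharTwo.two_eq_zero
  rw [h.grad_eq]
  simp only [quarticX, quarticY, quarticZ, quarticW, gradRho, gradTau, conicForms,
    Polynomial.eval_add, Polynomial.eval_mul, Polynomial.eval_C, Polynomial.eval_X, Polynomial.eval_pow,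
    hs 0 1 (by omega), hs 0 3 (by omega), hs 1 0 (by omega), hs 1 1 (by omega), hs 1 2 (by omega),
    hs 1 3 (by omega), hs 2 1 (by omega), hs 3 0 (by omega), hs 3 1 (by omega), sectionCoeff]
  linear_combination z * ((ν₁ * β₂ + β₁ * ν₂) * s ^ 2 + (α₁ * ν₂ + ν₁ * α₂) * s ^ 4) * h2

/-- The lines of the surface skew to two given coplanar lines, in coordinates. -/
theorem exists_conic_point (hc : Coords F b c)
    (hs : ∀ y z w, quartic c 0 y z w =
      (α₁ * y + ν₁ * z + β₁ * w) * (α₂ * y + ν₂ * z + β₂ * w) * (y * w + z ^ 2))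
    (hs' : ∀ j k, j + k ≤ 4 → c 0 j k = sectionCoeff α₁ ν₁ β₁ α₂ ν₂ β₂ j k)
    {n : Submodule K (Fin 4 → K)} (hn : n ∈ lines F) (hb : b 1 ∉ n)
    (h₁ : ∀ y z w, pt b 0 y z w ∈ n → α₁ * y + ν₁ * z + β₁ * w = 0 → pt b 0 y z w = 0)
    (h₂ : ∀ y z w, pt b 0 y z w ∈ n → α₂ * y + ν₂ * z + β₂ * w = 0 → pt b 0 y z w = 0) :
    ∃ s x, (conicForms α₁ ν₁ β₁ α₂ ν₂ β₂).eval s ≠ 0 ∧ pt b 0 (s ^ 2) s 1 ∈ n ∧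
      pt b ((conicForms α₁ ν₁ β₁ α₂ ν₂ β₂).eval s) ((gradRho c).eval s) x ((gradTau c).eval s) ∈ n := by
  have h2 : (2 : K) = 0 := CharTwo.two_eq_zero
  have hpt : ∀ v, b.coord 0 v = 0 → v = pt b 0 (b.coord 1 v) (b.coord 2 v) (b.coord 3 v) :=
    fun v hv => exists_eq_pt_ker (φ := b.coord 0) (by simp) (by simp) (by simp) (by simp) hv
  obtain ⟨v, hv, hv0, hne⟩ := exists_mem_ker hn.1 (b.coord 0)
  obtain ⟨y, z, w, rfl⟩ : ∃ y z w, v = pt b 0 y z w := ⟨_, _, _, hpt v hv0⟩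
  have hl₁ := fun e => hne (h₁ y z w hv e)
  have hl₂ := fun e => hne (h₂ y z w hv e)
  have h0 := hn.2 _ hv
  rw [hc.2, hs] at h0
  have hyw : y * w + z ^ 2 = 0 := (mul_eq_zero.1 h0).resolve_left (mul_ne_zero hl₁ hl₂)
  have hw : w ≠ 0 := fun hw => by
    have hz : z = 0 := by simpa [hw] using hyw
    have hy : y ≠ 0 := fun hy => hne (pt_eq_zero.2 ⟨rfl, hy, hz, hw⟩)
    refine hb ?_
    have := n.smul_mem y⁻¹ hv
    simpa [pt, hw, hz, smul_smul, hy] using this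
  have hP : pt b 0 ((z / w) ^ 2) (z / w) 1 ∈ n := by
    have : pt b 0 ((z / w) ^ 2) (z / w) 1 = w⁻¹ • pt b 0 y z w := by
      have e : (z / w) ^ 2 = w⁻¹ * y := by
        field_simp
        linear_combination hyw - y * w * h2
      rw [e]
      simp only [pt, smul_add, smul_smul, inv_mul_cancel₀ hw, one_smul, zero_smul, smul_zero,
        div_eq_inv_mul]
    rw [this]; exact n.smul_mem _ hv
  generalize z / w = s at hP
  clear h0 hl₁ hl₂ hyw hw hv hv0 hne y z w
  have hP0 : pt b 0 (s ^ 2) s 1 ≠ 0 := fun h => one_ne_zero (pt_eq_zero.1 h).2.2.2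
  have hlam : (conicForms α₁ ν₁ β₁ α₂ ν₂ β₂).eval s ≠ 0 := by
    simp only [conicForms, Polynomial.eval_mul, Polynomial.eval_add, Polynomial.eval_C,
      Polynomial.eval_X, Polynomial.eval_pow]
    exact mul_ne_zero (fun e => hP0 (h₁ _ _ _ hP (by linear_combination e)))
      fun e => hP0 (h₂ _ _ _ hP (by linear_combination e))
  obtain ⟨d, hd, hd0⟩ : ∃ d ∈ n, b.coord 0 d ≠ 0 := by
    by_contra! hcon
    obtain ⟨v, hv, hv0, hne⟩ := exists_mem_ker hn.1 (α₁ • b.coord 1 + ν₁ • b.coord 2 + β₁ • b.coord 3)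
    have e := hpt v (hcon v hv)
    refine hne (e.trans (h₁ _ _ _ (e ▸ hv) ?_))
    simpa using hv0
  obtain ⟨x, y, z, w, rfl⟩ := exists_eq_pt b d
  rw [coord_pt] at hd0
  have hx : x ≠ 0 := hd0
  have hg : grad F (pt b 0 (s ^ 2) s 1) (pt b x y z w) = 0 := le_ker_grad hn hP hd
  rw [hc.grad_conic hs'] at hg
  set L := (conicForms α₁ ν₁ β₁ α₂ ν₂ β₂).eval s
  set r := (gradRho c).eval s
  set t := (gradTau c).eval s
  let Y := x / L
  let a := w - Y * t
  refine ⟨s, Y⁻¹ * (z - a * s), hlam, hP, ?_⟩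
  have hY : Y ≠ 0 := div_ne_zero hx hlam
  have hYL : Y * L = x := div_mul_cancel₀ x hlam
  have : pt b L r (Y⁻¹ * (z - a * s)) t = Y⁻¹ • (pt b x y z w - a • pt b 0 (s ^ 2) s 1) := by
    have e0 : L = Y⁻¹ * (x - a * 0) := by field_simp; linear_combination hYL
    have e1 : r = Y⁻¹ * (y - a * s ^ 2) := by
      have : L * (Y * r - (y - a * s ^ 2)) = 0 := by
        linear_combination -hg + (r + s ^ 2 * w + s ^ 2 * t) * hYL * 0 +
          (r - s ^ 2 * t) * hYL + (x * r + L * s ^ 2 * w) * h2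
      field_simp
      linear_combination (mul_eq_zero.1 this).resolve_left hlam
    have e3 : t = Y⁻¹ * (w - a * 1) := by field_simp; simp only [a]; ring
    clear_value a Y
    rw [e1]
    nth_rw 1 [e0]
    nth_rw 1 [e3]
    simp only [pt]; module
  rw [this]
  exact n.smul_mem _ (n.sub_mem hd (n.smul_mem _ hP))

end Meeting

section Meeting
open scoped Polynomial
variable {K : Type*} [Field K] [IsAlgClosed K] [CharP K 2] {F : MvPolynomial (Fin 4) K}
  {b : Module.Basis (Fin 4) K (Fin 4 → K)} {c : ℕ → ℕ → ℕ → K} {α₁ ν₁ β₁ α₂ ν₂ β₂ : K}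

/-- The resultant along the residual conic. -/
noncomputable def conicRes (c : ℕ → ℕ → ℕ → K) (q : K[X]) (l : K) : K[X] :=
  lineRes c ![0, .X ^ 2, .X, 1] ![0, 0, 1, 0] ![q, gradRho c, 0, gradTau c] l

theorem natDegree_gradRho_le : (gradRho c).natDegree ≤ 4 := by
  unfold gradRho; compute_degree; omega

theorem natDegree_gradTau_le : (gradTau c).natDegree ≤ 4 := by
  unfold gradTau; compute_degree

theorem natDegree_conicRes_le (h₁ : α₁ ≠ 0) (h₂ : α₂ ≠ 0) (l : K) :
    (conicRes c (conicForms α₁ ν₁ β₁ α₂ ν₂ β₂) l).natDegree ≤ 48 := by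
  refine natDegree_lineRes_le c (p := 2) (n := 0) (m := 4) (fun v => ?_) (fun v => ?_) (fun v => ?_)
    (by omega) (by omega) l
  · fin_cases v <;> simp
  · fin_cases v <;> simp
  · fin_cases v
    · exact (natDegree_conicForms h₁ h₂).le
    · exact natDegree_gradRho_le
    · simp
    · exact natDegree_gradTau_le

theorem conicForms_dvd_conicRes
    (hs : ∀ j k, j + k ≤ 4 → c 0 j k = sectionCoeff α₁ ν₁ β₁ α₂ ν₂ β₂ j k) (l : K) :
    conicForms α₁ ν₁ β₁ α₂ ν₂ β₂ ∣ conicRes c (conicForms α₁ ν₁ β₁ α₂ ν₂ β₂) l := by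
  obtain ⟨q, hq⟩ : ∃ q, conicForms α₁ ν₁ β₁ α₂ ν₂ β₂ = q := ⟨_, rfl⟩
  rw [hq]
  let π := Ideal.Quotient.mk (Ideal.span {q})
  have hπ : ∀ p, π p = 0 ↔ q ∣ p := fun p => Ideal.Quotient.eq_zero_iff_dvd q p
  have h2 : (2 : K[X] ⧸ Ideal.span {q}) = 0 := by
    have : π (.C 2) = 0 := by rw [CharTwo.two_eq_zero, map_zero, map_zero]
    rwa [map_ofNat, map_ofNat] at this
  have h0 : π (conicForms α₁ ν₁ β₁ α₂ ν₂ β₂) = 0 := by rw [hq]; exact (hπ q).2 dvd_rfl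
  rw [← hπ, conicRes, lineRes, res24_map]
  have key := res24_section h2 (c := fun i j k => π (.C (c i j k))) (α₁ := π (.C α₁)) (ν₁ := π (.C ν₁))
    (β₁ := π (.C β₁)) (α₂ := π (.C α₂)) (ν₂ := π (.C ν₂)) (β₂ := π (.C β₂)) (s := π .X)
    (r := π (gradRho c)) (t := π (gradTau c))
    (P := fun v => π ((![0, .X ^ 2, .X, 1] : Fin 4 → K[X]) v))
    (N := fun v => π ((![0, 0, 1, 0] : Fin 4 → K[X]) v))
    (M := fun v => π ((![q, gradRho c, 0, gradTau c] : Fin 4 → K[X]) v))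
    (fun j k hjk => by rw [hs j k hjk, map_sectionCoeff, map_sectionCoeff])
    (by simpa [conicForms] using h0)
    (by ext v; fin_cases v <;> simp) (by ext v; fin_cases v <;> simp)
    (by ext v; fin_cases v <;> simp [(hπ q).2 dvd_rfl]) (π (.C l))
  convert key using 1
  refine res24_congr (fun i hi => ?_) fun i hi => ?_
  · simp only [expandQ, expand_map]
  · unfold expandF
    split <;> simp only [expand_map, map_add, map_mul, map_zero]

theorem expand_conic
    (hs : ∀ j k, j + k ≤ 4 → c 0 j k = sectionCoeff α₁ ν₁ β₁ α₂ ν₂ β₂ j k) {s : K} {M : Fin 4 → K} :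
    expand c ![0, s ^ 2, s, 1] ![0, 0, 1, 0] M 2 0 = (conicForms α₁ ν₁ β₁ α₂ ν₂ β₂).eval s := by
  have h2 : (2 : K) = 0 := CharTwo.two_eq_zero
  let φ := expand c ![0, s ^ 2, s, 1] ![0, 0, 1, 0] M
  let a₁ := α₁ * s ^ 2 + ν₁ * s + β₁
  let a₂ := α₂ * s ^ 2 + ν₂ * s + β₂
  have key : ∀ t : K, φ 0 0 + φ 1 0 * t + (φ 2 0 - (conicForms α₁ ν₁ β₁ α₂ ν₂ β₂).eval s) * t ^ 2 +
      (φ 3 0 - (a₁ * ν₂ + ν₁ * a₂)) * t ^ 3 + (φ 4 0 - ν₁ * ν₂) * t ^ 4 = 0 := fun t => by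
    have e := quartic_expand_line c ![0, s ^ 2, s, 1] ![0, 0, 1, 0] M 1 0 t
    simp only [Matrix.cons_val, mul_zero, zero_mul, add_zero] at e
    rw [quartic_sectionCoeff hs] at e
    simp only [conicForms, Polynomial.eval_mul, Polynomial.eval_add, Polynomial.eval_C,
      Polynomial.eval_X, Polynomial.eval_pow, φ, a₁, a₂]
    linear_combination -e + (α₁ * s ^ 2 + ν₁ * (s + t) + β₁) * (α₂ * s ^ 2 + ν₂ * (s + t) + β₂) *
      (s ^ 2 + s * t) * h2
  exact sub_eq_zero.1 (coeffs_eq_zero_of_forall key).2.2.1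

end Meeting

section Meeting
open scoped Polynomial
variable {K : Type*} [Field K] [IsAlgClosed K] [CharP K 2] {F : MvPolynomial (Fin 4) K}
  {b : Module.Basis (Fin 4) K (Fin 4 → K)} {c : ℕ → ℕ → ℕ → K} {α₁ ν₁ β₁ α₂ ν₂ β₂ : K}

theorem exists_conicRes_ne_zero (hF : IsSmoothQuartic F) (hc : Coords F b c)
    (hs : ∀ y z w, quartic c 0 y z w =
      (α₁ * y + ν₁ * z + β₁ * w) * (α₂ * y + ν₂ * z + β₂ * w) * (y * w + z ^ 2))
    (h0 : conicForms α₁ ν₁ β₁ α₂ ν₂ β₂ ≠ 0) :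
    ∃ l, conicRes c (conicForms α₁ ν₁ β₁ α₂ ν₂ β₂) l ≠ 0 := by
  have : Infinite K := IsAlgClosed.instInfinite
  have hs' := eq_sectionCoeff hs
  have hpt : ∀ s : K, b 3 + s • b 2 + s ^ 2 • b 1 = pt b 0 (s ^ 2) s 1 := fun s => by
    simp only [pt]; module
  obtain ⟨s, hs₀⟩ := (((finite_lines hF).biUnion fun m (hm : m ∈ lines F) =>
    finite_conic_points (u0 := b 3) (u1 := b 2) (u2 := b 1) (fun y z w h => by
      obtain ⟨-, h1, h2, h3⟩ := pt_eq_zero (b := b) (x := 0) (y := w) (z := z) (w := y) |>.1 (by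
        rw [← h]; simp only [pt]; module)
      exact ⟨h3, h2, h1⟩) hm.1).union (Polynomial.finite_setOfPred_isRoot h0)).exists_notMem
  simp only [Set.mem_union, Set.mem_iUnion, not_or, not_exists, hpt] at hs₀
  obtain ⟨hoff, hroot⟩ := hs₀
  set q := conicForms α₁ ν₁ β₁ α₂ ν₂ β₂
  have hqs : q.eval s ≠ 0 := hroot
  have h2 : (2 : K) = 0 := CharTwo.two_eq_zero
  obtain ⟨l, hl⟩ := Coords.exists_res24_ne_zero hF hc (P := ![0, s ^ 2, s, 1]) (N := ![0, 0, 1, 0])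
    (M := ![q.eval s, (gradRho c).eval s, 0, (gradTau c).eval s])
    (by
      simp only [Matrix.cons_val, hc.2, hs]
      linear_combination (α₁ * s ^ 2 + ν₁ * s + β₁ * 1) * (α₂ * s ^ 2 + ν₂ * s + β₂ * 1) * s ^ 2 * h2)
    (by simp only [Matrix.cons_val]; rw [hc.grad_conic hs']; ring)
    (by
      simp only [Matrix.cons_val]; rw [hc.grad_conic hs']
      linear_combination (q.eval s * ((gradRho c).eval s + s ^ 2 * (gradTau c).eval s)) * h2)
    (fun x z w h => by
      have e0 := h 0
      have e3 := h 3
      simp only [Matrix.cons_val, mul_zero, zero_add, mul_eq_zero, hqs, or_false] at e0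
      simpa [e0] using e3)
    (fun n hn => hoff n hn) (Or.inl (by rw [expand_conic hs']; exact hqs))
  refine ⟨l, fun h => hl ?_⟩
  have e := eval_lineRes c ![0, .X ^ 2, .X, 1] ![0, 0, 1, 0] ![q, gradRho c, 0, gradTau c] l s
  rw [show lineRes c _ _ _ l = conicRes c q l from rfl, h, Polynomial.eval_zero] at e
  rw [show (fun v => ((![0, .X ^ 2, .X, 1] : Fin 4 → K[X]) v).eval s) = ![0, s ^ 2, s, 1] by
      ext v; fin_cases v <;> simp, show (fun v => ((![0, 0, 1, 0] : Fin 4 → K[X]) v).eval s) =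
      ![0, 0, 1, 0] by ext v; fin_cases v <;> simp,
    show (fun v => ((![q, gradRho c, 0, gradTau c] : Fin 4 → K[X]) v).eval s) =
      ![q.eval s, (gradRho c).eval s, 0, (gradTau c).eval s] by ext v; fin_cases v <;> simp] at e
  exact e.symm

theorem card_conic_points_le (hF : IsSmoothQuartic F) (hN : NoTriple F) (hc : Coords F b c)
    (hs : ∀ y z w, quartic c 0 y z w =
      (α₁ * y + ν₁ * z + β₁ * w) * (α₂ * y + ν₂ * z + β₂ * w) * (y * w + z ^ 2))
    (h₁ : α₁ ≠ 0) (h₂ : α₂ ≠ 0) (S : Finset (Submodule K (Fin 4 → K)))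
    (hS : ∀ n ∈ S, n ∈ lines F ∧
      ∃ s x, (conicForms α₁ ν₁ β₁ α₂ ν₂ β₂).eval s ≠ 0 ∧ pt b 0 (s ^ 2) s 1 ∈ n ∧
      pt b ((conicForms α₁ ν₁ β₁ α₂ ν₂ β₂).eval s) ((gradRho c).eval s) x ((gradTau c).eval s) ∈ n) :
    S.card ≤ 44 := by
  have : Infinite K := IsAlgClosed.instInfinite
  have hs' := eq_sectionCoeff hs
  have hdeg := natDegree_conicForms (ν₁ := ν₁) (β₁ := β₁) (ν₂ := ν₂) (β₂ := β₂) h₁ h₂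
  have hq0 : conicForms α₁ ν₁ β₁ α₂ ν₂ β₂ ≠ 0 :=
    Polynomial.ne_zero_of_natDegree_gt (n := 0) (by omega)
  obtain ⟨l, hl⟩ := exists_conicRes_ne_zero hF hc hs hq0
  have hle := natDegree_conicRes_le (c := c) (ν₁ := ν₁) (β₁ := β₁) (ν₂ := ν₂) (β₂ := β₂) h₁ h₂ l
  obtain ⟨p, hp⟩ := conicForms_dvd_conicRes hs' l
  obtain ⟨q, hq⟩ : ∃ q, conicForms α₁ ν₁ β₁ α₂ ν₂ β₂ = q := ⟨_, rfl⟩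
  simp only [hq] at hS hdeg hq0 hl hle hp
  have hp0 : p ≠ 0 := by rintro rfl; exact hl (by rw [hp, mul_zero])
  rw [hp, Polynomial.natDegree_mul hq0 hp0, hdeg] at hle
  suffices S.card ≤ p.natDegree by omega
  choose! s x hqs hP hD using fun n hn => (hS n hn).2
  have hmem : ∀ n ∈ S, n ∈ lines F := fun n hn => (hS n hn).1
  have hvan : ∀ n ∈ S, ∀ t, quartic c
      (((![0, .X ^ 2, .X, 1] : Fin 4 → K[X]) 0).eval (s n) + t * (x n *
        ((![0, 0, 1, 0] : Fin 4 → K[X]) 0).eval (s n) +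
        ((![q, gradRho c, 0, gradTau c] : Fin 4 → K[X]) 0).eval (s n)))
      (((![0, .X ^ 2, .X, 1] : Fin 4 → K[X]) 1).eval (s n) + t * (x n *
        ((![0, 0, 1, 0] : Fin 4 → K[X]) 1).eval (s n) +
        ((![q, gradRho c, 0, gradTau c] : Fin 4 → K[X]) 1).eval (s n)))
      (((![0, .X ^ 2, .X, 1] : Fin 4 → K[X]) 2).eval (s n) + t * (x n *
        ((![0, 0, 1, 0] : Fin 4 → K[X]) 2).eval (s n) +
        ((![q, gradRho c, 0, gradTau c] : Fin 4 → K[X]) 2).eval (s n)))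
      (((![0, .X ^ 2, .X, 1] : Fin 4 → K[X]) 3).eval (s n) + t * (x n *
        ((![0, 0, 1, 0] : Fin 4 → K[X]) 3).eval (s n) +
        ((![q, gradRho c, 0, gradTau c] : Fin 4 → K[X]) 3).eval (s n))) = 0 := fun n hn t => by
    have e := hc.quartic_eq_zero_of_mem (hmem n hn) (P := ![0, s n ^ 2, s n, 1])
      (D := ![q.eval (s n), (gradRho c).eval (s n), x n, (gradTau c).eval (s n)]) (hP n hn) (hD n hn) t
    simpa using e
  have hspan : ∀ n ∈ S, Submodule.span K {pt b 0 (s n ^ 2) (s n) 1,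
      pt b (q.eval (s n)) ((gradRho c).eval (s n)) (x n) ((gradTau c).eval (s n))} = n := fun n hn =>
    span_pair_eq (hmem n hn).1 (hP n hn) (hD n hn) fun z w h => by
      obtain ⟨e0, -, -, e3⟩ := pt_eq_zero (b := b) (x := w * q.eval (s n)) (y := z * s n ^ 2 +
        w * (gradRho c).eval (s n)) (z := z * s n + w * x n) (w := z + w * (gradTau c).eval (s n)) |>.1
        (by rw [← h]; simp only [pt]; module)
      have hw : w = 0 := (mul_eq_zero.1 e0).resolve_right (hqs n hn)
      exact ⟨by simpa [hw] using e3, hw⟩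
  refine card_le_of_incidence S s hp0 hqs (fun n hn => ?_) (fun n hn m hm hnm e => ?_)
    fun n hn m hm k hk hnm hnk e e' => ?_
  · rw [← hp]
    exact dvd_lineRes (hvan n hn) l
  · rw [← hp]
    refine sq_dvd_lineRes (hvan n hn) (x' := x m) (by rw [e]; exact hvan m hm) (fun hx => hnm ?_) ?_ l
    · rw [← hspan n hn, ← hspan m hm, e, hx]
    · have := expand_conic hs' (s := s n) (M := fun v =>
        ((![q, gradRho c, 0, gradTau c] : Fin 4 → K[X]) v).eval (s n))
      rw [hq] at this
      rw [show (fun v => ((![0, .X ^ 2, .X, 1] : Fin 4 → K[X]) v).eval (s n)) =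
        ![0, s n ^ 2, s n, 1] by ext v; fin_cases v <;> simp,
        show (fun v => ((![0, 0, 1, 0] : Fin 4 → K[X]) v).eval (s n)) = ![0, 0, 1, 0] by
          ext v; fin_cases v <;> simp, this]
      exact hqs n hn
  · exact hN.eq_of_common hF (hmem n hn) (hmem m hm) (hmem k hk)
      (fun h => one_ne_zero (pt_eq_zero.1 h).2.2.2) (hP n hn) (by rw [e]; exact hP m hm)
      (by rw [e']; exact hP k hk) hnm hnk

theorem ncard_lines_le_of_meeting (hF : IsSmoothQuartic F) (hN : NoTriple F)
    {W W' : Submodule K (Fin 4 → K)} (hW : W ∈ lines F) (hW' : W' ∈ lines F) (hne : W ≠ W')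
    {o : Fin 4 → K} (hv : o ≠ 0) (hvW : o ∈ W) (hvW' : o ∈ W') :
    (lines F).ncard ≤ (nbrs F W).ncard + (nbrs F W').ncard + 44 := by
  obtain ⟨b, c, α₁, ν₁, β₁, α₂, ν₂, β₂, hc, hs, hl₁, hl₂, hb⟩ :=
    exists_conic_basis hF hN hW hW' hne hv hvW hvW'
  have hb1 : pt b 0 1 0 0 = b 1 := by simp [pt]
  have hα₁ : α₁ ≠ 0 := fun e => hb W hW (hb1 ▸ hl₁ 1 0 0 (by simp [e]))
  have hα₂ : α₂ ≠ 0 := fun e => hb W' hW' (hb1 ▸ hl₂ 1 0 0 (by simp [e]))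
  have hfin : (lines F \ (nbrs F W ∪ nbrs F W')).Finite := (finite_lines hF).sdiff
  have key := card_conic_points_le hF hN hc hs hα₁ hα₂ hfin.toFinset fun n hn => by
    rw [Set.Finite.mem_toFinset, Set.mem_sdiff, Set.mem_union, not_or] at hn
    obtain ⟨hn, h1, h2⟩ := hn
    have hnW : n ≠ W := fun e => h2 ⟨hn, e ▸ hne, o, e ▸ hvW, hvW', hv⟩
    have hnW' : n ≠ W' := fun e => h1 ⟨hn, e ▸ hne.symm, o, e ▸ hvW', hvW, hv⟩
    exact ⟨hn, exists_conic_point hc hs (eq_sectionCoeff hs) hn (hb n hn)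
      (fun y z w hm e => by_contra fun h0 => h1 ⟨hn, hnW, _, hm, hl₁ y z w e, h0⟩)
      fun y z w hm e => by_contra fun h0 => h2 ⟨hn, hnW', _, hm, hl₂ y z w e, h0⟩⟩
  rw [← Set.ncard_eq_toFinset_card _ hfin] at key
  have h1 := Set.ncard_le_ncard (s := lines F)
    (t := (nbrs F W ∪ nbrs F W') ∪ (lines F \ (nbrs F W ∪ nbrs F W')))
    (fun n hn => by rw [Set.union_sdiff_self]; exact Or.inr hn)
    (((finite_nbrs hF W).union (finite_nbrs hF W')).union hfin)
  have h2 := Set.ncard_union_le (nbrs F W ∪ nbrs F W') (lines F \ (nbrs F W ∪ nbrs F W'))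
  have h3 := Set.ncard_union_le (nbrs F W) (nbrs F W')
  omega

end Meeting

section Curve
variable {A : Type*} [CommRing A] (c : ℕ → ℕ → ℕ → A) (s : A)

/-- The part of bidegree `(1, 3)` of a quartic form in `x, y` and `z, w`, on the diagonal. -/
def diagP : A :=
  c 0 1 0 + (c 0 1 1 + c 1 0 0) * s + (c 0 1 2 + c 1 0 1) * s ^ 2 + (c 0 1 3 + c 1 0 2) * s ^ 3 +
    c 1 0 3 * s ^ 4

/-- The part of bidegree `(3, 1)` of a quartic form in `x, y` and `z, w`, on the diagonal. -/
def diagR : A :=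
  c 0 3 0 + (c 1 2 0 + c 0 3 1) * s + (c 2 1 0 + c 1 2 1) * s ^ 2 + (c 3 0 0 + c 2 1 1) * s ^ 3 +
    c 3 0 1 * s ^ 4

/-- The derivative, in characteristic two, of `diagP`. -/
def slopeP : A := (c 0 1 1 + c 1 0 0) + (c 0 1 3 + c 1 0 2) * s ^ 2

/-- The derivative, in characteristic two, of `diagR`. -/
def slopeR : A := (c 1 2 0 + c 0 3 1) + (c 3 0 0 + c 2 1 1) * s ^ 2

/-- The derivative in `x` of the part of bidegree `(1, 3)`. -/
def partialP : A := c 1 0 0 + c 1 0 1 * s + c 1 0 2 * s ^ 2 + c 1 0 3 * s ^ 3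

/-- The derivative in `x` of the part of bidegree `(3, 1)`. -/
def partialR : A := c 1 2 0 + c 1 2 1 * s + c 3 0 0 * s ^ 2 + c 3 0 1 * s ^ 3

/-- The derivative in `x` of the part of bidegree `(2, 2)`. -/
def partialD : A := c 1 1 0 + c 1 1 1 * s + c 1 1 2 * s ^ 2

/-- The residual curve on the quadric `x w = y z`. -/
def curve : Fin 4 → A := ![s * diagP c s, diagP c s, s * diagR c s, diagR c s]

/-- The derivative of `curve`. -/
def curveTangent : Fin 4 → A :=
  ![s * slopeP c s + diagP c s, slopeP c s, s * slopeR c s + diagR c s, slopeR c s]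

/-- The first coordinate of the vector `curveNormal`. -/
def normalP : A := slopeP c s * diagR c s + diagP c s * slopeR c s + diagR c s * partialP c s

/-- The second coordinate of the vector `curveNormal`. -/
def normalR : A := diagP c s * partialR c s + diagR c s * partialD c s

/-- A second tangent vector of the quartic along `curve`. -/
def curveNormal : Fin 4 → A :=
  ![s * normalP c s + diagP c s ^ 2, normalP c s, s * normalR c s + diagR c s ^ 2, normalR c s]

end Curve

section Triple
open scoped Polynomial
variable {K : Type*} [Field K]

/-- The quartic with coefficients `c` contains the three lines `x = y = 0`, `z = w = 0` and
`x - z = y - w = 0`, and its part of bidegree `(2, 2)` vanishes at a point at infinity. -/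
structure SkewTriple (c : ℕ → ℕ → ℕ → K) : Prop where
  left : c 0 4 0 = 0 ∧ c 1 3 0 = 0 ∧ c 2 2 0 = 0 ∧ c 3 1 0 = 0 ∧ c 4 0 0 = 0
  right : c 0 0 0 = 0 ∧ c 0 0 1 = 0 ∧ c 0 0 2 = 0 ∧ c 0 0 3 = 0 ∧ c 0 0 4 = 0
  diag : c 0 1 0 + c 0 2 0 + c 0 3 0 = 0 ∧
    c 0 1 1 + c 1 0 0 + (c 1 1 0 + c 0 2 1) + (c 1 2 0 + c 0 3 1) = 0 ∧
    c 0 1 2 + c 1 0 1 + (c 2 0 0 + c 1 1 1 + c 0 2 2) + (c 2 1 0 + c 1 2 1) = 0 ∧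
    c 0 1 3 + c 1 0 2 + (c 2 0 1 + c 1 1 2) + (c 3 0 0 + c 2 1 1) = 0 ∧ c 1 0 3 + c 3 0 1 = 0
  infinity : c 2 0 2 = 0

theorem eval_curve (c : ℕ → ℕ → ℕ → K) (s : K) :
    (diagP (fun i j k => .C (c i j k)) (.X : K[X])).eval s = diagP c s ∧
    (diagR (fun i j k => .C (c i j k)) (.X : K[X])).eval s = diagR c s ∧
    (fun v => (curve (fun i j k => .C (c i j k)) (.X : K[X]) v).eval s) = curve c s ∧
    (fun v => (curveTangent (fun i j k => .C (c i j k)) (.X : K[X]) v).eval s) = curveTangent c s ∧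
    (fun v => (curveNormal (fun i j k => .C (c i j k)) (.X : K[X]) v).eval s) = curveNormal c s := by
  refine ⟨by simp [diagP], by simp [diagR], ?_, ?_, ?_⟩
  · ext v; fin_cases v <;> simp [curve, diagP, diagR]
  · ext v; fin_cases v <;> simp [curveTangent, diagP, diagR, slopeP, slopeR]
  · ext v; fin_cases v <;>
      simp [curveNormal, normalP, normalR, diagP, diagR, slopeP, slopeR, partialP, partialR, partialD]

variable [CharP K 2] {c : ℕ → ℕ → ℕ → K}

theorem derivative_curve (v : Fin 4) :
    Polynomial.derivative (curve (fun i j k => .C (c i j k)) (.X : K[X]) v) =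
      curveTangent (fun i j k => .C (c i j k)) .X v := by
  have h2 : (2 : K) = 0 := CharTwo.two_eq_zero
  have h3 : (3 : K) = 1 := by linear_combination h2
  have e2 : (1 : K[X]) + 1 = 0 := CharTwo.add_self_eq_zero 1
  fin_cases v <;> simp [curve, curveTangent, diagP, diagR, slopeP, slopeR, h2, h3, e2] <;> ring

theorem derivative_curveTangent (v : Fin 4) :
    Polynomial.derivative (curveTangent (fun i j k => .C (c i j k)) (.X : K[X]) v) = 0 := by
  have h2 : (2 : K) = 0 := CharTwo.two_eq_zero
  have h3 : (3 : K) = 1 := by linear_combination h2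
  have e2 : (1 : K[X]) + 1 = 0 := CharTwo.add_self_eq_zero 1
  fin_cases v <;> simp [curveTangent, diagP, diagR, slopeP, slopeR, h2, h3, e2]
  all_goals exact CharTwo.add_self_eq_zero _

namespace SkewTriple
variable (h : SkewTriple c)
include h

theorem quartic_quadric (x y s : K) : quartic c (x * s) x (y * s) y =
    x * y * (x + y) * (x * diagR c s + y * diagP c s) := by
  obtain ⟨⟨a0, a1, a2, a3, a4⟩, ⟨b0, b1, b2, b3, b4⟩, ⟨d0, d1, d2, d3, d4⟩, e⟩ := h
  have h2 : (2 : K) = 0 := CharTwo.two_eq_zero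
  simp only [quartic, diagP, diagR, a0, a1, a2, a3, a4, b0, b1, b2, b3, b4, e]
  linear_combination (norm := (simp only [diagP, diagR]; ring)) x ^ 2 * y ^ 2 * (d0 + s * d1 + s ^ 2 * d2 + s ^ 3 * d3 + s ^ 4 * d4) -
    x ^ 2 * y ^ 2 * (diagP c s + diagR c s) * h2

theorem partials_quadric (x y s : K) :
    quarticX c (x * s) x (y * s) y =
      x ^ 2 * y * partialR c s + x * y ^ 2 * partialD c s + y ^ 3 * partialP c s ∧
    s * quarticX c (x * s) x (y * s) y + quarticY c (x * s) x (y * s) y =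
      x ^ 2 * y * diagR c s + y ^ 3 * diagP c s ∧
    quarticZ c (x * s) x (y * s) y = x ^ 3 * (slopeR c s + partialR c s) +
      x ^ 2 * y * (partialD c s + slopeP c s + slopeR c s) +
      x * y ^ 2 * (slopeP c s + partialP c s) ∧
    s * quarticZ c (x * s) x (y * s) y + quarticW c (x * s) x (y * s) y =
      x ^ 3 * diagR c s + x * y ^ 2 * diagP c s := by
  obtain ⟨⟨a0, a1, a2, a3, a4⟩, ⟨b0, b1, b2, b3, b4⟩, ⟨d0, d1, d2, d3, d4⟩, e⟩ := h
  have h2 : (2 : K) = 0 := CharTwo.two_eq_zero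
  simp only [quarticX, quarticY, quarticZ, quarticW, diagP, diagR, slopeP, slopeR, partialP, partialR,
    partialD, a1, a3, b1, b3]
  refine ⟨?_, ?_, ?_, ?_⟩
  · ring
  · clear d0 d1 d2 d3 d4 a0 a1 a2 a3 a4 b0 b1 b2 b3 b4
    grind
  · clear d0 d2 d4 a0 a1 a2 a3 a4 b0 b1 b2 b3 b4
    grind
  · clear d0 d1 d2 d3 d4 a0 a1 a2 a3 a4 b0 b1 b2 b3 b4
    grind

end SkewTriple
end Triple

section Triple
open scoped Polynomial
variable {K : Type*} [Field K]

theorem expand_aeval {A : Type*} [CommRing A] [Algebra K A] (c : ℕ → ℕ → ℕ → K)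
    (P N M : Fin 4 → K[X]) (x : A) (i j : ℕ) :
    Polynomial.aeval x (expand (fun i j k => Polynomial.C (c i j k)) P N M i j) =
      expand (fun i j k => algebraMap K A (c i j k)) (fun v => Polynomial.aeval x (P v))
        (fun v => Polynomial.aeval x (N v)) (fun v => Polynomial.aeval x (M v)) i j := by
  have := expand_map (Polynomial.aeval (R := K) x : K[X] →+* A)
    (fun i j k => Polynomial.C (c i j k)) P N M i j
  simpa using this

/-- The expansion of a quartic form along the tangents of a parametrized curve is constant along
the characteristics. -/
theorem derivative_expand [Infinite K] (c : ℕ → ℕ → ℕ → K) {P N : Fin 4 → K[X]} (M : Fin 4 → K[X])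
    (hP : ∀ v, Polynomial.derivative (P v) = N v) (hN : ∀ v, Polynomial.derivative (N v) = 0) (s : K) :
    let φ := expand (fun i j k => Polynomial.C (c i j k)) P N M
    (Polynomial.derivative (φ 2 0)).eval s = 3 * (φ 3 0).eval s ∧
    (Polynomial.derivative (φ 4 0)).eval s = 0 := by
  intro φ
  let ε : DualNumber K := DualNumber.eps
  have hε : ε ^ 2 = 0 := by rw [pow_two]; exact DualNumber.eps_mul_eps
  let a := algebraMap K (DualNumber K)
  have hev : ∀ f : K[X], Polynomial.aeval (a s + ε) f = a (f.eval s) +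
      a (f.derivative.eval s) * ε := fun f => by
    rw [Polynomial.aeval_add_of_sq_eq_zero _ _ _ hε, Polynomial.aeval_algebraMap_apply,
      Polynomial.aeval_algebraMap_apply]
    simp [a]
  let p : Fin 4 → DualNumber K := fun v => a ((P v).eval s)
  let n : Fin 4 → DualNumber K := fun v => a ((N v).eval s)
  have hp : ∀ v, Polynomial.aeval (a s + ε) (P v) = p v + n v * ε := fun v => by rw [hev, hP]
  have hn : ∀ v, Polynomial.aeval (a s + ε) (N v) = n v := fun v => by simp [hev, hN, n]
  have key : ∀ t : K, _ = (_ : DualNumber K) := fun t =>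
    (quartic_expand_line (fun i j k => a (c i j k)) (fun v => Polynomial.aeval (a s + ε) (P v))
      (fun v => Polynomial.aeval (a s + ε) (N v)) (fun v => Polynomial.aeval (a s + ε) (M v)) 1 0 (a t))
  have key' : ∀ t : K, _ = (_ : DualNumber K) := fun t =>
    (quartic_expand_line (fun i j k => a (c i j k)) p n (fun v => a ((M v).eval s)) 1 0 (a t + ε))
  have e0 : ∀ i, expand (fun i j k => a (c i j k)) p n (fun v => a ((M v).eval s)) i 0 =
      a ((φ i 0).eval s) := fun i => by
    rw [eval_expand, ← expand_map a c]
  have e1 : ∀ i, expand (fun i j k => a (c i j k)) (fun v => Polynomial.aeval (a s + ε) (P v))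
      (fun v => Polynomial.aeval (a s + ε) (N v)) (fun v => Polynomial.aeval (a s + ε) (M v)) i 0 =
      a ((φ i 0).eval s) + a ((φ i 0).derivative.eval s) * ε := fun i => by
    rw [← hev, expand_aeval]
  simp only [e1] at key
  simp only [e0, hp, hn, one_pow, mul_one, one_mul, mul_zero, zero_mul, add_zero, ne_eq,
    OfNat.ofNat_ne_zero, not_false_eq_true, zero_pow] at key key'
  have hfin : ∀ t : K, ((φ 0 0).derivative.eval s - (φ 1 0).eval s) +
      ((φ 1 0).derivative.eval s - 2 * (φ 2 0).eval s) * t +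
      ((φ 2 0).derivative.eval s - 3 * (φ 3 0).eval s) * t ^ 2 +
      ((φ 3 0).derivative.eval s - 4 * (φ 4 0).eval s) * t ^ 3 +
      (φ 4 0).derivative.eval s * t ^ 4 = 0 := fun t => by
    have e := (key t).symm.trans (Eq.trans ?_ (key' t))
    · have hb : ∀ u v : K, (a u + a v * ε).snd = v := fun u v => by
        simp [a, ε, TrivSqZeroExt.algebraMap_eq_inl]
      have e' : a 0 + a (((φ 0 0).derivative.eval s - (φ 1 0).eval s) +
          ((φ 1 0).derivative.eval s - 2 * (φ 2 0).eval s) * t +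
          ((φ 2 0).derivative.eval s - 3 * (φ 3 0).eval s) * t ^ 2 +
          ((φ 3 0).derivative.eval s - 4 * (φ 4 0).eval s) * t ^ 3 +
          (φ 4 0).derivative.eval s * t ^ 4) * ε = 0 := by
        simp only [map_add, map_sub, map_mul, map_pow, map_zero, map_ofNat]
        generalize a ((φ 0 0).eval s) = x0, a ((φ 1 0).eval s) = x1, a ((φ 2 0).eval s) = x2,
          a ((φ 3 0).eval s) = x3, a ((φ 4 0).eval s) = x4 at e ⊢
        linear_combination e + (x2 + x3 * (3 * a t + ε) + x4 * (6 * a t ^ 2 + 4 * a t * ε + ε ^ 2)) * hε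
      rw [← hb 0 (_ + _), e', TrivSqZeroExt.snd_zero]
    · congr 1 <;> ring
  obtain ⟨-, -, h2, -, h4⟩ := coeffs_eq_zero_of_forall hfin
  exact ⟨sub_eq_zero.1 h2, h4⟩

end Triple

section Triple
open scoped Polynomial
variable {K : Type*} [Field K] {c : ℕ → ℕ → ℕ → K}

theorem natDegree_curve_le (v : Fin 4) :
    (curve (fun i j k => .C (c i j k)) (.X : K[X]) v).natDegree ≤ 5 := by
  fin_cases v <;> simp only [curve, diagP, diagR] <;> dsimp <;> compute_degree <;> omega

theorem natDegree_curveTangent_le (v : Fin 4) :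
    (curveTangent (fun i j k => .C (c i j k)) (.X : K[X]) v).natDegree ≤ 4 := by
  fin_cases v <;> simp only [curveTangent, diagP, diagR, slopeP, slopeR] <;> dsimp <;>
    compute_degree <;> omega

theorem SkewTriple.natDegree_curveNormal_le (h : SkewTriple c) (v : Fin 4) :
    (curveNormal (fun i j k => .C (c i j k)) (.X : K[X]) v).natDegree ≤ 7 := by
  let c' : ℕ → ℕ → ℕ → K[X] := fun i j k => .C (c i j k)
  have hp : (diagP c' .X).natDegree ≤ 4 := by simp only [diagP, c']; compute_degree
  have hr : (diagR c' .X).natDegree ≤ 4 := by simp only [diagR, c']; compute_degree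
  have hp' : (slopeP c' .X).natDegree ≤ 2 := by simp only [slopeP, c']; compute_degree
  have hr' : (slopeR c' .X).natDegree ≤ 2 := by simp only [slopeR, c']; compute_degree
  have hA : (partialP c' .X).natDegree ≤ 3 := by simp only [partialP, c']; compute_degree
  have hB : (partialR c' .X).natDegree ≤ 3 := by simp only [partialR, c']; compute_degree
  have hE : (partialD c' .X).natDegree ≤ 2 := by simp only [partialD, c']; compute_degree
  have hg : (diagP c' .X + diagR c' .X).natDegree ≤ 3 := by
    have e : diagP c' .X + diagR c' .X = (c' 0 1 0 + c' 0 3 0) + (c' 0 1 1 + c' 1 0 0 +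
      (c' 1 2 0 + c' 0 3 1)) * .X + (c' 0 1 2 + c' 1 0 1 + (c' 2 1 0 + c' 1 2 1)) * .X ^ 2 +
        (c' 0 1 3 + c' 1 0 2 + (c' 3 0 0 + c' 2 1 1)) * .X ^ 3 := by
      have : c' 1 0 3 + c' 3 0 1 = 0 := by simp only [c', ← Polynomial.C_add, h.diag.2.2.2.2, map_zero]
      simp only [diagP, diagR]; linear_combination .X ^ 4 * this
    rw [e]; simp only [c']; compute_degree
  have hmul {f g : K[X]} {m n : ℕ} (hf : f.natDegree ≤ m) (hg : g.natDegree ≤ n) (k : ℕ)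
      (hk : m + n ≤ k) : (f * g).natDegree ≤ k := (Polynomial.natDegree_mul_le_of_le hf hg).trans hk
  have hadd {f g : K[X]} {k : ℕ} (hf : f.natDegree ≤ k) (hg : g.natDegree ≤ k) :
      (f + g).natDegree ≤ k := Polynomial.natDegree_add_le_of_degree_le hf hg
  have hX : (Polynomial.X : K[X]).natDegree ≤ 1 := Polynomial.natDegree_X_le
  have hx : (normalP c' .X).natDegree ≤ 7 :=
    hadd (hadd (hmul hp' hr 7 (by omega)) (hmul hp hr' 7 (by omega))) (hmul hr hA 7 (by omega))
  have hx' : (normalR c' .X).natDegree ≤ 7 := hadd (hmul hp hB 7 (by omega)) (hmul hr hE 7 (by omega))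
  have h0 : (.X * normalP c' .X + diagP c' .X ^ 2 : K[X]).natDegree ≤ 7 := by
    let B : K[X] := c' 0 1 0 + c' 0 1 1 * .X + c' 0 1 2 * .X ^ 2 + c' 0 1 3 * .X ^ 3
    have hB : (-B).natDegree ≤ 3 := by simp only [c', B]; compute_degree
    have e : .X * normalP c' .X + diagP c' .X ^ 2 = .X * (slopeP c' .X * diagR c' .X +
        diagP c' .X * slopeR c' .X) + diagP c' .X * (diagP c' .X + diagR c' .X) +
        diagR c' .X * (-B) := by
      have : diagP c' .X = .X * partialP c' .X + B := by simp only [diagP, partialP, B]; ring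
      simp only [normalP]; linear_combination (-diagR c' .X) * this
    rw [e]
    exact hadd (hadd (hmul hX (hadd (hmul hp' hr 6 le_rfl) (hmul hp hr' 6 le_rfl)) 7 le_rfl)
      (hmul hp hg 7 le_rfl)) (hmul hr hB 7 le_rfl)
  have h0' : (.X * normalR c' .X + diagR c' .X ^ 2 : K[X]).natDegree ≤ 7 := by
    let B : K[X] := c' 0 3 0 + c' 0 3 1 * .X + c' 2 1 0 * .X ^ 2 + c' 2 1 1 * .X ^ 3
    have hB : (-B).natDegree ≤ 3 := by simp only [c', B]; compute_degree
    have e : .X * normalR c' .X + diagR c' .X ^ 2 = .X * (diagR c' .X * partialD c' .X) +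
        diagR c' .X * (diagP c' .X + diagR c' .X) + diagP c' .X * (-B) := by
      have : diagR c' .X = .X * partialR c' .X + B := by simp only [diagR, partialR, B]; ring
      simp only [normalR]; linear_combination (-diagP c' .X) * this
    rw [e]
    exact hadd (hadd (hmul hX (hmul hr hE 6 le_rfl) 7 le_rfl) (hmul hr hg 7 le_rfl)) (hmul hp hB 7 le_rfl)
  match v with
  | 0 => exact h0
  | 1 => exact hx
  | 2 => exact h0'
  | 3 => exact hx'

theorem SkewTriple.natDegree_lineRes_le (h : SkewTriple c) (l : K) :
    (lineRes c (curve (fun i j k => .C (c i j k)) .X) (curveTangent (fun i j k => .C (c i j k)) .X)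
      (curveNormal (fun i j k => .C (c i j k)) .X) l).natDegree ≤ 128 :=
  QuarticLines.natDegree_lineRes_le c natDegree_curve_le natDegree_curveTangent_le
    h.natDegree_curveNormal_le (by norm_num) (by norm_num) l

variable [CharP K 2] [IsAlgClosed K] {F : MvPolynomial (Fin 4) K} {b : Module.Basis (Fin 4) K (Fin 4 → K)}

theorem SkewTriple.grad_curve (h : SkewTriple c) (hc : Coords F b c) (s y₁ x₁ y₂ x₂ : K) :
    grad F (pt b (curve c s 0) (curve c s 1) (curve c s 2) (curve c s 3))
      (pt b (y₁ * s + x₁) y₁ (y₂ * s + x₂) y₂) =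
      diagP c s * diagR c s * (diagP c s + diagR c s) * (y₁ * diagR c s + y₂ * diagP c s) +
      x₁ * (diagP c s ^ 2 * diagR c s * partialR c s + diagP c s * diagR c s ^ 2 * partialD c s +
        diagR c s ^ 3 * partialP c s) +
      x₂ * (diagP c s ^ 3 * (slopeR c s + partialR c s) +
        diagP c s ^ 2 * diagR c s * (partialD c s + slopeP c s + slopeR c s) +
        diagP c s * diagR c s ^ 2 * (slopeP c s + partialP c s)) := by
  obtain ⟨e1, e2, e3, e4⟩ := h.partials_quadric (diagP c s) (diagR c s) s
  have e0 : curve c s 0 = diagP c s * s := mul_comm _ _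
  have e0' : curve c s 2 = diagR c s * s := mul_comm _ _
  rw [hc.grad_eq, e0, e0', show curve c s 1 = diagP c s from rfl, show curve c s 3 = diagR c s from rfl]
  linear_combination x₁ * e1 + y₁ * e2 + x₂ * e3 + y₂ * e4

theorem SkewTriple.grad_curveTangent (h : SkewTriple c) (hc : Coords F b c) (s : K) :
    grad F (pt b (curve c s 0) (curve c s 1) (curve c s 2) (curve c s 3))
      (pt b (curveTangent c s 0) (curveTangent c s 1) (curveTangent c s 2) (curveTangent c s 3)) = 0 := by
  have := h.grad_curve hc s (slopeP c s) (diagP c s) (slopeR c s) (diagR c s)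
  rw [mul_comm _ s, mul_comm _ s] at this
  refine this.trans ?_
  have h2 : (2 : K) = 0 := CharTwo.two_eq_zero
  clear * - h2
  generalize diagP c s = p, diagR c s = r, slopeP c s = p', slopeR c s = r'
  grind

theorem SkewTriple.grad_curveNormal (h : SkewTriple c) (hc : Coords F b c) (s : K) :
    grad F (pt b (curve c s 0) (curve c s 1) (curve c s 2) (curve c s 3))
      (pt b (curveNormal c s 0) (curveNormal c s 1) (curveNormal c s 2) (curveNormal c s 3)) = 0 := by
  have := h.grad_curve hc s (normalP c s) (diagP c s ^ 2) (normalR c s) (diagR c s ^ 2)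
  rw [mul_comm _ s, mul_comm _ s] at this
  refine this.trans ?_
  have h2 : (2 : K) = 0 := CharTwo.two_eq_zero
  simp only [normalP, normalR]
  clear * - h2
  generalize diagP c s = p, diagR c s = r, slopeP c s = p', slopeR c s = r'
  grind

/-- Tangent vectors along the curve are combinations of the three standard ones. -/
theorem SkewTriple.exists_eq_tangent (h : SkewTriple c) (hc : Coords F b c) {s : K}
    (hs : diagP c s * diagR c s * (diagP c s + diagR c s) ≠ 0) {x y z w : K}
    (hd : grad F (pt b (curve c s 0) (curve c s 1) (curve c s 2) (curve c s 3)) (pt b x y z w) = 0) :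
    ∃ t u v : K, v * (diagP c s * diagR c s * (diagP c s + diagR c s)) =
        s * diagP c s * w + diagR c s * x + diagP c s * z + s * diagR c s * y ∧
      ∀ i, ![x, y, z, w] i = t * curve c s i + u * curveTangent c s i + v * curveNormal c s i := by
  have h2 : (2 : K) = 0 := CharTwo.two_eq_zero
  have hp := left_ne_zero_of_mul (left_ne_zero_of_mul hs)
  obtain ⟨v, hv⟩ : ∃ v, v * (diagP c s * diagR c s * (diagP c s + diagR c s)) =
    diagR c s * (x + y * s) + diagP c s * (z + w * s) := ⟨_, div_mul_cancel₀ _ hs⟩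
  obtain ⟨u, hu⟩ : ∃ u, u * diagP c s = x + y * s + v * diagP c s ^ 2 := ⟨_, div_mul_cancel₀ _ hp⟩
  have hu' : u * diagR c s = z + w * s + v * diagR c s ^ 2 := by
    refine mul_right_cancel₀ hp ?_
    linear_combination diagR c s * hu + hv +
      (diagR c s * (x + y * s) - v * diagR c s ^ 2 * diagP c s) * h2
  obtain ⟨t, ht⟩ : ∃ t, t * diagP c s = y + u * slopeP c s + v * normalP c s :=
    ⟨_, div_mul_cancel₀ _ hp⟩
  have ht' : t * diagR c s = w + u * slopeR c s + v * normalR c s := by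
    have e : diagP c s * diagR c s * (diagP c s + diagR c s) *
        ((y + u * slopeP c s + v * normalP c s) * diagR c s +
          (w + u * slopeR c s + v * normalR c s) * diagP c s) = 0 := by
      have e1 := h.grad_curve hc s y (x + y * s) w (z + w * s)
      have eN := h.grad_curveTangent hc s
      have eM := h.grad_curveNormal hc s
      rw [show y * s + (x + y * s) = x by linear_combination y * s * h2,
        show w * s + (z + w * s) = z by linear_combination w * s * h2, hd] at e1
      rw [show curveTangent c s 0 = slopeP c s * s + diagP c s by simp [curveTangent, mul_comm],
        show curveTangent c s 2 = slopeR c s * s + diagR c s by simp [curveTangent, mul_comm],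
        show curveTangent c s 1 = slopeP c s from rfl, show curveTangent c s 3 = slopeR c s from rfl,
        h.grad_curve hc] at eN
      rw [show curveNormal c s 0 = normalP c s * s + diagP c s ^ 2 by simp [curveNormal, mul_comm],
        show curveNormal c s 2 = normalR c s * s + diagR c s ^ 2 by simp [curveNormal, mul_comm],
        show curveNormal c s 1 = normalP c s from rfl, show curveNormal c s 3 = normalR c s from rfl,
        h.grad_curve hc] at eM
      generalize diagP c s ^ 2 * diagR c s * partialR c s + diagP c s * diagR c s ^ 2 * partialD c s +
        diagR c s ^ 3 * partialP c s = G at e1 eN eM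
      generalize diagP c s ^ 3 * (slopeR c s + partialR c s) +
        diagP c s ^ 2 * diagR c s * (partialD c s + slopeP c s + slopeR c s) +
        diagP c s * diagR c s ^ 2 * (slopeP c s + partialP c s) = H at e1 eN eM
      linear_combination -e1 + u * eN + v * eM + G * hu + H * hu' -
        (u * diagP c s * G + u * diagR c s * H) * h2
    have e' := (mul_eq_zero.1 e).resolve_left hs
    refine mul_right_cancel₀ hp ?_
    linear_combination diagR c s * ht + e' - (w + u * slopeR c s + v * normalR c s) * diagP c s * h2
  refine ⟨t, u, v, by linear_combination hv, fun i => ?_⟩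
  match i with
  | 0 =>
    change x = t * (s * diagP c s) + u * (s * slopeP c s + diagP c s) +
      v * (s * normalP c s + diagP c s ^ 2)
    linear_combination -s * ht - hu -
      (s * y + s * u * slopeP c s + s * v * normalP c s + v * diagP c s ^ 2) * h2
  | 1 =>
    change y = t * diagP c s + u * slopeP c s + v * normalP c s
    linear_combination - ht - (u * slopeP c s + v * normalP c s) * h2
  | 2 =>
    change z = t * (s * diagR c s) + u * (s * slopeR c s + diagR c s) +
      v * (s * normalR c s + diagR c s ^ 2)
    linear_combination -s * ht' - hu' -
      (s * w + s * u * slopeR c s + s * v * normalR c s + v * diagR c s ^ 2) * h2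
  | 3 =>
    change w = t * diagR c s + u * slopeR c s + v * normalR c s
    linear_combination - ht' - (u * slopeR c s + v * normalR c s) * h2

end Triple

section Frame
open scoped Polynomial
variable {K : Type*} [Field K]

/-- Coordinates adapted to three lines on a smooth quartic whose lines are pairwise skew. -/
structure SkewFrame (F : MvPolynomial (Fin 4) K) (b : Module.Basis (Fin 4) K (Fin 4 → K))
    (c : ℕ → ℕ → ℕ → K) (W : Fin 3 → Submodule K (Fin 4 → K)) : Prop where
  smooth : IsSmoothQuartic F
  coords : Coords F b c
  skew : ∀ m ∈ lines F, ∀ n ∈ lines F, ∀ v ∈ m, v ∈ n → v ≠ 0 → m = n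
  mem : ∀ i, W i ∈ lines F
  ne : W 0 ≠ W 1
  first : ∀ x y, pt b x y 0 0 ∈ W 0
  second : ∀ z w, pt b 0 0 z w ∈ W 1
  third : ∀ x y, pt b x y x y ∈ W 2
  infinity : c 2 0 2 = 0

variable [IsAlgClosed K] {F : MvPolynomial (Fin 4) K}
  {b : Module.Basis (Fin 4) K (Fin 4 → K)} {c : ℕ → ℕ → ℕ → K}
  {W : Fin 3 → Submodule K (Fin 4 → K)}

/-- A line contains a point of the quadric `x w = y z`. -/
theorem exists_isotropic {n : Submodule K (Fin 4 → K)} (hn : Module.finrank K n = 2) :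
    ∃ x y z w, pt b x y z w ∈ n ∧ pt b x y z w ≠ 0 ∧ x * w = y * z := by
  obtain ⟨u, hu, v, hv, huv⟩ := exists_pair hn
  obtain ⟨x, y, z, w, rfl⟩ := exists_eq_pt b u
  obtain ⟨x', y', z', w', rfl⟩ := exists_eq_pt b v
  by_cases h0 : x * w - y * z = 0
  · exact ⟨x, y, z, w, hu, fun h => one_ne_zero (huv 1 0 (by simp [h])).1, sub_eq_zero.1 h0⟩
  obtain ⟨t, ht⟩ := IsAlgClosed.exists_root
    (.C (x * w - y * z) * .X ^ 2 + .C (x * w' + x' * w - y * z' - y' * z) * .X +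
      .C (x' * w' - y' * z') : K[X])
    (by rw [Polynomial.degree_quadratic h0]; norm_num)
  have e : pt b (t * x + x') (t * y + y') (t * z + z') (t * w + w') =
    t • pt b x y z w + (1 : K) • pt b x' y' z' w' := by simp only [pt]; module
  refine ⟨t * x + x', t * y + y', t * z + z', t * w + w', ?_, ?_, ?_⟩
  · rw [e]; exact add_mem (n.smul_mem _ hu) (n.smul_mem _ hv)
  · rw [e]; exact fun h => one_ne_zero (huv _ _ h).2
  · simp only [Polynomial.IsRoot, Polynomial.eval_add, Polynomial.eval_mul, Polynomial.eval_pow,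
      Polynomial.eval_C, Polynomial.eval_X] at ht
    linear_combination ht

namespace SkewFrame
variable (h : SkewFrame F b c W)
include h

theorem skewTriple : SkewTriple c := by
  have h1 : ∀ x y, quartic c x y 0 0 = 0 := fun x y => by
    rw [← h.coords.2]; exact (h.mem 0).2 _ (h.first x y)
  have h2 : ∀ z w, quartic c 0 0 z w = 0 := fun z w => by
    rw [← h.coords.2]; exact (h.mem 1).2 _ (h.second z w)
  have h3 : ∀ x y, quartic c x y x y = 0 := fun x y => by
    rw [← h.coords.2]; exact (h.mem 2).2 _ (h.third x y)
  obtain ⟨a0, a1, a2, a3, a4⟩ := coeffs_eq_zero_of_forall (a0 := c 0 4 0) (a1 := c 1 3 0)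
    (a2 := c 2 2 0) (a3 := c 3 1 0) (a4 := c 4 0 0) fun z => by
      rw [← h1 z 1]; simp only [quartic]; ring
  obtain ⟨b0, b1, b2, b3, b4⟩ := coeffs_eq_zero_of_forall (a0 := c 0 0 0) (a1 := c 0 0 1)
    (a2 := c 0 0 2) (a3 := c 0 0 3) (a4 := c 0 0 4) fun z => by
      rw [← h2 z 1]; simp only [quartic]; ring
  refine ⟨⟨a0, a1, a2, a3, a4⟩, ⟨b0, b1, b2, b3, b4⟩, coeffs_eq_zero_of_forall fun z => ?_, h.infinity⟩
  rw [← h3 z 1]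
  simp only [quartic, a0, a1, a2, a3, a4, b0, b1, b2, b3, b4, h.infinity]
  ring

omit [IsAlgClosed K] in
theorem not_ruling {x y : K} (hxy : x ≠ 0 ∨ y ≠ 0)
    (h0 : ∀ z w, quartic c (x * z) (y * z) (x * w) (y * w) = 0) : False := by
  have hn : ∀ z w : K, z • pt b x y 0 0 + w • pt b 0 0 x y = 0 → z = 0 ∧ w = 0 := fun z w e => by
    obtain ⟨e0, e1, e2, e3⟩ := pt_eq_zero (b := b) (x := x * z) (y := y * z) (z := x * w) (w := y * w)
      |>.1 (by rw [← e]; simp only [pt]; module)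
    rcases hxy with hx | hx
    · exact ⟨(mul_eq_zero.1 e0).resolve_left hx, (mul_eq_zero.1 e2).resolve_left hx⟩
    · exact ⟨(mul_eq_zero.1 e1).resolve_left hx, (mul_eq_zero.1 e3).resolve_left hx⟩
  have hl := mem_lines_of_pair (F := F) hn fun z w => by
    refine Eq.trans ?_ (h0 z w)
    rw [← h.coords.2]
    refine congrArg (fun v => eval v F) ?_
    simp only [pt]; module
  refine h.ne ?_
  rw [← h.skew _ hl _ (h.mem 0) _ (Submodule.subset_span (Set.mem_insert _ _)) (h.first x y) fun e =>
      one_ne_zero (hn 1 0 (by simp [e])).1]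
  exact h.skew _ hl _ (h.mem 1) _ (Submodule.subset_span (Set.mem_insert_of_mem _ rfl))
    (h.second x y) fun e => one_ne_zero (hn 0 1 (by simp [e])).2

theorem coeff_ne_zero : c 1 0 3 ≠ 0 := fun e => by
  obtain ⟨⟨a0, a1, a2, a3, a4⟩, ⟨b0, b1, b2, b3, b4⟩, ⟨-, -, -, -, d⟩, i⟩ := h.skewTriple
  rw [e, zero_add] at d
  exact h.not_ruling (x := 1) (y := 0) (Or.inl one_ne_zero) fun z w => by
    simp only [quartic, a0, a1, a2, a3, a4, b0, b1, b2, b3, b4, d, e, i]; ring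

variable [CharP K 2]

theorem diagR_ne_zero {s : K} (hp : diagP c s = 0) : diagR c s ≠ 0 := fun hr =>
  h.not_ruling (x := s) (y := 1) (Or.inr one_ne_zero) fun z w => by
    have := h.skewTriple.quartic_quadric z w s
    rw [hp, hr] at this
    rw [mul_comm s, mul_comm s, one_mul, one_mul, this]
    ring

/-- A line other than the three basic ones avoids the isotropic vectors outside the curve. -/
theorem exists_curve_of_isotropic {n : Submodule K (Fin 4 → K)} (hn : n ∈ lines F)
    (hnW : ∀ i, n ≠ W i) {x y z w : K} (hm : pt b x y z w ∈ n) (h0 : pt b x y z w ≠ 0)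
    (hq : x * w = y * z) : ∃ s k : K,
      pt b x y z w = k • pt b (curve c s 0) (curve c s 1) (curve c s 2) (curve c s 3) ∧
      diagP c s * diagR c s * (diagP c s + diagR c s) ≠ 0 := by
  have h2 : (2 : K) = 0 := CharTwo.two_eq_zero
  have hx : ¬ (x = 0 ∧ y = 0) := fun ⟨ex, ey⟩ => hnW 1 (h.skew n hn _ (h.mem 1) _ hm
    (by rw [ex, ey]; exact h.second z w) h0)
  have hz : ¬ (z = 0 ∧ w = 0) := fun ⟨ez, ew⟩ => hnW 0 (h.skew n hn _ (h.mem 0) _ hm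
    (by rw [ez, ew]; exact h.first x y) h0)
  have hd : ¬ (x = z ∧ y = w) := fun ⟨ex, ey⟩ => hnW 2 (h.skew n hn _ (h.mem 2) _ hm
    (by rw [ex, ey]; exact h.third z w) h0)
  have hF : quartic c x y z w = 0 := by rw [← h.coords.2]; exact hn.2 _ hm
  have hyw : ¬ (y = 0 ∧ w = 0) := fun ⟨ey, ew⟩ => by
    have hc := h.coeff_ne_zero
    obtain ⟨⟨a0, a1, a2, a3, a4⟩, ⟨b0, b1, b2, b3, b4⟩, ⟨-, -, -, -, d⟩, i⟩ := h.skewTriple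
    have e : c 1 0 3 * (x * z * (z - x) ^ 2) = 0 := by
      simp only [quartic, ey, ew, a4, b4, i] at hF
      linear_combination hF - x ^ 3 * z * d + c 1 0 3 * (x ^ 3 * z - x ^ 2 * z ^ 2) * h2
    rcases mul_eq_zero.1 ((mul_eq_zero.1 e).resolve_left hc) with e | e
    · rcases mul_eq_zero.1 e with e | e
      · exact hx ⟨e, ey⟩
      · exact hz ⟨e, ew⟩
    · exact hd ⟨(sub_eq_zero.1 (pow_eq_zero_iff two_ne_zero |>.1 e)).symm, ey.trans ew.symm⟩
  obtain ⟨s, rfl, rfl⟩ : ∃ s, x = y * s ∧ z = w * s := by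
    by_cases hy : y = 0
    · have hw : w ≠ 0 := fun e => hyw ⟨hy, e⟩
      refine ⟨z / w, ?_, (mul_div_cancel₀ z hw).symm⟩
      rw [hy, zero_mul] at hq ⊢
      exact (mul_eq_zero.1 hq).resolve_right hw
    · refine ⟨x / y, (mul_div_cancel₀ x hy).symm, mul_left_cancel₀ hy ?_⟩
      rw [← hq]; field_simp
  have hy : y ≠ 0 := fun e => hx ⟨by rw [e, zero_mul], e⟩
  have hw : w ≠ 0 := fun e => hz ⟨by rw [e, zero_mul], e⟩
  have hs : y + w ≠ 0 := fun e => by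
    have : y = w := CharTwo.add_eq_zero.1 e
    exact hd ⟨by rw [this], this⟩
  rw [h.skewTriple.quartic_quadric] at hF
  have hF' := (mul_eq_zero.1 hF).resolve_left (mul_ne_zero (mul_ne_zero hy hw) hs)
  have hp : diagP c s ≠ 0 := fun e => by
    rw [e, mul_zero, add_zero] at hF'
    exact h.diagR_ne_zero e ((mul_eq_zero.1 hF').resolve_left hy)
  obtain ⟨k, rfl⟩ : ∃ k, y = k * diagP c s := ⟨_, (div_mul_cancel₀ y hp).symm⟩
  obtain rfl : w = k * diagR c s := mul_right_cancel₀ hp (by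
    linear_combination hF' - k * diagP c s * diagR c s * h2)
  refine ⟨s, k, ?_, mul_ne_zero (mul_ne_zero hp (right_ne_zero_of_mul hw)) fun e => hs ?_⟩
  · simp only [pt, curve, Matrix.cons_val]; module
  · rw [← mul_add, e, mul_zero]

end SkewFrame
end Frame

section Frame
open scoped Polynomial
variable {K : Type*} [Field K] [IsAlgClosed K] [CharP K 2] {F : MvPolynomial (Fin 4) K}
  {b : Module.Basis (Fin 4) K (Fin 4 → K)} {c : ℕ → ℕ → ℕ → K}
  {W : Fin 3 → Submodule K (Fin 4 → K)}

/-- The resultant controlling the lines on the quartic through the points of the curve. -/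
noncomputable abbrev curveRes (c : ℕ → ℕ → ℕ → K) (l : K) : K[X] :=
  lineRes c (curve (fun i j k => .C (c i j k)) .X) (curveTangent (fun i j k => .C (c i j k)) .X)
    (curveNormal (fun i j k => .C (c i j k)) .X) l

theorem sq_dvd_curveRes {s : K} (h : ∀ t, quartic c (curve c s 0 + t * curveTangent c s 0)
    (curve c s 1 + t * curveTangent c s 1) (curve c s 2 + t * curveTangent c s 2)
    (curve c s 3 + t * curveTangent c s 3) = 0) (l : K) :
    (Polynomial.X - Polynomial.C s) ^ 2 ∣ curveRes c l := by
  have : Infinite K := IsAlgClosed.instInfinite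
  let φ := expand (fun i j k => Polynomial.C (c i j k)) (curve (fun i j k => .C (c i j k)) .X)
    (curveTangent (fun i j k => .C (c i j k)) .X) (curveNormal (fun i j k => .C (c i j k)) .X)
  obtain ⟨-, -, eP, eN, eM⟩ := eval_curve c s
  have hφ : ∀ i, (φ i 0).eval s = expand c (curve c s) (curveTangent c s) (curveNormal c s) i 0 :=
    fun i => by rw [eval_expand, eP, eN, eM]
  obtain ⟨-, -, h2, h3, h4⟩ := coeffs_eq_zero_of_forall (a0 := (φ 0 0).eval s) (a1 := (φ 1 0).eval s)
    (a2 := (φ 2 0).eval s) (a3 := (φ 3 0).eval s) (a4 := (φ 4 0).eval s) fun t => by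
      have := quartic_expand_line c (curve c s) (curveTangent c s) (curveNormal c s) 1 0 t
      simp only [one_mul, zero_mul, add_zero, mul_one, one_pow, mul_zero, ne_eq, OfNat.ofNat_ne_zero,
        not_false_eq_true, zero_pow, h] at this
      simp only [hφ]
      exact this.symm
  obtain ⟨d2, d4⟩ := derivative_expand c (curveNormal (fun i j k => .C (c i j k)) .X)
    (derivative_curve (c := c)) derivative_curveTangent s
  have hsq : ∀ f : K[X], f.eval s = 0 → f.derivative.eval s = 0 → (Polynomial.X - Polynomial.C s) ^ 2 ∣ f :=
    fun f h h' => by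
      obtain ⟨g, rfl⟩ := Polynomial.dvd_iff_isRoot.2 h
      rw [pow_two]
      refine mul_dvd_mul_left _ (Polynomial.dvd_iff_isRoot.2 ?_)
      simpa using h'
  exact sq_dvd_res24_of_ends (hsq _ h2 (d2.trans (by rw [h3, mul_zero]))) (hsq _ h4 d4)

namespace SkewFrame
variable (h : SkewFrame F b c W)
include h

/-- A point of the curve on a line which is not basic is a root of the resultant; it is a double
root, or the line contains a second point of the curve. -/
theorem dvd_curveRes {n : Submodule K (Fin 4 → K)} (hn : n ∈ lines F) (hnW : ∀ i, n ≠ W i) {s : K}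
    (hs : pt b (curve c s 0) (curve c s 1) (curve c s 2) (curve c s 3) ∈ n)
    (hd : diagP c s * diagR c s * (diagP c s + diagR c s) ≠ 0) (l : K) :
    (Polynomial.X - Polynomial.C s) ∣ curveRes c l ∧
      ((Polynomial.X - Polynomial.C s) ^ 2 ∣ curveRes c l ∨ ∃ s', s' ≠ s ∧
      pt b (curve c s' 0) (curve c s' 1) (curve c s' 2) (curve c s' 3) ∈ n ∧
        diagP c s' * diagR c s' * (diagP c s' + diagR c s') ≠ 0) := by
  have : Infinite K := IsAlgClosed.instInfinite
  have h2 : (2 : K) = 0 := CharTwo.two_eq_zero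
  have hp : diagP c s ≠ 0 := left_ne_zero_of_mul (left_ne_zero_of_mul hd)
  obtain ⟨x, y, z, w, hm, hind⟩ : ∃ x y z w, pt b x y z w ∈ n ∧ ∀ t : K, pt b x y z w ≠
      t • pt b (curve c s 0) (curve c s 1) (curve c s 2) (curve c s 3) := by
    obtain ⟨u, hu, v, hv, huv⟩ := exists_pair hn.1
    have key : ∃ u ∈ n, ∀ t : K, u ≠ t • pt b (curve c s 0) (curve c s 1) (curve c s 2) (curve c s 3) := by
      by_contra! hall
      obtain ⟨t, ht⟩ := hall u hu
      obtain ⟨t', ht'⟩ := hall v hv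
      obtain ⟨e, -⟩ := huv t' (-t) (by rw [ht, ht']; module)
      obtain ⟨-, e'⟩ := huv 0 1 (by rw [ht', e]; module)
      exact one_ne_zero e'
    obtain ⟨u, hu, h⟩ := key
    obtain ⟨x, y, z, w, rfl⟩ := exists_eq_pt b u
    exact ⟨x, y, z, w, hu, h⟩
  obtain ⟨t, u, v, hv, e⟩ := h.skewTriple.exists_eq_tangent h.coords hd
    (LinearMap.mem_ker.1 (le_ker_grad hn hs hm))
  have e' : pt b x y z w = t • pt b (curve c s 0) (curve c s 1) (curve c s 2) (curve c s 3) +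
      (u • pt b (curveTangent c s 0) (curveTangent c s 1) (curveTangent c s 2) (curveTangent c s 3) +
      v • pt b (curveNormal c s 0) (curveNormal c s 1) (curveNormal c s 2) (curveNormal c s 3)) := by
    rw [show x = _ from e 0, show y = _ from e 1, show z = _ from e 2, show w = _ from e 3]
    simp only [pt]; module
  have hm' := n.sub_mem hm (n.smul_mem t hs)
  rw [e', add_sub_cancel_left] at hm'
  obtain ⟨-, -, eP, eN, eM⟩ := eval_curve c s
  by_cases hv0 : v = 0
  · have hu0 : u ≠ 0 := fun hu => hind t (by rw [e', hu, hv0]; module)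
    rw [hv0, zero_smul, add_zero] at hm'
    have := sq_dvd_curveRes (fun t => h.coords.quartic_eq_zero_of_mem hn hs
      ((n.smul_mem_iff hu0).1 hm') t) l
    exact ⟨(dvd_pow_self _ two_ne_zero).trans this, Or.inl this⟩
  · refine ⟨dvd_lineRes (x := u / v) (fun t => ?_) l, Or.inr ?_⟩
    · have := h.coords.quartic_eq_zero_of_mem hn hs (D := fun i => u / v * curveTangent c s i +
        curveNormal c s i) (by
          convert n.smul_mem v⁻¹ hm' using 1
          rw [smul_add, smul_smul, smul_smul, inv_mul_cancel₀ hv0, inv_mul_eq_div]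
          simp only [pt]; module) t
      simpa only [← eP, ← eN, ← eM] using this
    · obtain ⟨q, hq⟩ : ∃ q, q = s * diagP c s * w + diagR c s * x - diagP c s * z - s * diagR c s * y :=
        ⟨_, rfl⟩
      have hq0 : q ≠ 0 := by
        rw [show q = v * (diagP c s * diagR c s * (diagP c s + diagR c s)) by
          linear_combination hq - hv - (diagP c s * z + s * diagR c s * y) * h2]
        exact mul_ne_zero hv0 hd
      have hu : pt b ((x * w - y * z) * (s * diagP c s) - q * x) ((x * w - y * z) * diagP c s - q * y)
          ((x * w - y * z) * (s * diagR c s) - q * z) ((x * w - y * z) * diagR c s - q * w) =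
          (x * w - y * z) • pt b (curve c s 0) (curve c s 1) (curve c s 2) (curve c s 3) -
            q • pt b x y z w := by
        simp only [pt, curve, Matrix.cons_val]; module
      have hne : ∀ t : K, q • pt b x y z w ≠
          t • pt b (curve c s 0) (curve c s 1) (curve c s 2) (curve c s 3) := fun t ht =>
        hind (q⁻¹ * t) (by rw [mul_smul, ← ht, inv_smul_smul₀ hq0])
      obtain ⟨s', k, hk, hd'⟩ := h.exists_curve_of_isotropic hn hnW
        (by rw [hu]; exact n.sub_mem (n.smul_mem _ hs) (n.smul_mem _ hm))
        (by rw [hu]; exact fun e => hne _ (sub_eq_zero.1 e).symm) (by rw [hq]; ring)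
      rw [hu] at hk
      have hk0 : k ≠ 0 := fun e => hne _ (by rw [e, zero_smul] at hk; exact (sub_eq_zero.1 hk).symm)
      refine ⟨s', fun e => hne ((x * w - y * z) - k) ?_, (n.smul_mem_iff hk0).1 ?_, hd'⟩
      · rw [e] at hk; rw [sub_smul, ← hk, sub_sub_cancel]
      · rw [← hk]; exact n.sub_mem (n.smul_mem _ hs) (n.smul_mem _ hm)

end SkewFrame
end Frame

section Generic
open scoped Polynomial
variable {K : Type*} [Field K] {F : MvPolynomial (Fin 4) K}
  {b : Module.Basis (Fin 4) K (Fin 4 → K)} {c : ℕ → ℕ → ℕ → K}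
  {W : Fin 3 → Submodule K (Fin 4 → K)}

/-- The quartic along a line through a point of the line `x = y = 0`. -/
theorem SkewTriple.exists_quartic_tangent [CharP K 2] (h : SkewTriple c) {s : K} (hp : diagP c s = 0)
    (r a β e : K) : ∃ k m : K, ∀ t, quartic c (t * (s * a)) (t * a) (s * r + t * (s * β + e)) (r + t * β) =
      a * r ^ 2 * (e * (partialP c s + slopeP c s) + a * diagR c s) * t ^ 2 + k * t ^ 3 + m * t ^ 4 := by
  have h2 : (2 : K) = 0 := CharTwo.two_eq_zero
  let C₃ := s * c 1 0 3 + c 0 1 3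
  let C₂ := s * c 1 0 2 + c 0 1 2 + 3 * s * C₃
  let C₁ := s * c 1 0 1 + c 0 1 1 + 2 * s * (s * c 1 0 2 + c 0 1 2) + 3 * s ^ 2 * C₃
  let D₂ := s ^ 2 * c 2 0 2 + s * c 1 1 2 + c 0 2 2
  let D₁ := s ^ 2 * c 2 0 1 + s * c 1 1 1 + c 0 2 1 + 2 * s * D₂
  let D₀ := s ^ 2 * c 2 0 0 + s * c 1 1 0 + c 0 2 0 + s * (s ^ 2 * c 2 0 1 + s * c 1 1 1 + c 0 2 1) +
    s ^ 2 * D₂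
  let E₁ := s ^ 3 * c 3 0 1 + s ^ 2 * c 2 1 1 + s * c 1 2 1 + c 0 3 1
  obtain ⟨⟨a0, a1, a2, a3, a4⟩, ⟨b0, b1, b2, b3, b4⟩, ⟨d0, d1, d2, d3, d4⟩, i⟩ := h
  have hC : C₁ = partialP c s + slopeP c s := by
    clear * - h2
    simp only [C₁, C₃, partialP, slopeP]
    grind
  have hD : D₀ = diagR c s := by
    have hp' := hp
    simp only [diagP] at hp'
    simp only [D₀, D₂, diagR, i]
    linear_combination d0 + s * d1 + s ^ 2 * d2 + s ^ 3 * d3 + s ^ 4 * d4 - hp' -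
      (c 0 3 0 + (c 1 2 0 + c 0 3 1) * s + (c 2 1 0 + c 1 2 1) * s ^ 2 +
        (c 3 0 0 + c 2 1 1) * s ^ 3 + c 3 0 1 * s ^ 4) * h2
  refine ⟨a * (2 * r * β * e * C₁ + r * e ^ 2 * C₂) + a ^ 2 * (2 * r * β * D₀ + r * e * D₁) +
      a ^ 3 * r * diagR c s,
    a * (β ^ 2 * e * C₁ + β * e ^ 2 * C₂ + e ^ 3 * C₃) +
      a ^ 2 * (β ^ 2 * D₀ + β * e * D₁ + e ^ 2 * D₂) + a ^ 3 * (β * diagR c s + e * E₁), fun t => ?_⟩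
  rw [← hC]
  nth_rw 1 [← hD]
  simp only [quartic, a0, a1, a2, a3, a4, b0, b1, b2, b3, b4, C₁, C₂, C₃, D₀, D₁, D₂, E₁, diagR]
  simp only [diagP] at hp
  linear_combination t * a * (r + t * β) ^ 3 * hp

variable [IsAlgClosed K] [CharP K 2]

theorem SkewTriple.expand_curve_ne_zero (h : SkewTriple c) {s : K} (hp : diagP c s = 0)
    (hr : diagR c s ≠ 0) (hA : partialP c s ≠ 0) :
    expand c (curve c s) (curveTangent c s) (curveNormal c s) 2 0 ≠ 0 ∨
      expand c (curve c s) (curveTangent c s) (curveNormal c s) 1 1 ≠ 0 := by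
  have : Infinite K := IsAlgClosed.instInfinite
  have h2 : (2 : K) = 0 := CharTwo.two_eq_zero
  have key : ∀ u : K, expand c (curve c s) (curveTangent c s) (curveNormal c s) 2 0 +
      expand c (curve c s) (curveTangent c s) (curveNormal c s) 1 1 * u +
      expand c (curve c s) (curveTangent c s) (curveNormal c s) 0 2 * u ^ 2 =
      (slopeP c s + u * normalP c s) * diagR c s ^ 2 * ((diagR c s + u * diagR c s ^ 2) *
        (partialP c s + slopeP c s) + (slopeP c s + u * normalP c s) * diagR c s) := fun u => by
    obtain ⟨k, m, hk⟩ := h.exists_quartic_tangent hp (diagR c s) (slopeP c s + u * normalP c s)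
      (slopeR c s + u * normalR c s) (diagR c s + u * diagR c s ^ 2)
    have e : ∀ t : K, _ := fun t => (quartic_expand_line c (curve c s) (curveTangent c s) (curveNormal c s)
      1 u t).symm.trans (Eq.trans (by
        simp only [curve, curveTangent, curveNormal, Matrix.cons_val, hp]; congr 1 <;> ring) (hk t))
    generalize expand c (curve c s) (curveTangent c s) (curveNormal c s) = φ at e ⊢
    obtain ⟨-, -, e, -, -⟩ := coeffs_eq_zero_of_forall (a0 := φ 0 0) (a1 := φ 1 0 + φ 0 1 * u)
      (a2 := φ 2 0 + φ 1 1 * u + φ 0 2 * u ^ 2 - (slopeP c s + u * normalP c s) * diagR c s ^ 2 *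
        ((diagR c s + u * diagR c s ^ 2) * (partialP c s + slopeP c s) +
          (slopeP c s + u * normalP c s) * diagR c s))
      (a3 := φ 3 0 + φ 2 1 * u + φ 1 2 * u ^ 2 + φ 0 3 * u ^ 3 - k)
      (a4 := φ 4 0 + φ 3 1 * u + φ 2 2 * u ^ 2 + φ 1 3 * u ^ 3 + φ 0 4 * u ^ 4 - m)
      fun t => by linear_combination e t
    exact sub_eq_zero.1 e
  by_contra! h0
  rw [h0.1, h0.2] at key
  have hN : normalP c s = diagR c s * (slopeP c s + partialP c s) := by rw [normalP, hp]; ring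
  simp only [hN] at key
  have k0 : slopeP c s * (diagR c s ^ 3 * partialP c s) = 0 := by
    linear_combination -key 0 - slopeP c s ^ 2 * diagR c s ^ 3 * h2
  have hs := (mul_eq_zero.1 k0).resolve_right (mul_ne_zero (pow_ne_zero _ hr) hA)
  rw [hs] at key
  obtain ⟨-, e, -⟩ := coeffs_eq_zero_of_forall (a0 := 0) (a1 := diagR c s ^ 4 * partialP c s ^ 2)
    (a2 := 2 * diagR c s ^ 5 * partialP c s ^ 2 - expand c (curve c s) (curveTangent c s) (curveNormal c s) 0 2)
    (a3 := 0) (a4 := 0) fun u => by linear_combination -key u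
  exact mul_ne_zero (pow_ne_zero _ hr) (pow_ne_zero _ hA) e

end Generic

section Generic
open scoped Polynomial
variable {K : Type*} [Field K] [IsAlgClosed K] [CharP K 2] {F : MvPolynomial (Fin 4) K}
  {b : Module.Basis (Fin 4) K (Fin 4 → K)} {c : ℕ → ℕ → ℕ → K}
  {W : Fin 3 → Submodule K (Fin 4 → K)}

theorem SkewTriple.eval_pt_curve (h : SkewTriple c) (hc : Coords F b c) (s : K) :
    eval (pt b (curve c s 0) (curve c s 1) (curve c s 2) (curve c s 3)) F = 0 := by
  have h2 : (2 : K) = 0 := CharTwo.two_eq_zero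
  rw [hc.2]
  simp only [curve, Matrix.cons_val]
  rw [mul_comm s, mul_comm s, h.quartic_quadric]
  linear_combination (diagP c s * diagR c s) ^ 2 * (diagP c s + diagR c s) * h2

namespace SkewFrame
variable (h : SkewFrame F b c W)
include h

theorem partialP_ne_zero {s : K} (hp : diagP c s = 0) : partialP c s ≠ 0 := fun hA => by
  refine grad_ne_zero h.smooth ?_ (h.skewTriple.eval_pt_curve h.coords s) ?_
  · exact fun e => h.diagR_ne_zero hp (pt_eq_zero.1 e).2.2.2
  · refine LinearMap.ext fun v => ?_
    obtain ⟨x, y, z, w, hv⟩ := exists_eq_pt b v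
    have := h.skewTriple.grad_curve h.coords s y (x - y * s) w (z - w * s)
    rw [add_sub_cancel, add_sub_cancel, ← hv, hp, hA] at this
    rw [this, LinearMap.zero_apply]
    ring

theorem natDegree_diagP : (diagP (fun i j k => .C (c i j k)) (.X : K[X])).natDegree = 4 := by
  refine Polynomial.natDegree_eq_of_le_of_coeff_ne_zero (by simp only [diagP]; compute_degree) ?_
  rw [show (diagP (fun i j k => .C (c i j k)) (.X : K[X])).coeff 4 = c 1 0 3 by
    simp only [diagP]; compute_degree!]
  exact h.coeff_ne_zero

theorem pt_curve_ne_zero (s : K) : pt b (curve c s 0) (curve c s 1) (curve c s 2) (curve c s 3) ≠ 0 :=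
  fun e => h.diagR_ne_zero (pt_eq_zero.1 e).2.1 (pt_eq_zero.1 e).2.2.2

theorem finite_mem_lines :
    {s | ∃ n ∈ lines F, pt b (curve c s 0) (curve c s 1) (curve c s 2) (curve c s 3) ∈ n}.Finite := by
  have : {s | ∃ n ∈ lines F, pt b (curve c s 0) (curve c s 1) (curve c s 2) (curve c s 3) ∈ n} =
      ⋃ n ∈ lines F, {s | pt b (curve c s 0) (curve c s 1) (curve c s 2) (curve c s 3) ∈ n} := by
    ext; simp
  rw [this]
  refine (finite_lines h.smooth).biUnion fun n hn => ?_
  obtain ⟨φ, hφ, hnφ⟩ := Submodule.exists_le_ker_of_lt_top n (lt_top_iff_ne_top.2 fun e => by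
    have := hn.1
    rw [e, finrank_top, Module.finrank_fin_fun] at this
    omega)
  let P : K[X] := diagP (fun i j k => .C (c i j k)) .X
  let R : K[X] := diagR (fun i j k => .C (c i j k)) .X
  have hP : ∀ s, P.eval s = diagP c s := fun s => (eval_curve c s).1
  have hR : ∀ s, R.eval s = diagR c s := fun s => (eval_curve c s).2.1
  let f : K[X] := (.C (φ (b 0)) * .X + .C (φ (b 1))) * P + (.C (φ (b 2)) * .X + .C (φ (b 3))) * R
  have hcop : IsCoprime P R := by
    rw [Polynomial.isCoprime_iff_aeval_ne_zero_of_isAlgClosed K K]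
    intro s
    by_contra! h0
    simp only [Polynomial.coe_aeval_eq_eval, hP, hR] at h0
    exact h.diagR_ne_zero h0.1 h0.2
  have hlin : ∀ u v : K, (.C u * .X + .C v : K[X]) = 0 → u = 0 ∧ v = 0 := fun u v e =>
    ⟨by simpa using congrArg (·.coeff 1) e, by simpa using congrArg (·.coeff 0) e⟩
  have hf : f ≠ 0 := fun hf => by
    have hd : P ∣ .C (φ (b 2)) * .X + .C (φ (b 3)) := hcop.dvd_of_dvd_mul_right
      ⟨-(.C (φ (b 0)) * .X + .C (φ (b 1))), by linear_combination hf⟩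
    have e := Polynomial.eq_zero_of_dvd_of_natDegree_lt hd
      (lt_of_le_of_lt Polynomial.natDegree_linear_le (by rw [h.natDegree_diagP]; norm_num))
    have hP0 : P ≠ 0 := Polynomial.ne_zero_of_natDegree_gt (n := 0) (by rw [h.natDegree_diagP]; norm_num)
    have e' : (.C (φ (b 0)) * .X + .C (φ (b 1)) : K[X]) = 0 :=
      (mul_eq_zero.1 (by linear_combination hf - R * e)).resolve_right hP0
    refine hφ (b.ext fun i => ?_)
    match i with
    | 0 => exact (hlin _ _ e').1
    | 1 => exact (hlin _ _ e').2
    | 2 => exact (hlin _ _ e).1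
    | 3 => exact (hlin _ _ e).2
  refine (Polynomial.finite_setOfPred_isRoot hf).subset fun s hs => ?_
  have := LinearMap.mem_ker.1 (hnφ hs)
  simp only [pt, map_add, map_smul, smul_eq_mul, curve, Matrix.cons_val] at this
  simp only [Set.mem_ofPred_eq, Polynomial.IsRoot, f, Polynomial.eval_add, Polynomial.eval_mul,
    Polynomial.eval_C, Polynomial.eval_X, hP, hR]
  linear_combination this

theorem exists_curveRes_ne_zero_of_generic {s : K}
    (hs : ∀ n ∈ lines F, pt b (curve c s 0) (curve c s 1) (curve c s 2) (curve c s 3) ∉ n)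
    (hq : expand c (curve c s) (curveTangent c s) (curveNormal c s) 2 0 ≠ 0 ∨
      expand c (curve c s) (curveTangent c s) (curveNormal c s) 2 0 = 0 ∧
      expand c (curve c s) (curveTangent c s) (curveNormal c s) 3 0 = 0 ∧
      expand c (curve c s) (curveTangent c s) (curveNormal c s) 1 1 ≠ 0) : ∃ l, curveRes c l ≠ 0 := by
  have : Infinite K := IsAlgClosed.instInfinite
  have h2 : (2 : K) = 0 := CharTwo.two_eq_zero
  have hp : diagP c s ≠ 0 := fun e => hs _ (h.mem 1) (by simpa [curve, e] using h.second _ _)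
  have hr : diagR c s ≠ 0 := fun e => hs _ (h.mem 0) (by simpa [curve, e] using h.first _ _)
  have hpr : diagP c s + diagR c s ≠ 0 := fun e => hs _ (h.mem 2) (by
    simpa [curve, CharTwo.add_eq_zero.1 e] using h.third _ _)
  have h0 := h.skewTriple.eval_pt_curve h.coords s
  have hN := h.skewTriple.grad_curveTangent h.coords s
  have hM := h.skewTriple.grad_curveNormal h.coords s
  have hindT : ∀ z w : K, (∀ i, z * curve c s i + w * curveTangent c s i = 0) → z = 0 ∧ w = 0 := by
    intro z w e
    have e0 := e 0
    have e1 := e 1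
    simp only [curve, curveTangent, Matrix.cons_val] at e0 e1
    have ew : w = 0 := (mul_eq_zero.1 (by linear_combination e0 - s * e1)).resolve_right hp
    rw [ew] at e1
    exact ⟨(mul_eq_zero.1 (by linear_combination e1)).resolve_right hp, ew⟩
  have hindM : ∀ x z w : K, (∀ i, z * curve c s i + w * (x * curveTangent c s i + curveNormal c s i) = 0) →
      z = 0 ∧ w = 0 := fun x z w e => by
    have e0 := e 0
    have e1 := e 1
    have e2 := e 2
    have e3 := e 3
    simp only [curve, curveTangent, curveNormal, Matrix.cons_val] at e0 e1 e2 e3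
    have ew : w = 0 := by
      have k1 : w * (x + diagP c s) = 0 :=
        (mul_eq_zero.1 (by linear_combination e0 - s * e1)).resolve_right hp
      have k2 : w * (x + diagR c s) = 0 :=
        (mul_eq_zero.1 (by linear_combination e2 - s * e3)).resolve_right hr
      exact (mul_eq_zero.1 (by linear_combination k1 + k2 - w * x * h2)).resolve_right hpr
    rw [ew] at e1
    exact ⟨(mul_eq_zero.1 (by linear_combination e1)).resolve_right hp, ew⟩
  have hq' : expand c (curve c s) (curveTangent c s) (curveNormal c s) 2 0 = 0 →
      expand c (curve c s) (curveTangent c s) (curveNormal c s) 3 0 = 0 →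
      expand c (curve c s) (curveTangent c s) (curveNormal c s) 4 0 ≠ 0 := fun q2 q3 q4 => by
    have e00 := (h.coords.expand_zero_zero (curve c s) (curveTangent c s) (curveNormal c s)).trans h0
    have e10 := h.coords.expand_linear (curve c s) (curveTangent c s) (curveNormal c s) 1 0
    rw [one_smul, zero_smul, add_zero, hN, mul_one, mul_zero, add_zero] at e10
    refine hs _ (mem_lines_of_pair (u := pt b (curve c s 0) (curve c s 1) (curve c s 2) (curve c s 3))
      (v := pt b (curveTangent c s 0) (curveTangent c s 1) (curveTangent c s 2) (curveTangent c s 3))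
      (fun z w e => ?_) fun z w => eval_eq_zero_of_affine h.smooth.hom (fun t => ?_) z w)
      (Submodule.subset_span (Set.mem_insert _ _))
    · have := pt_eq_zero (b := b) (x := z * curve c s 0 + w * curveTangent c s 0)
        (y := z * curve c s 1 + w * curveTangent c s 1) (z := z * curve c s 2 + w * curveTangent c s 2)
        (w := z * curve c s 3 + w * curveTangent c s 3) |>.1 (by rw [← e]; simp only [pt]; module)
      refine hindT z w fun i => ?_
      match i with
      | 0 => exact this.1
      | 1 => exact this.2.1
      | 2 => exact this.2.2.1
      | 3 => exact this.2.2.2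
    · have := quartic_expand_line c (curve c s) (curveTangent c s) (curveNormal c s) 1 0 t
      rw [e00, e10, q2, q3, q4] at this
      rw [pt_add_smul, h.coords.2]
      simp only [one_mul, zero_mul, add_zero] at this
      rw [this]; ring
  obtain ⟨l, hl⟩ := h.coords.exists_res24_ne_zero h.smooth h0 hN hM hindM hs
    (hq.imp_right fun ⟨q2, q3, q11⟩ => ⟨q2, hq' q2 q3, Or.inl q11⟩)
  refine ⟨l, fun e => hl ?_⟩
  obtain ⟨-, -, eP, eN, eM⟩ := eval_curve c s
  have := eval_lineRes c (curve (fun i j k => .C (c i j k)) .X) (curveTangent (fun i j k => .C (c i j k)) .X)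
    (curveNormal (fun i j k => .C (c i j k)) .X) l s
  rw [eP, eN, eM] at this
  rw [← this]
  exact (congrArg (Polynomial.eval s) e).trans Polynomial.eval_zero

theorem exists_curveRes_ne_zero : ∃ l, curveRes c l ≠ 0 := by
  have : Infinite K := IsAlgClosed.instInfinite
  let φ := expand (fun i j k => Polynomial.C (c i j k)) (curve (fun i j k => .C (c i j k)) .X)
    (curveTangent (fun i j k => .C (c i j k)) .X) (curveNormal (fun i j k => .C (c i j k)) .X)
  have hφ : ∀ s i j, (φ i j).eval s = expand c (curve c s) (curveTangent c s) (curveNormal c s) i j :=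
    fun s i j => by
      obtain ⟨-, -, eP, eN, eM⟩ := eval_curve c s
      rw [eval_expand, eP, eN, eM]
  have hgen : ∀ f : K[X], f ≠ 0 → ∃ s, f.eval s ≠ 0 ∧
      ∀ n ∈ lines F, pt b (curve c s 0) (curve c s 1) (curve c s 2) (curve c s 3) ∉ n := fun f hf => by
    obtain ⟨s, hs⟩ := ((Polynomial.finite_setOfPred_isRoot hf).union
      h.finite_mem_lines).infinite_compl.nonempty
    rw [Set.mem_compl_iff, Set.mem_union, not_or] at hs
    exact ⟨s, hs.1, fun n hn hm => hs.2 ⟨n, hn, hm⟩⟩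
  by_cases h20 : φ 2 0 = 0
  · have h11 : φ 1 1 ≠ 0 := fun h11 => by
      obtain ⟨s, hs⟩ := IsAlgClosed.exists_root (diagP (fun i j k => .C (c i j k)) (.X : K[X]))
        (Polynomial.degree_ne_of_natDegree_ne (by rw [h.natDegree_diagP]; norm_num))
      have hp : diagP c s = 0 := (eval_curve c s).1.symm.trans hs
      rcases h.skewTriple.expand_curve_ne_zero hp (h.diagR_ne_zero hp) (h.partialP_ne_zero hp) with e | e
      · exact e (by rw [← hφ, h20, Polynomial.eval_zero])
      · exact e (by rw [← hφ, h11, Polynomial.eval_zero])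
    obtain ⟨s, hs, hs'⟩ := hgen _ h11
    refine h.exists_curveRes_ne_zero_of_generic hs' (Or.inr ⟨?_, ?_, hφ s 1 1 ▸ hs⟩)
    · rw [← hφ, h20, Polynomial.eval_zero]
    · have h2 : (2 : K) = 0 := CharTwo.two_eq_zero
      have := (derivative_expand c (curveNormal (fun i j k => .C (c i j k)) .X)
        (derivative_curve (c := c)) derivative_curveTangent s).1
      rw [show expand _ _ _ _ 2 0 = (0 : K[X]) from h20, Polynomial.derivative_zero,
        Polynomial.eval_zero] at this
      rw [← hφ]
      linear_combination -this - (φ 3 0).eval s * h2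
  · obtain ⟨s, hs, hs'⟩ := hgen _ h20
    exact h.exists_curveRes_ne_zero_of_generic hs' (Or.inl (hφ s 2 0 ▸ hs))

end SkewFrame
end Generic

section Skew
open scoped Polynomial
variable {K : Type*} [Field K] [IsAlgClosed K] [CharP K 2] {F : MvPolynomial (Fin 4) K}
  {b : Module.Basis (Fin 4) K (Fin 4 → K)} {c : ℕ → ℕ → ℕ → K}
  {W : Fin 3 → Submodule K (Fin 4 → K)}

theorem SkewFrame.exists_mul_dvd_curveRes (h : SkewFrame F b c W)
    {n : Submodule K (Fin 4 → K)} (hn : n ∈ lines F) (hnW : ∀ i, n ≠ W i) (l : K) : ∃ s s' : K,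
      pt b (curve c s 0) (curve c s 1) (curve c s 2) (curve c s 3) ∈ n ∧
      pt b (curve c s' 0) (curve c s' 1) (curve c s' 2) (curve c s' 3) ∈ n ∧
      (Polynomial.X - Polynomial.C s) * (Polynomial.X - Polynomial.C s') ∣ curveRes c l := by
  obtain ⟨x, y, z, w, hm, h0, hq⟩ := exists_isotropic (b := b) hn.1
  obtain ⟨s, k, hk, hd⟩ := h.exists_curve_of_isotropic hn hnW hm h0 hq
  have hk0 : k ≠ 0 := fun e => h0 (by rw [hk, e, zero_smul])
  rw [hk] at hm
  have hs := (n.smul_mem_iff hk0).1 hm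
  obtain ⟨h1, h2 | ⟨s', hne, hs', hd'⟩⟩ := h.dvd_curveRes hn hnW hs hd l
  · exact ⟨s, s, hs, hs, by rwa [← pow_two]⟩
  · exact ⟨s, s', hs, hs', (Polynomial.pairwise_coprime_X_sub_C Function.injective_id hne.symm).mul_dvd
      h1 (h.dvd_curveRes hn hnW hs' hd' l).1⟩

theorem SkewFrame.ncard_lines_le (h : SkewFrame F b c W) : (lines F).ncard ≤ 67 := by
  classical
  obtain ⟨l, hl⟩ := h.exists_curveRes_ne_zero
  have hfin := finite_lines h.smooth
  choose! s s' hs hs' hd using fun n (hn : n ∈ lines F ∧ ∀ i, n ≠ W i) =>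
    h.exists_mul_dvd_curveRes hn.1 hn.2 l
  let T := hfin.toFinset.filter fun n => ∀ i, n ≠ W i
  have hT : ∀ n ∈ T, n ∈ lines F ∧ ∀ i, n ≠ W i := fun n hn => by simpa [T] using hn
  have hcop : ∀ (t u : K) (m n : Submodule K (Fin 4 → K)), m ∈ lines F → n ∈ lines F → m ≠ n →
      pt b (curve c t 0) (curve c t 1) (curve c t 2) (curve c t 3) ∈ m →
      pt b (curve c u 0) (curve c u 1) (curve c u 2) (curve c u 3) ∈ n →
      IsCoprime (Polynomial.X - Polynomial.C t) (Polynomial.X - Polynomial.C u) :=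
    fun t u m n hm hn hmn ht hu => Polynomial.pairwise_coprime_X_sub_C Function.injective_id fun e =>
      hmn (h.skew m hm n hn _ ht (by rw [e]; exact hu) (h.pt_curve_ne_zero t))
  have hdvd : (∏ n ∈ T, (Polynomial.X - Polynomial.C (s n)) * (Polynomial.X - Polynomial.C (s' n))) ∣
      curveRes c l := by
    refine Finset.prod_dvd_of_coprime (fun m hm n hn hmn => ?_) fun n hn => hd n (hT n hn)
    have hm' := hT m hm
    have hn' := hT n hn
    have key := fun t u ht hu => hcop t u m n hm'.1 hn'.1 hmn ht hu
    exact IsCoprime.mul_left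
      (IsCoprime.mul_right (key _ _ (hs m hm') (hs n hn')) (key _ _ (hs m hm') (hs' n hn')))
      (IsCoprime.mul_right (key _ _ (hs' m hm') (hs n hn')) (key _ _ (hs' m hm') (hs' n hn')))
  have hdeg : 2 * T.card ≤ 128 := by
    refine le_trans (le_of_eq ?_) ((Polynomial.natDegree_le_of_dvd hdvd hl).trans
      (h.skewTriple.natDegree_lineRes_le l))
    rw [Polynomial.natDegree_prod_of_monic _ _ fun n _ =>
      (Polynomial.monic_X_sub_C _).mul (Polynomial.monic_X_sub_C _),
      Finset.sum_congr rfl fun n _ => by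
        rw [Polynomial.natDegree_mul (Polynomial.X_sub_C_ne_zero _) (Polynomial.X_sub_C_ne_zero _),
          Polynomial.natDegree_X_sub_C, Polynomial.natDegree_X_sub_C]]
    simp [mul_comm]
  have hsub : hfin.toFinset ⊆ T ∪ Finset.univ.image W := fun n hn => by
    by_cases hW : ∀ i, n ≠ W i
    · exact Finset.mem_union_left _ (Finset.mem_filter.2 ⟨hn, hW⟩)
    · push Not at hW
      obtain ⟨i, hi⟩ := hW
      exact Finset.mem_union_right _ (Finset.mem_image.2 ⟨i, Finset.mem_univ _, hi.symm⟩)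
  have h3 : (Finset.univ.image W).card ≤ 3 := Finset.card_image_le
  rw [Set.ncard_eq_toFinset_card _ hfin]
  have := (Finset.card_le_card hsub).trans (Finset.card_union_le _ _)
  omega

theorem exists_skewFrame (hF : IsSmoothQuartic F)
    (skew : ∀ m ∈ lines F, ∀ n ∈ lines F, ∀ v ∈ m, v ∈ n → v ≠ 0 → m = n)
    (mem : ∀ i, W i ∈ lines F) (hW : Function.Injective W) : ∃ b c, SkewFrame F b c W := by
  have : Infinite K := IsAlgClosed.instInfinite
  have hsk : ∀ i j, i ≠ j → ∀ v ∈ W i, v ∈ W j → v = 0 := fun i j hij v hi hj => by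
    by_contra hv
    exact hij (hW (skew _ (mem i) _ (mem j) v hi hj hv))
  obtain ⟨d, hd0, hd1, hd2, hd3⟩ := exists_basis_of_skew (mem 1).1 (mem 0).1 (hsk 1 0 (by decide))
  have dec : ∀ u, ∃ e ∈ W 0, ∃ f ∈ W 1, u = e + f := fun u => by
    obtain ⟨x, y, z, w, rfl⟩ := exists_eq_pt d u
    exact ⟨x • d 0 + y • d 1, add_mem ((W 0).smul_mem _ hd0) ((W 0).smul_mem _ hd1),
      z • d 2 + w • d 3, add_mem ((W 1).smul_mem _ hd2) ((W 1).smul_mem _ hd3), by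
        simp only [pt]; module⟩
  obtain ⟨u, hu, v, hv, huv⟩ := exists_pair (mem 2).1
  obtain ⟨e₀, he₀, f₀, hf₀, rfl⟩ := dec u
  obtain ⟨e₁, he₁, f₁, hf₁, rfl⟩ := dec v
  obtain ⟨b, hb⟩ := exists_basis ![e₀, e₁, f₀, f₁] fun x y z w e => by
    simp only [Matrix.cons_val] at e
    have hxy : x • e₀ + y • e₁ = 0 := by
      refine hsk 0 1 (by decide) _ (add_mem ((W 0).smul_mem _ he₀) ((W 0).smul_mem _ he₁)) ?_
      rw [show x • e₀ + y • e₁ = (-z) • f₀ + (-w) • f₁ by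
        rw [← sub_eq_zero]; refine Eq.trans ?_ e; module]
      exact add_mem ((W 1).smul_mem _ hf₀) ((W 1).smul_mem _ hf₁)
    have hzw : z • f₀ + w • f₁ = 0 := by
      refine Eq.trans ?_ e
      rw [hxy, zero_add]
    have h1 := huv x y (hsk 1 2 (by decide) _ (by
      rw [show x • (e₀ + f₀) + y • (e₁ + f₁) = (x • e₀ + y • e₁) + (x • f₀ + y • f₁) by module, hxy,
        zero_add]
      exact add_mem ((W 1).smul_mem _ hf₀) ((W 1).smul_mem _ hf₁))
      (add_mem ((W 2).smul_mem _ hu) ((W 2).smul_mem _ hv)))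
    have h2 := huv z w (hsk 0 2 (by decide) _ (by
      rw [show z • (e₀ + f₀) + w • (e₁ + f₁) = (z • e₀ + w • e₁) + (z • f₀ + w • f₁) by module, hzw,
        add_zero]
      exact add_mem ((W 0).smul_mem _ he₀) ((W 0).smul_mem _ he₁))
      (add_mem ((W 2).smul_mem _ hu) ((W 2).smul_mem _ hv)))
    exact ⟨h1.1, h1.2, h2⟩
  obtain ⟨c, hc⟩ := hF.coords b
  obtain ⟨x, y, hxy, h0⟩ : ∃ x y, (x ≠ 0 ∨ y ≠ 0) ∧
      c 2 0 2 * x ^ 4 + (c 2 0 1 + c 1 1 2) * x ^ 3 * y + (c 2 0 0 + c 1 1 1 + c 0 2 2) * x ^ 2 * y ^ 2 +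
        (c 1 1 0 + c 0 2 1) * x * y ^ 3 + c 0 2 0 * y ^ 4 = 0 := by
    by_cases h : c 2 0 2 = 0
    · exact ⟨1, 0, Or.inl one_ne_zero, by rw [h]; ring⟩
    · let f : K[X] := .C (c 2 0 2) * .X ^ 4 + .C (c 2 0 1 + c 1 1 2) * .X ^ 3 +
        .C (c 2 0 0 + c 1 1 1 + c 0 2 2) * .X ^ 2 + .C (c 1 1 0 + c 0 2 1) * .X + .C (c 0 2 0)
      have hf : f.natDegree = 4 := by simp only [f]; compute_degree!
      obtain ⟨x, hx⟩ := IsAlgClosed.exists_root f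
        (Polynomial.degree_ne_of_natDegree_ne (by rw [hf]; norm_num))
      refine ⟨x, 1, Or.inr one_ne_zero, ?_⟩
      simp only [f, Polynomial.IsRoot, Polynomial.eval_add, Polynomial.eval_mul, Polynomial.eval_pow,
        Polynomial.eval_C, Polynomial.eval_X] at hx
      linear_combination hx
  obtain ⟨x', y', hdet⟩ : ∃ x' y', x * y' - y * x' ≠ 0 := by
    rcases hxy with hx | hy
    · exact ⟨0, 1, by simpa using hx⟩
    · exact ⟨1, 0, by simpa using hy⟩
  have hinv : ∀ p q, p * x + q * x' = 0 → p * y + q * y' = 0 → p = 0 ∧ q = 0 := fun p q h h' =>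
    ⟨(mul_eq_zero.1 (by linear_combination y' * h - x' * h')).resolve_right hdet,
      (mul_eq_zero.1 (by linear_combination x * h' - y * h)).resolve_right hdet⟩
  obtain ⟨b', hb'⟩ := exists_basis ![pt b x y 0 0, pt b x' y' 0 0, pt b 0 0 x y, pt b 0 0 x' y']
    fun p q r t e => by
      obtain ⟨h1, h2, h3, h4⟩ := pt_eq_zero (b := b) (x := p * x + q * x') (y := p * y + q * y')
        (z := r * x + t * x') (w := r * y + t * y') |>.1 (by
          refine Eq.trans ?_ e; simp only [pt, Matrix.cons_val]; module)
      exact ⟨(hinv _ _ h1 h2).1, (hinv _ _ h1 h2).2, hinv _ _ h3 h4⟩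
  have hpt : ∀ p q r t, pt b' p q r t =
      pt b (p * x + q * x') (p * y + q * y') (r * x + t * x') (r * y + t * y') := fun p q r t => by
    rw [pt, hb', hb', hb', hb']
    simp only [pt, Matrix.cons_val]; module
  have hpb : ∀ p q r t, pt b p q r t = p • e₀ + q • e₁ + r • f₀ + t • f₁ := fun p q r t => by
    rw [pt, hb, hb, hb, hb]; rfl
  obtain ⟨c', hc'⟩ := hF.coords b'
  refine ⟨b', c', hF, hc', skew, mem, hW.ne (by decide), fun p q => ?_, fun r t => ?_, fun p q => ?_, ?_⟩
  · rw [hpt, hpb]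
    simpa using add_mem ((W 0).smul_mem _ he₀) ((W 0).smul_mem _ he₁)
  · rw [hpt, hpb]
    simpa using add_mem ((W 1).smul_mem _ hf₀) ((W 1).smul_mem _ hf₁)
  · rw [hpt, hpb]
    convert add_mem ((W 2).smul_mem (p * x + q * x') hu) ((W 2).smul_mem (p * y + q * y') hv) using 1
    module
  · have e : ∀ t, quartic c' t 0 1 0 = quartic c (t * x) (t * y) x y := fun t => by
      rw [← hc'.2, ← hc.2, hpt]; simp
    obtain ⟨-, -, e, -, -⟩ := coeffs_eq_zero_of_forall
      (a0 := c' 0 0 4 - (c 0 0 4 * x ^ 4 + c 0 0 3 * x ^ 3 * y + c 0 0 2 * x ^ 2 * y ^ 2 +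
        c 0 0 1 * x * y ^ 3 + c 0 0 0 * y ^ 4))
      (a1 := c' 1 0 3 - (c 1 0 3 * x ^ 4 + (c 1 0 2 + c 0 1 3) * x ^ 3 * y +
        (c 1 0 1 + c 0 1 2) * x ^ 2 * y ^ 2 + (c 1 0 0 + c 0 1 1) * x * y ^ 3 + c 0 1 0 * y ^ 4))
      (a2 := c' 2 0 2)
      (a3 := c' 3 0 1 - (c 3 0 1 * x ^ 4 + (c 3 0 0 + c 2 1 1) * x ^ 3 * y +
        (c 2 1 0 + c 1 2 1) * x ^ 2 * y ^ 2 + (c 1 2 0 + c 0 3 1) * x * y ^ 3 + c 0 3 0 * y ^ 4))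
      (a4 := c' 4 0 0 - (c 4 0 0 * x ^ 4 + c 3 1 0 * x ^ 3 * y + c 2 2 0 * x ^ 2 * y ^ 2 +
        c 1 3 0 * x * y ^ 3 + c 0 4 0 * y ^ 4))
      fun t => by
        have := e t
        simp only [quartic] at this
        linear_combination this + t ^ 2 * h0
    exact e

end Skew

section Bound
variable {K : Type*} [Field K] [IsAlgClosed K] [CharP K 2] {F : MvPolynomial (Fin 4) K}

theorem ncard_lines_le_of_skew (hF : IsSmoothQuartic F)
    (skew : ∀ m ∈ lines F, ∀ n ∈ lines F, ∀ v ∈ m, v ∈ n → v ≠ 0 → m = n) :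
    (lines F).ncard ≤ 67 := by
  by_contra! hN
  obtain ⟨W₀, W₁, W₂, h₀, h₁, h₂, h01, h02, h12⟩ :=
    (Set.two_lt_ncard_iff (finite_lines hF)).1 (by omega)
  obtain ⟨b, c, h⟩ := exists_skewFrame (W := ![W₀, W₁, W₂]) hF skew
    (fun i => by match i with | 0 => exact h₀ | 1 => exact h₁ | 2 => exact h₂)
    (fun i j e => by
      fin_cases i <;> fin_cases j <;> first | rfl | (revert e; simp [h01, h02, h12, h01.symm, h02.symm, h12.symm]))
  have := h.ncard_lines_le
  omega

theorem ncard_lines_le_of_nbr (hF : IsSmoothQuartic F) (hN : NoTriple F)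
    {W W' : Submodule K (Fin 4 → K)} (hW : W ∈ lines F) (hW' : W' ∈ nbrs F W) :
    (lines F).ncard ≤ (nbrs F W).ncard + (nbrs F W').ncard + 44 := by
  obtain ⟨h, hne, v, hv', hv, h0⟩ := hW'
  exact ncard_lines_le_of_meeting hF hN hW h hne.symm h0 hv hv'

theorem ncard_nbrs_le_twenty (hF : IsSmoothQuartic F) {W : Submodule K (Fin 4 → K)} (hW : W ∈ lines F) :
    (nbrs F W).ncard ≤ 20 := by
  rcases ncard_nbrs_le_or_special hF hW with h | ⟨h, -⟩ <;> omega

/-- A line with many neighbours has a neighbour with few neighbours. -/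
theorem exists_nbr_ncard_le (hF : IsSmoothQuartic F) (hN : NoTriple F)
    {W : Submodule K (Fin 4 → K)} (hW : W ∈ lines F) (h4 : 4 < (nbrs F W).ncard)
    (h21 : 21 < (lines F).ncard) : ∃ m ∈ nbrs F W, (nbrs F m).ncard ≤ 12 := by
  obtain ⟨m, hm, hi⟩ : ∃ m ∈ nbrs F W, ¬ Inert F m := by
    by_contra! hi
    exact absurd (ncard_nbrs_of_inert hF hN hW hi) (by omega)
  obtain ⟨n, hn, hnm⟩ := Set.exists_mem_notMem_of_ncard_lt_ncard
    (lt_of_le_of_lt ((Set.ncard_insert_le m (nbrs F m)).trans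
      (Nat.succ_le_succ (ncard_nbrs_le_twenty hF hm.1))) h21)
    ((finite_nbrs hF m).insert m)
  rw [Set.mem_insert_iff, not_or] at hnm
  exact ⟨m, hm, ncard_nbrs_le_twelve hF hN hm.1 hi hn hnm.1 hnm.2⟩

theorem ncard_lines_le (hF : IsSmoothQuartic F) : (lines F).ncard ≤ 68 := by
  by_contra! h68
  have hN : NoTriple F := fun φ hφ W hW W' hW' W'' hW'' h h' h'' h12 h13 => by
    by_contra h23
    have := ncard_lines_of_coplanar hF hφ hW hW' hW'' h h' h'' h12 h13 h23
    omega
  by_cases h4 : ∃ W ∈ lines F, 4 < (nbrs F W).ncard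
  · obtain ⟨W, hW, h4⟩ := h4
    obtain ⟨m, hm, hm12⟩ := exists_nbr_ncard_le hF hN hW h4 (by omega)
    by_cases hm4 : 4 < (nbrs F m).ncard
    · obtain ⟨n, hn, hn12⟩ := exists_nbr_ncard_le hF hN hm.1 hm4 (by omega)
      have := ncard_lines_le_of_nbr hF hN hm.1 hn
      omega
    · have := ncard_lines_le_of_nbr hF hN hW hm
      have := ncard_nbrs_le_twenty hF hW
      omega
  · push Not at h4
    have := ncard_lines_le_of_skew hF fun m hm n hn v hvm hvn h0 => by
      by_contra hmn
      have := ncard_lines_le_of_nbr hF hN hn ⟨hm, hmn, v, hvm, hvn, h0⟩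
      have := h4 m hm
      have := h4 n hn
      omega
    omega

end Bound
end QuarticLines

/-- Every smooth quartic surface in ℙ³ over an algebraically closed
field of characteristic 2 contains at most 68 lines.  Points of ℙ³ are represented by
nonzero vectors of `K⁴` up to scaling, and lines in ℙ³ by 2-dimensional linear
subspaces of `K⁴`. -/
theorem smooth_quartic_char2_at_most_68_lines
    (K : Type*) [Field K] [IsAlgClosed K] [CharP K 2]
    (F : MvPolynomial (Fin 4) K) (hF0 : F ≠ 0) (hhom : F.IsHomogeneous 4)
    (hsmooth : ∀ v : Fin 4 → K, v ≠ 0 → eval v F = 0 →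
      ∃ i : Fin 4, eval v (pderiv i F) ≠ 0) :
    {W : Submodule K (Fin 4 → K) |
        Module.finrank K W = 2 ∧ ∀ v ∈ W, eval v F = 0}.Finite ∧
    {W : Submodule K (Fin 4 → K) |
        Module.finrank K W = 2 ∧ ∀ v ∈ W, eval v F = 0}.ncard ≤ 68 := by
  have hF : QuarticLines.IsSmoothQuartic F := ⟨hhom, hsmooth⟩
  exact ⟨QuarticLines.finite_lines hF, QuarticLines.ncard_lines_le hF⟩
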